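/- Let K and L be convex bodies in the plane ℝ² with equal covariograms, g_K = g_L. Then L is a translate of K or a translate of −K; i.e. the covariogram determines a planar convex body up to translations and point reflections. -/

import Mathlib

open MeasureTheory Pointwise


/-- The Euclidean plane. -/
abbrev Plane := EuclideanSpace ℝ (Fin 2)

/-- The standard area form on the plane. -/
def om (a b : Plane) : ℝ := a 0 * b 1 - a 1 * b 0

/-- Convex bodies in the plane. -/
structure Body (K : Set Plane) : Prop where
  comp : IsCompact K
  conv : Convex ℝ K
  int : (interior K).Nonempty

/-- The directed chord from `p` to `q` is extremal: all parallel translates contained in `K`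
lie weakly to its left. -/
def Low (K : Set Plane) (p q : Plane) : Prop :=
  p ∈ K ∧ q ∈ K ∧ ∀ k ∈ K, k + (q - p) ∈ K → 0 ≤ om (q - p) (k - p)

/-- `τ` directs a supporting line of `K` at `p`, with `K` on its left. -/
def Tan (K : Set Plane) (p τ : Plane) : Prop :=
  τ ≠ 0 ∧ ∀ k ∈ K, 0 ≤ om τ (k - p)

/-- `x` is a difference of interior points. -/
def Ov (K : Set Plane) (x : Plane) : Prop :=
  ∃ k ∈ interior K, k + x ∈ interior K

/-- Some segment with oriented direction `x` lies on the boundary of `K`, with `K` on its left. -/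
def Edge (K : Set Plane) (x : Plane) : Prop :=
  ∃ p ∈ K, p + x ∈ K ∧ ∀ k ∈ K, 0 ≤ om x (k - p)

lemma om_add_left (a b c : Plane) : om (a + b) c = om a c + om b c := by
  simp [om]; ring
lemma om_add_right (a b c : Plane) : om a (b + c) = om a b + om a c := by
  simp [om]; ring
lemma om_sub_left (a b c : Plane) : om (a - b) c = om a c - om b c := by
  simp [om]; ring
lemma om_sub_right (a b c : Plane) : om a (b - c) = om a b - om a c := by
  simp [om]; ring
lemma om_smul_left (r : ℝ) (a b : Plane) : om (r • a) b = r * om a b := by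
  simp [om]; ring
lemma om_smul_right (r : ℝ) (a b : Plane) : om a (r • b) = r * om a b := by
  simp [om]; ring
lemma om_neg_left (a b : Plane) : om (-a) b = - om a b := by
  simp [om]; ring
lemma om_neg_right (a b : Plane) : om a (-b) = - om a b := by
  simp [om]; ring
@[simp] lemma om_self (a : Plane) : om a a = 0 := by simp [om]; ring
@[simp] lemma om_zero_right (a : Plane) : om a 0 = 0 := by simp [om]
@[simp] lemma om_zero_left (a : Plane) : om 0 a = 0 := by simp [om]
lemma om_comm (a b : Plane) : om a b = - om b a := by simp [om]; ring

@[fun_prop]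
lemma continuous_om {X : Type*} [TopologicalSpace X] {f g : X → Plane}
    (hf : Continuous f) (hg : Continuous g) : Continuous fun x => om (f x) (g x) := by
  unfold om
  have h (i : Fin 2) : Continuous fun x : Plane => x i := by fun_prop
  exact (((h 0).comp hf).mul ((h 1).comp hg)).sub (((h 1).comp hf).mul ((h 0).comp hg))

lemma Filter.Tendsto.om {ι : Type*} {l : Filter ι} {f g : ι → Plane} {a b : Plane}
    (hf : Filter.Tendsto f l (nhds a)) (hg : Filter.Tendsto g l (nhds b)) :
    Filter.Tendsto (fun i => om (f i) (g i)) l (nhds (om a b)) := by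
  have h (i : Fin 2) : Continuous fun x : Plane => x i := by fun_prop
  exact ((((h 0).tendsto a).comp hf).mul (((h 1).tendsto b).comp hg)).sub
    ((((h 1).tendsto a).comp hf).mul (((h 0).tendsto b).comp hg))

lemma om_cramer (a b x : Plane) : om a b • x = om x b • a + om a x • b := by
  ext i; fin_cases i <;> simp [om] <;> ring

lemma om_cramer_om (a b x z : Plane) :
    om a b * om x z = om x b * om a z + om a x * om b z := by
  simp [om]; ring

/-- Rotation by a right angle. -/
def rot (a : Plane) : Plane := !₂[-a 1, a 0]

lemma om_rot (a : Plane) : om a (rot a) = ‖a‖ ^ 2 := by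
  rw [EuclideanSpace.norm_sq_eq]; simp [om, rot, Fin.sum_univ_two]; ring

lemma norm_rot (a : Plane) : ‖rot a‖ = ‖a‖ := by
  rw [EuclideanSpace.norm_eq, EuclideanSpace.norm_eq]; simp [rot, Fin.sum_univ_two, add_comm]

lemma om_rot_pos {a : Plane} (h : a ≠ 0) : 0 < om a (rot a) := by
  rw [om_rot]; have := norm_pos_iff.2 h; positivity

lemma om_abs_le (a b : Plane) : |om a b| ≤ ‖a‖ * ‖b‖ := by
  rw [← abs_of_nonneg (mul_nonneg (norm_nonneg a) (norm_nonneg b))]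
  apply sq_le_sq.1
  rw [mul_pow, EuclideanSpace.norm_sq_eq, EuclideanSpace.norm_sq_eq]
  simp only [Fin.sum_univ_two, om, Real.norm_eq_abs, sq_abs]
  nlinarith [sq_nonneg (a 0 * b 0 + a 1 * b 1)]

lemma exists_smul_of_om_eq_zero {a b : Plane} (ha : a ≠ 0) (h : om a b = 0) :
    ∃ c : ℝ, b = c • a := by
  have hp := om_rot_pos ha
  have := om_cramer a (rot a) b
  rw [h, zero_smul, add_zero] at this
  refine ⟨om b (rot a) / om a (rot a), ?_⟩
  rw [div_eq_inv_mul, mul_smul, ← this, smul_smul, inv_mul_cancel₀ hp.ne', one_smul]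

lemma exists_pos_smul_interior {K : Set Plane} {k : Plane} (hk : k ∈ interior K) (n : Plane) :
    ∃ ε > (0 : ℝ), ∀ s, |s| ≤ ε → k + s • n ∈ interior K := by
  have hc : Continuous fun s : ℝ => k + s • n := by fun_prop
  have : (fun s : ℝ => k + s • n) ⁻¹' interior K ∈ nhds (0 : ℝ) :=
    (isOpen_interior.preimage hc).mem_nhds (by simpa using hk)
  obtain ⟨ε, hε, h⟩ := Metric.mem_nhds_iff.1 this
  refine ⟨ε / 2, by positivity, fun s hs => h ?_⟩
  rw [Metric.mem_ball, Real.dist_eq, sub_zero]; linarith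

lemma Body.nonempty {K : Set Plane} (hK : Body K) : K.Nonempty := hK.int.mono interior_subset

lemma Body.closure_interior {K : Set Plane} (hK : Body K) : closure (interior K) = K := by
  rw [hK.conv.closure_interior_eq_closure_of_nonempty_interior hK.int,
    hK.comp.isClosed.closure_eq]

lemma exists_om_rep (f : Plane →L[ℝ] ℝ) : ∃ τ, ∀ z, f z = om τ z := by
  refine ⟨!₂[f (EuclideanSpace.single 1 1), -f (EuclideanSpace.single 0 1)], fun z => ?_⟩
  have : z = z 0 • EuclideanSpace.single (0 : Fin 2) (1 : ℝ) +
      z 1 • EuclideanSpace.single (1 : Fin 2) (1 : ℝ) := by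
    ext i; fin_cases i <;> simp
  conv_lhs => rw [this]
  simp [om]; ring

lemma Body.exists_tan {K : Set Plane} (hK : Body K) {p : Plane} (hp : p ∉ interior K) :
    ∃ τ, Tan K p τ := by
  obtain ⟨f, hf⟩ := geometric_hahn_banach_open_point hK.conv.interior isOpen_interior hp
  have hle : ∀ k ∈ K, f k ≤ f p := by
    intro k hk
    rw [← hK.closure_interior] at hk
    exact closure_minimal (fun a ha => (hf a ha).le) (isClosed_le f.continuous continuous_const) hk
  obtain ⟨τ, hτ⟩ := exists_om_rep f
  refine ⟨-τ, ?_, fun k hk => ?_⟩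
  · rw [ne_eq, neg_eq_zero]
    rintro rfl
    obtain ⟨k, hk⟩ := hK.int
    simpa [hτ] using hf k hk
  · have := hle k hk
    rw [hτ, hτ] at this
    rw [om_neg_left, om_sub_right]; linarith

lemma Tan.pos {K : Set Plane} {p τ k : Plane} (h : Tan K p τ) (hk : k ∈ interior K) :
    0 < om τ (k - p) := by
  obtain ⟨ε, hε, hs⟩ := exists_pos_smul_interior hk (rot τ)
  have := h.2 _ (interior_subset (hs (-ε) (by rw [abs_neg, abs_of_pos hε])))
  have h2 := om_rot_pos h.1
  rw [add_sub_right_comm, om_add_right, om_smul_right] at this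
  nlinarith

lemma Tan.not_mem_interior {K : Set Plane} {p τ : Plane} (h : Tan K p τ) : p ∉ interior K := by
  intro hp
  simpa using h.pos hp

lemma low_exists {K : Set Plane} (hK : IsCompact K) {x k : Plane} (hk : k ∈ K) (hx : k + x ∈ K) :
    ∃ p, Low K p (p + x) := by
  have hc : IsCompact (K ∩ (fun y => y + x) ⁻¹' K) :=
    hK.inter_right (hK.isClosed.preimage (by fun_prop))
  obtain ⟨p, hp, hmin⟩ := hc.exists_isMinOn ⟨k, hk, hx⟩
    (f := fun y => om x y) (by fun_prop : Continuous fun y => om x y).continuousOn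
  refine ⟨p, hp.1, hp.2, fun k' hk' hk'x => ?_⟩
  rw [add_sub_cancel_left] at hk'x ⊢
  rw [om_sub_right, sub_nonneg]
  exact hmin ⟨hk', hk'x⟩

lemma Ov.neg {K : Set Plane} {x : Plane} (h : Ov K x) : Ov K (-x) := by
  obtain ⟨k, hk, hkx⟩ := h
  exact ⟨k + x, hkx, by simpa using hk⟩

lemma isOpen_ov (K : Set Plane) : IsOpen {x | Ov K x} := by
  have : {x | Ov K x} = ⋃ k ∈ interior K, (fun x => k + x) ⁻¹' interior K := by
    ext x; simp [Ov]
  rw [this]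
  exact isOpen_biUnion fun k _ => isOpen_interior.preimage (by fun_prop)

lemma Body.combo_mem_interior {K : Set Plane} (hK : Body K) {k c : Plane} (hk : k ∈ K)
    (hc : c ∈ interior K) {ε : ℝ} (h0 : 0 < ε) (h1 : ε ≤ 1) : k + ε • (c - k) ∈ interior K :=
  hK.conv.add_smul_sub_mem_interior hk hc ⟨h0, h1⟩

lemma Low.of_tendsto {K : Set Plane} (hK : Body K) {ι : Type*} {l : Filter ι} [l.NeBot]
    {u v : ι → Plane} {p q : Plane} (hov : Ov K (q - p))
    (hu : Filter.Tendsto u l (nhds p)) (hv : Filter.Tendsto v l (nhds q))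
    (h : ∃ᶠ i in l, Low K (u i) (v i)) : Low K p q := by
  have hcl := hK.comp.isClosed
  refine ⟨?_, ?_, ?_⟩
  · exact hcl.mem_of_frequently_of_tendsto (h.mono fun i hi => hi.1) hu
  · exact hcl.mem_of_frequently_of_tendsto (h.mono fun i hi => hi.2.1) hv
  intro k hk hkx
  obtain ⟨c, hc, hcx⟩ := hov
  have key : ∀ ε ∈ Set.Ioo (0:ℝ) 1, 0 ≤ om (q - p) (k + ε • (c - k) - p) := by
    intro ε hε
    have h1 := hK.combo_mem_interior hk hc hε.1 hε.2.le
    have h2 := hK.combo_mem_interior hkx hcx hε.1 hε.2.le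
    have h2' : k + ε • (c - k) + (q - p) ∈ interior K := by
      convert h2 using 1; module
    have ht : Filter.Tendsto (fun i => k + ε • (c - k) + (v i - u i)) l
        (nhds (k + ε • (c - k) + (q - p))) := (hv.sub hu).const_add _
    have hev := ht.eventually (isOpen_interior.mem_nhds h2')
    have hfr := h.and_eventually hev
    have ht2 : Filter.Tendsto (fun i => om (v i - u i) (k + ε • (c - k) - u i)) l
        (nhds (om (q - p) (k + ε • (c - k) - p))) := (hv.sub hu).om (tendsto_const_nhds.sub hu)
    by_contra hneg
    push Not at hneg
    have hev2 := ht2.eventually (gt_mem_nhds hneg)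
    obtain ⟨i, hi, hi2⟩ := (hfr.and_eventually hev2).exists
    exact absurd (hi.1.2.2 _ (interior_subset h1) (interior_subset hi.2)) (not_le.2 hi2)
  have hcont : Filter.Tendsto (fun ε : ℝ => om (q - p) (k + ε • (c - k) - p)) (nhdsWithin 0 (Set.Ioi 0))
      (nhds (om (q - p) (k + (0:ℝ) • (c - k) - p))) :=
    ((by fun_prop : Continuous fun ε : ℝ => om (q - p) (k + ε • (c - k) - p)).tendsto 0).mono_left
      nhdsWithin_le_nhds
  rw [zero_smul, add_zero] at hcont
  exact ge_of_tendsto hcont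
    (Filter.eventually_of_mem (Ioo_mem_nhdsGT (by norm_num : (0:ℝ) < 1)) key)

lemma low_unique {K : Set Plane} (hK : Convex ℝ K) {x p p' : Plane}
    (hx : x ≠ 0) (he : ¬ Edge K x) (hp : Low K p (p + x)) (hp' : Low K p' (p' + x)) : p = p' := by
  have key : ∀ p p' : Plane, Low K p (p + x) → Low K p' (p' + x) → ∀ c : ℝ, 0 < c →
      p' = p + c • x → False := by
    intro p p' hp hp' c hc hpc
    apply he
    refine ⟨p, hp.1, hp.2.1, fun k hk => ?_⟩
    by_contra hneg
    push Not at hneg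
    have h1 : (1 - c / (1 + c)) • p + (c / (1 + c)) • k ∈ K :=
      hK hp.1 hk (by rw [sub_nonneg, div_le_one (by positivity)]; linarith) (by positivity)
        (by ring)
    have h2 : (1 - c / (1 + c)) • (p' + x) + (c / (1 + c)) • k ∈ K :=
      hK hp'.2.1 hk (by rw [sub_nonneg, div_le_one (by positivity)]; linarith) (by positivity)
        (by ring)
    have h3 := hp.2.2 _ h1 (by
      convert h2 using 1
      rw [hpc]
      have : 1 - c / (1 + c) = 1 / (1 + c) := by field_simp; ring
      match_scalars <;> field_simp <;> ring)
    have h4 : (1 - c / (1 + c)) • p + (c / (1 + c)) • k - p = (c / (1 + c)) • (k - p) := by module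
    rw [h4, om_smul_right, add_sub_cancel_left] at h3
    have : 0 < c / (1 + c) := by positivity
    nlinarith
  have h1 := hp.2.2 p' hp'.1 (by rw [add_sub_cancel_left]; exact hp'.2.1)
  have h2 := hp'.2.2 p hp.1 (by rw [add_sub_cancel_left]; exact hp.2.1)
  rw [add_sub_cancel_left, om_sub_right] at h1 h2
  obtain ⟨c, hc⟩ := exists_smul_of_om_eq_zero hx (b := p' - p) (by rw [om_sub_right]; linarith)
  rcases lt_trichotomy c 0 with h | h | h
  · exact (key p' p hp' hp (-c) (by linarith) (by rw [neg_smul, ← hc]; abel)).elim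
  · rw [h, zero_smul, sub_eq_zero] at hc; exact hc.symm
  · exact (key p p' hp hp' c h (by rw [← hc]; abel)).elim

lemma Low.left_not_mem_interior {K : Set Plane} (hK : Convex ℝ K) {p q : Plane} (h : Low K p q)
    (hpq : p ≠ q) : p ∉ interior K := by
  intro hp
  have htan : Tan K q (q - p) := by
    refine ⟨sub_ne_zero.2 hpq.symm, fun k hk => ?_⟩
    obtain ⟨ε, hε, hs⟩ := exists_pos_smul_interior hp (k - q)
    have hm : 0 < min ε 1 := lt_min hε one_pos
    have h1 := h.2.2 _ (interior_subset (hs (min ε 1) (by rw [abs_of_pos hm]; exact min_le_left _ _)))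
      (by
        have := hK.add_smul_sub_mem h.2.1 hk ⟨hm.le, min_le_right _ _⟩
        convert this using 1; abel)
    rw [add_sub_cancel_left, om_smul_right] at h1
    exact nonneg_of_mul_nonneg_right h1 hm
  have := htan.pos hp
  rw [← neg_sub q p, om_neg_right, om_self] at this
  simp at this

lemma Low.right_not_mem_interior {K : Set Plane} (hK : Convex ℝ K) {p q : Plane} (h : Low K p q)
    (hpq : p ≠ q) : q ∉ interior K := by
  intro hq
  have htan : Tan K p (q - p) := by
    refine ⟨sub_ne_zero.2 hpq.symm, fun k hk => ?_⟩
    obtain ⟨ε, hε, hs⟩ := exists_pos_smul_interior hq (k - p)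
    have hm : 0 < min ε 1 := lt_min hε one_pos
    have h1 := h.2.2 _ (hK.add_smul_sub_mem h.1 hk ⟨hm.le, min_le_right _ _⟩)
      (by
        have := interior_subset (hs (min ε 1) (by rw [abs_of_pos hm]; exact min_le_left _ _))
        convert this using 1; abel)
    rw [add_sub_cancel_left, om_smul_right] at h1
    exact nonneg_of_mul_nonneg_right h1 hm
  have := htan.pos hq
  rw [om_self] at this
  simp at this

lemma low_of_tan {K : Set Plane} {p q t₁ t₂ : Plane} (hp : p ∈ K) (hq : q ∈ K)
    (h₁ : Tan K p t₁) (h₂ : Tan K q t₂) (h : 0 < om t₁ t₂) : Low K p q := by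
  refine ⟨hp, hq, fun k hk hkx => ?_⟩
  have e1 := h₁.2 k hk
  have e2 := h₂.2 _ hkx
  have e3 := h₁.2 q hq
  have e4 := h₂.2 p hp
  rw [show k + (q - p) - q = k - p by abel] at e2
  rw [← neg_sub q p, om_neg_right, ← om_comm] at e4
  have := om_cramer_om t₁ t₂ (q - p) (k - p)
  have h5 : 0 ≤ om t₁ t₂ * om (q - p) (k - p) := by rw [this]; positivity
  exact nonneg_of_mul_nonneg_right h5 h

lemma Ov.not_opposite {K : Set Plane} {p q t : Plane} {c : ℝ} (hov : Ov K (q - p))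
    (h₁ : Tan K p t) (h₂ : Tan K q (c • t)) : 0 < c := by
  obtain ⟨k, hk, hkx⟩ := hov
  have e1 := h₁.pos hk
  have e2 := h₂.pos hkx
  rw [show k + (q - p) - q = k - p by abel, om_smul_left] at e2
  exact pos_of_mul_pos_left e2 e1.le

lemma Ov.tan_parallel {K : Set Plane} {p q t₁ t₂ : Plane} (hp : p ∈ K) (hq : q ∈ K)
    (hov : Ov K (q - p)) (h₁ : Tan K p t₁) (h₂ : Tan K q t₂) (h : om t₁ t₂ = 0) :
    (∃ s : ℝ, q - p = s • t₁) ∧ Tan K q t₁ := by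
  obtain ⟨c, rfl⟩ := exists_smul_of_om_eq_zero h₁.1 h
  have hc := hov.not_opposite h₁ h₂
  have ht : Tan K q t₁ := ⟨h₁.1, fun k hk => by
    have := h₂.2 k hk
    rw [om_smul_left] at this
    exact nonneg_of_mul_nonneg_right this hc⟩
  refine ⟨?_, ht⟩
  apply exists_smul_of_om_eq_zero h₁.1
  have e1 := h₁.2 q hq
  have e2 := ht.2 p hp
  rw [← neg_sub q p, om_neg_right] at e2
  linarith

lemma low_or_low {K : Set Plane} (hK : Body K) {p q : Plane} (hp : p ∈ K) (hq : q ∈ K)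
    (hp' : p ∉ interior K) (hq' : q ∉ interior K) (hov : Ov K (q - p)) : Low K p q ∨ Low K q p := by
  obtain ⟨t₁, h₁⟩ := hK.exists_tan hp'
  obtain ⟨t₂, h₂⟩ := hK.exists_tan hq'
  rcases lt_trichotomy (om t₁ t₂) 0 with h | h | h
  · exact Or.inr (low_of_tan hq hp h₂ h₁ (by rw [om_comm]; linarith))
  · obtain ⟨⟨s, hs⟩, ht⟩ := hov.tan_parallel hp hq h₁ h₂ h
    rcases le_total 0 s with h0 | h0
    · refine Or.inl ⟨hp, hq, fun k hk _ => ?_⟩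
      rw [hs, om_smul_left]
      exact mul_nonneg h0 (h₁.2 k hk)
    · refine Or.inr ⟨hq, hp, fun k hk _ => ?_⟩
      rw [← neg_sub q p, hs, om_neg_left, om_smul_left]
      nlinarith [ht.2 k hk]
  · exact Or.inl (low_of_tan hp hq h₁ h₂ h)

lemma Ov.exists_om_pos {K : Set Plane} {x p q : Plane} (hx : x ≠ 0) (hov : Ov K x)
    (hp : Low K p (p + x)) (hq : Low K (q + x) q) : 0 < om x (q - p) := by
  obtain ⟨k, hk, hkx⟩ := hov
  obtain ⟨ε₁, h1, hs1⟩ := exists_pos_smul_interior hk (rot x)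
  obtain ⟨ε₂, h2, hs2⟩ := exists_pos_smul_interior hkx (rot x)
  have hm : 0 < min ε₁ ε₂ := lt_min h1 h2
  have hr := om_rot_pos hx
  have e1 := hp.2.2 k (interior_subset hk) (by rw [add_sub_cancel_left]; exact interior_subset hkx)
  have e2 := hq.2.2 _ (interior_subset (hs2 (min ε₁ ε₂) (by rw [abs_of_pos hm]; exact min_le_right _ _)))
    (by
      convert interior_subset (hs1 (min ε₁ ε₂) (by rw [abs_of_pos hm]; exact min_le_left _ _)) using 1
      abel)
  rw [add_sub_cancel_left] at e1
  rw [show q - (q + x) = -x by abel, om_neg_left, show k + x + min ε₁ ε₂ • rot x - (q + x) =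
    (k - p) - (q - p) + min ε₁ ε₂ • rot x by abel, om_add_right, om_smul_right, om_sub_right] at e2
  nlinarith [mul_pos hm hr]

lemma Low.not_low_symm {K : Set Plane} {p q : Plane} (hpq : p ≠ q) (hov : Ov K (q - p))
    (h : Low K p q) : ¬ Low K q p := by
  intro h'
  have := hov.exists_om_pos (sub_ne_zero.2 hpq.symm) (p := p) (q := p) (by simpa using h)
    (by simpa using h')
  simp at this

lemma Low.om_tan_nonneg {K : Set Plane} {p q t₁ t₂ : Plane} (h : Low K p q) (hpq : p ≠ q)
    (hov : Ov K (q - p)) (h₁ : Tan K p t₁) (h₂ : Tan K q t₂) : 0 ≤ om t₁ t₂ := by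
  by_contra hneg
  exact h.not_low_symm hpq hov (low_of_tan h.2.1 h.1 h₂ h₁ (by rw [om_comm]; linarith))

lemma Low.om_tan_pos {K : Set Plane} {p q t₁ t₂ : Plane} (h : Low K p q) (hpq : p ≠ q)
    (hov : Ov K (q - p)) (h₁ : Tan K p t₁) (h₂ : Tan K q t₂) (he : ¬ Edge K (q - p)) :
    0 < om t₁ t₂ := by
  refine lt_of_le_of_ne (h.om_tan_nonneg hpq hov h₁ h₂) fun h0 => ?_
  obtain ⟨⟨s, hs⟩, ht⟩ := hov.tan_parallel h.1 h.2.1 h₁ h₂ h0.symm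
  rcases le_total 0 s with hs0 | hs0
  · refine he ⟨p, h.1, by simpa using h.2.1, fun k hk => ?_⟩
    rw [hs, om_smul_left]
    exact mul_nonneg hs0 (h₁.2 k hk)
  · refine h.not_low_symm hpq hov ⟨h.2.1, h.1, fun k hk _ => ?_⟩
    rw [← neg_sub q p, hs, om_neg_left, om_smul_left]
    nlinarith [ht.2 k hk]

/-- The relabelling of an inscribed parallelogram. -/
lemma low_reindex {K : Set Plane} (hK : Body K) {x p q : Plane} (hx : x ≠ 0) (hov : Ov K x)
    (hp : Low K p (p + x)) (hq : Low K (q + x) q) (hy : Ov K (q - p)) :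
    Low K (p + x) (q + x) ∧ Low K q p := by
  have hpos := hov.exists_om_pos hx hp hq
  have hpx : p ≠ p + x := by simpa using hx
  have hqx : q + x ≠ q := by simpa using hx
  constructor
  · refine (low_or_low hK hp.2.1 hq.1 (hp.right_not_mem_interior hK.conv hpx)
      (hq.left_not_mem_interior hK.conv hqx) (by simpa using hy)).resolve_right fun h => ?_
    have := h.2.2 q hq.2.1 (by convert hp.1 using 1; abel)
    rw [show p + x - (q + x) = -(q - p) by abel, show q - (q + x) = -x by abel, om_neg_left,
      om_neg_right, neg_neg, om_comm] at this
    linarith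
  · refine (low_or_low hK hp.1 hq.2.1 (hp.left_not_mem_interior hK.conv hpx)
      (hq.right_not_mem_interior hK.conv hqx) hy).resolve_left fun h => ?_
    have := h.2.2 (p + x) hp.2.1 (by convert hq.1 using 1; abel)
    rw [add_sub_cancel_left, om_comm] at this
    linarith

lemma exists_tan_of_not_ov {K : Set Plane} (hK : Body K) {p y : Plane} (hy : ¬ Ov K y)
    (hp : p ∈ K) (hpy : p + y ∈ K) :
    ∃ τ, Tan K p τ ∧ Tan K (p + y) (-τ) := by
  have hopen : IsOpen (interior K - interior K) := isOpen_interior.sub_right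
  have hny : y ∉ interior K - interior K := by
    rintro ⟨a, ha, b, hb, rfl⟩
    exact hy ⟨b, hb, by simpa using ha⟩
  obtain ⟨f, hf⟩ := geometric_hahn_banach_open_point
    (hK.conv.interior.sub hK.conv.interior) hopen hny
  obtain ⟨τ, hτ⟩ := exists_om_rep f
  have h0 : ∀ a ∈ interior K, ∀ b ∈ interior K, f (a - b) ≤ f y := fun a ha b hb =>
    (hf _ ⟨a, ha, b, hb, rfl⟩).le
  have h1 : ∀ a ∈ K, ∀ b ∈ interior K, f (a - b) ≤ f y := by
    intro a ha b hb
    rw [← hK.closure_interior] at ha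
    exact closure_minimal (fun a ha => h0 a ha b hb)
      (isClosed_le (f.continuous.comp (by fun_prop)) continuous_const) ha
  have h2 : ∀ a ∈ K, ∀ b ∈ K, f (a - b) ≤ f y := by
    intro a ha b hb
    rw [← hK.closure_interior] at hb
    exact closure_minimal (fun b hb => h1 a ha b hb)
      (isClosed_le (f.continuous.comp (by fun_prop)) continuous_const) hb
  have hτ0 : τ ≠ 0 := by
    rintro rfl
    obtain ⟨k, hk⟩ := hK.int
    simpa [hτ] using hf _ ⟨k, hk, k, hk, rfl⟩
  refine ⟨τ, ⟨hτ0, fun k hk => ?_⟩, by simpa using hτ0, fun k hk => ?_⟩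
  · have := h2 _ hpy _ hk
    rw [hτ, hτ] at this
    rw [om_sub_right] at *; rw [om_add_right] at *; linarith
  · have := h2 _ hk _ hp
    rw [hτ, hτ] at this
    rw [om_neg_left]; rw [om_sub_right] at *; rw [om_add_right] at *; linarith

lemma ov_of_not_edge {K : Set Plane} (hK : Body K) {x p q : Plane}
    (h₁ : ¬ Edge K x) (h₂ : ¬ Edge K (-x)) (hp : p ∈ K) (hpx : p + x ∈ K) (hq : q ∈ K)
    (hqx : q + x ∈ K) : Ov K (q - p) := by
  by_contra hy
  obtain ⟨τ, h3, h4⟩ := exists_tan_of_not_ov hK hy hp (by simpa using hq)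
  have e1 := h3.2 _ hpx
  have e2 := h4.2 _ hqx
  rw [add_sub_cancel_left] at e1
  rw [show q + x - (p + (q - p)) = x by abel, om_neg_left] at e2
  obtain ⟨c, rfl⟩ := exists_smul_of_om_eq_zero h3.1 (b := x) (by linarith)
  rcases le_total 0 c with hc | hc
  · refine h₁ ⟨p, hp, hpx, fun k hk => ?_⟩
    rw [om_smul_left]; exact mul_nonneg hc (h3.2 k hk)
  · refine h₂ ⟨p + c • τ, hpx, by simpa using hp, fun k hk => ?_⟩
    have := h3.2 k hk
    rw [← sub_sub, om_neg_left, om_sub_right, om_smul_left, om_smul_left, om_smul_right, om_self]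
    nlinarith

lemma Edge.smul {K : Set Plane} (hK : Convex ℝ K) {x : Plane} (h : Edge K x) {c : ℝ}
    (h0 : 0 ≤ c) (h1 : c ≤ 1) : Edge K (c • x) := by
  obtain ⟨p, hp, hpx, hk⟩ := h
  refine ⟨p, hp, ?_, fun k hk' => ?_⟩
  · simpa using hK.add_smul_sub_mem hp hpx ⟨h0, h1⟩
  · rw [om_smul_left]; exact mul_nonneg h0 (hk k hk')

lemma isClosed_edge {K : Set Plane} (hK : IsCompact K) : IsClosed {x | Edge K x} := by
  have hc : IsCompact ((K ×ˢ K) ∩ {z : Plane × Plane | ∀ k ∈ K, 0 ≤ om (z.2 - z.1) (k - z.1)}) := by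
    refine (hK.prod hK).inter_right ?_
    simp only [Set.ofPred_forall]
    exact isClosed_biInter fun k _ => isClosed_le continuous_const (by fun_prop)
  have : {x | Edge K x} = (fun z : Plane × Plane => z.2 - z.1) ''
      ((K ×ˢ K) ∩ {z : Plane × Plane | ∀ k ∈ K, 0 ≤ om (z.2 - z.1) (k - z.1)}) := by
    ext x
    constructor
    · rintro ⟨p, hp, hpx, h⟩
      exact ⟨(p, p + x), ⟨⟨hp, hpx⟩, by simpa using h⟩, by simp⟩
    · rintro ⟨⟨p, q⟩, ⟨⟨hp, hq⟩, h⟩, rfl⟩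
      exact ⟨p, hp, by simpa using hq, h⟩
  rw [this]
  exact (hc.image (by fun_prop)).isClosed

open Classical in
/-- The starting point of an extremal chord with direction `x`. -/
noncomputable def lo (K : Set Plane) (x : Plane) : Plane :=
  if h : ∃ p, Low K p (p + x) then h.choose else 0

lemma low_lo {K : Set Plane} (hK : Body K) {x : Plane} (hov : Ov K x) :
    Low K (lo K x) (lo K x + x) := by
  obtain ⟨k, hk, hkx⟩ := hov
  have h := low_exists hK.comp (interior_subset hk) (interior_subset hkx)
  rw [lo, dif_pos h]
  exact h.choose_spec

lemma lo_eq {K : Set Plane} (hK : Body K) {x p : Plane} (hx : x ≠ 0) (he : ¬ Edge K x)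
    (h : Low K p (p + x)) : lo K x = p := by
  have h' : ∃ p, Low K p (p + x) := ⟨p, h⟩
  rw [lo, dif_pos h']
  exact low_unique hK.conv hx he h'.choose_spec h

lemma lo_tendsto {K : Set Plane} (hK : Body K) {x : Plane} (hx : x ≠ 0) (he : ¬ Edge K x)
    (hov : Ov K x) {ι : Type*} {l : Filter ι} {u v : ι → Plane} (hv : Filter.Tendsto v l (nhds x))
    (h : ∀ᶠ i in l, Low K (u i) (u i + v i)) : Filter.Tendsto u l (nhds (lo K x)) := by
  refine hK.comp.tendsto_nhds_of_unique_mapClusterPt (h.mono fun i hi => hi.1) fun y _ hc => ?_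
  refine (lo_eq hK hx he ?_).symm
  have hne : (l ⊓ Filter.comap u (nhds y)).NeBot := by
    rw [inf_comm]; exact mapClusterPt_iff_ultrafilter.1 hc |>.elim fun U hU => by
      refine Filter.neBot_of_le (f := (U : Filter ι)) (le_inf ?_ hU.1)
      exact (Filter.tendsto_iff_comap.1 hU.2)
  have hu' : Filter.Tendsto u (l ⊓ Filter.comap u (nhds y)) (nhds y) :=
    Filter.tendsto_comap.mono_left inf_le_right
  refine Low.of_tendsto hK (l := l ⊓ Filter.comap u (nhds y)) (u := u) (v := fun i => u i + v i)
    (by simpa using hov) hu' (hu'.add (hv.mono_left inf_le_left)) ?_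
  exact (h.filter_mono inf_le_left).frequently

lemma continuousAt_lo {K : Set Plane} (hK : Body K) {x : Plane} (hx : x ≠ 0) (he : ¬ Edge K x)
    (hov : Ov K x) : ContinuousAt (lo K) x :=
  lo_tendsto hK hx he hov Filter.tendsto_id
    (Filter.mem_of_superset ((isOpen_ov K).mem_nhds hov) fun _ h => low_lo hK h)


lemma interior_neg_set (K : Set Plane) : interior (-K) = -interior K :=
  ((Homeomorph.neg Plane).preimage_interior K).symm

lemma Body.neg {K : Set Plane} (hK : Body K) : Body (-K) := by
  refine ⟨hK.comp.neg, hK.conv.neg, ?_⟩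
  rw [interior_neg_set]; exact hK.int.neg

lemma low_neg {K : Set Plane} {p q : Plane} : Low (-K) (-p) (-q) ↔ Low K p q := by
  simp only [Low, Set.mem_neg, neg_neg]
  refine and_congr_right fun _ => and_congr_right fun _ => ⟨fun h k hk hkx => ?_, fun h k hk hkx => ?_⟩
  · have := h (-k) (by simpa using hk) (by convert hkx using 1; abel)
    rw [show -q - -p = -(q - p) by abel, show -k - -p = -(k - p) by abel, om_neg_left,
      om_neg_right, neg_neg] at this
    exact this
  · have := h (-k) hk (by convert hkx using 1; abel)
    rw [show -q - -p = -(q - p) by abel, show k - -p = -(-k - p) by abel, om_neg_left,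
      om_neg_right, neg_neg]
    exact this

lemma ov_neg_iff {K : Set Plane} {x : Plane} : Ov K (-x) ↔ Ov K x :=
  ⟨fun h => by simpa using h.neg, Ov.neg⟩

lemma ov_neg_set {K : Set Plane} {x : Plane} : Ov (-K) x ↔ Ov K x := by
  rw [← ov_neg_iff (K := K)]
  simp only [Ov, interior_neg_set, Set.mem_neg]
  constructor
  · rintro ⟨k, hk, h⟩; exact ⟨-k, hk, by convert h using 1; abel⟩
  · rintro ⟨k, hk, h⟩; exact ⟨-k, by simpa using hk, by convert h using 1; abel⟩

lemma edge_neg_set {K : Set Plane} {x : Plane} : Edge (-K) x ↔ Edge K (-x) := by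
  simp only [Edge, Set.mem_neg]
  constructor
  · rintro ⟨k, hk, h, h'⟩
    refine ⟨-k, hk, by convert h using 1; abel, fun z hz => ?_⟩
    have := h' (-z) (by simpa using hz)
    rw [show z - -k = -(-z - k) by abel, om_neg_left, om_neg_right, neg_neg]; exact this
  · rintro ⟨k, hk, h, h'⟩
    refine ⟨-k, by simpa using hk, by convert h using 1; abel, fun z hz => ?_⟩
    have := h' (-z) hz
    rw [show -z - k = -(z - -k) by abel, om_neg_left, om_neg_right, neg_neg] at this; exact this

lemma tan_neg {K : Set Plane} {p τ : Plane} : Tan (-K) (-p) (-τ) ↔ Tan K p τ := by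
  simp only [Tan, Set.mem_neg, neg_ne_zero, ne_eq]
  refine and_congr_right fun _ => ⟨fun h k hk => ?_, fun h k hk => ?_⟩
  · have := h (-k) (by simpa using hk)
    rw [show -k - -p = -(k - p) by abel, om_neg_left, om_neg_right, neg_neg] at this; exact this
  · have := h (-k) hk
    rw [show k - -p = -(-k - p) by abel, om_neg_left, om_neg_right, neg_neg]; exact this

/-- The covariogram. -/
noncomputable def cov (K : Set Plane) (x : Plane) : ℝ :=
  volume.real {k | k ∈ K ∧ k + x ∈ K}

lemma cov_eq_of_volume_eq {K L : Set Plane}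
    (h : ∀ t : Plane, volume (K ∩ ((fun x => x + t) '' K)) =
      volume (L ∩ ((fun x => x + t) '' L))) (x : Plane) : cov K x = cov L x := by
  have key : ∀ M : Set Plane, M ∩ ((fun y => y + -x) '' M) = {k | k ∈ M ∧ k + x ∈ M} := by
    intro M; ext k
    simp [← sub_eq_add_neg, sub_eq_iff_eq_add]
  have := h (-x)
  rw [key, key] at this
  simp only [cov, Measure.real, this]

lemma measureReal_translate (s : Set Plane) (v : Plane) :
    volume.real ((fun k => k + v) ⁻¹' s) = volume.real s := by
  simp only [Measure.real]; rw [measure_preimage_add_right]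

lemma cov_neg {K : Set Plane} (x : Plane) : cov (-K) x = cov K x := by
  have h1 : {k | k ∈ -K ∧ k + x ∈ -K} = -((fun k => k + -x) ⁻¹' {k | k ∈ K ∧ k + x ∈ K}) := by
    ext k; simp [and_comm, add_comm]
  rw [cov, h1, cov, ← measureReal_translate {k | k ∈ K ∧ k + x ∈ K} (-x)]
  simp only [Measure.real, Measure.measure_neg]

lemma cov_translate {K : Set Plane} (x v : Plane) : cov ((fun y => y + v) '' K) x = cov K x := by
  have h1 : {k | k ∈ (fun y => y + v) '' K ∧ k + x ∈ (fun y => y + v) '' K} =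
      (fun k => k + -v) ⁻¹' {k | k ∈ K ∧ k + x ∈ K} := by
    ext k
    simp only [Set.image_add_right, Set.mem_preimage, Set.mem_ofPred_eq]
    rw [add_right_comm]
  rw [cov, h1, cov, measureReal_translate]

lemma Body.translate {K : Set Plane} (hK : Body K) (v : Plane) : Body ((fun y => y + v) '' K) := by
  refine ⟨hK.comp.image (by fun_prop), ?_, ?_⟩
  · have := hK.conv.translate v
    simpa only [add_comm] using this
  · have : interior ((fun y => y + v) '' K) = (fun y => y + v) '' interior K :=
      ((Homeomorph.addRight v).image_interior K).symm
    rw [this]; exact hK.int.image _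

lemma Body.measure_ne_top {K s : Set Plane} (hK : Body K) (h : s ⊆ K) : volume s ≠ ⊤ :=
  ((measure_mono h).trans_lt hK.comp.measure_lt_top).ne

lemma ov_iff_cov_pos {K : Set Plane} (hK : Body K) {x : Plane} : Ov K x ↔ 0 < cov K x := by
  have hsub : {k | k ∈ K ∧ k + x ∈ K} ⊆ K := fun k hk => hk.1
  constructor
  · rintro ⟨k, hk, hkx⟩
    have ho : IsOpen (interior K ∩ (fun y => y + x) ⁻¹' interior K) :=
      isOpen_interior.inter (isOpen_interior.preimage (by fun_prop))
    have h1 := ho.measure_pos volume ⟨k, hk, hkx⟩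
    have h2 : volume (interior K ∩ (fun y => y + x) ⁻¹' interior K) ≤
        volume {k | k ∈ K ∧ k + x ∈ K} :=
      measure_mono fun k hk => ⟨interior_subset hk.1, interior_subset hk.2⟩
    exact ENNReal.toReal_pos (h1.trans_le h2).ne' (hK.measure_ne_top hsub)
  · intro h
    have hconv : Convex ℝ {k | k ∈ K ∧ k + x ∈ K} :=
      hK.conv.inter (hK.conv.translate_preimage_left x)
    by_cases hne : (interior {k | k ∈ K ∧ k + x ∈ K}).Nonempty
    · obtain ⟨k, hk⟩ := hne
      refine ⟨k, interior_mono hsub hk, ?_⟩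
      have : interior {k | k ∈ K ∧ k + x ∈ K} ⊆ (fun y => y + x) ⁻¹' interior K := by
        have h3 := (Homeomorph.addRight x).preimage_interior K
        change (fun y => y + x) ⁻¹' interior K = interior ((fun y => y + x) ⁻¹' K) at h3
        rw [h3]
        exact interior_mono fun k hk => hk.2
      exact this hk
    · exfalso
      have h0 : volume {k | k ∈ K ∧ k + x ∈ K} = 0 := by
        refine measure_mono_null ?_ (hconv.addHaar_frontier volume)
        rw [frontier, Set.not_nonempty_iff_eq_empty.1 hne, Set.sdiff_empty]
        exact subset_closure
      rw [cov, Measure.real, h0] at h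
      simp at h

lemma exists_diff_of_ov {K L : Set Plane} (hK : Body K) (hL : Body L)
    (h : ∀ x, Ov K x → Ov L x) {p q : Plane} (hp : p ∈ K) (hq : q ∈ K) :
    ∃ p' ∈ L, p' + (q - p) ∈ L := by
  have hc : IsClosed (L - L) := (by
    rw [← Set.image2_sub, ← Set.image_prod]
    exact ((hL.comp.prod hL.comp).image (by fun_prop)).isClosed)
  obtain ⟨c, hc'⟩ := hK.int
  have ht : Filter.Tendsto (fun ε : ℝ => (q + ε • (c - q)) - (p + ε • (c - p)))
      (nhdsWithin 0 (Set.Ioi 0)) (nhds ((q + (0:ℝ) • (c - q)) - (p + (0:ℝ) • (c - p)))) :=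
    ((by fun_prop : Continuous fun ε : ℝ => (q + ε • (c - q)) - (p + ε • (c - p))).tendsto 0).mono_left
      nhdsWithin_le_nhds
  simp only [zero_smul, add_zero] at ht
  have hmem : q - p ∈ L - L := by
    refine hc.mem_of_tendsto ht
      (Filter.eventually_of_mem (Ioo_mem_nhdsGT (by norm_num : (0:ℝ) < 1)) fun ε hε => ?_)
    obtain ⟨k, hk, hkx⟩ := h (q + ε • (c - q) - (p + ε • (c - p)))
      ⟨_, hK.combo_mem_interior hp hc' hε.1 hε.2.le, by
        have := hK.combo_mem_interior hq hc' hε.1 hε.2.le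
        convert this using 1; abel⟩
    exact ⟨_, interior_subset hkx, k, interior_subset hk, by simp⟩
  obtain ⟨a, ha, b, hb, hab⟩ := hmem
  exact ⟨b, hb, by rw [← hab]; simpa using ha⟩

/-- A (possibly degenerate) parallelogram-shaped set in the coordinates `p + α x + β y`. -/
def pbox (p x y : Plane) (S T : Set ℝ) : Set Plane :=
  {k | ∃ α ∈ S, ∃ β ∈ T, k = p + α • x + β • y}

lemma mem_pbox_iff {p x y k : Plane} {S T : Set ℝ} (h : om x y ≠ 0) :
    k ∈ pbox p x y S T ↔ om (k - p) y / om x y ∈ S ∧ om x (k - p) / om x y ∈ T := by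
  constructor
  · rintro ⟨α, hα, β, hβ, rfl⟩
    rw [show p + α • x + β • y - p = α • x + β • y by abel]
    simp only [om_add_left, om_add_right, om_smul_left, om_smul_right, om_self]
    simp only [mul_zero, add_zero, zero_add]
    rw [mul_div_cancel_right₀ _ h, mul_div_cancel_right₀ _ h]
    exact ⟨hα, hβ⟩
  · rintro ⟨h1, h2⟩
    refine ⟨_, h1, _, h2, ?_⟩
    have := om_cramer x y (k - p)
    rw [div_eq_inv_mul, div_eq_inv_mul, mul_smul, mul_smul, add_assoc, ← smul_add, ← this,
      smul_smul, inv_mul_cancel₀ h]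
    simp

lemma volume_pbox {p x y : Plane} {S T : Set ℝ} (h : 0 < om x y) :
    volume.real (pbox p x y S T) = om x y * volume.real S * volume.real T := by
  let M : Matrix (Fin 2) (Fin 2) ℝ := !![x 0, y 0; x 1, y 1]
  let f : Plane →ₗ[ℝ] Plane := Matrix.toLin (EuclideanSpace.basisFun (Fin 2) ℝ).toBasis
    (EuclideanSpace.basisFun (Fin 2) ℝ).toBasis M
  have hdet : LinearMap.det f = om x y := by
    simp only [f, LinearMap.det_toLin]
    simp [M, Matrix.det_fin_two, om]; ring
  have hf : ∀ z : Plane, f z = z 0 • x + z 1 • y := by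
    intro z
    ext i
    have := Matrix.toLin_apply (EuclideanSpace.basisFun (Fin 2) ℝ).toBasis
      (EuclideanSpace.basisFun (Fin 2) ℝ).toBasis M z
    simp only [f, this]
    fin_cases i <;>
      simp [Matrix.mulVec, dotProduct, Fin.sum_univ_two, M] <;> ring
  have himg : pbox p x y S T = (fun k => k + -p) ⁻¹' (f '' {z : Plane | z 0 ∈ S ∧ z 1 ∈ T}) := by
    ext k
    simp only [pbox, Set.mem_ofPred_eq, Set.mem_preimage, Set.mem_image]
    constructor
    · rintro ⟨α, hα, β, hβ, rfl⟩
      refine ⟨!₂[α, β], ⟨by simpa using hα, by simpa using hβ⟩, ?_⟩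
      rw [hf]; simp; abel
    · rintro ⟨z, ⟨h1, h2⟩, h3⟩
      refine ⟨_, h1, _, h2, ?_⟩
      rw [hf] at h3
      rw [add_assoc, h3]; abel
  have hbox : volume {z : Plane | z 0 ∈ S ∧ z 1 ∈ T} = volume S * volume T := by
    have hmp := EuclideanSpace.volume_preserving_symm_measurableEquiv_toLp (Fin 2)
    have : {z : Plane | z 0 ∈ S ∧ z 1 ∈ T} =
        (MeasurableEquiv.toLp 2 (Fin 2 → ℝ)).symm ⁻¹' (Set.univ.pi ![S, T]) := by
      ext z; simp [Set.mem_pi, Fin.forall_fin_two]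
    rw [this, hmp.measure_preimage_equiv, volume_pi_pi]
    simp
  rw [himg, measureReal_translate]
  simp only [Measure.real]
  rw [Measure.addHaar_image_linearMap, hdet, hbox, ENNReal.toReal_mul, ENNReal.toReal_mul,
    abs_of_pos h, ENNReal.toReal_ofReal h.le, mul_assoc]

/-- If `p` and `p + y` are boundary points, then points of `K` behind the chord `[p, p + y]`
can be moved by `x`. -/
lemma cap_shift {K : Set Plane} (hK : Body K) {p x y : Plane} (h : 0 < om x y)
    (hp : p ∈ K) (hpx : p + x ∈ K) (hpy : p + y ∈ K) (hpxy : p + x + y ∈ K)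
    (hpi : p ∉ interior K) (hpyi : p + y ∉ interior K) {α β : ℝ}
    (hk : p + α • x + β • y ∈ K) (hα : α < 0) :
    (0 ≤ β ∧ β ≤ 1) ∧ p + α • x + β • y + x ∈ K := by
  have hzero : ∀ t : Plane, t ≠ 0 → om t x = 0 → om t y = 0 → False := by
    intro t ht h1 h2
    obtain ⟨c, rfl⟩ := exists_smul_of_om_eq_zero ht h1
    obtain ⟨d, rfl⟩ := exists_smul_of_om_eq_zero ht h2
    simp [om_smul_left, om_smul_right] at h
  have h0 : 0 ≤ β := by
    by_contra hβ
    push Not at hβ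
    obtain ⟨t, ht⟩ := hK.exists_tan hpi
    have e1 := ht.2 _ hpx
    have e2 := ht.2 _ hpy
    have e3 := ht.2 _ hk
    rw [show p + α • x + β • y - p = α • x + β • y by abel, om_add_right, om_smul_right,
      om_smul_right] at e3
    rw [add_sub_cancel_left] at e1 e2
    exact hzero t ht.1 (by nlinarith) (by nlinarith)
  have h1 : β ≤ 1 := by
    by_contra hβ
    push Not at hβ
    obtain ⟨t, ht⟩ := hK.exists_tan hpyi
    have e1 := ht.2 _ hpxy
    have e2 := ht.2 _ hp
    have e3 := ht.2 _ hk
    rw [show p + α • x + β • y - (p + y) = α • x + (β - 1) • y by module, om_add_right,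
      om_smul_right, om_smul_right] at e3
    rw [show p + x + y - (p + y) = x by abel] at e1
    rw [show p - (p + y) = -y by abel, om_neg_right] at e2
    exact hzero t ht.1 (by nlinarith) (by nlinarith)
  refine ⟨⟨h0, h1⟩, ?_⟩
  have hm : p + x + β • y ∈ K := by
    have := hK.conv.add_smul_sub_mem hpx hpxy ⟨h0, h1⟩
    convert this using 1; module
  have := hK.conv.add_smul_sub_mem hk hm (t := 1 / (1 - α))
    ⟨by have : 0 < 1 - α := by linarith
        positivity, by rw [div_le_one (by linarith)]; linarith⟩
  convert this using 1
  have hne : 1 - α ≠ 0 := by linarith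
  match_scalars <;> field_simp <;> ring

lemma cov_ge_caps {K : Set Plane} (hK : Body K) {p x y : Plane} (h : 0 < om x y)
    (hp : p ∈ K) (hpx : p + x ∈ K) (hpy : p + y ∈ K) (hpxy : p + x + y ∈ K)
    (hpi : p ∉ interior K) (hpyi : p + y ∉ interior K) (hpxi : p + x ∉ interior K)
    (hpxyi : p + x + y ∉ interior K) :
    volume.real (K ∩ {k | om (k - p) y / om x y < 0}) +
      volume.real (K ∩ {k | 1 < om (k - p) y / om x y}) ≤ cov K x := by
  have hmeas : MeasurableSet (K ∩ {k | 1 < om (k - p) y / om x y}) := by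
    refine hK.comp.isClosed.measurableSet.inter (IsOpen.measurableSet ?_)
    exact isOpen_lt continuous_const (by fun_prop)
  rw [← measureReal_translate (K ∩ {k | 1 < om (k - p) y / om x y}) x, cov]
  have hcoord : ∀ k, k = p + (om (k - p) y / om x y) • x + (om x (k - p) / om x y) • y := by
    intro k
    have := (mem_pbox_iff (p := p) (k := k) (S := {om (k - p) y / om x y})
      (T := {om x (k - p) / om x y}) h.ne').2 ⟨rfl, rfl⟩
    obtain ⟨_, rfl, _, rfl, h⟩ := this
    exact h
  have hlamx : ∀ k, om (k + x - p) y / om x y = om (k - p) y / om x y + 1 := by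
    intro k
    rw [show k + x - p = (k - p) + x by abel, om_add_left, add_div, div_self h.ne']
  rw [← measureReal_union ?_ ?_ (h₁ := ?_) (h₂ := ?_)]
  · refine measureReal_mono ?_ (hK.measure_ne_top fun k hk => hk.1)
    rintro k (⟨hk, hl⟩ | ⟨hk, hl⟩)
    · refine ⟨hk, ?_⟩
      have := cap_shift hK h hp hpx hpy hpxy hpi hpyi (α := om (k - p) y / om x y)
        (β := om x (k - p) / om x y) (by rw [← hcoord]; exact hk) hl
      rw [← hcoord] at this
      exact this.2
    · refine ⟨?_, hk⟩
      simp only [Set.mem_ofPred_eq, hlamx] at hl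
      have h2 : p + x + y + (-(om (k - p) y / om x y)) • (-x) +
          (1 - om x (k - p) / om x y) • (-y) = k + x := by
        conv_rhs => rw [hcoord k]
        module
      have := cap_shift hK (p := p + x + y) (x := -x) (y := -y)
        (by simpa [om_neg_left, om_neg_right] using h) hpxy (by convert hpy using 1; abel)
        (by convert hpx using 1; abel) (by convert hp using 1; abel) hpxyi
        (by convert hpxi using 2; abel) (α := -(om (k - p) y / om x y))
        (β := 1 - om x (k - p) / om x y) (by rw [h2]; exact hk) (by linarith)
      rw [h2] at this
      simpa using this.2
  · rw [Set.disjoint_left]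
    rintro k ⟨_, hl⟩ ⟨_, hl'⟩
    simp only [Set.mem_ofPred_eq, hlamx] at hl hl'
    linarith
  · exact hmeas.preimage (by fun_prop)
  · exact hK.measure_ne_top Set.inter_subset_left
  · refine ne_top_of_le_ne_top (hK.measure_ne_top (s := K ∩ {k | 1 < om (k - p) y / om x y})
      Set.inter_subset_left) ?_
    rw [measure_preimage_add_right]

lemma cov_le_caps {K : Set Plane} (hK : Body K) {p x y : Plane} (x' : Plane) :
    cov K x' ≤ volume.real (K ∩ {k | om (k - p) y / om x y < 0}) +
      volume.real (K ∩ {k | om x' y / om x y ≤ om (k - p) y / om x y}) := by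
  rw [← measureReal_translate (K ∩ {k | om x' y / om x y ≤ om (k - p) y / om x y}) x', cov]
  refine (measureReal_mono ?_ ?_).trans (measureReal_union_le _ _)
  · rintro k ⟨hk, hkx⟩
    by_cases hl : om (k - p) y / om x y < 0
    · exact Or.inl ⟨hk, hl⟩
    · refine Or.inr ⟨hkx, ?_⟩
      simp only [Set.mem_ofPred_eq]
      rw [show k + x' - p = (k - p) + x' by abel, om_add_left, add_div]
      linarith
  · refine measure_union_ne_top (hK.measure_ne_top Set.inter_subset_left) ?_
    rw [measure_preimage_add_right]
    exact hK.measure_ne_top Set.inter_subset_left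

lemma cov_le_of_boxes {K : Set Plane} (hK : Body K) {p x y : Plane} (h : 0 < om x y)
    (hp : p ∈ K) (hpx : p + x ∈ K) (hpy : p + y ∈ K) (hpxy : p + x + y ∈ K)
    (hpi : p ∉ interior K) (hpyi : p + y ∉ interior K) (hpxi : p + x ∉ interior K)
    (hpxyi : p + x + y ∉ interior K) {x' : Plane} {ε : ℝ} (hε : 0 < ε) (hε' : ε < 1 / 2)
    (hin : ∀ α, |α - 1| ≤ |om x' y / om x y - 1| → ∀ β ∈ Set.Icc ε (1 - ε),
      p + α • x + β • y ∈ K)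
    (hout : ∀ α β, |α - 1| ≤ |om x' y / om x y - 1| → p + α • x + β • y ∈ K →
      β ∈ Set.Icc (-ε) (1 + ε)) :
    cov K x' ≤ cov K x + om y (x' - x) + 2 * ε * |om y (x' - x)| := by
  have h1 := cov_ge_caps hK h hp hpx hpy hpxy hpi hpyi hpxi hpxyi
  have h2 := cov_le_caps hK (p := p) (x := x) (y := y) x'
  set η := om x' y / om x y - 1 with hη
  have hηx : om y (x' - x) = - (η * om x y) := by
    rw [hη, sub_mul, div_mul_cancel₀ _ h.ne', om_sub_right, om_comm y x', om_comm y x]; ring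
  have hℓ : om x' y / om x y = 1 + η := by rw [hη]; ring
  rw [hℓ] at h2
  rw [hηx, abs_neg, abs_mul, abs_of_pos h]
  have hfin : ∀ s : Set Plane, volume (K ∩ s) ≠ ⊤ := fun s =>
    hK.measure_ne_top Set.inter_subset_left
  rcases le_or_gt η 0 with hη0 | hη0
  · rw [abs_of_nonpos hη0]
    have h3 : volume.real (K ∩ {k | 1 + η ≤ om (k - p) y / om x y}) ≤
        volume.real (K ∩ {k | 1 < om (k - p) y / om x y}) +
        volume.real (pbox p x y (Set.Icc (1 + η) 1) (Set.Icc (-ε) (1 + ε))) := by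
      refine (measureReal_mono ?_ ?_).trans (measureReal_union_le _ _)
      · rintro k ⟨hk, hl⟩
        by_cases hl' : 1 < om (k - p) y / om x y
        · exact Or.inl ⟨hk, hl'⟩
        right
        rw [mem_pbox_iff h.ne']
        have hα : om (k - p) y / om x y ∈ Set.Icc (1 + η) 1 := ⟨hl, not_lt.1 hl'⟩
        refine ⟨hα, ?_⟩
        refine hout (om (k - p) y / om x y) _ ?_ ?_
        · rw [abs_of_nonpos hη0, abs_of_nonpos (by linarith [hα.2])]; linarith [hα.1]
        · obtain ⟨_, rfl, _, rfl, h'⟩ := (mem_pbox_iff (p := p) (k := k)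
            (S := {om (k - p) y / om x y}) (T := {om x (k - p) / om x y}) h.ne').2 ⟨rfl, rfl⟩
          rw [← h']; exact hk
      · refine measure_union_ne_top (hfin _) (ne_of_lt ?_)
        refine Bornology.IsBounded.measure_lt_top ?_
        have : pbox p x y (Set.Icc (1 + η) 1) (Set.Icc (-ε) (1 + ε)) =
            (fun z : ℝ × ℝ => p + z.1 • x + z.2 • y) ''
              (Set.Icc (1 + η) 1 ×ˢ Set.Icc (-ε) (1 + ε)) := by
          ext k; simp only [pbox, Set.mem_image, Set.mem_prod, Set.mem_ofPred_eq, Prod.exists]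
          constructor
          · rintro ⟨a, ha, b, hb, rfl⟩; exact ⟨a, b, ⟨ha, hb⟩, rfl⟩
          · rintro ⟨a, b, ⟨ha, hb⟩, rfl⟩; exact ⟨a, ha, b, hb, rfl⟩
        rw [this]
        exact ((isCompact_Icc.prod isCompact_Icc).image (by fun_prop)).isBounded
    rw [volume_pbox h, Real.volume_real_Icc_of_le (by linarith),
      Real.volume_real_Icc_of_le (by linarith)] at h3
    have : om x y * (1 - (1 + η)) * (1 + ε - -ε) = -(η * om x y) + 2 * ε * (-η * om x y) := by ring
    linarith
  · rw [abs_of_pos hη0]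
    have h3 : volume.real (K ∩ {k | 1 + η ≤ om (k - p) y / om x y}) +
        volume.real (pbox p x y (Set.Ioo 1 (1 + η)) (Set.Icc ε (1 - ε))) ≤
        volume.real (K ∩ {k | 1 < om (k - p) y / om x y}) := by
      rw [add_comm, ← measureReal_union ?_ ?_ (h₁ := ?_) (h₂ := ?_)]
      · refine measureReal_mono ?_ (hfin _)
        rintro k (hk | ⟨hk, hl⟩)
        · have hk' := hk
          rw [mem_pbox_iff h.ne'] at hk
          refine ⟨?_, hk.1.1⟩
          obtain ⟨α, hα, β, hβ, rfl⟩ := hk'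
          refine hin α ?_ β hβ
          rw [abs_of_pos (by linarith [hα.1]), abs_of_pos hη0]; linarith [hα.2]
        · exact ⟨hk, by simp only [Set.mem_ofPred_eq] at hl ⊢; linarith⟩
      · rw [Set.disjoint_left]
        rintro k hk ⟨_, hl⟩
        rw [mem_pbox_iff h.ne'] at hk
        simp only [Set.mem_ofPred_eq] at hl
        linarith [hk.1.2]
      · refine hK.comp.isClosed.measurableSet.inter (IsClosed.measurableSet ?_)
        exact isClosed_le continuous_const (by fun_prop)
      · refine hK.measure_ne_top ?_
        rintro k ⟨α, hα, β, hβ, rfl⟩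
        refine hin α ?_ β hβ
        rw [abs_of_pos (by linarith [hα.1]), abs_of_pos hη0]; linarith [hα.2]
      · exact hfin _
    rw [volume_pbox h, Real.volume_real_Ioo_of_le (by linarith),
      Real.volume_real_Icc_of_le (by linarith)] at h3
    have : om x y * (1 + η - 1) * (1 - ε - ε) = η * om x y - 2 * ε * (η * om x y) := by ring
    linarith

/-- The second side of the parallelogram inscribed in `K` with first side `x`. -/
noncomputable def yv (K : Set Plane) (x : Plane) : Plane := lo K (-x) - x - lo K x

/-- `x` is the direction of a nondegenerate uniquely determined inscribed parallelogram. -/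
structure Reg (K : Set Plane) (x : Plane) : Prop where
  ne : x ≠ 0
  ov : Ov K x
  edge : ¬ Edge K x
  edge' : ¬ Edge K (-x)

lemma Reg.neg {K : Set Plane} {x : Plane} (h : Reg K x) : Reg K (-x) :=
  ⟨neg_ne_zero.2 h.ne, h.ov.neg, h.edge', by simpa using h.edge⟩

lemma Reg.neg_set {K : Set Plane} {x : Plane} (h : Reg K x) : Reg (-K) x :=
  ⟨h.ne, ov_neg_set.2 h.ov, fun he => h.edge' (edge_neg_set.1 he), fun he =>
    h.edge (by simpa using edge_neg_set.1 he)⟩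

lemma isOpen_reg {K : Set Plane} (hK : Body K) : IsOpen {x | Reg K x} := by
  have : {x | Reg K x} = {x | x ≠ 0} ∩ {x | Ov K x} ∩ {x | Edge K x}ᶜ ∩
      (fun x => -x) ⁻¹' {x | Edge K x}ᶜ := by
    ext x
    exact ⟨fun h => ⟨⟨⟨h.1, h.2⟩, h.3⟩, h.4⟩, fun h => ⟨h.1.1.1, h.1.1.2, h.1.2, h.2⟩⟩
  rw [this]
  exact ((isOpen_ne.inter (isOpen_ov K)).inter (isClosed_edge hK.comp).isOpen_compl).inter
    ((isClosed_edge hK.comp).isOpen_compl.preimage continuous_neg)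

lemma lo_neg_set {K : Set Plane} (hK : Body K) {x : Plane} (h : Reg K x) :
    lo (-K) x = - lo K (-x) := by
  refine lo_eq hK.neg h.ne h.neg_set.edge ?_
  have := low_lo hK h.ov.neg
  rw [← low_neg] at this
  convert this using 1; abel

lemma yv_neg_set {K : Set Plane} (hK : Body K) {x : Plane} (h : Reg K x) :
    yv (-K) x = yv K x := by
  rw [yv, yv, lo_neg_set hK h, lo_neg_set hK h.neg, neg_neg]; abel

/-- The properties of the parallelogram inscribed in `K` with first side `x`. -/
structure Para (K : Set Plane) (p x y : Plane) : Prop where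
  pos : 0 < om x y
  mem : p ∈ K
  memx : p + x ∈ K
  memy : p + y ∈ K
  memxy : p + x + y ∈ K
  ni : p ∉ interior K
  nix : p + x ∉ interior K
  niy : p + y ∉ interior K
  nixy : p + x + y ∉ interior K
  ov : Ov K x
  ov' : Ov K y
  low1 : Low K p (p + x)
  low2 : Low K (p + x) (p + x + y)
  low3 : Low K (p + x + y) (p + y)
  low4 : Low K (p + y) p

lemma para_of_low {K : Set Plane} (hK : Body K) {x p q : Plane} (hx : x ≠ 0) (hov : Ov K x)
    (hp : Low K p (p + x)) (hq : Low K (q + x) q) (hy : Ov K (q - p)) : Para K p x (q - p) := by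
  have h := low_reindex hK hx hov hp hq hy
  have hpx : p ≠ p + x := by simpa using hx
  have hqx : q + x ≠ q := by simpa using hx
  have e1 : p + (q - p) = q := by abel
  have e2 : p + x + (q - p) = q + x := by abel
  refine ⟨hov.exists_om_pos hx hp hq, hp.1, hp.2.1, ?_, ?_, hp.left_not_mem_interior hK.conv hpx,
    hp.right_not_mem_interior hK.conv hpx, ?_, ?_, hov, hy, hp, ?_, ?_, ?_⟩ <;>
    simp only [e1, e2]
  exacts [hq.2.1, hq.1, hq.right_not_mem_interior hK.conv hqx,
    hq.left_not_mem_interior hK.conv hqx, h.1, hq, h.2]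

lemma Reg.para {K : Set Plane} (hK : Body K) {x : Plane} (h : Reg K x) :
    Para K (lo K x) x (yv K x) := by
  have hq := low_lo hK h.ov.neg
  have hp := low_lo hK h.ov
  have hq' : Low K (lo K (-x) - x + x) (lo K (-x) - x) := by
    simpa [sub_eq_add_neg] using hq
  exact para_of_low hK h.ne h.ov hp hq'
    (ov_of_not_edge hK h.edge h.edge' hp.1 hp.2.1 hq'.2.1 hq'.1)

lemma Reg.continuousAt_lo {K : Set Plane} (hK : Body K) {x : Plane} (h : Reg K x) :
    ContinuousAt (lo K) x := _root_.continuousAt_lo hK h.ne h.edge h.ov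

lemma Reg.continuousAt_lo_neg {K : Set Plane} (hK : Body K) {x : Plane} (h : Reg K x) :
    ContinuousAt (fun x => lo K (-x)) x :=
  ContinuousAt.comp (f := fun x : Plane => -x) (h.neg.continuousAt_lo hK) continuous_neg.continuousAt

lemma Reg.continuousAt_yv {K : Set Plane} (hK : Body K) {x : Plane} (h : Reg K x) :
    ContinuousAt (yv K) x :=
  ((h.continuousAt_lo_neg hK).sub continuousAt_id).sub (h.continuousAt_lo hK)

lemma interior_of_between {K : Set Plane} (hK : Body K) {a b : Plane} (ha : a ∈ interior K)
    {s : ℝ} (hs : 1 < s) (hb : a + s • (b - a) ∈ K) : b ∈ interior K := by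
  have h0 : 0 < s := by linarith
  have := hK.combo_mem_interior hb ha (ε := 1 - 1 / s)
    (by rw [sub_pos, div_lt_one h0]; exact hs) (by simp; positivity)
  convert this using 1
  match_scalars <;> field_simp <;> ring

lemma cov_upper_of_seg {K : Set Plane} (hK : Body K) {x₀ : Plane} (h : Reg K x₀)
    (hseg : ∀ β ∈ Set.Ioo (0:ℝ) 1, lo K x₀ + x₀ + β • yv K x₀ ∈ interior K) {ε : ℝ} (hε : 0 < ε) :
    ∀ᶠ z in nhds (x₀, x₀), cov K z.2 ≤ cov K z.1 + om (yv K z.1) (z.2 - z.1) +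
      ε * ‖z.2 - z.1‖ := by
  have hpar := h.para hK
  have hF : ∀ β : ℝ, ContinuousAt (fun z : (Plane × ℝ) × ℝ =>
      lo K z.1.1 + z.1.2 • z.1.1 + z.2 • yv K z.1.1) ((x₀, 1), β) := by
    intro β
    have c1 : ContinuousAt (fun z : (Plane × ℝ) × ℝ => z.1.1) ((x₀, 1), β) := by fun_prop
    have c2 : ContinuousAt (fun z : (Plane × ℝ) × ℝ => lo K z.1.1) ((x₀, 1), β) :=
      ContinuousAt.comp (g := lo K) (h.continuousAt_lo hK) c1
    have c3 : ContinuousAt (fun z : (Plane × ℝ) × ℝ => yv K z.1.1) ((x₀, 1), β) :=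
      ContinuousAt.comp (g := yv K) (h.continuousAt_yv hK) c1
    fun_prop
  have hY : 0 < ‖yv K x₀‖ + 1 := by positivity
  obtain ⟨e, he0, he1, he2⟩ : ∃ e : ℝ, 0 < e ∧ e < 1 / 2 ∧ 2 * e * (‖yv K x₀‖ + 1) ≤ ε := by
    refine ⟨min (1 / 4) (ε / (2 * (‖yv K x₀‖ + 1))), by positivity, ?_, ?_⟩
    · exact (min_le_left _ _).trans_lt (by norm_num)
    · calc 2 * min (1 / 4) (ε / (2 * (‖yv K x₀‖ + 1))) * (‖yv K x₀‖ + 1)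
          ≤ 2 * (ε / (2 * (‖yv K x₀‖ + 1))) * (‖yv K x₀‖ + 1) := by
            gcongr; exact min_le_right _ _
        _ = ε := by field_simp
  have hhalf : lo K x₀ + x₀ + (1 / 2 : ℝ) • yv K x₀ ∈ interior K := hseg _ ⟨by norm_num, by norm_num⟩
  have hout1 : lo K x₀ + (1:ℝ) • x₀ + (1 + e) • yv K x₀ ∈ Kᶜ := by
    intro hk
    refine hpar.nixy (interior_of_between hK hhalf (s := (1 / 2 + e) / (1 / 2)) ?_ ?_)
    · rw [lt_div_iff₀] <;> linarith
    · convert hk using 1; match_scalars <;> ring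
  have hout0 : lo K x₀ + (1:ℝ) • x₀ + (-e) • yv K x₀ ∈ Kᶜ := by
    intro hk
    refine hpar.nix (interior_of_between hK hhalf (s := (1 / 2 + e) / (1 / 2)) ?_ ?_)
    · rw [lt_div_iff₀] <;> linarith
    · convert hk using 1; match_scalars <;> ring
  have ev1 : ∀ᶠ w : Plane × ℝ in nhds (x₀, 1), ∀ β ∈ Set.Icc e (1 - e),
      lo K w.1 + w.2 • w.1 + β • yv K w.1 ∈ interior K := by
    refine isCompact_Icc.eventually_forall_of_forall_eventually fun β hβ => ?_
    exact (hF β).eventually (isOpen_interior.mem_nhds (by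
      simp only [one_smul]; exact hseg β ⟨by linarith [hβ.1], by linarith [hβ.2]⟩))
  have ev2 : ∀ᶠ w : Plane × ℝ in nhds (x₀, 1), lo K w.1 + w.2 • w.1 + (1 + e) • yv K w.1 ∈ Kᶜ := by
    have := (hF (1 + e)).eventually (hK.comp.isClosed.isOpen_compl.mem_nhds hout1)
    exact (Continuous.tendsto (by fun_prop : Continuous fun w : Plane × ℝ => (w, 1 + e))
      (x₀, 1)).eventually this
  have ev3 : ∀ᶠ w : Plane × ℝ in nhds (x₀, 1), lo K w.1 + w.2 • w.1 + (-e) • yv K w.1 ∈ Kᶜ := by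
    have := (hF (-e)).eventually (hK.comp.isClosed.isOpen_compl.mem_nhds hout0)
    exact (Continuous.tendsto (by fun_prop : Continuous fun w : Plane × ℝ => (w, -e))
      (x₀, 1)).eventually this
  obtain ⟨δ, hδ, hball⟩ := Metric.eventually_nhds_iff.1 (ev1.and (ev2.and ev3))
  have c1 : ContinuousAt (fun z : Plane × Plane => yv K z.1) (x₀, x₀) :=
    ContinuousAt.comp (g := yv K) (h.continuousAt_yv hK) continuousAt_fst
  have evη : ∀ᶠ z in nhds (x₀, x₀), |om z.2 (yv K z.1) / om z.1 (yv K z.1) - 1| < δ := by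
    have : Filter.Tendsto (fun z : Plane × Plane => om z.2 (yv K z.1) / om z.1 (yv K z.1) - 1)
        (nhds (x₀, x₀)) (nhds (om x₀ (yv K x₀) / om x₀ (yv K x₀) - 1)) :=
      ((continuous_snd.tendsto _).om c1 |>.div ((continuous_fst.tendsto _).om c1)
        hpar.pos.ne').sub_const _
    rw [div_self hpar.pos.ne', sub_self] at this
    have h2 := this.abs
    rw [abs_zero] at h2
    exact h2.eventually (gt_mem_nhds hδ)
  have evY : ∀ᶠ z in nhds (x₀, x₀), ‖yv K z.1‖ < ‖yv K x₀‖ + 1 :=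
    c1.norm.eventually (gt_mem_nhds (by simp))
  have evd : ∀ᶠ z : Plane × Plane in nhds (x₀, x₀), dist z.1 x₀ < δ :=
    (continuous_fst.tendsto (x₀, x₀)).eventually
      (show ∀ᶠ y in nhds x₀, dist y x₀ < δ from Metric.ball_mem_nhds x₀ hδ)
  have evr : ∀ᶠ z : Plane × Plane in nhds (x₀, x₀), Reg K z.1 :=
    (continuous_fst.tendsto _).eventually ((isOpen_reg hK).mem_nhds h)
  filter_upwards [evη, evY, evd, evr] with z hη hYz hd hr
  have hp := hr.para hK
  have hnear : ∀ α, |α - 1| < δ → dist (z.1, α) (x₀, (1:ℝ)) < δ := by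
    intro α hα
    rw [Prod.dist_eq]; exact max_lt hd (by rwa [Real.dist_eq])
  have := cov_le_of_boxes hK hp.pos hp.mem hp.memx hp.memy hp.memxy hp.ni hp.niy hp.nix hp.nixy
    (x' := z.2) he0 he1 ?_ ?_
  · refine this.trans ?_
    have h1 := om_abs_le (yv K z.1) (z.2 - z.1)
    have h2 : 2 * e * |om (yv K z.1) (z.2 - z.1)| ≤ ε * ‖z.2 - z.1‖ := by
      calc 2 * e * |om (yv K z.1) (z.2 - z.1)| ≤ 2 * e * (‖yv K z.1‖ * ‖z.2 - z.1‖) := by gcongr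
        _ ≤ 2 * e * ((‖yv K x₀‖ + 1) * ‖z.2 - z.1‖) := by gcongr
        _ = 2 * e * (‖yv K x₀‖ + 1) * ‖z.2 - z.1‖ := by ring
        _ ≤ ε * ‖z.2 - z.1‖ := by gcongr
    linarith
  · intro α hα β hβ
    exact interior_subset ((hball (hnear α (hα.trans_lt hη))).1 β hβ)
  · intro α β hα hk
    constructor
    · by_contra hlt
      push Not at hlt
      have hk' := hK.conv.add_smul_sub_mem hp.memxy hk (t := (1 + e) / (1 - β))
        ⟨by have : 0 < 1 - β := by linarith
            positivity, by rw [div_le_one (by linarith)]; linarith⟩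
      refine (hball (hnear (1 + (1 + e) / (1 - β) * (α - 1)) ?_)).2.2 ?_
      · rw [add_sub_cancel_left, abs_mul, abs_of_pos (div_pos (by linarith) (by linarith))]
        refine lt_of_le_of_lt (mul_le_of_le_one_left (abs_nonneg _) ?_) (hα.trans_lt hη)
        rw [div_le_one (by linarith)]; linarith
      · convert hk' using 1
        have hne : 1 - β ≠ 0 := by linarith
        match_scalars <;> field_simp <;> ring
    · by_contra hlt
      push Not at hlt
      have hβ : 0 < β := by linarith
      have hk' := hK.conv.add_smul_sub_mem hp.memx hk (t := (1 + e) / β)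
        ⟨by positivity, by rw [div_le_one hβ]; linarith⟩
      refine (hball (hnear (1 + (1 + e) / β * (α - 1)) ?_)).2.1 ?_
      · rw [add_sub_cancel_left, abs_mul, abs_of_pos (by positivity)]
        refine lt_of_le_of_lt (mul_le_of_le_one_left (abs_nonneg _) ?_) (hα.trans_lt hη)
        rw [div_le_one hβ]; linarith
      · convert hk' using 1
        match_scalars <;> field_simp <;> ring

lemma seg_or_seg {K : Set Plane} (hK : Body K) {p x y : Plane} (h : Para K p x y) :
    (∀ β ∈ Set.Ioo (0:ℝ) 1, p + x + β • y ∈ interior K) ∨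
      (∀ β ∈ Set.Ioo (0:ℝ) 1, p + β • y ∈ interior K) := by
  have key : ∀ m : Plane, m ∈ K → m + y ∈ K → ∀ β ∈ Set.Ioo (0:ℝ) 1, m + β • y ∉ interior K →
      ∃ t, Tan K m t ∧ om t y = 0 := by
    intro m hm hmy β hβ hni
    obtain ⟨t, ht⟩ := hK.exists_tan hni
    have e1 := ht.2 _ hm
    have e2 := ht.2 _ hmy
    rw [show m - (m + β • y) = (-β) • y by module, om_smul_right] at e1
    rw [show m + y - (m + β • y) = (1 - β) • y by module, om_smul_right] at e2
    have h0 : om t y = 0 := by nlinarith [hβ.1, hβ.2]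
    refine ⟨t, ⟨ht.1, fun k hk => ?_⟩, h0⟩
    have := ht.2 k hk
    rwa [show k - (m + β • y) = (k - m) - β • y by abel, om_sub_right, om_smul_right, h0,
      mul_zero, sub_zero] at this
  by_contra hcon
  push Not at hcon
  obtain ⟨⟨β, hβ, h1⟩, ⟨β', hβ', h2⟩⟩ := hcon
  obtain ⟨t, ht, hty⟩ := key _ h.memx h.memxy β hβ h1
  obtain ⟨t', ht', hty'⟩ := key _ h.mem h.memy β' hβ' h2
  obtain ⟨c, rfl⟩ := exists_smul_of_om_eq_zero ht.1 hty
  have hc : c ≠ 0 := by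
    rintro rfl
    have := h.pos
    simp at this
  have htt : om t t' = 0 := by
    rw [om_smul_right] at hty'
    rw [om_comm, (mul_eq_zero.1 hty').resolve_left hc, neg_zero]
  obtain ⟨s, rfl⟩ := exists_smul_of_om_eq_zero ht.1 htt
  have hov : Ov K (p + x - p) := by simpa using h.ov
  have hs0 : 0 < s := by
    by_contra hneg
    obtain ⟨k, hk, hkx⟩ := hov
    have e1 := ht'.pos hk
    have e2 := ht.pos hkx
    rw [show k + (p + x - p) - (p + x) = k - p by abel] at e2
    rw [om_smul_left] at e1
    nlinarith
  have e1 := ht.2 _ h.mem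
  have e2 := ht'.2 _ h.memx
  rw [show p - (p + x) = -x by abel, om_neg_right] at e1
  rw [add_sub_cancel_left, om_smul_left] at e2
  have : om t x = 0 := by nlinarith
  have hpos := h.pos
  rw [om_smul_right, om_comm, this] at hpos
  simp at hpos

lemma cov_upper {K : Set Plane} (hK : Body K) {x₀ : Plane} (h : Reg K x₀) {ε : ℝ} (hε : 0 < ε) :
    ∀ᶠ z in nhds (x₀, x₀), cov K z.2 ≤ cov K z.1 + om (yv K z.1) (z.2 - z.1) +
      ε * ‖z.2 - z.1‖ := by
  rcases seg_or_seg hK (h.para hK) with hs | hs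
  · exact cov_upper_of_seg hK h hs hε
  · have h2 : ∀ β ∈ Set.Ioo (0:ℝ) 1, lo (-K) x₀ + x₀ + β • yv (-K) x₀ ∈ interior (-K) := by
      intro β hβ
      have := hs (1 - β) ⟨by linarith [hβ.2], by linarith [hβ.1]⟩
      rw [interior_neg_set, Set.mem_neg, lo_neg_set hK h, yv_neg_set hK h]
      convert this using 1
      rw [yv]; module
    have evr : ∀ᶠ z : Plane × Plane in nhds (x₀, x₀), Reg K z.1 :=
      (continuous_fst.tendsto _).eventually ((isOpen_reg hK).mem_nhds h)
    filter_upwards [cov_upper_of_seg hK.neg h.neg_set h2 hε, evr] with z hz hr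
    rwa [cov_neg, cov_neg, yv_neg_set hK hr] at hz

/-- The covariogram determines the inscribed parallelograms up to translation. -/
lemma yv_eq_of_cov_eq {K L : Set Plane} (hK : Body K) (hL : Body L) (hcov : ∀ x, cov K x = cov L x)
    {x : Plane} (h : Reg K x) (h' : Reg L x) : yv K x = yv L x := by
  have key : ∀ ε : ℝ, 0 < ε → ‖yv L x - yv K x‖ ≤ 3 * ε := by
    intro ε hε
    have c0 : Filter.Tendsto (fun s : ℝ => x + s • rot (yv L x - yv K x)) (nhds 0) (nhds x) := by
      have : Continuous fun s : ℝ => x + s • rot (yv L x - yv K x) := by fun_prop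
      simpa using this.tendsto 0
    have ev1 := (tendsto_const_nhds (x := x)).prodMk_nhds c0 |>.eventually (cov_upper hK h hε)
    have ev2 := c0.prodMk_nhds (tendsto_const_nhds (x := x)) |>.eventually (cov_upper hL h' hε)
    have ev3 : ∀ᶠ s : ℝ in nhds 0, ‖yv L (x + s • rot (yv L x - yv K x)) - yv L x‖ < ε := by
      have := (h'.continuousAt_yv hL).tendsto.comp c0
      have := this.eventually (Metric.ball_mem_nhds _ hε)
      simpa [dist_eq_norm] using this
    have hev := (ev1.and (ev2.and ev3)).filter_mono (nhdsWithin_le_nhds (s := Set.Ioi (0:ℝ)))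
    obtain ⟨s, ⟨h1, h2, h3⟩, hs⟩ := (hev.and self_mem_nhdsWithin).exists
    simp only at h1 h2
    rw [hcov, hcov] at h1
    set u := yv L x - yv K x with hu
    rw [add_sub_cancel_left] at h1
    rw [show x - (x + s • rot u) = -(s • rot u) by abel, om_neg_right, norm_neg] at h2
    have h4 : om (yv L (x + s • rot u)) (s • rot u) =
        om (yv K x) (s • rot u) + om u (s • rot u) +
        om (yv L (x + s • rot u) - yv L x) (s • rot u) := by
      rw [hu, om_sub_left, om_sub_left]; ring
    have h5 := om_abs_le (yv L (x + s • rot u) - yv L x) (s • rot u)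
    have h6 : om u (s • rot u) = s * ‖u‖ ^ 2 := by rw [om_smul_right, om_rot]
    have h7 : ‖s • rot u‖ = s * ‖u‖ := by rw [norm_smul, norm_rot, Real.norm_of_nonneg hs.le]
    rw [h7] at h5 h1 h2
    have h8 : |om (yv L (x + s • rot u) - yv L x) (s • rot u)| ≤ ε * (s * ‖u‖) :=
      h5.trans (by gcongr)
    have h9 := neg_le_of_abs_le h8
    have h10 : s * ‖u‖ ^ 2 ≤ 3 * ε * (s * ‖u‖) := by linarith
    rcases (norm_nonneg u).eq_or_lt with h0 | h0
    · rw [← h0]; positivity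
    · have : 0 < s * ‖u‖ := by positivity
      nlinarith
  have : ‖yv L x - yv K x‖ ≤ 0 := by
    by_contra hpos
    push Not at hpos
    have := key (‖yv L x - yv K x‖ / 6) (by positivity)
    linarith
  rw [norm_le_zero_iff, sub_eq_zero] at this
  exact this.symm


/-- `K` has only one supporting line at `p`. -/
def Smooth (K : Set Plane) (p : Plane) : Prop :=
  ∀ t t', Tan K p t → Tan K p t' → om t t' = 0

lemma Smooth.exists_pos {K : Set Plane} (hK : Body K) {p t t' : Plane} (hs : Smooth K p)
    (h : Tan K p t) (h' : Tan K p t') : ∃ c : ℝ, 0 < c ∧ t' = c • t := by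
  obtain ⟨c, rfl⟩ := exists_smul_of_om_eq_zero h.1 (hs _ _ h h')
  refine ⟨c, ?_, rfl⟩
  obtain ⟨k, hk⟩ := hK.int
  have h1 := h.pos hk
  have h2 := h'.pos hk
  rw [om_smul_left] at h2
  exact pos_of_mul_pos_left h2 h1.le

lemma Smooth.enter {K : Set Plane} (hK : Body K) {p t v : Plane} (hs : Smooth K p)
    (h : Tan K p t) (hv : 0 < om t v) : ∃ s : ℝ, 0 < s ∧ p + s • v ∈ interior K := by
  by_contra hcon
  push Not at hcon
  have hR : Convex ℝ ((fun s : ℝ => p + s • v) '' Set.Ioi 0) := by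
    rintro _ ⟨a, ha, rfl⟩ _ ⟨b, hb, rfl⟩ α β hα hβ hαβ
    refine ⟨α * a + β * b, ?_, ?_⟩
    · rcases hα.eq_or_lt with h0 | h0
      · rw [← h0] at hαβ ⊢
        simp only [zero_add] at hαβ
        rw [hαβ]; simpa using hb
      · have h1 : 0 < a := ha
        have h2 : 0 < b := hb
        exact add_pos_of_pos_of_nonneg (mul_pos h0 h1) (mul_nonneg hβ h2.le)
    · obtain rfl : β = 1 - α := by linarith
      module
  have hd : Disjoint (interior K) ((fun s : ℝ => p + s • v) '' Set.Ioi 0) := by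
    rw [Set.disjoint_left]
    rintro _ hk ⟨s, hs, rfl⟩
    exact hcon s hs hk
  obtain ⟨f, u, h1, h2⟩ := geometric_hahn_banach_open hK.conv.interior isOpen_interior hR hd
  obtain ⟨τ, hτ⟩ := exists_om_rep f
  have h3 : ∀ s : ℝ, 0 < s → u ≤ om τ p + s * om τ v := by
    intro s hs
    have := h2 _ ⟨s, hs, rfl⟩
    rwa [hτ, om_add_right, om_smul_right] at this
  have hfv : 0 ≤ om τ v := by
    by_contra hneg
    push Not at hneg
    have := h3 (max 1 ((u - om τ p - 1) / om τ v)) (by positivity)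
    have h4 : max 1 ((u - om τ p - 1) / om τ v) * om τ v ≤ ((u - om τ p - 1) / om τ v) * om τ v :=
      mul_le_mul_of_nonpos_right (le_max_right _ _) hneg.le
    rw [div_mul_cancel₀ _ hneg.ne] at h4
    linarith
  have hfp : u ≤ om τ p := by
    refine le_of_forall_pos_le_add fun ε hε => ?_
    have := h3 (ε / (om τ v + 1)) (by positivity)
    have h4 : ε / (om τ v + 1) * om τ v ≤ ε := by
      rw [div_mul_eq_mul_div, div_le_iff₀ (by positivity)]; nlinarith
    linarith
  have hτ0 : τ ≠ 0 := by
    rintro rfl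
    obtain ⟨k, hk⟩ := hK.int
    have := h1 k hk
    rw [hτ] at this
    simp at this hfp
    linarith
  have htan : Tan K p (-τ) := by
    refine ⟨neg_ne_zero.2 hτ0, fun k hk => ?_⟩
    have : om τ k ≤ u := by
      rw [← hτ]
      rw [← hK.closure_interior] at hk
      exact closure_minimal (fun a ha => (h1 a ha).le) (isClosed_le f.continuous continuous_const) hk
    rw [om_neg_left, om_sub_right]; linarith
  obtain ⟨c, hc, hct⟩ := hs.exists_pos hK h htan
  have : om (-τ) v = c * om t v := by rw [hct, om_smul_left]
  rw [om_neg_left] at this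
  nlinarith

lemma Tan.combo_interior {K : Set Plane} (hK : Body K) {p a b k : Plane} (hp : p ∈ K)
    (ha : a ∈ interior K) (hb : b ∈ interior K) {α β : ℝ} (hα : 0 ≤ α) (hβ : 0 ≤ β)
    (hαβ : 0 < α + β) (h1 : α + β ≤ 1) (hk : k = p + α • (a - p) + β • (b - p)) :
    k ∈ interior K := by
  by_contra hni
  obtain ⟨τ, h⟩ := hK.exists_tan hni
  have e1 := h.2 p hp
  have e2 := h.pos ha
  have e3 := h.pos hb
  have h4 : (1 - α - β) * om τ (p - k) + α * om τ (a - k) + β * om τ (b - k) = 0 := by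
    rw [← om_smul_right, ← om_smul_right, ← om_smul_right, ← om_add_right, ← om_add_right]
    have : (1 - α - β) • (p - k) + α • (a - k) + β • (b - k) = 0 := by
      rw [hk]; module
    rw [this, om_zero_right]
  rcases hα.eq_or_lt with h0 | h0
  · rw [← h0] at h4 hαβ h1
    nlinarith [mul_pos (by linarith : 0 < β) e3, mul_nonneg (by linarith : 0 ≤ 1 - 0 - β) e1]
  · nlinarith [mul_pos h0 e2, mul_nonneg hβ e3.le, mul_nonneg (by linarith : 0 ≤ 1 - α - β) e1]

lemma Smooth.frontier_estimate {K : Set Plane} (hK : Body K) {p t : Plane} (hp : p ∈ K)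
    (hs : Smooth K p) (h : Tan K p t) {ε : ℝ} (hε : 0 < ε) :
    ∀ᶠ k in nhds p, k ∉ interior K → om t (k - p) ≤ ε * ‖k - p‖ := by
  have ht : 0 < ‖t‖ := norm_pos_iff.2 h.1
  have hr := om_rot_pos h.1
  set e := ε / ‖t‖ with he
  have he0 : 0 < e := by positivity
  obtain ⟨s₁, hs₁, hi₁⟩ := hs.enter hK h (v := (1 / e) • t + rot t)
    (by rw [om_add_right, om_smul_right, om_self]; linarith)
  obtain ⟨s₂, hs₂, hi₂⟩ := hs.enter hK h (v := (-(1 / e)) • t + rot t)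
    (by rw [om_add_right, om_smul_right, om_self]; linarith)
  have hc : Filter.Tendsto (fun k => om t (k - p) / om t (rot t)) (nhds p) (nhds 0) := by
    have : Continuous fun k => om t (k - p) / om t (rot t) := by fun_prop
    simpa using this.tendsto p
  have ev := hc.eventually (gt_mem_nhds (lt_min hs₁ hs₂))
  filter_upwards [ev] with k hk hni
  by_contra hcon
  push Not at hcon
  have hkp : 0 < ‖k - p‖ := by
    rw [norm_pos_iff]
    intro h0
    rw [h0] at hcon; simp at hcon
  set β := om t (k - p) / om t (rot t) with hβ
  set α := om (k - p) (rot t) / om t (rot t) with hα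
  have hdecomp : k - p = α • t + β • rot t := by
    have := om_cramer t (rot t) (k - p)
    rw [hα, hβ, div_eq_inv_mul, div_eq_inv_mul, mul_smul, mul_smul, ← smul_add, ← this, smul_smul,
      inv_mul_cancel₀ hr.ne', one_smul]
  have hαβ : e * |α| < β := by
    rw [hα, hβ, abs_div, abs_of_pos hr, mul_div_assoc', div_lt_div_iff_of_pos_right hr]
    have := om_abs_le (k - p) (rot t)
    rw [norm_rot] at this
    calc e * |om (k - p) (rot t)| ≤ e * (‖k - p‖ * ‖t‖) := by gcongr
      _ = ε * ‖k - p‖ := by rw [he]; field_simp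
      _ < _ := hcon
  have hβ0 : 0 < β := lt_of_le_of_lt (by positivity) hαβ
  have hm1 : 0 ≤ (β + e * α) / 2 := by
    have := neg_le_of_abs_le (le_refl |α|); nlinarith
  have hm2 : 0 ≤ (β - e * α) / 2 := by
    have := le_abs_self α; nlinarith
  have h1 : β < s₁ := hk.trans_le (min_le_left _ _)
  have h2 : β < s₂ := hk.trans_le (min_le_right _ _)
  refine hni (Tan.combo_interior hK hp hi₁ hi₂ (α := (β + e * α) / 2 / s₁)
    (β := (β - e * α) / 2 / s₂) (by positivity) (by positivity) ?_ ?_ ?_)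
  · rcases hm1.eq_or_lt with h0 | h0
    · rw [← h0, zero_div, zero_add]
      exact div_pos (by linarith) hs₂
    · exact add_pos_of_pos_of_nonneg (div_pos h0 hs₁) (div_nonneg hm2 hs₂.le)
  · calc (β + e * α) / 2 / s₁ + (β - e * α) / 2 / s₂
        ≤ (β + e * α) / 2 / β + (β - e * α) / 2 / β := by gcongr
      _ = 1 := by field_simp; ring
  · rw [eq_add_of_sub_eq hdecomp]
    match_scalars <;> field_simp <;> ring

lemma countable_corners (K : Set Plane) : {p | p ∈ K ∧ ¬ Smooth K p}.Countable := by
  have hch : ∀ p : {p | p ∈ K ∧ ¬ Smooth K p}, ∃ t t', Tan K p.1 t ∧ Tan K p.1 t' ∧ 0 < om t t' := by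
    rintro ⟨p, hp, hs⟩
    simp only [Smooth, not_forall] at hs
    obtain ⟨t, t', h, h', hne⟩ := hs
    rcases lt_or_gt_of_ne hne with h0 | h0
    · exact ⟨t', t, h', h, by rw [om_comm]; linarith⟩
    · exact ⟨t, t', h, h', h0⟩
  choose t t' ht ht' hpos using hch
  rw [← Set.countable_coe_iff]
  have hd : (Set.univ : Set {p | p ∈ K ∧ ¬ Smooth K p}).PairwiseDisjoint
      (fun p => {τ : Plane | 0 < om τ (t' p) ∧ 0 < om (t p) τ}) := by
    intro p _ q _ hpq
    rw [Function.onFun, Set.disjoint_left]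
    rintro τ ⟨a1, a2⟩ ⟨b1, b2⟩
    apply hpq
    have key : ∀ p q : {p | p ∈ K ∧ ¬ Smooth K p}, 0 < om τ (t' p) → 0 < om (t p) τ →
        q.1 ≠ p.1 → 0 < om τ (q.1 - p.1) := by
      intro p q h1 h2 hne
      have e1 := (ht p).2 q.1 q.2.1
      have e2 := (ht' p).2 q.1 q.2.1
      have := om_cramer_om (t p) (t' p) τ (q.1 - p.1)
      by_contra hneg
      push Not at hneg
      have h3 : om (t p) (t' p) * om τ (q.1 - p.1) ≤ 0 :=
        mul_nonpos_of_nonneg_of_nonpos (hpos p).le hneg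
      have h4 : om (t p) (q.1 - p.1) = 0 := by nlinarith [mul_nonneg h1.le e1, mul_nonneg h2.le e2]
      have h5 : om (t' p) (q.1 - p.1) = 0 := by nlinarith [mul_nonneg h1.le e1, mul_nonneg h2.le e2]
      have h6 := om_cramer (t p) (t' p) (q.1 - p.1)
      rw [om_comm (q.1 - p.1) (t' p), h5, h4, neg_zero, zero_smul, zero_smul, add_zero] at h6
      exact hne (sub_eq_zero.1 ((smul_eq_zero.1 h6).resolve_left (hpos p).ne'))
    by_contra hne
    have hne' : p.1 ≠ q.1 := fun h => hne (Subtype.ext h)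
    have h1 := key p q a1 a2 hne'.symm
    have h2 := key q p b1 b2 hne'
    rw [← neg_sub q.1 p.1, om_neg_right] at h2
    linarith
  have := hd.countable_of_isOpen (fun p _ => ?_) (fun p _ => ?_)
  · exact Set.countable_univ_iff.1 this
  · exact (isOpen_lt continuous_const (by fun_prop : Continuous fun τ => om τ (t' p))).inter
      (isOpen_lt continuous_const (by fun_prop : Continuous fun τ => om (t p) τ))
  · refine ⟨t p + t' p, ?_, ?_⟩
    · rw [om_add_left, om_self, add_zero]; exact hpos p
    · rw [om_add_right, om_self, zero_add]; exact hpos p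

lemma ae_smooth_corners {K : Set Plane} (hK : Body K) :
    ∀ᵐ x : Plane, ∀ p ∈ K, p + x ∈ K → p ∉ interior K → p + x ∉ interior K →
      Smooth K p ∧ Smooth K (p + x) := by
  have hfr : volume (K \ interior K) = 0 := by
    have := hK.conv.addHaar_frontier volume
    rwa [frontier, hK.comp.isClosed.closure_eq] at this
  have h1 : ∀ᵐ x : Plane, ∀ c ∈ {p | p ∈ K ∧ ¬ Smooth K p}, c + x ∉ K \ interior K := by
    rw [MeasureTheory.ae_ball_iff (countable_corners K)]
    intro c _
    rw [ae_iff]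
    simp only [not_not]
    have := measure_preimage_add volume c (K \ interior K)
    rw [hfr] at this
    exact this
  have h2 : ∀ᵐ x : Plane, ∀ c ∈ {p | p ∈ K ∧ ¬ Smooth K p}, c - x ∉ K \ interior K := by
    rw [MeasureTheory.ae_ball_iff (countable_corners K)]
    intro c _
    rw [ae_iff]
    simp only [not_not]
    have := (Measure.measurePreserving_sub_left volume c).measure_preimage
      (s := K \ interior K) ((hK.comp.isClosed.measurableSet.diff isOpen_interior.measurableSet).nullMeasurableSet)
    rw [hfr] at this
    exact this
  filter_upwards [h1, h2] with x h1 h2 p hp hpx hpi hpxi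
  constructor
  · by_contra hs
    exact h1 p ⟨hp, hs⟩ ⟨hpx, hpxi⟩
  · by_contra hs
    exact h2 _ ⟨hpx, hs⟩ (by simpa using ⟨hp, hpi⟩)

lemma hasFDerivAt_lo {K : Set Plane} (hK : Body K) {x t₁ t₂ : Plane} (hx : Reg K x)
    (hs₁ : Smooth K (lo K x)) (hs₂ : Smooth K (lo K x + x)) (h₁ : Tan K (lo K x) t₁)
    (h₂ : Tan K (lo K x + x) t₂) :
    ∃ D : Plane →L[ℝ] Plane, HasFDerivAt (lo K) D x ∧
      ∀ h, D h = (om t₂ h / om t₁ t₂) • t₁ := by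
  have hp := hx.para hK
  have hpos : 0 < om t₁ t₂ := hp.low1.om_tan_pos (by simpa using hx.ne) (by simpa using hx.ov) h₁ h₂
    (by simpa using hx.edge)
  let D₀ : Plane →ₗ[ℝ] Plane :=
    { toFun := fun h => (om t₂ h / om t₁ t₂) • t₁
      map_add' := fun a b => by rw [om_add_right, add_div, add_smul]
      map_smul' := fun r a => by rw [om_smul_right, mul_div_assoc, mul_smul]; rfl }
  refine ⟨LinearMap.toContinuousLinearMap D₀, ?_, fun h => rfl⟩
  rw [hasFDerivAt_iff_isLittleO_nhds_zero]
  set C : ℝ := (‖t₁‖ + ‖t₂‖) / om t₁ t₂ with hC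
  have hC0 : 0 < C := by
    have : 0 < ‖t₁‖ := norm_pos_iff.2 h₁.1
    positivity
  have hcont : Filter.Tendsto (fun h => lo K (x + h)) (nhds 0) (nhds (lo K x)) := by
    have : Filter.Tendsto (fun h => x + h) (nhds 0) (nhds x) := by
      simpa using (by fun_prop : Continuous fun h => x + h).tendsto 0
    exact (hx.continuousAt_lo hK).tendsto.comp this
  have hcont2 : Filter.Tendsto (fun h => lo K (x + h) + (x + h)) (nhds 0) (nhds (lo K x + x)) := by
    have : Filter.Tendsto (fun h => x + h) (nhds 0) (nhds x) := by
      simpa using (by fun_prop : Continuous fun h => x + h).tendsto 0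
    exact hcont.add this
  have hreg : ∀ᶠ h in nhds (0 : Plane), Reg K (x + h) := by
    have : Filter.Tendsto (fun h => x + h) (nhds 0) (nhds x) := by
      simpa using (by fun_prop : Continuous fun h => x + h).tendsto 0
    exact this.eventually ((isOpen_reg hK).mem_nhds hx)
  -- a uniform bound for the remainder
  have key : ∀ e : ℝ, 0 < e → ∀ᶠ h in nhds (0 : Plane),
      ‖lo K (x + h) - lo K x - D₀ h‖ ≤ C * e * (2 * ‖lo K (x + h) - lo K x‖ + ‖h‖) := by
    intro e he
    filter_upwards [hcont.eventually (hs₁.frontier_estimate hK hp.mem h₁ he),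
      hcont2.eventually (hs₂.frontier_estimate hK hp.memx h₂ he), hreg] with h e1 e2 hr
    have hp' := hr.para hK
    have f1 := e1 hp'.ni
    have f2 := e2 hp'.nix
    have g1 := h₁.2 _ hp'.mem
    have g2 := h₂.2 _ hp'.memx
    set u := lo K (x + h) - lo K x with hu
    rw [show lo K (x + h) + (x + h) - (lo K x + x) = u + h by rw [hu]; abel] at f2 g2
    have hrem : u - D₀ h = (om t₁ t₂)⁻¹ • (om t₁ u • t₂ - om t₂ (u + h) • t₁) := by
      have h3 := om_cramer t₁ t₂ u
      change u - (om t₂ h / om t₁ t₂) • t₁ = _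
      have h4 : u = (om t₁ t₂)⁻¹ • (om u t₂ • t₁ + om t₁ u • t₂) := by
        rw [← h3, smul_smul, inv_mul_cancel₀ hpos.ne', one_smul]
      conv_lhs => rw [h4]
      rw [om_comm u t₂, om_add_right]
      match_scalars <;> field_simp
      ring
    rw [hrem, norm_smul, norm_inv, Real.norm_of_nonneg hpos.le]
    have h5 : ‖om t₁ u • t₂ - om t₂ (u + h) • t₁‖ ≤ e * ‖u‖ * ‖t₂‖ + e * (‖u‖ + ‖h‖) * ‖t₁‖ := by
      refine (norm_sub_le _ _).trans ?_
      rw [norm_smul, norm_smul, Real.norm_of_nonneg g1, Real.norm_of_nonneg g2]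
      have : ‖u + h‖ ≤ ‖u‖ + ‖h‖ := norm_add_le _ _
      gcongr
      exact f2.trans (by gcongr)
    calc (om t₁ t₂)⁻¹ * ‖om t₁ u • t₂ - om t₂ (u + h) • t₁‖
        ≤ (om t₁ t₂)⁻¹ * (e * ‖u‖ * ‖t₂‖ + e * (‖u‖ + ‖h‖) * ‖t₁‖) := by gcongr
      _ ≤ (om t₁ t₂)⁻¹ * ((‖t₁‖ + ‖t₂‖) * e * (2 * ‖u‖ + ‖h‖)) := by
          gcongr
          have := norm_nonneg u; have := norm_nonneg h; have := norm_nonneg t₁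
          have := norm_nonneg t₂
          have e1 : 0 ≤ e * ‖u‖ * ‖t₂‖ := by positivity
          have e2 : 0 ≤ e * ‖h‖ * ‖t₂‖ := by positivity
          have e3 : 0 ≤ e * ‖u‖ * ‖t₁‖ := by positivity
          nlinarith
      _ = C * e * (2 * ‖u‖ + ‖h‖) := by rw [hC]; field_simp
  set M : ℝ := ‖LinearMap.toContinuousLinearMap D₀‖ with hM
  have hD : ∀ h, ‖D₀ h‖ ≤ M * ‖h‖ := fun h => (LinearMap.toContinuousLinearMap D₀).le_opNorm h
  have hM0 : 0 ≤ M := norm_nonneg _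
  rw [Asymptotics.isLittleO_iff]
  intro ε hε
  obtain ⟨e, he, he1, he2⟩ : ∃ e : ℝ, 0 < e ∧ C * e * 2 ≤ 1 / 2 ∧ C * e * (2 * (2 * M + 1) + 1) ≤ ε := by
    refine ⟨min (1 / (4 * C)) (ε / (C * (2 * (2 * M + 1) + 1))), by positivity, ?_, ?_⟩
    · calc C * min (1 / (4 * C)) (ε / (C * (2 * (2 * M + 1) + 1))) * 2 ≤ C * (1 / (4 * C)) * 2 := by
            gcongr; exact min_le_left _ _
        _ = 1 / 2 := by field_simp; norm_num
    · calc C * min (1 / (4 * C)) (ε / (C * (2 * (2 * M + 1) + 1))) * (2 * (2 * M + 1) + 1)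
          ≤ C * (ε / (C * (2 * (2 * M + 1) + 1))) * (2 * (2 * M + 1) + 1) := by
            gcongr; exact min_le_right _ _
        _ = ε := by field_simp
  filter_upwards [key e he] with h hk
  change ‖lo K (x + h) - lo K x - D₀ h‖ ≤ ε * ‖h‖
  set u := lo K (x + h) - lo K x
  have hu : ‖u‖ ≤ ‖u - D₀ h‖ + ‖D₀ h‖ := by
    simpa using norm_add_le (u - D₀ h) (D₀ h)
  have hu2 : ‖u‖ ≤ (2 * M + 1) * ‖h‖ := by
    have h1 := hD h
    have h2 : C * e * (2 * ‖u‖ + ‖h‖) ≤ 1 / 2 * ‖u‖ + 1 / 4 * ‖h‖ := by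
      nlinarith [norm_nonneg u, norm_nonneg h]
    nlinarith [norm_nonneg h]
  calc ‖u - D₀ h‖ ≤ C * e * (2 * ‖u‖ + ‖h‖) := hk
    _ ≤ C * e * (2 * ((2 * M + 1) * ‖h‖) + ‖h‖) := by gcongr
    _ = C * e * (2 * (2 * M + 1) + 1) * ‖h‖ := by ring
    _ ≤ ε * ‖h‖ := by gcongr


/-- Every edge has a parallel edge on the opposite side which is at least as long. -/
def Bal (K : Set Plane) : Prop := ∀ x, Edge K x → Edge K (-x)

lemma Bal.neg_set {K : Set Plane} (h : Bal K) : Bal (-K) := fun _ hx =>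
  edge_neg_set.2 (h _ (edge_neg_set.1 hx))

/-- Two balanced convex bodies with equal covariograms. -/
structure Twins (K L : Set Plane) : Prop where
  bK : Body K
  bL : Body L
  balK : Bal K
  balL : Bal L
  cov_eq : ∀ x, cov K x = cov L x

lemma Twins.symm {K L : Set Plane} (T : Twins K L) : Twins L K :=
  ⟨T.bL, T.bK, T.balL, T.balK, fun x => (T.cov_eq x).symm⟩

lemma Twins.neg_left {K L : Set Plane} (T : Twins K L) : Twins (-K) L :=
  ⟨T.bK.neg, T.bL, T.balK.neg_set, T.balL, fun x => by rw [cov_neg, T.cov_eq]⟩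

lemma Twins.neg_right {K L : Set Plane} (T : Twins K L) : Twins K (-L) :=
  T.symm.neg_left.symm

lemma ov_iff_of_cov {K L : Set Plane} (hK : Body K) (hL : Body L) (h : ∀ x, cov K x = cov L x)
    (x : Plane) : Ov K x ↔ Ov L x := by
  rw [ov_iff_cov_pos hK, ov_iff_cov_pos hL, h]

lemma Twins.ov_iff {K L : Set Plane} (T : Twins K L) (x : Plane) : Ov K x ↔ Ov L x :=
  ov_iff_of_cov T.bK T.bL T.cov_eq x

lemma Twins.exists_diff {K L : Set Plane} (T : Twins K L) {p q : Plane} (hp : p ∈ K) (hq : q ∈ K) :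
    ∃ p' ∈ L, p' + (q - p) ∈ L :=
  exists_diff_of_ov T.bK T.bL (fun x hx => (T.ov_iff x).1 hx) hp hq

lemma edge_of_le {K : Set Plane} (hK : Convex ℝ K) {x r : Plane} {c : ℝ} (hr : r ∈ K)
    (hrc : r + c • x ∈ K) (hmin : ∀ k ∈ K, 0 ≤ om x (k - r)) (hc : 1 ≤ |c|) : Edge K x := by
  have key : ∀ r : Plane, ∀ c : ℝ, r ∈ K → r + c • x ∈ K → (∀ k ∈ K, 0 ≤ om x (k - r)) → 1 ≤ c →
      Edge K x := by
    intro r c hr hrc hmin hc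
    have h1 : Edge K (c • x) := ⟨r, hr, hrc, fun k hk => by
      rw [om_smul_left]; exact mul_nonneg (by linarith) (hmin k hk)⟩
    have := h1.smul hK (c := 1 / c) (by positivity) (by rw [div_le_one (by linarith)]; exact hc)
    rwa [smul_smul, one_div, inv_mul_cancel₀ (by linarith), one_smul] at this
  rcases le_total 0 c with h0 | h0
  · exact key r c hr hrc hmin (by rwa [abs_of_nonneg h0] at hc)
  · refine key (r + c • x) (-c) hrc (by simpa using hr) (fun k hk => ?_)
      (by rwa [abs_of_nonpos h0] at hc)
    have := hmin k hk
    rw [← sub_sub, om_sub_right, om_smul_right, om_self]; linarith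

lemma Twins.edge_of_edge {K L : Set Plane} (T : Twins K L) {x : Plane} (hx : Edge K x) :
    Edge L x := by
  obtain ⟨p, hp, hpx, hmin⟩ := hx
  obtain ⟨q, hq, hqx, hmax⟩ := T.balK x ⟨p, hp, hpx, hmin⟩
  by_cases hx0 : x = 0
  · subst hx0
    obtain ⟨k, hk⟩ := T.bL.nonempty
    exact ⟨k, hk, by simpa using hk, by simp⟩
  obtain ⟨r, hr, hr1⟩ := T.exists_diff hp hq
  obtain ⟨r', hr', hr1'⟩ := T.exists_diff hpx hqx
  have hH : ∀ l ∈ L, ∀ l' ∈ L, om x (l - l') ≤ om x (q - p) := by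
    intro l hl l' hl'
    obtain ⟨k, hk, hk'⟩ := T.symm.exists_diff hl' hl
    have e1 := hmin k hk
    have e2 := hmax _ hk'
    rw [om_neg_left] at e2
    rw [om_sub_right] at e1 e2 ⊢
    rw [om_add_right, om_sub_right] at e2
    rw [om_sub_right]
    linarith
  have b1 : ∀ k ∈ L, 0 ≤ om x (k - r) := by
    intro k hk
    have := hH _ hr1 k hk
    rw [show r + (q - p) - k = (q - p) - (k - r) by abel, om_sub_right] at this
    linarith
  have b2 : ∀ k ∈ L, 0 ≤ om x (k - r') := by
    intro k hk
    have := hH _ hr1' k hk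
    rw [show r' + (q + -x - (p + x)) - k = (q - p) - (k - r') - (2:ℝ) • x by module, om_sub_right,
      om_sub_right, om_smul_right, om_self] at this
    linarith
  have hrr : om x (r' - r) = 0 := by
    have e1 := b1 r' hr'
    have e2 := b2 r hr
    rw [← neg_sub r' r, om_neg_right] at e2
    linarith
  obtain ⟨c, hc⟩ := exists_smul_of_om_eq_zero hx0 hrr
  have hr'c : r' = r + c • x := by rw [← hc]; abel
  rcases le_or_gt 1 |c| with h1 | h1
  · exact edge_of_le T.bL.conv hr (hr'c ▸ hr') b1 h1
  · have h2 : 1 ≤ |2 - c| := by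
      rw [abs_lt] at h1
      rw [le_abs]; left; linarith
    have := edge_of_le T.bL.conv (x := -x) (c := 2 - c) hr1 (by
      convert hr1' using 1; rw [hr'c]; module) (fun k hk => by
        have := hH k hk r hr
        rw [om_neg_left, om_sub_right]
        rw [om_sub_right, om_sub_right] at this
        rw [om_add_right, om_sub_right]; linarith) h2
    simpa using T.balL _ this

lemma Twins.edge_iff {K L : Set Plane} (T : Twins K L) {x : Plane} : Edge K x ↔ Edge L x :=
  ⟨T.edge_of_edge, T.symm.edge_of_edge⟩

lemma Twins.reg {K L : Set Plane} (T : Twins K L) {x : Plane} (h : Reg K x) : Reg L x :=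
  ⟨h.ne, (T.ov_iff x).1 h.ov, fun he => h.edge (T.edge_iff.2 he), fun he =>
    h.edge' (T.edge_iff.2 he)⟩

lemma Twins.yv_eq {K L : Set Plane} (T : Twins K L) {x : Plane} (h : Reg K x) :
    yv L x = yv K x := (yv_eq_of_cov_eq T.bK T.bL T.cov_eq h (T.reg h)).symm

lemma Bal.reg {K : Set Plane} (hb : Bal K) {x : Plane} (h0 : x ≠ 0) (ho : Ov K x)
    (he : ¬ Edge K x) : Reg K x :=
  ⟨h0, ho, he, fun h => he (by simpa using hb _ h)⟩

lemma Para.reindex {K : Set Plane} {p x y : Plane} (h : Para K p x y) :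
    Para K (p + x) y (-x) := by
  have e1 : p + x + -x = p := by abel
  have e2 : p + x + y + -x = p + y := by abel
  refine ⟨by rw [om_neg_right, ← om_comm]; exact h.pos, h.memx, h.memxy, ?_, ?_, h.nix, h.nixy,
    ?_, ?_, h.ov', h.ov.neg, h.low2, ?_, ?_, ?_⟩ <;> simp only [e1, e2]
  exacts [h.mem, h.memy, h.ni, h.niy, h.low3, h.low4, h.low1]

lemma om_indep {x y t : Plane} (h : 0 < om x y) (hx : om t x = 0) (hy : om t y = 0) : t = 0 := by
  by_contra ht
  obtain ⟨c, rfl⟩ := exists_smul_of_om_eq_zero ht hx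
  obtain ⟨d, rfl⟩ := exists_smul_of_om_eq_zero ht hy
  simp [om_smul_left, om_smul_right] at h

lemma Para.diag_ne {K : Set Plane} {p x y : Plane} (h : Para K p x y) : p ≠ p + (x + y) := by
  intro h0
  have h1 : x + y = 0 := by simpa using h0
  have := h.pos
  rw [eq_neg_of_add_eq_zero_right h1, om_neg_right, om_self] at this
  simp at this

lemma Para.diag_tan {K : Set Plane} {p x y t₁ t₃ : Plane} (h : Para K p x y)
    (hov : Ov K (x + y)) (h₁ : Tan K p t₁) (h₃ : Tan K (p + (x + y)) t₃) :
    om t₁ t₃ ≠ 0 ∧ (Low K p (p + (x + y)) ↔ 0 < om t₁ t₃) := by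
  have hm : p + (x + y) ∈ K := by rw [← add_assoc]; exact h.memxy
  have hov' : Ov K (p + (x + y) - p) := by simpa using hov
  have hne : om t₁ t₃ ≠ 0 := by
    intro h0
    obtain ⟨⟨s, hs⟩, _⟩ := hov'.tan_parallel h.mem hm h₁ h₃ h0
    rw [add_sub_cancel_left] at hs
    have e1 := h₁.2 _ h.memx
    have e2 := h₁.2 _ h.memy
    rw [add_sub_cancel_left] at e1 e2
    have e3 : om t₁ (x + y) = 0 := by rw [hs, om_smul_right, om_self, mul_zero]
    rw [om_add_right] at e3
    exact h₁.1 (om_indep h.pos (by linarith) (by linarith))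
  refine ⟨hne, fun hl => ?_, low_of_tan h.mem hm h₁ h₃⟩
  exact lt_of_le_of_ne (hl.om_tan_nonneg h.diag_ne hov' h₁ h₃) hne.symm

lemma Para.diag_low_symm {K : Set Plane} (hK : Body K) {p x y : Plane} (h : Para K p x y)
    (hov : Ov K (x + y)) : Low K (p + (x + y)) p ↔ ¬ Low K p (p + (x + y)) := by
  have hov' : Ov K (p + (x + y) - p) := by simpa using hov
  constructor
  · exact fun h1 h2 => h2.not_low_symm h.diag_ne hov' h1
  · intro h1
    refine (low_or_low hK h.mem ?_ h.ni ?_ hov').resolve_left h1 <;> rw [← add_assoc]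
    exacts [h.memxy, h.nixy]

lemma low_eventually_const {K : Set Plane} (hK : Body K) {u v : Plane → Plane} {x : Plane}
    (hu : ContinuousAt u x) (hv : ContinuousAt v x) (hne : u x ≠ v x) (hov : Ov K (v x - u x))
    (hmem : ∀ᶠ z in nhds x, u z ∈ K ∧ u z ∉ interior K ∧ v z ∈ K ∧ v z ∉ interior K) :
    ∀ᶠ z in nhds x, (Low K (u z) (v z) ↔ Low K (u x) (v x)) := by
  have hov' : ∀ᶠ z in nhds x, Ov K (v z - u z) :=
    (hv.sub hu).eventually ((isOpen_ov K).mem_nhds hov)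
  by_cases h : Low K (u x) (v x)
  · simp only [h, iff_true]
    by_contra hcon
    rw [Filter.not_eventually] at hcon
    have hfr : ∃ᶠ z in nhds x, Low K (v z) (u z) := by
      refine (hcon.and_eventually (hmem.and hov')).mono ?_
      rintro z ⟨h1, ⟨h2, h3, h4, h5⟩, h6⟩
      exact (low_or_low hK h2 h4 h3 h5 h6).resolve_left h1
    exact h.not_low_symm hne hov (Low.of_tendsto hK (by simpa using hov.neg) hv hu hfr)
  · simp only [h, iff_false]
    by_contra hcon
    rw [Filter.not_eventually] at hcon
    exact h (Low.of_tendsto hK hov hu hv (hcon.mono fun z hz => not_not.1 hz))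

/-- Orientation of the first diagonal of the inscribed parallelogram. -/
def s13 (K : Set Plane) (x : Plane) : Prop := Low K (lo K x) (lo K x + (x + yv K x))

/-- Orientation of the second diagonal of the inscribed parallelogram. -/
def s24 (K : Set Plane) (x : Plane) : Prop := Low K (lo K x + x) (lo K x + x + (yv K x + -x))

lemma Reg.eventually_para {K : Set Plane} (hK : Body K) {x : Plane} (h : Reg K x) :
    ∀ᶠ z in nhds x, Para K (lo K z) z (yv K z) :=
  Filter.mem_of_superset ((isOpen_reg hK).mem_nhds h) fun _ hz => Reg.para hK hz

lemma s13_eventually {K : Set Plane} (hK : Body K) {x : Plane} (h : Reg K x)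
    (hov : Ov K (x + yv K x)) : ∀ᶠ z in nhds x, (s13 K z ↔ s13 K x) := by
  have c1 := h.continuousAt_lo hK
  have c2 := h.continuousAt_yv hK
  refine low_eventually_const hK (u := lo K) (v := fun z => lo K z + (z + yv K z)) c1
    (c1.add (continuousAt_id.add c2)) (h.para hK).diag_ne (by simpa using hov) ?_
  filter_upwards [h.eventually_para hK] with z hz
  refine ⟨hz.mem, hz.ni, ?_, ?_⟩ <;> rw [← add_assoc]
  exacts [hz.memxy, hz.nixy]

lemma s24_eventually {K : Set Plane} (hK : Body K) {x : Plane} (h : Reg K x)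
    (hov : Ov K (yv K x + -x)) : ∀ᶠ z in nhds x, (s24 K z ↔ s24 K x) := by
  have c1 := h.continuousAt_lo hK
  have c2 := h.continuousAt_yv hK
  refine low_eventually_const hK (u := fun z => lo K z + z)
    (v := fun z => lo K z + z + (yv K z + -z)) (c1.add continuousAt_id)
    ((c1.add continuousAt_id).add (c2.add continuousAt_id.neg)) (h.para hK).reindex.diag_ne
    (by simpa using hov) ?_
  filter_upwards [h.eventually_para hK] with z hz
  refine ⟨hz.memx, hz.nix, ?_, ?_⟩ <;> rw [← add_assoc]
  exacts [hz.reindex.memxy, hz.reindex.nixy]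

lemma Reg.ov_diag_eventually {K : Set Plane} (hK : Body K) {x : Plane} (h : Reg K x)
    (hov : Ov K (x + yv K x)) : ∀ᶠ z in nhds x, Ov K (z + yv K z) :=
  (continuousAt_id.add (h.continuousAt_yv hK)).eventually ((isOpen_ov K).mem_nhds hov)

lemma Reg.ov_diag_eventually' {K : Set Plane} (hK : Body K) {x : Plane} (h : Reg K x)
    (hov : Ov K (yv K x + -x)) : ∀ᶠ z in nhds x, Ov K (yv K z + -z) :=
  ((h.continuousAt_yv hK).add continuousAt_id.neg).eventually ((isOpen_ov K).mem_nhds hov)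

lemma Reg.det_deriv {K : Set Plane} (hK : Body K) {x : Plane} (h : Reg K x)
    (hs : ∀ p ∈ K, p + x ∈ K → p ∉ interior K → p + x ∉ interior K →
      Smooth K p ∧ Smooth K (p + x))
    (hd : Ov K (x + yv K x)) (he : Ov K (yv K x + -x)) :
    ∃ D : Plane →L[ℝ] Plane, HasFDerivAt (yv K) D x ∧
      ((s13 K x ↔ s24 K x) ↔ 0 < om (EuclideanSpace.single 0 1 + D (EuclideanSpace.single 0 1))
        (EuclideanSpace.single 1 1 + D (EuclideanSpace.single 1 1))) := by
  have hp := h.para hK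
  obtain ⟨sm1, sm2⟩ := hs _ hp.mem hp.memx hp.ni hp.nix
  obtain ⟨sm4, sm3⟩ := hs _ hp.memy (by convert hp.memxy using 1; abel) hp.niy
    (by convert hp.nixy using 2; abel)
  have e3 : lo K (-x) = lo K x + yv K x + x := by rw [yv]; abel
  have e4 : lo K (-x) + -x = lo K x + yv K x := by rw [yv]; abel
  rw [← e3] at sm3
  rw [← e4] at sm4
  have hp' := h.neg.para hK
  obtain ⟨t₁, h₁⟩ := hK.exists_tan hp.ni
  obtain ⟨t₂, h₂⟩ := hK.exists_tan hp.nix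
  obtain ⟨t₃, h₃⟩ := hK.exists_tan hp'.ni
  obtain ⟨t₄, h₄⟩ := hK.exists_tan hp'.nix
  obtain ⟨D₁, hD₁, hD₁'⟩ := hasFDerivAt_lo hK h sm1 sm2 h₁ h₂
  obtain ⟨D₃, hD₃, hD₃'⟩ := hasFDerivAt_lo hK h.neg sm3 sm4 h₃ h₄
  have p12 : 0 < om t₁ t₂ := hp.low1.om_tan_pos (by simpa using h.ne) (by simpa using h.ov) h₁ h₂
    (by simpa using h.edge)
  have p34 : 0 < om t₃ t₄ := hp'.low1.om_tan_pos (by simpa using h.ne) (by simpa using h.ov.neg)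
    h₃ h₄ (by simpa using h.edge')
  have hneg : HasFDerivAt (fun z : Plane => -z) (-ContinuousLinearMap.id ℝ Plane) x :=
    (hasFDerivAt_id x).neg
  have hcomp := hD₃.comp x hneg
  refine ⟨D₃.comp (-ContinuousLinearMap.id ℝ Plane) - ContinuousLinearMap.id ℝ Plane - D₁,
    (hcomp.sub (hasFDerivAt_id x)).sub hD₁, ?_⟩
  obtain ⟨n13, i13⟩ := hp.diag_tan hd h₁ (t₃ := t₃) (by convert h₃ using 1; rw [e3]; abel)
  obtain ⟨n24, i24⟩ := hp.reindex.diag_tan he h₂ (t₃ := t₄) (by convert h₄ using 1; rw [e4]; abel)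
  rw [s13, s24, i13, i24]
  have hval : ∀ u : Plane, u + (D₃.comp (-ContinuousLinearMap.id ℝ Plane) -
      ContinuousLinearMap.id ℝ Plane - D₁) u =
      -((om t₄ u / om t₃ t₄) • t₃ + (om t₂ u / om t₁ t₂) • t₁) := by
    intro u
    simp only [sub_apply, ContinuousLinearMap.comp_apply,
      neg_apply, ContinuousLinearMap.id_apply, hD₁', hD₃']
    rw [om_neg_right, neg_div, neg_smul]
    abel
  have hdet : om (EuclideanSpace.single 0 1 + (D₃.comp (-ContinuousLinearMap.id ℝ Plane) -
      ContinuousLinearMap.id ℝ Plane - D₁) (EuclideanSpace.single 0 1))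
        (EuclideanSpace.single 1 1 + (D₃.comp (-ContinuousLinearMap.id ℝ Plane) -
      ContinuousLinearMap.id ℝ Plane - D₁) (EuclideanSpace.single 1 1)) =
      om t₁ t₃ * om t₂ t₄ / (om t₁ t₂ * om t₃ t₄) := by
    rw [hval, hval, om_neg_left, om_neg_right, neg_neg]
    simp only [om_add_left, om_add_right, om_smul_left, om_smul_right, om_self]
    have a0 : ∀ t : Plane, om t (EuclideanSpace.single 0 1) = - t 1 := by intro t; simp [om]
    have a1 : ∀ t : Plane, om t (EuclideanSpace.single 1 1) = t 0 := by intro t; simp [om]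
    rw [a0, a0, a1, a1, om_comm t₃ t₁]
    have : om t₂ t₄ = t₂ 0 * t₄ 1 - t₂ 1 * t₄ 0 := rfl
    rw [this]
    field_simp
    ring
  rw [hdet, div_pos_iff_of_pos_right (mul_pos p12 p34), mul_pos_iff]
  rcases lt_or_gt_of_ne n13 with a | a <;> rcases lt_or_gt_of_ne n24 with b | b <;>
    simp [a, b, not_lt.2 a.le, not_lt.2 b.le]

lemma Twins.product_rule {K L : Set Plane} (T : Twins K L) {x : Plane} (h : Reg K x)
    (hd : Ov K (x + yv K x)) (he : Ov K (yv K x + -x)) :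
    (s13 K x ↔ s24 K x) ↔ (s13 L x ↔ s24 L x) := by
  have hL := T.reg h
  have hdL : Ov L (x + yv L x) := by rw [T.yv_eq h]; exact (T.ov_iff _).1 hd
  have heL : Ov L (yv L x + -x) := by rw [T.yv_eq h]; exact (T.ov_iff _).1 he
  have hev : ∀ᶠ z in nhds x, Reg K z ∧ (s13 K z ↔ s13 K x) ∧ (s24 K z ↔ s24 K x) ∧
      (s13 L z ↔ s13 L x) ∧ (s24 L z ↔ s24 L x) ∧ Ov K (z + yv K z) ∧ Ov K (yv K z + -z) := by
    filter_upwards [(isOpen_reg T.bK).mem_nhds h, s13_eventually T.bK h hd,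
      s24_eventually T.bK h he, s13_eventually T.bL hL hdL, s24_eventually T.bL hL heL,
      h.ov_diag_eventually T.bK hd, h.ov_diag_eventually' T.bK he] with z a1 a2 a3 a4 a5 a6 a7
    exact ⟨a1, a2, a3, a4, a5, a6, a7⟩
  have hdense := Measure.dense_of_ae ((ae_smooth_corners T.bK).and (ae_smooth_corners T.bL))
  obtain ⟨z, ⟨sK, sL⟩, hz, a2, a3, a4, a5, a6, a7⟩ := (hdense.inter_nhds_nonempty hev)
  have hzL := T.reg hz
  obtain ⟨D, hD, iD⟩ := hz.det_deriv T.bK sK a6 a7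
  obtain ⟨D', hD', iD'⟩ := hzL.det_deriv T.bL sL (by rw [T.yv_eq hz]; exact (T.ov_iff _).1 a6)
    (by rw [T.yv_eq hz]; exact (T.ov_iff _).1 a7)
  have hee : yv L =ᶠ[nhds z] yv K :=
    Filter.mem_of_superset ((isOpen_reg T.bK).mem_nhds hz) fun w hw => T.yv_eq hw
  have hDD : D' = D := hD'.unique (hD.congr_of_eventuallyEq hee)
  rw [hDD] at iD'
  rw [← a2, ← a3, ← a4, ← a5, iD, iD']

/-- The inscribed parallelograms of `K` and `L` with first side `x` have equally oriented
diagonals. -/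
def Sig (K L : Set Plane) (x : Plane) : Prop :=
  (Ov K (x + yv K x) → (s13 K x ↔ s13 L x)) ∧ (Ov K (yv K x + -x) → (s24 K x ↔ s24 L x))

lemma Twins.sig_iff {K L : Set Plane} (T : Twins K L) {x : Plane} (h : Reg K x)
    (hd : Ov K (x + yv K x)) : Sig K L x ↔ (s13 K x ↔ s13 L x) := by
  refine ⟨fun hs => hs.1 hd, fun hs => ⟨fun _ => hs, fun he => ?_⟩⟩
  have := T.product_rule h hd he
  tauto

lemma Twins.sig_iff' {K L : Set Plane} (T : Twins K L) {x : Plane} (h : Reg K x)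
    (he : Ov K (yv K x + -x)) : Sig K L x ↔ (s24 K x ↔ s24 L x) := by
  refine ⟨fun hs => hs.2 he, fun hs => ⟨fun hd => ?_, fun _ => hs⟩⟩
  have := T.product_rule h hd he
  tauto

lemma Twins.sig_eventually {K L : Set Plane} (T : Twins K L) {x : Plane} (h : Reg K x)
    (hde : Ov K (x + yv K x) ∨ Ov K (yv K x + -x)) :
    ∀ᶠ z in nhds x, (Sig K L z ↔ Sig K L x) := by
  rcases hde with hd | he
  · have hdL : Ov L (x + yv L x) := by rw [T.yv_eq h]; exact (T.ov_iff _).1 hd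
    filter_upwards [(isOpen_reg T.bK).mem_nhds h, s13_eventually T.bK h hd,
      s13_eventually T.bL (T.reg h) hdL, h.ov_diag_eventually T.bK hd] with z a1 a2 a3 a4
    rw [T.sig_iff h hd, T.sig_iff a1 a4, a2, a3]
  · have heL : Ov L (yv L x + -x) := by rw [T.yv_eq h]; exact (T.ov_iff _).1 he
    filter_upwards [(isOpen_reg T.bK).mem_nhds h, s24_eventually T.bK h he,
      s24_eventually T.bL (T.reg h) heL, h.ov_diag_eventually' T.bK he] with z a1 a2 a3 a4
    rw [T.sig_iff' h he, T.sig_iff' a1 a4, a2, a3]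

lemma Para.lo_eq_reindex {K : Set Plane} (hK : Body K) {p x y : Plane} (h : Para K p x y)
    (hy : Reg K y) : lo K y = p + x ∧ yv K y = -x := by
  have h1 := lo_eq hK hy.ne hy.edge h.low2
  have h2 : lo K (-y) = p + y := lo_eq hK hy.neg.ne hy.neg.edge (by
    have := h.low4; convert this using 1; abel)
  refine ⟨h1, ?_⟩
  rw [yv, h1, h2]; abel

lemma Reg.s13_reindex {K : Set Plane} (hK : Body K) {x : Plane} (h : Reg K x)
    (hy : Reg K (yv K x)) : s13 K (yv K x) ↔ s24 K x := by
  obtain ⟨h1, h2⟩ := (h.para hK).lo_eq_reindex hK hy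
  rw [s13, s24, h1, h2]

lemma Reg.s24_reindex {K : Set Plane} (hK : Body K) {x : Plane} (h : Reg K x)
    (hy : Reg K (yv K x)) (hd : Ov K (x + yv K x)) : s24 K (yv K x) ↔ ¬ s13 K x := by
  obtain ⟨h1, h2⟩ := (h.para hK).lo_eq_reindex hK hy
  rw [s13, s24, h1, h2, ← (h.para hK).diag_low_symm hK hd]
  rw [show lo K x + x + yv K x + (-x + -yv K x) = lo K x by abel, add_assoc]

lemma Twins.sig_reindex {K L : Set Plane} (T : Twins K L) {x : Plane} (h : Reg K x)
    (hy : Reg K (yv K x)) : Sig K L (yv K x) ↔ Sig K L x := by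
  have hL := T.reg h
  have e := T.yv_eq h
  have hyL : Reg L (yv L x) := by rw [e]; exact T.reg hy
  obtain ⟨h1, h2⟩ := (h.para T.bK).lo_eq_reindex T.bK hy
  have a1 := h.s13_reindex T.bK hy
  have b1 := hL.s13_reindex T.bL hyL
  rw [Sig, Sig, h2, a1, ← e, b1, e, and_comm]
  have hn : Ov K (-x + -yv K x) ↔ Ov K (x + yv K x) := by
    rw [← ov_neg_iff, show -(-x + -yv K x) = x + yv K x by abel]
  rw [hn]
  refine and_congr_left fun _ => forall_congr' fun hd => ?_
  have a2 := h.s24_reindex T.bK hy hd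
  have b2 := hL.s24_reindex T.bL hyL (by rw [e]; exact (T.ov_iff _).1 hd)
  rw [e] at b2
  rw [a2, b2, not_iff_not]

lemma Reg.s13_neg_set {K : Set Plane} (hK : Body K) {x : Plane} (h : Reg K x)
    (hd : Ov K (x + yv K x)) : s13 (-K) x ↔ ¬ s13 K x := by
  rw [s13, s13, ← (h.para hK).diag_low_symm hK hd, lo_neg_set hK h, yv_neg_set hK h]
  have e3 : lo K (-x) = lo K x + (x + yv K x) := by rw [yv]; abel
  rw [e3, show -(lo K x + (x + yv K x)) + (x + yv K x) = - lo K x by abel, low_neg]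

lemma Reg.s24_neg_set {K : Set Plane} (hK : Body K) {x : Plane} (h : Reg K x)
    (hd : Ov K (yv K x + -x)) : s24 (-K) x ↔ ¬ s24 K x := by
  rw [s24, s24, ← (h.para hK).reindex.diag_low_symm hK hd, lo_neg_set hK h, yv_neg_set hK h]
  have e3 : lo K (-x) = lo K x + (x + yv K x) := by rw [yv]; abel
  rw [e3, show -(lo K x + (x + yv K x)) + x + (yv K x + -x) = - (lo K x + x) by abel,
    show -(lo K x + (x + yv K x)) + x = -(lo K x + x + (yv K x + -x)) by abel, low_neg]

lemma Twins.sig_neg_right {K L : Set Plane} (T : Twins K L) {x : Plane} (h : Reg K x)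
    (hde : Ov K (x + yv K x) ∨ Ov K (yv K x + -x)) : Sig K (-L) x ↔ ¬ Sig K L x := by
  rcases hde with hd | he
  · have := (T.reg h).s13_neg_set T.bL (by rw [T.yv_eq h]; exact (T.ov_iff _).1 hd)
    rw [T.sig_iff h hd, T.neg_right.sig_iff h hd, this]
    tauto
  · have := (T.reg h).s24_neg_set T.bL (by rw [T.yv_eq h]; exact (T.ov_iff _).1 he)
    rw [T.sig_iff' h he, T.neg_right.sig_iff' h he, this]
    tauto

lemma Twins.sig_symm {K L : Set Plane} (T : Twins K L) {x : Plane} (h : Reg K x) :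
    Sig L K x ↔ Sig K L x := by
  rw [Sig, Sig, T.yv_eq h, T.ov_iff, T.ov_iff, iff_comm (a := s13 L x), iff_comm (a := s24 L x)]

lemma Twins.sig_neg_neg {K L : Set Plane} (T : Twins K L) {x : Plane} (h : Reg K x)
    (hde : Ov K (x + yv K x) ∨ Ov K (yv K x + -x)) : Sig (-K) (-L) x ↔ Sig K L x := by
  have hde' : Ov L (x + yv L x) ∨ Ov L (yv L x + -x) := by
    rw [T.yv_eq h, ← T.ov_iff, ← T.ov_iff]; exact hde
  have hde'' : Ov (-K) (x + yv (-K) x) ∨ Ov (-K) (yv (-K) x + -x) := by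
    rw [yv_neg_set T.bK h, ov_neg_set, ov_neg_set]; exact hde
  rw [T.neg_left.sig_neg_right h.neg_set hde'', ← T.neg_left.sig_symm h.neg_set,
    T.symm.sig_neg_right (T.reg h) hde', not_not, T.sig_symm h]

/-- Radial projection onto the boundary. -/
lemma exists_boundary_path {K : Set Plane} (hK : Body K) {c : Plane} (hc : c ∈ interior K) :
    ∃ f : Plane → Plane, (∀ u, u ≠ 0 → ContinuousAt f u) ∧
      (∀ u, u ≠ 0 → f u ∈ K ∧ f u ∉ interior K ∧ ∃ r : ℝ, 0 < r ∧ f u = c + r • u) ∧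
      ∀ q ∈ K, q ∉ interior K → f (q - c) = q := by
  set K₀ : Set Plane := (fun z => c + z) ⁻¹' K with hK₀
  have hconv : Convex ℝ K₀ := hK.conv.translate_preimage_right c
  have hinter : interior K₀ = (fun z => c + z) ⁻¹' interior K :=
    ((Homeomorph.addLeft c).preimage_interior K).symm
  have hfr : frontier K₀ = (fun z => c + z) ⁻¹' (K \ interior K) := by
    rw [frontier, hinter, (hK.comp.isClosed.preimage (by fun_prop)).closure_eq]; rfl
  have h0 : K₀ ∈ nhds (0 : Plane) := by
    rw [mem_nhds_iff]
    exact ⟨interior K₀, interior_subset, isOpen_interior, by rw [hinter]; simpa using hc⟩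
  have hb : Bornology.IsVonNBounded ℝ K₀ := by
    rw [NormedSpace.isVonNBounded_iff]
    have : K₀ = (fun z => z - c) '' K := by
      ext z; simp [hK₀, sub_eq_iff_eq_add, add_comm]
    rw [this]
    exact (hK.comp.image (by fun_prop)).isBounded
  have hpos : ∀ u : Plane, u ≠ 0 → 0 < gauge K₀ u := fun u hu =>
    (gauge_pos (absorbent_nhds_zero h0) hb).2 hu
  have hg := continuous_gauge hconv h0
  refine ⟨fun u => c + (gauge K₀ u)⁻¹ • u, fun u hu => ?_, fun u hu => ?_, fun q hq hqi => ?_⟩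
  · exact continuousAt_const.add ((hg.continuousAt.inv₀ (hpos u hu).ne').smul continuousAt_id)
  · have : (gauge K₀ u)⁻¹ • u ∈ frontier K₀ := by
      rw [← gauge_eq_one_iff_mem_frontier hconv h0, gauge_smul_of_nonneg (inv_nonneg.2 (hpos u hu).le),
        smul_eq_mul, inv_mul_cancel₀ (hpos u hu).ne']
    rw [hfr] at this
    exact ⟨this.1, this.2, _, inv_pos.2 (hpos u hu), rfl⟩
  · have : q - c ∈ frontier K₀ := by
      rw [hfr]; simpa using ⟨hq, hqi⟩
    rw [← gauge_eq_one_iff_mem_frontier hconv h0] at this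
    simp [this]

/-- `p` is a smooth exposed point of `K` with antipode `pb`. -/
structure Base (K : Set Plane) (p pb τ : Plane) : Prop where
  mem : p ∈ K
  memb : pb ∈ K
  tan : Tan K p τ
  tanb : Tan K pb (-τ)
  smooth : Smooth K p
  exposed : ∀ k ∈ K, om τ (k - p) = 0 → k = p
  exposedb : ∀ k ∈ K, om τ (k - pb) = 0 → k = pb

lemma Base.pos {K : Set Plane} (hK : Body K) {p pb τ : Plane} (h : Base K p pb τ) :
    0 < om τ (pb - p) := by
  obtain ⟨k, hk⟩ := hK.int
  have e1 := h.tan.pos hk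
  have e2 := h.tanb.pos hk
  rw [om_neg_left] at e2
  rw [om_sub_right] at *
  linarith

lemma Base.seg_interior {K : Set Plane} (hK : Body K) {p pb τ : Plane} (h : Base K p pb τ)
    {β : ℝ} (h0 : 0 < β) (h1 : β < 1) : p + β • (pb - p) ∈ interior K := by
  have hpos := h.pos hK
  obtain ⟨s, hs, hi⟩ := h.smooth.enter hK h.tan hpos
  have hs1 : s < 1 := by
    have := h.tanb.pos hi
    rw [show p + s • (pb - p) - pb = (s - 1) • (pb - p) by module, om_neg_left,
      om_smul_right] at this
    nlinarith
  rcases le_total β s with hb | hb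
  · have := hK.combo_mem_interior h.mem hi (ε := β / s) (by positivity)
      (by rw [div_le_one hs]; exact hb)
    convert this using 1
    match_scalars <;> field_simp <;> ring
  · have hs1' : 0 < 1 - s := by linarith
    have := hK.combo_mem_interior h.memb hi (ε := (1 - β) / (1 - s))
      (div_pos (by linarith) hs1') (by rw [div_le_one hs1']; linarith)
    convert this using 1
    match_scalars <;> field_simp <;> ring

lemma Base.ov {K : Set Plane} (hK : Body K) {p pb τ q : Plane} (h : Base K p pb τ) (hq : q ∈ K)
    (hqb : q ≠ pb) : Ov K (q - p) := by
  by_contra hov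
  obtain ⟨t, h1, h2⟩ := exists_tan_of_not_ov hK hov h.mem (by simpa using hq)
  obtain ⟨c, hc, rfl⟩ := h.smooth.exists_pos hK h.tan h1
  rw [add_sub_cancel] at h2
  apply hqb
  apply h.exposedb q hq
  have e1 := h2.2 pb h.memb
  have e2 := h.tanb.2 q hq
  rw [om_neg_left, om_smul_left, ← neg_sub q pb, om_neg_right] at e1
  rw [om_neg_left] at e2
  nlinarith

lemma Base.not_edge {K : Set Plane} (hK : Body K) {p pb τ q : Plane} (h : Base K p pb τ)
    (hb : Bal K) (hq : q ∈ K) (hqi : q ∉ interior K) (hqp : q ≠ p) (hqb : q ≠ pb) :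
    ¬ Edge K (q - p) := by
  intro he
  have key : ∀ c : ℝ, Tan K p (c • (q - p)) → False := by
    intro c ht
    obtain ⟨d, hd, hdq⟩ := h.smooth.exists_pos hK h.tan ht
    have hc : c ≠ 0 := by rintro rfl; exact ht.1 (by simp)
    apply hqp
    apply h.exposed q hq
    have h1 : om (d • τ) (q - p) = 0 := by rw [← hdq, om_smul_left, om_self, mul_zero]
    rw [om_smul_left] at h1
    exact (mul_eq_zero.1 h1).resolve_left hd.ne'
  have hx : q - p ≠ 0 := sub_ne_zero.2 hqp
  rcases low_or_low hK h.mem hq h.tan.not_mem_interior hqi (h.ov hK hq hqb) with hl | hl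
  · obtain ⟨b, hb1, hb2, hb3⟩ := he
    have h1 := hl.2.2 b hb1 hb2
    refine key 1 ⟨by simpa using hx, fun k hk => ?_⟩
    have h2 := hb3 p h.mem
    have h3 := hb3 k hk
    rw [one_smul]
    rw [om_sub_right (q - p)] at *
    linarith
  · obtain ⟨b, hb1, hb2, hb3⟩ := hb _ he
    rw [neg_sub] at hb2 hb3
    have h1 := hl.2.2 b hb1 hb2
    refine key (-1) ⟨by rw [neg_one_smul]; exact neg_ne_zero.2 hx, fun k hk => ?_⟩
    have h2 := hb3 q hq
    have h3 := hb3 k hk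
    rw [neg_one_smul, neg_sub]
    have h4 : om (p - q) (q - p) = 0 := by rw [← neg_sub p q, om_neg_right, om_self, neg_zero]
    rw [om_sub_right (p - q)] at *
    linarith

lemma Base.reg {K : Set Plane} (hK : Body K) {p pb τ q : Plane} (h : Base K p pb τ)
    (hb : Bal K) (hq : q ∈ K) (hqi : q ∉ interior K) (hqp : q ≠ p) (hqb : q ≠ pb) :
    Reg K (q - p) :=
  hb.reg (sub_ne_zero.2 hqp) (h.ov hK hq hqb) (h.not_edge hK hb hq hqi hqp hqb)

lemma Base.low_iff {K : Set Plane} (hK : Body K) {p pb τ q : Plane} (h : Base K p pb τ)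
    (hq : q ∈ K) (hqi : q ∉ interior K) (hqp : q ≠ p) (hqb : q ≠ pb) :
    Low K p q ↔ 0 < om (q - p) (pb - p) := by
  have hpos := h.pos hK
  obtain ⟨t, ht⟩ := hK.exists_tan hqi
  set v := pb - p with hv
  have hov := h.ov hK hq hqb
  have hcr : ∀ z : Plane, ∃ a b : ℝ, z = a • τ + b • v := by
    intro z
    refine ⟨om z v / om τ v, om τ z / om τ v, ?_⟩
    have := om_cramer τ v z
    rw [div_eq_inv_mul, div_eq_inv_mul, mul_smul, mul_smul, ← smul_add, ← this, smul_smul,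
      inv_mul_cancel₀ hpos.ne', one_smul]
  obtain ⟨α, β, hα⟩ := hcr (q - p)
  obtain ⟨a, b, hab⟩ := hcr t
  have e1 := h.tan.2 q hq
  have e2 := h.tanb.2 q hq
  have e1' : om τ (q - p) ≠ 0 := fun h0 => hqp (h.exposed q hq h0)
  have e2' : om τ (q - pb) ≠ 0 := fun h0 => hqb (h.exposedb q hq h0)
  have hqpb : q - pb = α • τ + (β - 1) • v := by
    rw [show q - pb = (q - p) - v by rw [hv]; abel, hα]; module
  rw [hα] at e1 e1'
  rw [hqpb] at e2 e2'
  have f1 := ht.2 p h.mem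
  have f2 := ht.2 pb h.memb
  rw [← neg_sub q p, hα, hab] at f1
  rw [← neg_sub q pb, hqpb, hab] at f2
  rw [hα]
  simp only [om_add_left, om_add_right, om_smul_left, om_smul_right, om_self, om_neg_left,
    om_neg_right, mul_zero, zero_add, add_zero, om_comm v τ] at e1 e1' e2 e2' f1 f2 ⊢
  have hβ0 : 0 < β := by
    rcases lt_or_ge 0 β with hh | hh
    · exact hh
    · exact absurd (le_antisymm (mul_nonpos_of_nonpos_of_nonneg hh hpos.le) e1) e1'
  have hβ1 : β < 1 := by
    rcases lt_or_ge β 1 with hh | hh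
    · exact hh
    · exact absurd (le_antisymm (by nlinarith) (mul_nonneg (by linarith) hpos.le)) e2'
  have hα0 : α ≠ 0 := by
    rintro rfl
    rw [zero_smul, zero_add] at hα
    exact hqi (by rw [show q = p + β • v by rw [← hα]; abel]; exact h.seg_interior hK hβ0 hβ1)
  set w := om τ v with hw
  have g1 : 0 ≤ b * α - a * β := by nlinarith
  have g2 : 0 ≤ b * α + a * (1 - β) := by nlinarith
  have hb0 : b * α ≠ 0 := by
    intro h0
    have ha0 : a = 0 := by nlinarith
    have hb' : b = 0 := (mul_eq_zero.1 h0).resolve_right hα0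
    exact ht.1 (by rw [hab, ha0, hb']; simp)
  have hb1 : 0 < b * α := by
    refine lt_of_le_of_ne ?_ hb0.symm
    nlinarith
  rw [mul_pos_iff_of_pos_right hpos]
  constructor
  · intro hl
    by_contra hneg
    have hα' : α < 0 := lt_of_le_of_ne (not_lt.1 hneg) hα0
    have hb' : b < 0 := by nlinarith
    refine hl.not_low_symm hqp.symm hov (low_of_tan hq h.mem ht h.tan ?_)
    rw [hab, om_comm]
    simp only [om_add_right, om_smul_right, om_self]
    nlinarith
  · intro hα'
    have hb' : 0 < b := by nlinarith
    refine low_of_tan h.mem hq h.tan ht ?_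
    rw [hab]
    simp only [om_add_right, om_smul_right, om_self]
    nlinarith

/-- A base none of whose inscribed parallelograms has two antipodal diagonals. -/
structure Good (K : Set Plane) (p pb τ : Plane) : Prop extends Base K p pb τ where
  nonDouble : ∀ p₂ ∈ K, ∀ p₄ ∈ K, p₂ + p₄ = p + pb → ¬ Ov K (p₄ - p₂) → p₂ = p ∨ p₂ = pb

lemma Good.ov_diag {K : Set Plane} (hK : Body K) {p pb τ q : Plane} (h : Good K p pb τ)
    (hb : Bal K) (hl : Low K p q) (hqp : q ≠ p) (hqb : q ≠ pb) :
    Reg K (q - p) ∧ lo K (q - p) = p ∧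
    (Ov K ((q - p) + yv K (q - p)) ∨ Ov K (yv K (q - p) + -(q - p))) := by
  have hr := h.toBase.reg hK hb hl.2.1 (hl.right_not_mem_interior hK.conv hqp.symm) hqp hqb
  have hlo : lo K (q - p) = p := lo_eq hK hr.ne hr.edge (by simpa using hl)
  refine ⟨hr, hlo, ?_⟩
  have hpar := hr.para hK
  rw [hlo] at hpar
  by_contra hcon
  push Not at hcon
  set y := yv K (q - p) with hy
  have h3 : p + ((q - p) + y) = pb := by
    by_contra hne
    exact hcon.1 (by
      have := h.toBase.ov hK (q := p + ((q - p) + y)) (by rw [← add_assoc]; exact hpar.memxy) hne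
      simpa using this)
  have h4 : p + y - q = y + -(q - p) := by abel
  rcases h.nonDouble q hl.2.1 (p + y) hpar.memy (by rw [← h3]; abel)
    (by rw [h4]; exact hcon.2) with h5 | h5
  · exact hqp h5
  · exact hqb h5

lemma Twins.sig_path {K L : Set Plane} (T : Twins K L) {p pb τ q q' : Plane} (h : Good K p pb τ)
    (hl : Low K p q) (hqp : q ≠ p) (hqb : q ≠ pb) (hl' : Low K p q') (hqp' : q' ≠ p)
    (hqb' : q' ≠ pb) : Sig K L (q - p) ↔ Sig K L (q' - p) := by
  have hK := T.bK
  have hc := h.toBase.seg_interior hK (β := 1 / 2) (by norm_num) (by norm_num)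
  set c := p + (1 / 2 : ℝ) • (pb - p) with hcdef
  obtain ⟨f, f1, f2, f3⟩ := exists_boundary_path hK hc
  set H : Set Plane := {u | 0 < om u (pb - p)} with hH
  have hHconv : Convex ℝ H := by
    intro a ha b hb α β hα hβ hαβ
    simp only [hH, Set.mem_ofPred_eq] at *
    rw [om_add_left, om_smul_left, om_smul_left]
    rcases hα.eq_or_lt with h0 | h0
    · have : β = 1 := by linarith
      rw [← h0, this]; linarith
    · have := mul_pos h0 ha
      have := mul_nonneg hβ hb.le
      linarith
  have hne : ∀ u ∈ H, u ≠ 0 := by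
    rintro u hu rfl
    simp [hH] at hu
  have hprop : ∀ u ∈ H, Low K p (f u) ∧ f u ≠ p ∧ f u ≠ pb := by
    intro u hu
    obtain ⟨g1, g2, r, hr, g3⟩ := f2 u (hne u hu)
    have hom : 0 < om (f u - p) (pb - p) := by
      rw [g3, show c + r • u - p = (1 / 2 : ℝ) • (pb - p) + r • u by rw [hcdef]; abel, om_add_left,
        om_smul_left, om_smul_left, om_self]
      have := mul_pos hr hu
      linarith
    have n1 : f u ≠ p := by intro h0; rw [h0] at hom; simp at hom
    have n2 : f u ≠ pb := by intro h0; rw [h0] at hom; simp at hom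
    exact ⟨(h.toBase.low_iff hK g1 g2 n1 n2).2 hom, n1, n2⟩
  have hmemH : ∀ q, Low K p q → q ≠ p → q ≠ pb → q - c ∈ H ∧ f (q - c) = q := by
    intro q hl hqp hqb
    have hqi := hl.right_not_mem_interior hK.conv hqp.symm
    refine ⟨?_, f3 q hl.2.1 hqi⟩
    have := (h.toBase.low_iff hK hl.2.1 hqi hqp hqb).1 hl
    simp only [hH, Set.mem_ofPred_eq]
    rw [hcdef, show q - (p + (1 / 2 : ℝ) • (pb - p)) = (q - p) - (1 / 2 : ℝ) • (pb - p) by abel,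
      om_sub_left, om_smul_left, om_self]
    linarith
  have hconst : ∀ u ∈ H, ∀ v ∈ H, (Sig K L (f u - p) ↔ Sig K L (f v - p)) := by
    classical
    have hloc : ∀ u ∈ H, ∀ᶠ v in nhdsWithin u H, (Sig K L (f v - p) ↔ Sig K L (f u - p)) := by
      intro u hu
      obtain ⟨g1, g2, g3⟩ := hprop u hu
      obtain ⟨k1, _, k2⟩ := h.ov_diag hK T.balK g1 g2 g3
      have hcont : ContinuousAt (fun v => f v - p) u := (f1 u (hne u hu)).sub continuousAt_const
      exact (hcont.eventually (T.sig_eventually k1 k2)).filter_mono nhdsWithin_le_nhds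
    have hco : ContinuousOn (fun v => decide (Sig K L (f v - p))) H := by
      intro u hu
      refine (continuousWithinAt_const (b := decide (Sig K L (f u - p)))).congr_of_eventuallyEq
        (Filter.mem_of_superset (hloc u hu) fun v hv => ?_) rfl
      simp [show (Sig K L (f v - p) ↔ Sig K L (f u - p)) from hv]
    intro u hu v hv
    have := hHconv.isPreconnected.constant hco hu hv
    simpa using this
  obtain ⟨a1, a2⟩ := hmemH q hl hqp hqb
  obtain ⟨b1, b2⟩ := hmemH q' hl' hqp' hqb'
  have := hconst _ a1 _ b1
  rwa [a2, b2] at this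

lemma Twins.sig_share {K L : Set Plane} (T : Twins K L) {p pb τ p' pb' τ' q q' : Plane}
    (h : Good K p pb τ) (h' : Good K p' pb' τ') (hne : p' ≠ p) (hne1 : p' ≠ pb) (hne2 : p ≠ pb')
    (hl : Low K p q) (hqp : q ≠ p) (hqb : q ≠ pb) (hl' : Low K p' q') (hqp' : q' ≠ p')
    (hqb' : q' ≠ pb') : Sig K L (q - p) ↔ Sig K L (q' - p') := by
  have hK := T.bK
  have key : ∀ p pb τ p' pb' τ' q q' : Plane, Good K p pb τ → Good K p' pb' τ' → p' ≠ p →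
      p' ≠ pb → Low K p p' → Low K p q → q ≠ p → q ≠ pb → Low K p' q' → q' ≠ p' → q' ≠ pb' →
      (Sig K L (q - p) ↔ Sig K L (q' - p')) := by
    intro p pb τ p' pb' τ' q q' h h' hne hne1 hpp hl hqp hqb hl' hqp' hqb'
    rw [T.sig_path h hl hqp hqb hpp hne hne1]
    obtain ⟨k1, k2, k3⟩ := h.ov_diag hK T.balK hpp hne hne1
    have hpar := k1.para hK
    rw [k2] at hpar
    have hlow2 := hpar.low2
    rw [add_sub_cancel] at hlow2
    set y := yv K (p' - p) with hy
    have hy0 : y ≠ 0 := by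
      intro h0
      have := hpar.pos
      rw [h0] at this
      simp at this
    have n1 : p' + y ≠ p' := by simpa using hy0
    have n2 : p' + y ≠ pb' := by
      intro h0
      have h1 : Tan K (p' + y) ((-1 : ℝ) • τ') := by rw [h0]; simpa using h'.tanb
      have := Ov.not_opposite (q := p' + y) (p := p') (by simpa using hpar.ov') h'.tan h1
      norm_num at this
    have hry : Reg K y := by
      have := h'.toBase.reg hK T.balK hlow2.2.1 (hlow2.right_not_mem_interior hK.conv n1.symm) n1 n2
      simpa using this
    rw [← T.sig_reindex k1 hry]
    have := T.sig_path h' hlow2 n1 n2 hl' hqp' hqb'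
    rwa [add_sub_cancel_left] at this
  have hov := h.toBase.ov hK h'.mem hne1
  rcases low_or_low hK h.mem h'.mem h.tan.not_mem_interior h'.tan.not_mem_interior hov with hh | hh
  · exact key _ _ _ _ _ _ _ _ h h' hne hne1 hh hl hqp hqb hl' hqp' hqb'
  · exact (key _ _ _ _ _ _ _ _ h' h hne.symm hne2 hh hl' hqp' hqb' hl hqp hqb).symm


/-- First coordinate with respect to the basis `τ, v`. -/
noncomputable def cu (τ v z : Plane) : ℝ := om z v / om τ v

/-- Second coordinate with respect to the basis `τ, v`. -/
noncomputable def ch (τ v z : Plane) : ℝ := om τ z / om τ v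

lemma cu_add (τ v a b : Plane) : cu τ v (a + b) = cu τ v a + cu τ v b := by
  simp only [cu, om_add_left, add_div]
lemma ch_add (τ v a b : Plane) : ch τ v (a + b) = ch τ v a + ch τ v b := by
  simp only [ch, om_add_right, add_div]
lemma cu_sub (τ v a b : Plane) : cu τ v (a - b) = cu τ v a - cu τ v b := by
  simp only [cu, om_sub_left, sub_div]
lemma ch_sub (τ v a b : Plane) : ch τ v (a - b) = ch τ v a - ch τ v b := by
  simp only [ch, om_sub_right, sub_div]
lemma cu_neg (τ v a : Plane) : cu τ v (-a) = - cu τ v a := by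
  simp only [cu, om_neg_left, neg_div]
lemma ch_neg (τ v a : Plane) : ch τ v (-a) = - ch τ v a := by
  simp only [ch, om_neg_right, neg_div]
lemma cu_zero (τ v : Plane) : cu τ v 0 = 0 := by simp [cu]
lemma ch_zero (τ v : Plane) : ch τ v 0 = 0 := by simp [ch]
lemma cu_combo {τ v : Plane} (h : 0 < om τ v) (a b : ℝ) : cu τ v (a • τ + b • v) = a := by
  simp only [cu, om_add_left, om_smul_left, om_self, mul_zero, add_zero]
  field_simp
lemma ch_combo {τ v : Plane} (h : 0 < om τ v) (a b : ℝ) : ch τ v (a • τ + b • v) = b := by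
  simp only [ch, om_add_right, om_smul_right, om_self, mul_zero, zero_add]
  field_simp
lemma combo_cu_ch {τ v : Plane} (h : 0 < om τ v) (z : Plane) :
    cu τ v z • τ + ch τ v z • v = z := by
  have := om_cramer τ v z
  rw [cu, ch, div_eq_inv_mul, div_eq_inv_mul, mul_smul, mul_smul, ← smul_add, ← this, smul_smul,
    inv_mul_cancel₀ h.ne', one_smul]
lemma continuous_cu (τ v : Plane) : Continuous (cu τ v) := by unfold cu; fun_prop
lemma continuous_ch (τ v : Plane) : Continuous (ch τ v) := by unfold ch; fun_prop
lemma om_slope {τ v : Plane} (h : 0 < om τ v) (k : ℝ) (w : Plane) :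
    om (τ + k • v) w = om τ v * (ch τ v w - k * cu τ v w) := by
  rw [om_add_left, om_smul_left, cu, ch, om_comm v w]
  field_simp
  ring

/-- Slopes of supporting lines along a boundary curve. -/
structure Slopes (l : ℝ → ℝ) (r : ℝ) : Prop where
  pos : 0 < r
  zero : l 0 = 0
  cont : ContinuousAt l 0
  mono : MonotoneOn l (Set.Ioo (-r) r)
  ne : ∀ t ∈ Set.Ioo (-r) r, t ≠ 0 → l t ≠ 0

/-- The boundary curve `t ↦ A t τ + B t v` of `S` has supporting lines of slope `l t`. -/
structure Curve (S : Set Plane) (τ v : Plane) (l A B : ℝ → ℝ) (ρ r : ℝ) : Prop where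
  line : ∀ t ∈ Set.Ioo (-r) r, ∀ w ∈ S, B t + l t * (cu τ v w - A t) ≤ ch τ v w
  mem : ∀ t ∈ Set.Ioo (-r) r, A t • τ + B t • v ∈ S
  cont : ContinuousOn A (Set.Ioo (-r) r)
  deriv : HasDerivAt A ρ 0
  A0 : A 0 = 0
  B0 : B 0 = 0

lemma Curve.legendre {S : Set Plane} {τ v : Plane} {l A B : ℝ → ℝ} {ρ r : ℝ}
    (h : Curve S τ v l A B ρ r) (hv : 0 < om τ v) {s t : ℝ} (hs : s ∈ Set.Ioo (-r) r)
    (ht : t ∈ Set.Ioo (-r) r) :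
    (l s * A s - B s) + A s * (l t - l s) ≤ l t * A t - B t := by
  have := h.line t ht _ (h.mem s hs)
  rw [cu_combo hv, ch_combo hv] at this
  linarith

lemma Slopes.zero_mem {l : ℝ → ℝ} {r : ℝ} (h : Slopes l r) : (0:ℝ) ∈ Set.Ioo (-r) r :=
  ⟨by linarith [h.pos], h.pos⟩

lemma Curve.tendsto_slope {S : Set Plane} {τ v : Plane} {l A B : ℝ → ℝ} {ρ r : ℝ}
    (h : Curve S τ v l A B ρ r) (θ : ℝ) :
    Filter.Tendsto (fun t => A (θ * t) / t) (nhdsWithin 0 {0}ᶜ) (nhds (ρ * θ)) := by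
  have h1 : HasDerivAt (fun t => A (θ * t)) (ρ * θ) 0 := by
    have h2 : HasDerivAt (fun t : ℝ => θ * t) θ 0 := by
      simpa using (hasDerivAt_id (0:ℝ)).const_mul θ
    have h3 : HasDerivAt A ρ (θ * 0) := by simpa using h.deriv
    exact h3.comp 0 h2
  have := h1.tendsto_slope
  refine this.congr fun t => ?_
  simp [slope_def_field, h.A0]

lemma Curve.legendre_lt {S₁ S₂ : Set Plane} {τ v : Plane} {l A₁ B₁ A₂ B₂ : ℝ → ℝ} {ρ₁ ρ₂ r : ℝ}
    (hv : 0 < om τ v) (hl : Slopes l r) (h₁ : Curve S₁ τ v l A₁ B₁ ρ₁ r)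
    (h₂ : Curve S₂ τ v l A₂ B₂ ρ₂ r) (h0 : 0 ≤ ρ₂) (hρ : ρ₂ < ρ₁) :
    ∃ r' > 0, r' ≤ r ∧ ∀ t, |t| < r' → t ≠ 0 →
      l t * A₂ t - B₂ t < l t * A₁ t - B₁ t := by
  have hρ1 : 0 < ρ₁ := by linarith
  set θ : ℝ := (ρ₁ + ρ₂) / (2 * ρ₁) with hθ
  have hθ0 : 0 < θ := by positivity
  have hθ1 : θ < 1 := by rw [hθ, div_lt_one (by positivity)]; linarith
  have hlim : Filter.Tendsto (fun t => A₁ (θ * t) / t - A₂ t / t) (nhdsWithin 0 {0}ᶜ)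
      (nhds (ρ₁ * θ - ρ₂)) := by
    have e2 := h₂.tendsto_slope 1
    simp only [one_mul, mul_one] at e2
    exact (h₁.tendsto_slope θ).sub e2
  have hpos : 0 < ρ₁ * θ - ρ₂ := by
    have : ρ₁ * θ = (ρ₁ + ρ₂) / 2 := by rw [hθ]; field_simp
    rw [this]; linarith
  have hev := hlim.eventually (lt_mem_nhds hpos)
  rw [eventually_nhdsWithin_iff] at hev
  obtain ⟨r₀, hr₀, hball⟩ := Metric.eventually_nhds_iff.1 hev
  set r' := min r₀ r with hr'
  have hr'0 : 0 < r' := lt_min hr₀ hl.pos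
  have hmem : ∀ t, |t| < r' → t ∈ Set.Ioo (-r) r := fun t ht =>
    abs_lt.1 (ht.trans_le (min_le_right _ _))
  have hθt : ∀ t, |t| < r' → |θ * t| < r' := by
    intro t ht
    rw [abs_mul, abs_of_pos hθ0]
    exact lt_of_le_of_lt (mul_le_of_le_one_left (abs_nonneg _) hθ1.le) ht
  set e : ℝ → ℝ := fun t => (l t * A₁ t - B₁ t) - (l t * A₂ t - B₂ t) with he
  -- one step of the recursion
  have hstep : ∀ t, |t| < r' → t ≠ 0 → ∃ c : ℝ, 0 < c ∧ 0 ≤ t * (l t - l (θ * t)) ∧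
      e (θ * t) + c * (t * (l t - l (θ * t))) ≤ e t := by
    intro t ht ht0
    have e1 := h₁.legendre hv (hmem _ (hθt t ht)) (hmem t ht)
    have e2 := h₂.legendre hv (hmem t ht) (hmem _ (hθt t ht))
    have e3 : 0 < A₁ (θ * t) / t - A₂ t / t :=
      hball (by rw [Real.dist_eq, sub_zero]; exact ht.trans_le (min_le_left _ _)) ht0
    refine ⟨A₁ (θ * t) / t - A₂ t / t, e3, ?_, ?_⟩
    · rcases lt_or_gt_of_ne ht0 with hneg | hpos
      · refine mul_nonneg_of_nonpos_of_nonpos hneg.le (sub_nonpos.2 ?_)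
        exact hl.mono (hmem t ht) (hmem _ (hθt t ht)) (by nlinarith)
      · refine mul_nonneg hpos.le (sub_nonneg.2 ?_)
        exact hl.mono (hmem _ (hθt t ht)) (hmem t ht) (by nlinarith)
    · have : (A₁ (θ * t) / t - A₂ t / t) * (t * (l t - l (θ * t))) =
          (A₁ (θ * t) - A₂ t) * (l t - l (θ * t)) := by field_simp
      rw [this]
      simp only [he]
      linarith
  have hpow : ∀ n : ℕ, ∀ t, |t| < r' → |θ ^ n * t| < r' := by
    intro n
    induction n with
    | zero => intro t ht; simpa using ht
    | succ n ih => intro t ht; rw [pow_succ', mul_assoc]; exact hθt _ (ih t ht)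
  have hmono : ∀ n : ℕ, ∀ t, |t| < r' → t ≠ 0 → e (θ ^ n * t) ≤ e t := by
    intro n
    induction n with
    | zero => intro t ht ht0; simp
    | succ n ih =>
      intro t ht ht0
      obtain ⟨c, hc, hc1, hc2⟩ := hstep (θ ^ n * t) (hpow n t ht) (by positivity)
      rw [pow_succ', mul_assoc]
      nlinarith [ih t ht ht0, mul_nonneg hc.le hc1]
  have hseq : ∀ t : ℝ, Filter.Tendsto (fun n : ℕ => θ ^ n * t) Filter.atTop (nhds 0) := by
    intro t
    simpa using (tendsto_pow_atTop_nhds_zero_of_lt_one hθ0.le hθ1).mul_const t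
  have hce : ∀ t, |t| < r' → -(l t * A₂ t) ≤ e t := by
    intro t ht
    have e1 := h₁.legendre hv hl.zero_mem (hmem t ht)
    have e2 := h₂.legendre hv (hmem t ht) hl.zero_mem
    rw [h₁.A0, h₁.B0, hl.zero] at e1
    rw [h₂.A0, h₂.B0, hl.zero] at e2
    simp only [he]
    linarith
  have hnonneg : ∀ t, |t| < r' → t ≠ 0 → 0 ≤ e t := by
    intro t ht ht0
    have hA : Filter.Tendsto A₂ (nhds 0) (nhds 0) := by
      have := h₂.deriv.continuousAt.tendsto; rwa [h₂.A0] at this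
    have hL : Filter.Tendsto l (nhds 0) (nhds 0) := by
      have := hl.cont.tendsto; rwa [hl.zero] at this
    have hlim : Filter.Tendsto (fun n : ℕ => -(l (θ ^ n * t) * A₂ (θ ^ n * t))) Filter.atTop
        (nhds 0) := by
      simpa using ((hL.comp (hseq t)).mul (hA.comp (hseq t))).neg
    exact le_of_tendsto' hlim fun n => (hce _ (hpow n t ht)).trans (hmono n t ht ht0)
  refine ⟨r', hr'0, min_le_right _ _, fun t ht ht0 => ?_⟩
  have hfin : 0 < e t := by
    refine lt_of_le_of_ne (hnonneg t ht ht0) fun h0 => ?_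
    have hall : ∀ n : ℕ, e (θ ^ n * t) = 0 ∧ l (θ ^ n * t) = l t := by
      intro n
      induction n with
      | zero => simp [← h0]
      | succ n ih =>
        obtain ⟨c, hc, hc1, hc2⟩ := hstep (θ ^ n * t) (hpow n t ht) (by positivity)
        rw [← mul_assoc, ← pow_succ'] at hc1 hc2
        have hn := hnonneg (θ ^ (n + 1) * t) (hpow _ t ht) (by positivity)
        rw [ih.1] at hc2
        have h3 := mul_nonneg hc.le hc1
        have h4 : c * (θ ^ n * t * (l (θ ^ n * t) - l (θ ^ (n + 1) * t))) = 0 := by linarith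
        refine ⟨by linarith, ?_⟩
        have h5 : θ ^ n * t ≠ 0 := by positivity
        have h6 : l (θ ^ n * t) - l (θ ^ (n + 1) * t) = 0 := by
          simpa [hc.ne', h5, ht0, hθ0.ne'] using h4
        rw [← ih.2]; linarith
    have hL : Filter.Tendsto l (nhds 0) (nhds 0) := by
      have := hl.cont.tendsto; rwa [hl.zero] at this
    have h7 := (hL.comp (hseq t))
    have h8 : (l ∘ fun n : ℕ => θ ^ n * t) = fun _ => l t := by
      funext n; exact (hall n).2
    rw [h8] at h7
    exact hl.ne t (hmem t ht) ht0 (tendsto_nhds_unique tendsto_const_nhds h7)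
  simp only [he] at hfin
  linarith

lemma Curve.line_lt {S₁ S₂ : Set Plane} {τ v : Plane} {l A₁ B₁ A₂ B₂ : ℝ → ℝ} {ρ₁ ρ₂ r : ℝ}
    (hv : 0 < om τ v) (hl : Slopes l r) (h₁ : Curve S₁ τ v l A₁ B₁ ρ₁ r)
    (h₂ : Curve S₂ τ v l A₂ B₂ ρ₂ r) (h0 : 0 ≤ ρ₂) (hρ : ρ₂ < ρ₁) :
    ∃ r' > 0, r' ≤ r ∧ ∀ t, |t| < r' → t ≠ 0 →
      ∃ b, B₁ t < b ∧ ∀ w ∈ S₂, b + l t * (cu τ v w - A₁ t) ≤ ch τ v w := by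
  obtain ⟨r', hr', hle, h⟩ := Curve.legendre_lt hv hl h₁ h₂ h0 hρ
  refine ⟨r', hr', hle, fun t ht ht0 => ?_⟩
  have h3 := h t ht ht0
  refine ⟨B₁ t + ((l t * A₁ t - B₁ t) - (l t * A₂ t - B₂ t)), by linarith, fun w hw => ?_⟩
  have := h₂.line t (abs_lt.1 (ht.trans_le hle)) w hw
  linarith

lemma Curve.exists_param {S : Set Plane} {τ v : Plane} {l A B : ℝ → ℝ} {ρ r : ℝ}
    (hl : Slopes l r) (h : Curve S τ v l A B ρ r) (hρ : 0 < ρ) {ε : ℝ} (hε : 0 < ε) :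
    ∃ η > 0, ∀ u, |u| < η → ∃ t, |t| < ε ∧ |t| < r ∧ A t = u ∧ (0 < u → 0 < t) := by
  have h1 := h.tendsto_slope 1
  simp only [one_mul, mul_one] at h1
  have hev := h1.eventually (lt_mem_nhds hρ)
  rw [eventually_nhdsWithin_iff] at hev
  obtain ⟨r₀, hr₀, hball⟩ := Metric.eventually_nhds_iff.1 hev
  set m := min (min r₀ r) ε / 2 with hm
  have hm0 : 0 < m := by
    have := lt_min (lt_min hr₀ hl.pos) hε
    positivity
  have hm1 : m < min (min r₀ r) ε := by rw [hm]; linarith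
  have ha : m < r₀ := hm1.trans_le ((min_le_left _ _).trans (min_le_left _ _))
  have hb : m < r := hm1.trans_le ((min_le_left _ _).trans (min_le_right _ _))
  have hc : m < ε := hm1.trans_le (min_le_right _ _)
  have hsign : ∀ t, |t| ≤ m → t ≠ 0 → 0 < A t / t := fun t ht ht0 =>
    hball (by rw [Real.dist_eq, sub_zero]; exact ht.trans_lt ha) ht0
  have hp : 0 < A m := by
    have := hsign m (by rw [abs_of_pos hm0]) hm0.ne'
    exact (div_pos_iff_of_pos_right hm0).1 this
  have hn : A (-m) < 0 := by
    have := hsign (-m) (by rw [abs_neg, abs_of_pos hm0]) (by linarith)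
    by_contra hcon
    push Not at hcon
    have := div_nonpos_of_nonneg_of_nonpos hcon (by linarith : -m ≤ 0)
    linarith
  refine ⟨min (A m) (-A (-m)), lt_min hp (by linarith), fun u hu => ?_⟩
  have hu1 : |u| < A m := hu.trans_le (min_le_left _ _)
  have hu2 : |u| < -A (-m) := hu.trans_le (min_le_right _ _)
  have hcont : ContinuousOn A (Set.Icc (-m) m) :=
    h.cont.mono fun t ht => ⟨by linarith [ht.1], by linarith [ht.2]⟩
  have hivt := intermediate_value_Icc (by linarith : -m ≤ m) hcont
  obtain ⟨t, ht, htu⟩ := hivt (show u ∈ Set.Icc (A (-m)) (A m) from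
    ⟨by linarith [neg_abs_le u], by linarith [le_abs_self u]⟩)
  have htm : |t| ≤ m := abs_le.2 ht
  refine ⟨t, htm.trans_lt hc, htm.trans_lt hb, htu, fun hpos => ?_⟩
  by_contra hcon
  push Not at hcon
  rcases hcon.eq_or_lt with h0 | h0
  · rw [h0, h.A0] at htu; linarith
  · have := hsign t htm h0.ne
    rw [htu] at this
    have := div_neg_of_pos_of_neg hpos h0
    linarith

lemma Curve.exists_below {S₁ S₂ : Set Plane} {τ v : Plane} {l A₁ B₁ A₂ B₂ : ℝ → ℝ} {ρ₁ ρ₂ r : ℝ}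
    (hv : 0 < om τ v) (hl : Slopes l r) (h₁ : Curve S₁ τ v l A₁ B₁ ρ₁ r)
    (h₂ : Curve S₂ τ v l A₂ B₂ ρ₂ r) (h0 : 0 ≤ ρ₂) (hρ : ρ₂ < ρ₁) :
    ∃ η > 0, ∀ w ∈ S₂, |cu τ v w| < η → cu τ v w ≠ 0 →
      ∃ b, b < ch τ v w ∧ cu τ v w • τ + b • v ∈ S₁ := by
  obtain ⟨r', hr', hle, h⟩ := Curve.line_lt hv hl h₁ h₂ h0 hρ
  obtain ⟨η, hη, hp⟩ := h₁.exists_param hl (by linarith) hr'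
  refine ⟨η, hη, fun w hw hwη hw0 => ?_⟩
  obtain ⟨t, ht, htr, hA, -⟩ := hp _ hwη
  have ht0 : t ≠ 0 := by rintro rfl; exact hw0 (by rw [← hA, h₁.A0])
  obtain ⟨b, hb, hline⟩ := h t ht ht0
  refine ⟨B₁ t, ?_, ?_⟩
  · have := hline w hw
    rw [hA, sub_self, mul_zero, add_zero] at this
    linarith
  · have := h₁.mem t (abs_lt.1 htr)
    rwa [hA] at this

/-- Short extremal chords in direction close to `τ` are close to the exposed point. -/
lemma low_thin {M : Set Plane} (hM : Body M) {o τ v : Plane} (ho : o ∈ M)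
    (hexp : ∀ k ∈ M, om τ (k - o) = 0 → k = o) (htan : Tan M o τ) {N : Set Plane}
    (hN : N ∈ nhds o) :
    ∃ δ > 0, ∀ a c : ℝ, 0 < a → a < δ → |c| < δ → ∀ q, Low M q (q + a • (τ + c • v)) → q ∈ N := by
  by_contra hcon
  push Not at hcon
  have hch : ∀ n : ℕ, ∃ z : (ℝ × ℝ) × Plane, 0 < z.1.1 ∧ z.1.1 < 1 / (n + 1 : ℝ) ∧
      |z.1.2| < 1 / (n + 1 : ℝ) ∧ Low M z.2 (z.2 + z.1.1 • (τ + z.1.2 • v)) ∧ z.2 ∉ N := by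
    intro n
    obtain ⟨a, c, h1, h2, h3, q, h4, h5⟩ := hcon (1 / (n + 1 : ℝ)) (by positivity)
    exact ⟨((a, c), q), h1, h2, h3, h4, h5⟩
  choose z hz1 hz2 hz3 hz4 hz5 using hch
  have hto : Filter.Tendsto (fun n : ℕ => 1 / (n + 1 : ℝ)) Filter.atTop (nhds 0) :=
    tendsto_one_div_add_atTop_nhds_zero_nat
  have ha : Filter.Tendsto (fun n => (z n).1.1) Filter.atTop (nhds 0) :=
    squeeze_zero (fun n => (hz1 n).le) (fun n => (hz2 n).le) hto
  have hc : Filter.Tendsto (fun n => (z n).1.2) Filter.atTop (nhds 0) :=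
    squeeze_zero_norm (fun n => (hz3 n).le) hto
  have hdir : Filter.Tendsto (fun n => τ + (z n).1.2 • v) Filter.atTop (nhds τ) := by
    simpa using (hc.smul_const v).const_add τ
  have hx : Filter.Tendsto (fun n => (z n).1.1 • (τ + (z n).1.2 • v)) Filter.atTop (nhds 0) := by
    simpa using ha.smul hdir
  have hq : Filter.Tendsto (fun n => (z n).2) Filter.atTop (nhds o) := by
    refine hM.comp.tendsto_nhds_of_unique_mapClusterPt
      (Filter.Eventually.of_forall fun n => (hz4 n).1) fun y hy hcl => ?_
    obtain ⟨φ, hφ, hlim⟩ := MapClusterPt.tendsto_subseq hcl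
    have hinter : ∀ k ∈ interior M, 0 ≤ om τ (k - y) := by
      intro k hk
      have hkx : Filter.Tendsto (fun n => k + (z n).1.1 • (τ + (z n).1.2 • v)) Filter.atTop
          (nhds k) := by simpa using hx.const_add k
      have hev := hkx.eventually (isOpen_interior.mem_nhds hk)
      have hev2 : ∀ᶠ n in Filter.atTop, 0 ≤ om (τ + (z n).1.2 • v) (k - (z n).2) := by
        filter_upwards [hev] with n hn
        have := (hz4 n).2.2 k (interior_subset hk) (by
          rw [add_sub_cancel_left]; exact interior_subset hn)
        rw [add_sub_cancel_left, om_smul_left] at this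
        exact nonneg_of_mul_nonneg_right this (hz1 n)
      have hlim2 : Filter.Tendsto (fun n => om (τ + (z (φ n)).1.2 • v) (k - (z (φ n)).2))
          Filter.atTop (nhds (om τ (k - y))) :=
        (hdir.comp hφ.tendsto_atTop).om (hlim.const_sub k)
      exact ge_of_tendsto hlim2 (hφ.tendsto_atTop.eventually hev2)
    have hall : 0 ≤ om τ (o - y) := by
      have ho' := ho
      rw [← hM.closure_interior] at ho'
      exact closure_minimal hinter (isClosed_le continuous_const
        (by fun_prop : Continuous fun k => om τ (k - y))) ho'
    have h1 := htan.2 y hy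
    rw [← neg_sub y o, om_neg_right] at hall
    exact hexp y hy (by linarith)
  obtain ⟨n, hn⟩ := (hq.eventually hN).exists
  exact hz5 n hn

lemma exists_slope {M : Set Plane} (hM : Body M) {p τ v : Plane} (hv : 0 < om τ v)
    (hp : p ∉ interior M) (hi : p + (1 / 2 : ℝ) • v ∈ interior M) : ∃ k : ℝ, Tan M p (τ + k • v) := by
  obtain ⟨t, ht⟩ := hM.exists_tan hp
  have h1 := ht.pos hi
  rw [add_sub_cancel_left, om_smul_right] at h1
  have h2 : 0 < om t v := by linarith
  have h3 := combo_cu_ch hv t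
  have hc : 0 < cu τ v t := div_pos h2 hv
  refine ⟨ch τ v t / cu τ v t, ?_, fun k hk => ?_⟩
  · intro h0
    have := congrArg (fun z => om z v) h0
    simp only [om_add_left, om_smul_left, om_self, om_zero_left] at this
    linarith
  · have h4 : t = cu τ v t • (τ + (ch τ v t / cu τ v t) • v) := by
      conv_lhs => rw [← h3]
      rw [smul_add, smul_smul, mul_div_cancel₀ _ hc.ne']
    have := ht.2 k hk
    rw [h4, om_smul_left] at this
    exact nonneg_of_mul_nonneg_right this hc

lemma exists_slope_top {M : Set Plane} (hM : Body M) {p τ v : Plane} (hv : 0 < om τ v)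
    (hp : p ∉ interior M) (hi : p - (1 / 2 : ℝ) • v ∈ interior M) :
    ∃ k : ℝ, Tan M p (-(τ + k • v)) := by
  obtain ⟨k, hk⟩ := exists_slope hM.neg (p := -p) hv
    (by rw [interior_neg_set]; simpa using hp) (by
      rw [interior_neg_set, Set.mem_neg]; convert hi using 1; abel)
  exact ⟨k, by rw [← tan_neg]; simpa using hk⟩

lemma Tan.slope {M : Set Plane} {p τ v : Plane} {k : ℝ} (hv : 0 < om τ v)
    (h : Tan M p (τ + k • v)) {z : Plane} (hz : z ∈ M) :
    k * cu τ v (z - p) ≤ ch τ v (z - p) := by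
  have := h.2 z hz
  rw [om_slope hv] at this
  have := nonneg_of_mul_nonneg_right this hv
  linarith

lemma Tan.slope_top {M : Set Plane} {p τ v : Plane} {k : ℝ} (hv : 0 < om τ v)
    (h : Tan M p (-(τ + k • v))) {z : Plane} (hz : z ∈ M) :
    k * cu τ v (p - z) ≤ ch τ v (p - z) := by
  have := h.2 z hz
  rw [om_neg_left, ← om_neg_right, neg_sub, om_slope hv] at this
  have := nonneg_of_mul_nonneg_right this hv
  linarith

lemma start_neg {a b lam B s h k : ℝ} (ha : 0 < a) (hO : B - lam * a ≤ 0)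
    (hE : B + lam * s ≤ h + b) (hk1 : k * a ≤ b) (hk2 : h ≤ k * s) (hb : b < B) : s < 0 := by
  by_contra hs
  push Not at hs
  have h1 : k < lam := by
    by_contra hcon
    push Not at hcon
    nlinarith [mul_le_mul_of_nonneg_right hcon ha.le]
  nlinarith [mul_le_mul_of_nonneg_right h1.le hs]

/-- The four supporting slopes of a thin inscribed parallelogram. -/
lemma thin_data {M : Set Plane} (hM : Body M) {o τ v : Plane} (hv : 0 < om τ v) (ho : o ∈ M)
    (hov : o + v ∈ M) (htan : Tan M o τ) (htan' : Tan M (o + v) (-τ))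
    (hexp : ∀ k ∈ M, om τ (k - o) = 0 → k = o)
    (hexp' : ∀ k ∈ M, om τ (k - (o + v)) = 0 → k = o + v)
    (hmid : o + (1 / 2 : ℝ) • v ∈ interior M) {η : ℝ} (hη : 0 < η) :
    ∃ δ > 0, ∀ a c : ℝ, 0 < a → a < δ → |c| < δ → Reg M (a • (τ + c • v)) →
      ∃ w₁ w₃ : Plane, ∃ k₁ k₃ k₄ : ℝ, lo M (a • (τ + c • v)) = o + w₁ ∧
        lo M (-(a • (τ + c • v))) = o + v - w₃ ∧ |cu τ v w₁| < η ∧ |cu τ v w₃| < η ∧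
        Tan M (o + w₁) (τ + k₁ • v) ∧ Tan M (o + v - w₃) (-(τ + k₃ • v)) ∧
        Tan M (o + v - w₃ - a • (τ + c • v)) (-(τ + k₄ • v)) := by
  obtain ⟨ε, hε, hball⟩ := Metric.isOpen_iff.1 isOpen_interior _ hmid
  have hN1 : {q : Plane | dist q o < ε ∧ |cu τ v (q - o)| < η} ∈ nhds o := by
    refine Filter.inter_mem (Metric.ball_mem_nhds o hε) ?_
    have : Continuous fun q : Plane => |cu τ v (q - o)| :=
      ((continuous_cu τ v).comp (by fun_prop : Continuous fun q : Plane => q - o)).abs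
    exact this.continuousAt.eventually (gt_mem_nhds (by simpa [cu_zero] using hη))
  have hN3 : {q : Plane | dist q (o + v) < ε / 2 ∧ |cu τ v (o + v - q)| < η} ∈ nhds (o + v) := by
    refine Filter.inter_mem (Metric.ball_mem_nhds _ (by positivity)) ?_
    have : Continuous fun q : Plane => |cu τ v (o + v - q)| :=
      ((continuous_cu τ v).comp (by fun_prop : Continuous fun q : Plane => o + v - q)).abs
    exact this.continuousAt.eventually (gt_mem_nhds (by simpa [cu_zero] using hη))
  obtain ⟨δ₁, hδ₁, h1⟩ := low_thin hM (v := v) ho hexp htan hN1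
  obtain ⟨δ₃, hδ₃, h3⟩ := low_thin hM (v := -v) hov
    (fun k hk h => hexp' k hk (by rw [om_neg_left] at h; linarith)) htan' hN3
  set C := ‖τ‖ + ‖v‖ + 1 with hC
  have hC0 : 0 < C := by positivity
  refine ⟨min (min δ₁ δ₃) (min 1 (ε / (2 * C))), by positivity, fun a c ha haδ hcδ hreg => ?_⟩
  have ha1 : a < δ₁ := haδ.trans_le ((min_le_left _ _).trans (min_le_left _ _))
  have ha3 : a < δ₃ := haδ.trans_le ((min_le_left _ _).trans (min_le_right _ _))
  have hc1 : |c| < δ₁ := hcδ.trans_le ((min_le_left _ _).trans (min_le_left _ _))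
  have hc3 : |c| < δ₃ := hcδ.trans_le ((min_le_left _ _).trans (min_le_right _ _))
  have hcc : |c| < 1 := hcδ.trans_le ((min_le_right _ _).trans (min_le_left _ _))
  have haε : a < ε / (2 * C) := haδ.trans_le ((min_le_right _ _).trans (min_le_right _ _))
  set x := a • (τ + c • v) with hx
  have hxn : ‖x‖ < ε / 2 := by
    rw [hx, norm_smul, Real.norm_of_nonneg ha.le]
    have h5 : ‖τ + c • v‖ ≤ C := by
      refine (norm_add_le _ _).trans ?_
      rw [norm_smul, Real.norm_eq_abs]
      nlinarith [norm_nonneg v, norm_nonneg τ]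
    calc a * ‖τ + c • v‖ ≤ a * C := by gcongr
      _ < ε / (2 * C) * C := by gcongr
      _ = ε / 2 := by field_simp
  have hp := hreg.para hM
  have hp' := hreg.neg.para hM
  obtain ⟨d1, e1⟩ := h1 a c ha ha1 hc1 _ hp.low1
  obtain ⟨d3, e3⟩ := h3 a c ha ha3 hc3 (lo M (-x)) (by
    have := hp'.low1
    convert this using 2
    rw [hx]; module)
  have i1 : lo M x + (1 / 2 : ℝ) • v ∈ interior M := by
    apply hball
    rw [Metric.mem_ball, dist_add_right]; exact d1
  have i3 : lo M (-x) - (1 / 2 : ℝ) • v ∈ interior M := by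
    apply hball
    rw [Metric.mem_ball, show lo M (-x) - (1 / 2 : ℝ) • v =
      lo M (-x) - (o + v) + (o + (1 / 2 : ℝ) • v) by module, dist_eq_norm, add_sub_cancel_right,
      ← dist_eq_norm]
    linarith
  have i4 : lo M (-x) - x - (1 / 2 : ℝ) • v ∈ interior M := by
    apply hball
    rw [Metric.mem_ball, show lo M (-x) - x - (1 / 2 : ℝ) • v =
      (lo M (-x) - (o + v)) - x + (o + (1 / 2 : ℝ) • v) by module, dist_eq_norm,
      add_sub_cancel_right]
    refine (norm_sub_le _ _).trans_lt ?_
    rw [← dist_eq_norm]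
    linarith
  obtain ⟨k₁, hk₁⟩ := exists_slope hM hv hp.ni i1
  obtain ⟨k₃, hk₃⟩ := exists_slope_top hM hv hp'.ni i3
  obtain ⟨k₄, hk₄⟩ := exists_slope_top hM hv
    (by have := hp'.nix; rwa [← sub_eq_add_neg] at this) i4
  refine ⟨lo M x - o, o + v - lo M (-x), k₁, k₃, k₄, by abel, by abel, e1, e3, ?_, ?_, ?_⟩
  · rwa [add_sub_cancel]
  · rwa [sub_sub_cancel]
  · rwa [sub_sub_cancel]

lemma om_slope_top {τ v : Plane} (k₁ k₃ : ℝ) :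
    om (τ + k₁ • v) (-(τ + k₃ • v)) = (k₁ - k₃) * om τ v := by
  simp only [om_neg_right, om_add_left, om_add_right, om_smul_left, om_smul_right, om_self]
  rw [om_comm v τ]; ring

lemma Curve.thin_params {S : Set Plane} {τ v : Plane} {l A B : ℝ → ℝ} {ρ r : ℝ}
    (hv : 0 < om τ v) (hl : Slopes l r) (h : Curve S τ v l A B ρ r) (h0 : (0 : Plane) ∈ S)
    {δ : ℝ} (hδ : 0 < δ) :
    ∃ ε > 0, ε ≤ r ∧ ∀ t, |t| < ε → 0 < A t →
      A t < δ ∧ |B t / A t| < δ ∧ 0 ≤ B t := by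
  have hA : Filter.Tendsto A (nhds 0) (nhds 0) := by
    have := h.deriv.continuousAt.tendsto; rwa [h.A0] at this
  have hL : Filter.Tendsto l (nhds 0) (nhds 0) := by
    have := hl.cont.tendsto; rwa [hl.zero] at this
  have ev := (hA.eventually (gt_mem_nhds hδ)).and (hL.eventually (gt_mem_nhds hδ))
  obtain ⟨ε, hε, hb⟩ := Metric.eventually_nhds_iff.1 ev
  refine ⟨min ε r, lt_min hε hl.pos, min_le_right _ _, fun t ht hAt => ?_⟩
  have htr : t ∈ Set.Ioo (-r) r := abs_lt.1 (ht.trans_le (min_le_right _ _))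
  obtain ⟨h1, h2⟩ := hb (y := t) (by
    rw [Real.dist_eq, sub_zero]; exact ht.trans_le (min_le_left _ _))
  have e1 := h.line t htr 0 h0
  rw [cu_zero, ch_zero] at e1
  have e2 := h.line 0 hl.zero_mem _ (h.mem t htr)
  rw [cu_combo hv, ch_combo hv, hl.zero, h.B0, zero_mul, add_zero] at e2
  refine ⟨h1, ?_, e2⟩
  rw [abs_of_nonneg (div_nonneg e2 hAt.le), div_lt_iff₀ hAt]
  nlinarith

set_option maxHeartbeats 2000000 in
theorem Twins.exists_not_sig {K L : Set Plane} (T : Twins K L) {o o' v τ : Plane}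
    (G : Good K o (o + v) τ) (o'L : o' ∈ L) (obL : o' + v ∈ L) (tL : Tan L o' τ)
    (tL' : Tan L (o' + v) (-τ)) (eL : ∀ k ∈ L, om τ (k - o') = 0 → k = o')
    (eL' : ∀ k ∈ L, om τ (k - (o' + v)) = 0 → k = o' + v)
    (midL : o' + (1 / 2 : ℝ) • v ∈ interior L) {l : ℝ → ℝ} {r : ℝ} (hl : Slopes l r)
    {A₁ B₁ A₃ B₃ A₁' B₁' A₃' B₃' : ℝ → ℝ} {ρ ρ' : ℝ}
    (C₁ : Curve {w | o + w ∈ K} τ v l A₁ B₁ ρ r)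
    (C₃ : Curve {w | o + v - w ∈ K} τ v l A₃ B₃ (1 - ρ) r)
    (C₁' : Curve {w | o' + w ∈ L} τ v l A₁' B₁' ρ' r)
    (C₃' : Curve {w | o' + v - w ∈ L} τ v l A₃' B₃' (1 - ρ') r)
    (h0 : 0 ≤ ρ') (hlt : ρ' < ρ) (h1 : ρ ≤ 1) (hb : ρ < 1 → Base K (o + v) o (-τ)) :
    ∃ q, Low K o q ∧ q ≠ o ∧ q ≠ o + v ∧ ¬ Sig K L (q - o) := by
  have hK := T.bK
  have hL := T.bL
  have hv : 0 < om τ v := by simpa using G.toBase.pos hK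
  have hρ : 0 < ρ := by linarith
  have midK : o + (1 / 2 : ℝ) • v ∈ interior K := by
    have := G.toBase.seg_interior hK (β := 1 / 2) (by norm_num) (by norm_num)
    rwa [add_sub_cancel_left] at this
  obtain ⟨η, hη, below3⟩ := Curve.exists_below hv hl C₃' C₃ (by linarith) (by linarith)
  obtain ⟨η₁, hη₁, below1⟩ := Curve.exists_below hv hl C₁ C₁' h0 hlt
  obtain ⟨r₁, hr₁, hr₁r, line1⟩ := Curve.line_lt hv hl C₁ C₁' h0 hlt
  obtain ⟨δK, hδK, dataK⟩ := thin_data hK hv G.mem G.memb G.tan G.tanb G.exposed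
    G.exposedb midK hη
  obtain ⟨δL, hδL, dataL⟩ := thin_data hL hv o'L obL tL tL' eL eL' midL hη₁
  have hδ : 0 < min δK δL := lt_min hδK hδL
  obtain ⟨ε₁, hε₁, hε₁r, par1⟩ := C₁.thin_params hv hl (by simpa using G.mem) hδ
  have hKface : ∀ k ∈ K, 0 ≤ ch τ v (k - o) := fun k hk => div_nonneg (G.tan.2 k hk) hv.le
  have hKtop : ∀ k ∈ K, 0 ≤ ch τ v (o + v - k) := fun k hk => by
    have := G.tanb.2 k hk
    rw [om_neg_left, ← om_neg_right, neg_sub] at this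
    exact div_nonneg this hv.le
  have hLtop : ∀ k ∈ L, 0 ≤ ch τ v (o' + v - k) := fun k hk => by
    have := tL'.2 k hk
    rw [om_neg_left, ← om_neg_right, neg_sub] at this
    exact div_nonneg this hv.le
  have hxeq : ∀ a b : ℝ, 0 < a → a • (τ + (b / a) • v) = a • τ + b • v := by
    intro a b ha
    rw [smul_add, smul_smul, mul_div_cancel₀ _ ha.ne']
  have hyLK : ∀ x, Reg K x → ∀ w₁ w₃ w₁' w₃', lo K x = o + w₁ → lo K (-x) = o + v - w₃ →
      lo L x = o' + w₁' → lo L (-x) = o' + v - w₃' → w₁ + w₃ = w₁' + w₃' := by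
    intro x hx w₁ w₃ w₁' w₃' e1 e3 e1' e3'
    have := T.yv_eq hx
    rw [yv, yv, e1, e3, e1', e3'] at this
    have h2 : (o' + v - w₃' - x - (o' + w₁')) - (o + v - w₃ - x - (o + w₁)) = 0 := by
      rw [this, sub_self]
    rw [← sub_eq_zero, ← h2]; abel
  -- the case where the lower boundary is flatter than the upper one
  have caseA : ∀ t, |t| < min ε₁ r₁ → t ≠ 0 → 0 < A₁ t → (∃ lam b, B₁ t < b ∧
      ∀ w, o + v - w ∈ K → b + lam * (cu τ v w - A₁ t) ≤ ch τ v w) →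
      ∃ q, Low K o q ∧ q ≠ o ∧ q ≠ o + v ∧ ¬ Sig K L (q - o) := by
    rintro t ht ht0 hAt ⟨lam, bb, hbb, hlam⟩
    obtain ⟨ha, hc, hB0⟩ := par1 t (ht.trans_le (min_le_left _ _)) hAt
    have htr : t ∈ Set.Ioo (-r) r := abs_lt.1 (ht.trans_le ((min_le_left _ _).trans hε₁r))
    set a := A₁ t with haA
    set b := B₁ t with hbB
    have hqK : o + (a • τ + b • v) ∈ K := C₁.mem t htr
    have hqn : o + (a • τ + b • v) ∉ interior K := by
      intro hi
      obtain ⟨s, hs, hsi⟩ := exists_pos_smul_interior hi (-v)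
      have h2 := interior_subset (hsi s (by rw [abs_of_pos hs]))
      have h3 := C₁.line t htr (a • τ + b • v + s • (-v)) (by
        change o + (a • τ + b • v + s • (-v)) ∈ K
        rw [← add_assoc]; exact h2)
      rw [show a • τ + b • v + s • (-v) = a • τ + (b - s) • v by module, cu_combo hv,
        ch_combo hv, ← haA, ← hbB] at h3
      simp at h3
      linarith
    set q := o + (a • τ + b • v) with hq
    have hqo : q - o = a • τ + b • v := by rw [hq]; abel
    have hom : 0 < om (q - o) (o + v - o) := by
      rw [hqo, add_sub_cancel_left, om_add_left, om_smul_left, om_smul_left, om_self]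
      have := mul_pos hAt hv
      linarith
    have n1 : q ≠ o := by intro h; rw [h] at hom; simp at hom
    have n2 : q ≠ o + v := by intro h; rw [h] at hom; simp at hom
    have hlow := (G.toBase.low_iff hK hqK hqn n1 n2).2 hom
    refine ⟨q, hlow, n1, n2, ?_⟩
    obtain ⟨hreg, hlo, -⟩ := G.ov_diag hK T.balK hlow n1 n2
    have hregL := T.reg hreg
    have hxx : q - o = a • (τ + (b / a) • v) := by rw [hqo, hxeq a b hAt]
    rw [hxx] at hreg hlo hregL ⊢
    obtain ⟨w₁, w₃, k₁, k₃, k₄, e1, e3, u1, u3, T1, T3, T4⟩ := dataK a (b / a) hAt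
      (ha.trans_le (min_le_left _ _)) (hc.trans_le (min_le_left _ _)) hreg
    obtain ⟨w₁', w₃', k₁', k₃', k₄', e1', e3', u1', u3', T1', T3', T4'⟩ := dataL a (b / a) hAt
      (ha.trans_le (min_le_right _ _)) (hc.trans_le (min_le_right _ _)) hregL
    have hw1 : w₁ = 0 := by rw [hlo] at e1; simpa using e1.symm
    have hsum := hyLK _ hreg w₁ w₃ w₁' w₃' e1 e3 e1' e3'
    rw [hw1, zero_add] at hsum
    set x := a • (τ + (b / a) • v) with hx
    have cux : cu τ v x = a := by rw [← hxx, hqo, cu_combo hv]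
    have chx : ch τ v x = b := by rw [← hxx, hqo, ch_combo hv]
    have hpK := hreg.para hK
    have hpL := hregL.para hL
    have p3K : lo K x + x + yv K x = lo K (-x) := by rw [yv]; abel
    have p3L : lo L x + x + yv L x = lo L (-x) := by rw [yv]; abel
    have p4K : lo K x + yv K x = lo K (-x) - x := by rw [yv]; abel
    have m3K : o + v - w₃ ∈ K := by rw [← e3, ← p3K]; exact hpK.memxy
    have m4K : o + v - w₃ - x ∈ K := by rw [← e3, ← p4K]; exact hpK.memy
    have m1L : o' + w₁' ∈ L := by rw [← e1']; exact hpL.mem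
    have m2L : o' + w₁' + x ∈ L := by rw [← e1']; exact hpL.memx
    -- the upper chord of `K` starts strictly on one side
    have f0 := hlam 0 (by simpa using G.memb)
    have f4 := hlam (w₃ + x) (by rw [← sub_sub]; exact m4K)
    have g0 := T3.slope_top hv G.memb
    have g4 := T3.slope_top hv m4K
    rw [show o + v - w₃ - (o + v) = -w₃ by abel, cu_neg, ch_neg] at g0
    rw [show o + v - w₃ - (o + v - w₃ - x) = x by abel, cux, chx] at g4
    rw [cu_zero, ch_zero] at f0
    rw [cu_add, ch_add, cux, chx] at f4
    have s2neg : cu τ v w₃ < 0 :=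
      start_neg (k := k₃) (h := ch τ v w₃) hAt (B := bb) (lam := lam) (b := b)
        (by linarith) (by linarith) g4 (by linarith) hbb
    have h2nn := hKtop _ m3K
    rw [sub_sub_cancel] at h2nn
    have k3neg : k₃ < 0 := by
      have hle : k₃ ≤ 0 := by
        by_contra hcon
        push Not at hcon
        nlinarith
      refine lt_of_le_of_ne hle fun hk0 => ?_
      rw [hk0] at g0
      have hch : ch τ v w₃ = 0 := by linarith
      have : o + v - w₃ = o + v := G.exposedb _ m3K (by
        rw [show o + v - w₃ - (o + v) = -w₃ by abel, om_neg_right]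
        have : om τ w₃ = ch τ v w₃ * om τ v := by rw [ch]; field_simp
        rw [this, hch]; simp)
      have hw3 : w₃ = 0 := by simpa using this
      rw [hw3, cu_zero] at s2neg
      exact lt_irrefl _ s2neg
    -- the lower chord of `L`
    obtain ⟨bL, hbL, lineL⟩ := line1 t (ht.trans_le (min_le_right _ _)) ht0
    have l0 := lineL 0 (by simpa using o'L)
    have l2 := lineL (w₁' + x) (by change o' + (w₁' + x) ∈ L; rw [← add_assoc]; exact m2L)
    have j0 := T1'.slope hv o'L
    have j2 := T1'.slope hv m2L
    rw [show o' - (o' + w₁') = -w₁' by abel, cu_neg, ch_neg] at j0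
    rw [add_sub_cancel_left, cux, chx] at j2
    rw [cu_zero, ch_zero] at l0
    rw [cu_add, ch_add, cux, chx] at l2
    have s1neg : cu τ v w₁' < 0 :=
      start_neg (k := k₁') (h := ch τ v w₁') hAt (B := bL) (lam := l t) (b := b)
        (by linarith) (by linarith) j2 (by linarith) hbL
    have hk : k₁' < k₃' := by
      by_contra hcon
      push Not at hcon
      obtain ⟨B, hB, hBm⟩ := below3 w₃ m3K u3 s2neg.ne
      have i3 := T3'.slope_top hv hBm
      rw [show o' + v - w₃' - (o' + v - (cu τ v w₃ • τ + B • v)) =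
        (cu τ v w₃ • τ + B • v) - w₃' by abel, cu_sub, ch_sub, cu_combo hv, ch_combo hv] at i3
      have hcu : cu τ v w₃ = cu τ v w₁' + cu τ v w₃' := by rw [hsum, cu_add]
      have hch : ch τ v w₃ = ch τ v w₁' + ch τ v w₃' := by rw [hsum, ch_add]
      rw [hcu, add_sub_cancel_right] at i3
      have := mul_le_mul_of_nonpos_right hcon s1neg.le
      linarith
    -- orientations of the diagonals
    have hd : Ov K (x + yv K x) := by
      have h5 := G.toBase.ov hK m3K (by
        intro h6
        have hw3 : w₃ = 0 := by simpa using h6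
        rw [hw3, cu_zero] at s2neg
        exact lt_irrefl _ s2neg)
      rw [← e3, ← p3K, hlo] at h5
      convert h5 using 1; abel
    have hdL : Ov L (x + yv L x) := by rw [T.yv_eq hreg]; exact (T.ov_iff _).1 hd
    rw [T.sig_iff hreg hd]
    have e3K : lo K x + (x + yv K x) = o + v - w₃ := by rw [← add_assoc, p3K, e3]
    have e3L : lo L x + (x + yv L x) = o' + v - w₃' := by rw [← add_assoc, p3L, e3']
    have dK := hpK.diag_tan hd (t₁ := τ + (0:ℝ) • v) (t₃ := -(τ + k₃ • v))
      (by rw [hlo]; simpa using G.tan) (by rw [e3K]; exact T3)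
    have dL := hpL.diag_tan hdL (t₁ := τ + k₁' • v) (t₃ := -(τ + k₃' • v))
      (by rw [e1']; exact T1') (by rw [e3L]; exact T3')
    rw [om_slope_top] at dK dL
    have hsK : s13 K x := dK.2.2 (mul_pos (by linarith) hv)
    have hsL : ¬ s13 L x := by
      intro hs
      have := dL.2.1 hs
      nlinarith
    tauto
  -- choice of a small parameter
  have htends := C₁.tendsto_slope 1
  simp only [one_mul, mul_one] at htends
  have hevp := htends.eventually (lt_mem_nhds hρ)
  rw [eventually_nhdsWithin_iff] at hevp
  obtain ⟨ε₂, hε₂, hpos⟩ := Metric.eventually_nhds_iff.1 hevp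
  have hApos : ∀ t, 0 < t → t < ε₂ → 0 < A₁ t := by
    intro t ht ht2
    have h3 := hpos (y := t) (by rw [Real.dist_eq, sub_zero, abs_of_pos ht]; exact ht2) ht.ne'
    exact (div_pos_iff_of_pos_right ht).1 h3
  rcases lt_or_ge (1 / 2) ρ with hhalf | hhalf
  · obtain ⟨r₃, hr₃, hr₃r, line3⟩ := Curve.line_lt hv hl C₁ C₃ (by linarith) (by linarith)
    set t := min (min ε₁ r₁) (min ε₂ r₃) / 2 with ht
    have htm : 0 < min (min ε₁ r₁) (min ε₂ r₃) := lt_min (lt_min hε₁ hr₁) (lt_min hε₂ hr₃)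
    have ht0 : 0 < t := by positivity
    have htlt : t < min (min ε₁ r₁) (min ε₂ r₃) := by linarith
    obtain ⟨b, hb1, hb2⟩ := line3 t (by
      rw [abs_of_pos ht0]; exact htlt.trans_le ((min_le_right _ _).trans (min_le_right _ _))) ht0.ne'
    exact caseA t (by rw [abs_of_pos ht0]; exact htlt.trans_le (min_le_left _ _)) ht0.ne'
      (hApos t ht0 (htlt.trans_le ((min_le_right _ _).trans (min_le_left _ _)))) ⟨l t, b, hb1, hb2⟩
  · have hbase := hb (by linarith)
    obtain ⟨ε₃, hε₃, hε₃r, par3⟩ := C₃.thin_params hv hl (by simpa using G.memb) hδ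
    obtain ⟨η₃, hη₃, param3⟩ := C₃.exists_param hl (by linarith) hε₃
    have hA0 : Filter.Tendsto A₁ (nhds 0) (nhds 0) := by
      have := C₁.deriv.continuousAt.tendsto; rwa [C₁.A0] at this
    obtain ⟨ε₄, hε₄, hsmall⟩ := Metric.eventually_nhds_iff.1
      (hA0.eventually (gt_mem_nhds (lt_min hη₃ hη)))
    set t := min (min ε₁ r₁) (min ε₂ ε₄) / 2 with ht
    have htm : 0 < min (min ε₁ r₁) (min ε₂ ε₄) := lt_min (lt_min hε₁ hr₁) (lt_min hε₂ hε₄)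
    have ht0 : 0 < t := by positivity
    have htlt : t < min (min ε₁ r₁) (min ε₂ ε₄) := by linarith
    have ht1 : |t| < min ε₁ r₁ := by rw [abs_of_pos ht0]; exact htlt.trans_le (min_le_left _ _)
    have htr : t ∈ Set.Ioo (-r) r := abs_lt.1 (ht1.trans_le ((min_le_left _ _).trans hε₁r))
    have hAt := hApos t ht0 (htlt.trans_le ((min_le_right _ _).trans (min_le_left _ _)))
    have hAs := hsmall (y := t) (by
      rw [Real.dist_eq, sub_zero, abs_of_pos ht0]
      exact htlt.trans_le ((min_le_right _ _).trans (min_le_right _ _)))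
    obtain ⟨t', ht'ε, ht'r, hAA, -⟩ := param3 (A₁ t) (by
      rw [abs_of_pos hAt]; exact hAs.trans_le (min_le_left _ _))
    have ht'm : t' ∈ Set.Ioo (-r) r := abs_lt.1 ht'r
    rcases lt_or_ge (B₁ t) (B₃ t') with hBB | hBB
    · refine caseA t ht1 ht0.ne' hAt ⟨l t', B₃ t', hBB, fun w hw => ?_⟩
      rw [← hAA]
      exact C₃.line t' ht'm w hw
    exfalso
    obtain ⟨ha, hc, hb0⟩ := par3 t' ht'ε (by rw [hAA]; exact hAt)
    have hxS := C₃.mem t' ht'm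
    have hline3 := C₃.line t' ht'm
    rw [hAA] at ha hc hxS hline3
    set a := A₁ t with haA
    set b := B₃ t' with hbB
    have hxx : a • τ + b • v = a • (τ + (b / a) • v) := (hxeq a b hAt).symm
    set x := a • τ + b • v with hx
    have cux : cu τ v x = a := cu_combo hv a b
    have chx : ch τ v x = b := ch_combo hv a b
    have hqK : o + v - x ∈ K := hxS
    have hqn : o + v - x ∉ interior K := by
      intro hi
      obtain ⟨s, hs, hsi⟩ := exists_pos_smul_interior hi v
      have h2 := interior_subset (hsi s (by rw [abs_of_pos hs]))
      have h3 := hline3 (x - s • v) (by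
        change o + v - (x - s • v) ∈ K
        convert h2 using 1; abel)
      rw [show x - s • v = a • τ + (b - s) • v by rw [hx]; module, cu_combo hv, ch_combo hv] at h3
      simp at h3
      linarith
    have hqd : o + v - x - (o + v) = -x := by abel
    have hom : 0 < om (o + v - x - (o + v)) (o - (o + v)) := by
      rw [hqd, show o - (o + v) = -v by abel, om_neg_left, om_neg_right, neg_neg, hx, om_add_left,
        om_smul_left, om_smul_left, om_self]
      have := mul_pos hAt hv
      linarith
    have n1 : o + v - x ≠ o + v := by intro h; rw [h] at hom; simp at hom
    have n2 : o + v - x ≠ o := by intro h; rw [h] at hom; simp at hom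
    have hlow := (hbase.low_iff hK hqK hqn n1 n2).2 hom
    have hregn := hbase.reg hK T.balK hqK hqn n1 n2
    rw [hqd] at hregn
    have hlo : lo K (-x) = o + v := lo_eq hK hregn.ne hregn.edge (by
      convert hlow using 1; abel)
    have hreg : Reg K x := by simpa using hregn.neg
    have hregL := T.reg hreg
    rw [hxx] at hreg hregL hlo
    obtain ⟨w₁, w₃, k₁, k₃, k₄, e1, e3, u1, u3, T1, T3, T4⟩ := dataK a (b / a) hAt
      (ha.trans_le (min_le_left _ _)) (hc.trans_le (min_le_left _ _)) hreg
    obtain ⟨w₁', w₃', k₁', k₃', k₄', e1', e3', u1', u3', T1', T3', T4'⟩ := dataL a (b / a) hAt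
      (ha.trans_le (min_le_right _ _)) (hc.trans_le (min_le_right _ _)) hregL
    have hw3 : w₃ = 0 := by rw [hlo] at e3; simpa using e3.symm
    have hsum := hyLK _ hreg w₁ w₃ w₁' w₃' e1 e3 e1' e3'
    rw [hw3, add_zero] at hsum
    rw [← hxx] at hreg hregL e1 e1' e3' T4'
    have hpK := hreg.para hK
    have hpL := hregL.para hL
    have p3L : lo L x + x + yv L x = lo L (-x) := by rw [yv]; abel
    have m1K : o + w₁ ∈ K := by rw [← e1]; exact hpK.mem
    have m2K : o + w₁ + x ∈ K := by rw [← e1]; exact hpK.memx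
    have m1L : o' + w₁' ∈ L := by rw [← e1']; exact hpL.mem
    have m2L : o' + w₁' + x ∈ L := by rw [← e1']; exact hpL.memx
    have m3L : o' + v - w₃' ∈ L := by rw [← e3', ← p3L]; exact hpL.memxy
    have hcu : cu τ v w₁ = cu τ v w₁' + cu τ v w₃' := by rw [hsum, cu_add]
    have hch : ch τ v w₁ = ch τ v w₁' + ch τ v w₃' := by rw [hsum, ch_add]
    have hh0 := hKface _ m1K
    rw [add_sub_cancel_left] at hh0
    have hg0 := hLtop _ m3L
    rw [sub_sub_cancel] at hg0
    have i0 := T1.slope hv G.mem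
    have i2 := T1.slope hv m2K
    rw [show o - (o + w₁) = -w₁ by abel, cu_neg, ch_neg] at i0
    rw [add_sub_cancel_left, cux, chx] at i2
    have m0 := C₁.line t htr 0 (by simpa using G.mem)
    have m2 := C₁.line t htr (w₁ + x) (by change o + (w₁ + x) ∈ K; rw [← add_assoc]; exact m2K)
    rw [cu_zero, ch_zero, ← haA] at m0
    rw [cu_add, ch_add, cux, chx, ← haA, add_sub_cancel_right] at m2
    have hs : cu τ v w₁ ≤ 0 := by
      by_contra hcon
      push Not at hcon
      have h2 : k₁ ≤ l t := by
        have : k₁ * a ≤ l t * a := by linarith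
        exact le_of_mul_le_mul_right this hAt
      have h3 := mul_le_mul_of_nonneg_right h2 hcon.le
      have h4 : k₁ * cu τ v w₁ = l t * cu τ v w₁ := by linarith
      have h5 : k₁ = l t := mul_right_cancel₀ hcon.ne' h4
      rw [h5] at i2 i0
      have h6 : B₁ t = l t * a := by linarith
      have h7 : Tan K o (τ + l t • v) := by
        refine ⟨?_, fun k hk => ?_⟩
        · intro h8
          have := congrArg (fun z => om z v) h8
          simp only [om_add_left, om_smul_left, om_self, om_zero_left] at this
          linarith
        · rw [om_slope hv]
          have h8 := C₁.line t htr (k - o) (by change o + (k - o) ∈ K; rwa [add_sub_cancel])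
          rw [← haA, h6] at h8
          exact mul_nonneg hv.le (by linarith)
      obtain ⟨c, hc, hce⟩ := G.smooth.exists_pos hK G.tan h7
      have h9 := congrArg (fun z => om τ z) hce
      simp only [om_add_right, om_smul_right, om_self] at h9
      have h10 : l t * om τ v = 0 := by linarith
      rcases mul_eq_zero.1 h10 with h11 | h11
      · exact hl.ne t htr ht0.ne' h11
      · exact hv.ne' h11
    obtain ⟨bL, hbL, lineL⟩ := line1 t (ht1.trans_le (min_le_right _ _)) ht0.ne'
    have l0 := lineL 0 (by simpa using o'L)
    have l2 := lineL (w₁' + x) (by change o' + (w₁' + x) ∈ L; rw [← add_assoc]; exact m2L)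
    have j0 := T1'.slope hv o'L
    have j2 := T1'.slope hv m2L
    rw [show o' - (o' + w₁') = -w₁' by abel, cu_neg, ch_neg] at j0
    rw [add_sub_cancel_left, cux, chx] at j2
    rw [cu_zero, ch_zero, ← haA] at l0
    rw [cu_add, ch_add, cux, chx, ← haA, add_sub_cancel_right] at l2
    have s1neg : cu τ v w₁' < 0 :=
      start_neg (k := k₁') (h := ch τ v w₁') hAt (B := bL) (lam := l t) (b := b)
        (by linarith) (by linarith) j2 (by linarith) (by linarith)
    have s2pos : 0 < cu τ v w₃' := by
      by_contra hcon
      push Not at hcon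
      obtain ⟨B, hB, hBm⟩ := below3 x hxS (by
        rw [cux, abs_of_pos hAt]; exact hAs.trans_le (min_le_right _ _)) (by rw [cux]; exact hAt.ne')
      rw [cux] at hBm
      rw [chx] at hB
      have q0 := T4'.slope_top hv m3L
      have q1 := T4'.slope_top hv hBm
      rw [show o' + v - w₃' - x - (o' + v - w₃') = -x by abel, cu_neg, ch_neg, cux, chx] at q0
      rw [show o' + v - w₃' - x - (o' + v - (a • τ + B • v)) = (a • τ + B • v) - w₃' - x by abel,
        cu_sub, cu_sub, ch_sub, ch_sub, cu_combo hv, ch_combo hv, cux, chx] at q1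
      have q2 : 0 ≤ k₄' := by
        have : 0 ≤ k₄' * a := by linarith
        exact nonneg_of_mul_nonneg_left this hAt
      have q3 := mul_nonneg q2 (neg_nonneg.2 hcon)
      linarith
    obtain ⟨B, hB, hBm⟩ := below1 w₁' m1L u1' s1neg.ne
    have hBm' : o + (cu τ v w₁' • τ + B • v) ∈ K := hBm
    have hB0 := hKface _ hBm'
    rw [add_sub_cancel_left, ch_combo hv] at hB0
    have q1 := T1.slope hv hBm'
    rw [show o + (cu τ v w₁' • τ + B • v) - (o + w₁) = (cu τ v w₁' • τ + B • v) - w₁ by abel,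
      cu_sub, ch_sub, cu_combo hv, ch_combo hv] at q1
    rcases le_or_gt k₁ 0 with hk | hk
    · have := mul_nonneg_of_nonpos_of_nonpos hk
        (by linarith : cu τ v w₁' - cu τ v w₁ ≤ 0)
      linarith
    · have := mul_nonpos_of_nonneg_of_nonpos hk.le hs
      linarith


/-- The direction of slope `c`. -/
noncomputable def dir (c : ℝ) : Plane := !₂[1, c]

lemma dir_zero (c : ℝ) : dir c 0 = 1 := rfl
lemma dir_one (c : ℝ) : dir c 1 = c := rfl

lemma om_dir (c : ℝ) (z : Plane) : om (dir c) z = z 1 - c * z 0 := by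
  simp [om, dir_zero, dir_one]

lemma dir_ne_zero (c : ℝ) : dir c ≠ 0 := by
  intro h
  have := congrArg (fun z : Plane => z 0) h
  simp [dir_zero] at this

lemma plane_ext {x y : Plane} (h0 : x 0 = y 0) (h1 : x 1 = y 1) : x = y := by
  ext i; fin_cases i <;> assumption

lemma tan_dir_iff {K : Set Plane} {p : Plane} {c : ℝ} :
    Tan K p (dir c) ↔ ∀ k ∈ K, c * (k 0 - p 0) ≤ k 1 - p 1 := by
  simp only [Tan, om_dir, ne_eq, dir_ne_zero, not_false_eq_true, true_and]
  refine forall₂_congr fun k _ => ?_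
  simp

lemma tan_neg_dir_iff {K : Set Plane} {p : Plane} {c : ℝ} :
    Tan K p (-dir c) ↔ ∀ k ∈ K, k 1 - p 1 ≤ c * (k 0 - p 0) := by
  simp only [Tan, om_neg_left, om_dir, ne_eq, neg_eq_zero, dir_ne_zero, not_false_eq_true, true_and]
  refine forall₂_congr fun k _ => ?_
  simp

/-- The lower boundary of the difference body of `K`, with slopes of supporting lines. -/
structure Floor (K : Set Plane) (w : ℝ) (δ κ : ℝ → ℝ) : Prop where
  pos : 0 < w
  mem : ∀ s ∈ Set.Ioo (-w) w, ∃ x ∈ K, ∃ y ∈ K, x 0 - y 0 = s ∧ x 1 - y 1 = δ s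
  line : ∀ s ∈ Set.Ioo (-w) w, ∀ x ∈ K, ∀ y ∈ K, δ s + κ s * (x 0 - y 0 - s) ≤ x 1 - y 1
  wide : ∀ x ∈ K, ∀ y ∈ K, x 0 - y 0 ≤ w
  attained : ∃ x ∈ K, ∃ y ∈ K, x 0 - y 0 = w

lemma Body.exists_floor {K : Set Plane} (hK : Body K) : ∃ w δ κ, Floor K w δ κ := by
  have c0 : Continuous fun x : Plane => x 0 := by fun_prop
  have c1 : Continuous fun x : Plane => x 1 := by fun_prop
  obtain ⟨xM, hxM, hM⟩ := hK.comp.exists_isMaxOn hK.nonempty c0.continuousOn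
  obtain ⟨xm, hxm, hm⟩ := hK.comp.exists_isMinOn hK.nonempty c0.continuousOn
  have hM' : ∀ k ∈ K, k 0 ≤ xM 0 := fun k hk => hM hk
  have hm' : ∀ k ∈ K, xm 0 ≤ k 0 := fun k hk => hm hk
  set w := xM 0 - xm 0 with hw
  have hwpos : 0 < w := by
    obtain ⟨k, hk⟩ := hK.int
    obtain ⟨ε, hε, h⟩ := exists_pos_smul_interior hk (dir 0)
    have h1 := hM' _ (interior_subset (h ε (by rw [abs_of_pos hε])))
    have h2 := hm' k (interior_subset hk)
    simp [dir_zero] at h1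
    linarith
  set D : Set Plane := K + -K with hD
  have hDmem : ∀ z, z ∈ D ↔ ∃ x ∈ K, ∃ y ∈ K, z = x - y := by
    intro z
    rw [hD, Set.mem_add]
    constructor
    · rintro ⟨x, hx, y, hy, rfl⟩; exact ⟨x, hx, -y, hy, by abel⟩
    · rintro ⟨x, hx, y, hy, rfl⟩; exact ⟨x, hx, -y, by simpa using hy, by abel⟩
  have hDB : Body D := by
    refine ⟨hK.comp.add hK.comp.neg, hK.conv.add hK.conv.neg, ?_⟩
    obtain ⟨k, hk⟩ := hK.int
    exact ⟨k + -xm, subset_interior_add_left (Set.add_mem_add hk (by simpa using hxm))⟩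
  have hdM : xM - xm ∈ D := (hDmem _).2 ⟨_, hxM, _, hxm, rfl⟩
  have hdm : xm - xM ∈ D := (hDmem _).2 ⟨_, hxm, _, hxM, rfl⟩
  have key : ∀ s ∈ Set.Ioo (-w) w, ∃ d c : ℝ, (∃ x ∈ K, ∃ y ∈ K, x 0 - y 0 = s ∧ x 1 - y 1 = d) ∧
      ∀ x ∈ K, ∀ y ∈ K, d + c * (x 0 - y 0 - s) ≤ x 1 - y 1 := by
    intro s hs
    have hinter : ∃ k ∈ interior D, k 0 = s := by
      obtain ⟨c, hc⟩ := hDB.int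
      obtain ⟨x, hx, y, hy, hxy⟩ := (hDmem c).1 (interior_subset hc)
      have e0 : c 0 = x 0 - y 0 := by rw [hxy]; simp
      rcases le_or_gt (c 0) s with h | h
      · have hlt : 0 < w - c 0 := by linarith [hs.2]
        refine ⟨_, hDB.combo_mem_interior hdM hc (ε := (w - s) / (w - c 0))
          (div_pos (by linarith [hs.2]) hlt) ((div_le_one hlt).2 (by linarith)), ?_⟩
        simp only [PiLp.add_apply, PiLp.smul_apply, PiLp.sub_apply, smul_eq_mul, ← hw]
        field_simp
        ring
      · have hlt : 0 < c 0 + w := by linarith [hs.1]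
        refine ⟨_, hDB.combo_mem_interior hdm hc (ε := (s + w) / (c 0 + w))
          (div_pos (by linarith [hs.1]) hlt) ((div_le_one hlt).2 (by linarith)), ?_⟩
        simp only [PiLp.add_apply, PiLp.smul_apply, PiLp.sub_apply, smul_eq_mul]
        rw [show xm 0 - xM 0 = -w by rw [hw]; ring, sub_neg_eq_add]
        field_simp
        ring
    obtain ⟨k, hk, hks⟩ := hinter
    have hcl : IsCompact (D ∩ {z : Plane | z 0 = s}) :=
      hDB.comp.inter_right (isClosed_eq c0 continuous_const)
    obtain ⟨z, ⟨hz, hzs⟩, hzmin⟩ := hcl.exists_isMinOn ⟨k, interior_subset hk, hks⟩ c1.continuousOn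
    have hzs' : z 0 = s := hzs
    have hzmin' : ∀ d ∈ D, d 0 = s → z 1 ≤ d 1 := fun d hd hds => hzmin ⟨hd, hds⟩
    have hni : z ∉ interior D := by
      intro hi
      obtain ⟨ε, hε, h⟩ := exists_pos_smul_interior hi (!₂[0, 1] : Plane)
      have h1 := hzmin' _ (interior_subset (h (-ε) (by rw [abs_neg, abs_of_pos hε])))
        (by simp [hzs'])
      simp at h1
      linarith
    obtain ⟨τ, hτ⟩ := hDB.exists_tan hni
    have h1 := hτ.pos hk
    have h2 := hzmin' k (interior_subset hk) hks
    simp only [om, PiLp.sub_apply, hks, hzs', sub_self, mul_zero, sub_zero] at h1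
    have hτ0 : 0 < τ 0 := pos_of_mul_pos_left h1 (by linarith)
    obtain ⟨x, hx, y, hy, hxy⟩ := (hDmem z).1 hz
    refine ⟨z 1, τ 1 / τ 0, ⟨x, hx, y, hy, by rw [← hzs', hxy]; simp, by rw [hxy]; simp⟩, ?_⟩
    intro x' hx' y' hy'
    have h3 := hτ.2 (x' - y') ((hDmem _).2 ⟨_, hx', _, hy', rfl⟩)
    simp only [om, PiLp.sub_apply, hzs'] at h3
    have h4 : τ 1 / τ 0 * (x' 0 - y' 0 - s) ≤ x' 1 - y' 1 - z 1 := by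
      rw [div_mul_eq_mul_div, div_le_iff₀ hτ0]; linarith
    linarith
  choose! δ κ h1 h2 using key
  exact ⟨w, δ, κ, hwpos, h1, h2, fun x hx y hy => by linarith [hM' x hx, hm' y hy],
    xM, hxM, xm, hxm, rfl⟩

lemma Floor.transfer {K L : Set Plane} (h : ∀ p ∈ K, ∀ q ∈ K, ∃ p' ∈ L, p' + (q - p) ∈ L)
    (h' : ∀ p ∈ L, ∀ q ∈ L, ∃ p' ∈ K, p' + (q - p) ∈ K)
    {w : ℝ} {δ κ : ℝ → ℝ} (F : Floor K w δ κ) : Floor L w δ κ where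
  pos := F.pos
  mem := by
    intro s hs
    obtain ⟨x, hx, y, hy, e0, e1⟩ := F.mem s hs
    obtain ⟨p, hp, hp'⟩ := h y hy x hx
    exact ⟨_, hp', p, hp, by simpa using e0, by simpa using e1⟩
  line := by
    intro s hs x hx y hy
    obtain ⟨p, hp, hp'⟩ := h' y hy x hx
    simpa using F.line s hs _ hp' p hp
  wide := by
    intro x hx y hy
    obtain ⟨p, hp, hp'⟩ := h' y hy x hx
    simpa using F.wide _ hp' p hp
  attained := by
    obtain ⟨x, hx, y, hy, e⟩ := F.attained
    obtain ⟨p, hp, hp'⟩ := h y hy x hx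
    exact ⟨_, hp', p, hp, by simpa using e⟩

lemma Floor.mono {K : Set Plane} {w : ℝ} {δ κ : ℝ → ℝ} (F : Floor K w δ κ) :
    MonotoneOn κ (Set.Ioo (-w) w) := by
  intro s hs t ht hst
  rcases hst.eq_or_lt with rfl | hlt
  · exact le_rfl
  obtain ⟨x, hx, y, hy, e0, e1⟩ := F.mem s hs
  obtain ⟨x', hx', y', hy', e0', e1'⟩ := F.mem t ht
  have h1 := F.line s hs x' hx' y' hy'
  have h2 := F.line t ht x hx y hy
  rw [e0', e1'] at h1
  rw [e0, e1] at h2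
  by_contra hcon
  push Not at hcon
  nlinarith

/-- Pairs of antipodal boundary points of `K` realizing the lower boundary of the
difference body. -/
structure Chart (K : Set Plane) (w : ℝ) (κ : ℝ → ℝ) (p q : ℝ → Plane) : Prop where
  memp : ∀ s ∈ Set.Ioo (-w) w, p s ∈ K
  memq : ∀ s ∈ Set.Ioo (-w) w, q s ∈ K
  sub : ∀ s ∈ Set.Ioo (-w) w, p s 0 - q s 0 = s
  tanp : ∀ s ∈ Set.Ioo (-w) w, ∀ k ∈ K, κ s * (k 0 - p s 0) ≤ k 1 - p s 1
  tanq : ∀ s ∈ Set.Ioo (-w) w, ∀ k ∈ K, k 1 - q s 1 ≤ κ s * (k 0 - q s 0)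
  monop : ∀ s ∈ Set.Ioo (-w) w, ∀ t ∈ Set.Ioo (-w) w, s ≤ t → p s 0 ≤ p t 0
  monoq : ∀ s ∈ Set.Ioo (-w) w, ∀ t ∈ Set.Ioo (-w) w, s ≤ t → q t 0 ≤ q s 0

lemma Chart.neg {K : Set Plane} {w : ℝ} {κ : ℝ → ℝ} {p q : ℝ → Plane} (C : Chart K w κ p q) :
    Chart (-K) w κ (fun s => - q s) (fun s => - p s) where
  memp := fun s hs => by simpa using C.memq s hs
  memq := fun s hs => by simpa using C.memp s hs
  sub := fun s hs => by have := C.sub s hs; simp; linarith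
  tanp := fun s hs k hk => by
    have := C.tanq s hs (-k) hk
    simp at this ⊢
    linarith
  tanq := fun s hs k hk => by
    have := C.tanp s hs (-k) hk
    simp at this ⊢
    linarith
  monop := fun s hs t ht h => by simpa using C.monoq s hs t ht h
  monoq := fun s hs t ht h => by simpa using C.monop s hs t ht h

lemma convex_coord {K : Set Plane} (hK : Convex ℝ K) {x y z : Plane} {c : ℝ} (hx : x ∈ K)
    (hy : y ∈ K) (h1 : x 0 ≤ z 0) (h2 : z 0 ≤ y 0) (hxy : y 1 - x 1 = c * (y 0 - x 0))
    (hz : z 1 - x 1 = c * (z 0 - x 0)) : z ∈ K := by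
  rcases (h1.trans h2).eq_or_lt with h0 | h0
  · have : z 0 = x 0 := by linarith
    have hzx : z = x := plane_ext this (by rw [this, sub_self, mul_zero] at hz; linarith)
    rwa [hzx]
  have hpos : 0 < y 0 - x 0 := by linarith
  have := hK hx hy (a := (y 0 - z 0) / (y 0 - x 0)) (b := (z 0 - x 0) / (y 0 - x 0))
    (div_nonneg (by linarith) hpos.le) (div_nonneg (by linarith) hpos.le) (by field_simp; ring)
  convert this using 1
  have hz' : z 1 = x 1 + c * (z 0 - x 0) := by linarith
  have hy' : y 1 = x 1 + c * (y 0 - x 0) := by linarith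
  apply plane_ext
  · simp only [PiLp.add_apply, PiLp.smul_apply, smul_eq_mul]; field_simp; ring
  · simp only [PiLp.add_apply, PiLp.smul_apply, smul_eq_mul]; rw [hz', hy']; field_simp; ring

lemma Floor.exists_chart {K : Set Plane} (hK : Body K) {w : ℝ} {δ κ : ℝ → ℝ}
    (F : Floor K w δ κ) : ∃ p q, Chart K w κ p q ∧
      (∀ s ∈ Set.Ioo (-w) w, p s 1 - q s 1 = δ s) ∧
      ∀ s ∈ Set.Ioo (-w) w, ∀ x ∈ K, ∀ y ∈ K, x 0 - y 0 = s → x 1 - y 1 = δ s → x 0 ≤ p s 0 := by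
  have key : ∀ s ∈ Set.Ioo (-w) w, ∃ x y : Plane, x ∈ K ∧ y ∈ K ∧ x 0 - y 0 = s ∧
      x 1 - y 1 = δ s ∧ ∀ x' ∈ K, ∀ y' ∈ K, x' 0 - y' 0 = s → x' 1 - y' 1 = δ s → x' 0 ≤ x 0 := by
    intro s hs
    have hcl : IsCompact ((K ×ˢ K) ∩ {z : Plane × Plane | z.1 0 - z.2 0 = s ∧ z.1 1 - z.2 1 = δ s}) := by
      refine (hK.comp.prod hK.comp).inter_right ?_
      exact (isClosed_eq (by fun_prop) continuous_const).inter
        (isClosed_eq (by fun_prop) continuous_const)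
    obtain ⟨x, hx, y, hy, e0, e1⟩ := F.mem s hs
    obtain ⟨z, ⟨⟨h1, h2⟩, h3, h4⟩, hmax⟩ := hcl.exists_isMaxOn ⟨(x, y), ⟨hx, hy⟩, e0, e1⟩
      (by fun_prop : Continuous fun z : Plane × Plane => z.1 0).continuousOn
    exact ⟨z.1, z.2, h1, h2, h3, h4, fun x' hx' y' hy' a b =>
      hmax (show (x', y') ∈ _ from ⟨⟨hx', hy'⟩, a, b⟩)⟩
  choose! p q hp hq h0 h1 hmax using key
  have tp : ∀ s ∈ Set.Ioo (-w) w, ∀ k ∈ K, κ s * (k 0 - p s 0) ≤ k 1 - p s 1 := by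
    intro s hs k hk
    have := F.line s hs k hk (q s) (hq s hs)
    have e0 := h0 s hs
    have e1 := h1 s hs
    rw [show k 0 - q s 0 - s = k 0 - p s 0 by linarith] at this
    linarith
  have tq : ∀ s ∈ Set.Ioo (-w) w, ∀ k ∈ K, k 1 - q s 1 ≤ κ s * (k 0 - q s 0) := by
    intro s hs k hk
    have := F.line s hs (p s) (hp s hs) k hk
    have e0 := h0 s hs
    have e1 := h1 s hs
    rw [show p s 0 - k 0 - s = -(k 0 - q s 0) by linarith] at this
    linarith
  have mono : ∀ s ∈ Set.Ioo (-w) w, ∀ t ∈ Set.Ioo (-w) w, s ≤ t →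
      p s 0 ≤ p t 0 ∧ q t 0 ≤ q s 0 := by
    intro s hs t ht hst
    have u0 := h0 s hs
    have u1 := h1 s hs
    have v0 := h0 t ht
    have v1 := h1 t ht
    have a1 := tp s hs _ (hp t ht)
    have a2 := tp t ht _ (hp s hs)
    have b1 := tq s hs _ (hq t ht)
    have b2 := tq t ht _ (hq s hs)
    rcases (F.mono hs ht hst).eq_or_lt with hk | hk
    · rw [← hk] at a2 b2
      set c := κ s
      have ep : p t 1 - p s 1 = c * (p t 0 - p s 0) := by linarith
      have eq : q t 1 - q s 1 = c * (q t 0 - q s 0) := by linarith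
      constructor
      · by_contra hcon
        push Not at hcon
        have hm : (!₂[p s 0 - t, p s 1 - δ t] : Plane) ∈ K := by
          refine convex_coord hK.conv (c := c) (hq t ht) (hq s hs) ?_ ?_ ?_ ?_ <;> simp
          · linarith
          · linarith
          · linarith
          · rw [show p s 0 - t - q t 0 = p s 0 - p t 0 by linarith]; linarith
        have := hmax t ht (p s) (hp s hs) _ hm (by simp) (by simp)
        linarith
      · by_contra hcon
        push Not at hcon
        have hm : (!₂[q t 0 + s, q t 1 + δ s] : Plane) ∈ K := by
          refine convex_coord hK.conv (c := c) (hp s hs) (hp t ht) ?_ ?_ ?_ ?_ <;> simp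
          · linarith
          · linarith
          · linarith
          · rw [show q t 0 + s - p s 0 = q t 0 - q s 0 by linarith]; linarith
        have := hmax s hs _ hm (q t) (hq t ht) (by simp) (by simp)
        simp at this
        linarith
    · constructor
      · by_contra hcon
        push Not at hcon
        nlinarith
      · by_contra hcon
        push Not at hcon
        nlinarith
  exact ⟨p, q, ⟨hp, hq, h0, tp, tq, fun s hs t ht h => (mono s hs t ht h).1,
    fun s hs t ht h => (mono s hs t ht h).2⟩, h1, hmax⟩


lemma countable_of_isolated {X : Type*} [TopologicalSpace X] [SecondCountableTopology X]
    {S : Set X} (h : ∀ x ∈ S, ∀ᶠ y in nhdsWithin x {x}ᶜ, y ∉ S) : S.Countable := by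
  have : DiscreteTopology S := by
    rw [discreteTopology_subtype_iff]
    intro x hx
    rw [← Filter.empty_mem_iff_bot, Filter.mem_inf_principal]
    filter_upwards [h x hx] with y hy hyS
    exact hy hyS
  exact TopologicalSpace.separableSpace_iff_countable.1 inferInstance

lemma countable_level_of_deriv_ne_zero (f : ℝ → ℝ) (y : ℝ) :
    {s | (∃ d, d ≠ 0 ∧ HasDerivAt f d s) ∧ f s = y}.Countable := by
  refine countable_of_isolated fun s hs => ?_
  obtain ⟨⟨d, hd, hf⟩, -⟩ := hs
  filter_upwards [hf.eventually_ne hd (c := y)] with t ht hmem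
  exact ht hmem.2

lemma volume_image_eq_zero_of_lipschitzOnWith {f : ℝ → ℝ} {S : Set ℝ} {c : NNReal}
    (hf : LipschitzOnWith c f S) (hS : volume S = 0) : volume (f '' S) = 0 := by
  have h := hf.hausdorffMeasure_image_le (d := 1) zero_le_one
  rw [hausdorffMeasure_real, hS, mul_zero] at h
  exact le_antisymm h bot_le

lemma volume_preimage_null_of_deriv_ne_zero (f : ℝ → ℝ) {N : Set ℝ} (hN : volume N = 0) :
    volume {s | (∃ d, d ≠ 0 ∧ HasDerivAt f d s) ∧ f s ∈ N} = 0 := by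
  set S : ℕ → Set ℝ := fun n => {s | f s ∈ N ∧ ∀ t, |t - s| < 1 / (n + 1 : ℝ) →
    |t - s| ≤ (n + 1 : ℝ) * |f t - f s|} with hS
  have hsub : {s | (∃ d, d ≠ 0 ∧ HasDerivAt f d s) ∧ f s ∈ N} ⊆ ⋃ n, S n := by
    rintro s ⟨⟨d, hd, hf⟩, hfs⟩
    have hd' : 0 < |d| := abs_pos.2 hd
    have ho := (hasDerivAt_iff_isLittleO.1 hf).def (half_pos hd')
    obtain ⟨ε, hε, hb⟩ := Metric.eventually_nhds_iff.1 ho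
    obtain ⟨n, hn⟩ := exists_nat_gt (max (1 / ε) (2 / |d|))
    refine Set.mem_iUnion.2 ⟨n, hfs, fun t ht => ?_⟩
    have hn1 : 1 / ε < n + 1 := by linarith [le_max_left (1 / ε) (2 / |d|)]
    have hn2 : 2 / |d| < n + 1 := by linarith [le_max_right (1 / ε) (2 / |d|)]
    have hlt : |t - s| < ε := by
      refine ht.trans ?_
      rw [div_lt_comm₀ (by positivity) hε]; exact hn1
    have h1 := hb (y := t) (by rwa [Real.dist_eq])
    rw [Real.norm_eq_abs, Real.norm_eq_abs, smul_eq_mul] at h1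
    have h2 : |t - s| * |d| ≤ |f t - f s| + |d| / 2 * |t - s| := by
      rw [← abs_mul]
      calc |(t - s) * d| = |(f t - f s) - (f t - f s - (t - s) * d)| := by ring_nf
        _ ≤ |f t - f s| + |f t - f s - (t - s) * d| := abs_sub _ _
        _ ≤ _ := by linarith
    have h3 : |t - s| ≤ 2 / |d| * |f t - f s| := by
      rw [div_mul_eq_mul_div, le_div_iff₀ hd']; linarith
    exact h3.trans (mul_le_mul_of_nonneg_right hn2.le (abs_nonneg _))
  refine measure_mono_null hsub (measure_iUnion_null fun n => ?_)
  refine measure_null_of_locally_null _ fun x _ => ?_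
  have hn : (0:ℝ) < 1 / (n + 1 : ℝ) := by positivity
  refine ⟨S n ∩ Metric.ball x (1 / (n + 1 : ℝ) / 2), Filter.inter_mem self_mem_nhdsWithin
    (mem_nhdsWithin_of_mem_nhds (Metric.ball_mem_nhds x (by positivity))), ?_⟩
  set u := S n ∩ Metric.ball x (1 / (n + 1 : ℝ) / 2) with hu
  have hanti : ∀ s ∈ u, ∀ t ∈ u, |t - s| ≤ (n + 1 : ℝ) * |f t - f s| := by
    intro s hs t ht
    refine hs.1.2 t ?_
    have h1 := hs.2
    have h2 := ht.2
    rw [Metric.mem_ball, Real.dist_eq] at h1 h2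
    have := abs_sub_le t x s
    rw [abs_sub_comm x s] at this
    linarith
  have hinj : Set.InjOn f u := by
    intro s hs t ht hst
    have := hanti s hs t ht
    rw [hst, sub_self, abs_zero, mul_zero] at this
    have := abs_eq_zero.1 (le_antisymm this (abs_nonneg _))
    linarith
  have hlip : LipschitzOnWith (n + 1 : NNReal) (Function.invFunOn f u) (f '' u) := by
    refine LipschitzOnWith.of_dist_le_mul ?_
    rintro _ ⟨s, hs, rfl⟩ _ ⟨t, ht, rfl⟩
    rw [hinj.leftInvOn_invFunOn hs, hinj.leftInvOn_invFunOn ht, Real.dist_eq, Real.dist_eq]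
    exact hanti t ht s hs
  have := volume_image_eq_zero_of_lipschitzOnWith hlip
    (measure_mono_null (by rintro _ ⟨s, hs, rfl⟩; exact hs.1.1) hN)
  rwa [hinj.invFunOn_image subset_rfl] at this

lemma volume_image_eq_zero_of_deriv_eq_zero (f : ℝ → ℝ) :
    volume (f '' {s | HasDerivAt f 0 s}) = 0 := by
  refine addHaar_image_eq_zero_of_det_fderivWithin_eq_zero volume
    (f' := fun _ => ContinuousLinearMap.toSpanSingleton ℝ (0 : ℝ)) (fun x hx => ?_) fun x _ => ?_
  · have hx' : HasDerivAt f 0 x := hx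
    exact hx'.hasFDerivAt.hasFDerivWithinAt
  · simp [ContinuousLinearMap.det]

section Chart

variable {K : Set Plane} {w : ℝ} {δ κ : ℝ → ℝ} {p q : ℝ → Plane}

lemma Chart.height_ge (C : Chart K w κ p q) {s t : ℝ} (hs : s ∈ Set.Ioo (-w) w)
    (ht : t ∈ Set.Ioo (-w) w) : κ s * (p t 0 - p s 0) ≤ p t 1 - p s 1 :=
  C.tanp s hs _ (C.memp t ht)

lemma Chart.height_le (C : Chart K w κ p q) {s t : ℝ} (hs : s ∈ Set.Ioo (-w) w)
    (ht : t ∈ Set.Ioo (-w) w) : p t 1 - p s 1 ≤ κ t * (p t 0 - p s 0) := by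
  have := C.tanp t ht _ (C.memp s hs); linarith

lemma Chart.lip (C : Chart K w κ p q) {s t : ℝ} (hs : s ∈ Set.Ioo (-w) w)
    (ht : t ∈ Set.Ioo (-w) w) : |p t 0 - p s 0| ≤ |t - s| := by
  have e1 := C.sub s hs
  have e2 := C.sub t ht
  rcases le_total s t with h | h
  · have h1 := C.monop s hs t ht h
    have h2 := C.monoq s hs t ht h
    rw [abs_of_nonneg (by linarith), abs_of_nonneg (by linarith)]; linarith
  · have h1 := C.monop t ht s hs h
    have h2 := C.monoq t ht s hs h
    rw [abs_of_nonpos (by linarith), abs_of_nonpos (by linarith)]; linarith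

lemma Chart.height_sub_le (C : Chart K w κ p q) {s t : ℝ} (hs : s ∈ Set.Ioo (-w) w)
    (ht : t ∈ Set.Ioo (-w) w) :
    |p t 1 - p s 1 - κ s * (p t 0 - p s 0)| ≤ |κ t - κ s| * |t - s| := by
  have h1 := C.height_ge hs ht
  have h2 := C.height_le hs ht
  rw [abs_of_nonneg (by linarith)]
  calc p t 1 - p s 1 - κ s * (p t 0 - p s 0) ≤ (κ t - κ s) * (p t 0 - p s 0) := by linarith
    _ ≤ |κ t - κ s| * |p t 0 - p s 0| := by rw [← abs_mul]; exact le_abs_self _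
    _ ≤ _ := mul_le_mul_of_nonneg_left (C.lip hs ht) (abs_nonneg _)

lemma Chart.hasDerivAt_height (C : Chart K w κ p q) {s ρ : ℝ} (hs : s ∈ Set.Ioo (-w) w)
    (hκ : ContinuousAt κ s) (h : HasDerivAt (fun t => p t 0) ρ s) :
    HasDerivAt (fun t => p t 1) (κ s * ρ) s := by
  have h1 : HasDerivAt (fun t => p t 1 - κ s * p t 0) 0 s := by
    rw [hasDerivAt_iff_isLittleO, Asymptotics.isLittleO_iff]
    intro c hc
    have hev := (hκ.tendsto.sub_const (κ s)).abs
    rw [sub_self, abs_zero] at hev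
    filter_upwards [hev.eventually (gt_mem_nhds hc), isOpen_Ioo.mem_nhds hs] with t ht htI
    rw [smul_zero, sub_zero, Real.norm_eq_abs, Real.norm_eq_abs]
    have := C.height_sub_le hs htI
    rw [show p t 1 - κ s * p t 0 - (p s 1 - κ s * p s 0) =
      p t 1 - p s 1 - κ s * (p t 0 - p s 0) by ring]
    exact this.trans (mul_le_mul_of_nonneg_right ht.le (abs_nonneg _))
  have h2 := h1.add (h.const_mul (κ s))
  rw [zero_add] at h2
  refine h2.congr_of_eventuallyEq (Filter.Eventually.of_forall fun t => ?_)
  simp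

lemma Chart.hasDerivAt_om (C : Chart K w κ p q) {s ρ : ℝ} (hs : s ∈ Set.Ioo (-w) w)
    (hκ : ContinuousAt κ s) (h : HasDerivAt (fun t => p t 0) ρ s) (e : Plane) :
    HasDerivAt (fun t => om e (p t)) (ρ * om e (dir (κ s))) s := by
  have h1 := ((C.hasDerivAt_height hs hκ h).const_mul (e 0)).sub (h.const_mul (e 1))
  rw [show ρ * om e (dir (κ s)) = e 0 * (κ s * ρ) - e 1 * ρ by
    simp only [om, dir_zero, dir_one]; ring]
  exact h1

lemma Chart.continuousAt (C : Chart K w κ p q) (hκ : MonotoneOn κ (Set.Ioo (-w) w)) {s : ℝ}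
    (hs : s ∈ Set.Ioo (-w) w) (e : Plane) : ContinuousAt (fun t => om e (p t)) s := by
  have h0 : ContinuousAt (fun t => p t 0) s := by
    refine Metric.continuousAt_iff'.2 fun ε hε => ?_
    filter_upwards [isOpen_Ioo.mem_nhds hs, Metric.ball_mem_nhds s hε] with t ht htb
    exact (C.lip hs ht).trans_lt htb
  have h1 : ContinuousAt (fun t => p t 1) s := by
    obtain ⟨u, hu1, hu2⟩ := exists_between hs.1
    obtain ⟨v, hv1, hv2⟩ := exists_between hs.2
    have hu : u ∈ Set.Ioo (-w) w := ⟨hu1, by linarith⟩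
    have hv : v ∈ Set.Ioo (-w) w := ⟨by linarith, hv2⟩
    set b := κ v - κ u with hb
    have hlim : Filter.Tendsto (fun t => p s 1 + κ s * (p t 0 - p s 0) + b * |t - s|) (nhds s)
        (nhds (p s 1)) := by
      have e1 := ((h0.tendsto.sub_const (p s 0)).const_mul (κ s)).const_add (p s 1)
      have e2 : Filter.Tendsto (fun t => b * |t - s|) (nhds s) (nhds (b * |s - s|)) :=
        (by fun_prop : Continuous fun t => b * |t - s|).tendsto s
      simpa using e1.add e2
    have hlim' : Filter.Tendsto (fun t => p s 1 + κ s * (p t 0 - p s 0)) (nhds s)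
        (nhds (p s 1)) := by
      have e1 := ((h0.tendsto.sub_const (p s 0)).const_mul (κ s)).const_add (p s 1)
      simpa using e1
    refine tendsto_of_tendsto_of_tendsto_of_le_of_le' hlim' hlim ?_ ?_
    · filter_upwards [isOpen_Ioo.mem_nhds hs] with t ht
      linarith [C.height_ge hs ht]
    · filter_upwards [isOpen_Ioo.mem_nhds (⟨hu2, hv1⟩ : s ∈ Set.Ioo u v)] with t ht
      have htI : t ∈ Set.Ioo (-w) w := ⟨hu1.trans ht.1, ht.2.trans hv2⟩
      have h3 := C.height_sub_le hs htI
      have h4 : |κ t - κ s| ≤ b := by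
        rw [abs_le]
        have := hκ hu htI ht.1.le
        have := hκ htI hv ht.2.le
        have := hκ hu hs hu2.le
        have := hκ hs hv hv1.le
        constructor <;> linarith
      have h5 := mul_le_mul_of_nonneg_right h4 (abs_nonneg (t - s))
      linarith [le_abs_self (p t 1 - p s 1 - κ s * (p t 0 - p s 0))]
  exact (h1.const_mul (e 0)).sub (h0.const_mul (e 1))

lemma Chart.deriv_nonneg (C : Chart K w κ p q) {s ρ : ℝ} (hs : s ∈ Set.Ioo (-w) w)
    (h : HasDerivAt (fun t => p t 0) ρ s) : 0 ≤ ρ := by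
  have hw := h.hasDerivWithinAt (s := Set.Ioi s)
  rw [hasDerivWithinAt_iff_tendsto_slope' (by simp)] at hw
  refine ge_of_tendsto hw ?_
  filter_upwards [self_mem_nhdsWithin, mem_nhdsWithin_of_mem_nhds (isOpen_Ioo.mem_nhds hs)]
    with t ht htI
  rw [slope_def_field]
  have ht' : s < t := ht
  exact div_nonneg (sub_nonneg.2 (C.monop s hs t htI ht'.le)) (by linarith)

lemma Chart.hasDerivAt_neg (C : Chart K w κ p q) {s ρ : ℝ} (hs : s ∈ Set.Ioo (-w) w)
    (h : HasDerivAt (fun t => p t 0) ρ s) : HasDerivAt (fun t => (-q t) 0) (1 - ρ) s := by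
  have h1 := (hasDerivAt_id s).sub h
  refine h1.congr_of_eventuallyEq ?_
  filter_upwards [isOpen_Ioo.mem_nhds hs] with t ht
  have := C.sub t ht
  simp
  linarith

lemma Chart.deriv_le_one (C : Chart K w κ p q) {s ρ : ℝ} (hs : s ∈ Set.Ioo (-w) w)
    (h : HasDerivAt (fun t => p t 0) ρ s) : ρ ≤ 1 := by
  have := C.neg.deriv_nonneg hs (C.hasDerivAt_neg hs h)
  linarith

/-- The difference body of `K` has no edge of the slope of its boundary point over `s`. -/
def NoEdge (K : Set Plane) (κ : ℝ → ℝ) (p q : ℝ → Plane) (s : ℝ) : Prop :=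
  ∀ x ∈ K, ∀ y ∈ K, x 1 - y 1 = p s 1 - q s 1 + κ s * (x 0 - y 0 - s) → x 0 - y 0 = s

lemma NoEdge.neg {s : ℝ} (h : NoEdge K κ p q s) :
    NoEdge (-K) κ (fun s => - q s) (fun s => - p s) s := by
  intro x hx y hy hxy
  have := h (-y) hy (-x) hx (by simp at hxy ⊢; linarith)
  simp at this
  linarith

lemma NoEdge.slope_ne (C : Chart K w κ p q) {s t : ℝ} (hs : s ∈ Set.Ioo (-w) w)
    (ht : t ∈ Set.Ioo (-w) w) (h : NoEdge K κ p q s) (hst : t ≠ s) : κ t ≠ κ s := by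
  intro hk
  apply hst
  have a1 := C.height_ge hs ht
  have a2 := C.height_le hs ht
  have b1 := C.neg.height_ge hs ht
  have b2 := C.neg.height_le hs ht
  rw [hk] at a2 b2
  simp at b1 b2
  have e1 := C.sub s hs
  have e2 := C.sub t ht
  have := h _ (C.memp t ht) _ (C.memq t ht) (by
    rw [show p t 0 - q t 0 - s = (p t 0 - p s 0) - (q t 0 - q s 0) by linarith]; linarith)
  linarith

lemma NoEdge.exposed (C : Chart K w κ p q) {s : ℝ} (hs : s ∈ Set.Ioo (-w) w)
    (h : NoEdge K κ p q s) : ∀ k ∈ K, om (dir (κ s)) (k - p s) = 0 → k = p s := by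
  intro k hk hom
  rw [om_dir] at hom
  simp at hom
  have e1 := C.sub s hs
  have := h k hk _ (C.memq s hs) (by
    rw [show k 0 - q s 0 - s = k 0 - p s 0 by linarith]; linarith)
  have h0 : k 0 = p s 0 := by linarith
  exact plane_ext h0 (by rw [h0] at hom; linarith)

lemma NoEdge.exposed_neg (C : Chart K w κ p q) {s : ℝ} (hs : s ∈ Set.Ioo (-w) w)
    (h : NoEdge K κ p q s) : ∀ k ∈ K, om (dir (κ s)) (k - q s) = 0 → k = q s := by
  intro k hk hom
  have := h.neg.exposed C.neg hs (-k) (by simpa using hk) (by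
    rw [show -k - -q s = -(k - q s) by abel, om_neg_right, hom, neg_zero])
  simpa using this

lemma Chart.tan (C : Chart K w κ p q) {s : ℝ} (hs : s ∈ Set.Ioo (-w) w) :
    Tan K (p s) (dir (κ s)) := tan_dir_iff.2 (C.tanp s hs)

lemma Chart.tan_neg (C : Chart K w κ p q) {s : ℝ} (hs : s ∈ Set.Ioo (-w) w) :
    Tan K (q s) (-dir (κ s)) := tan_neg_dir_iff.2 (C.tanq s hs)

lemma Chart.smooth (C : Chart K w κ p q) {s ρ : ℝ} (hs : s ∈ Set.Ioo (-w) w)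
    (hκ : ContinuousAt κ s) (h : HasDerivAt (fun t => p t 0) ρ s) (hρ : 0 < ρ) :
    Smooth K (p s) := by
  have key : ∀ t, Tan K (p s) t → om t (dir (κ s)) = 0 := by
    intro t ht
    have hd := C.hasDerivAt_om hs hκ h t
    have hmin : IsLocalMin (fun u => om t (p u)) s := by
      filter_upwards [isOpen_Ioo.mem_nhds hs] with u hu
      have := ht.2 _ (C.memp u hu)
      rw [om_sub_right] at this
      linarith
    have := hmin.hasDerivAt_eq_zero hd
    rcases mul_eq_zero.1 this with h0 | h0
    · linarith
    · exact h0
  intro t t' ht ht'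
  obtain ⟨c, hc⟩ := exists_smul_of_om_eq_zero (dir_ne_zero (κ s))
    (by rw [om_comm, key t ht, neg_zero])
  rw [hc, om_smul_left, om_comm, key t' ht']; simp

lemma Chart.base (C : Chart K w κ p q) {s ρ : ℝ} (hs : s ∈ Set.Ioo (-w) w)
    (hκ : ContinuousAt κ s) (h : HasDerivAt (fun t => p t 0) ρ s) (hρ : 0 < ρ)
    (hn : NoEdge K κ p q s) : Base K (p s) (q s) (dir (κ s)) :=
  ⟨C.memp s hs, C.memq s hs, C.tan hs, C.tan_neg hs, C.smooth hs hκ h hρ, hn.exposed C hs,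
    hn.exposed_neg C hs⟩

lemma Smooth.neg_set {p : Plane} (h : Smooth K p) : Smooth (-K) (-p) := by
  intro t t' ht ht'
  have e1 : Tan K p (-t) := by rw [← tan_neg]; simpa using ht
  have e2 : Tan K p (-t') := by rw [← tan_neg]; simpa using ht'
  simpa [om_neg_left, om_neg_right] using h _ _ e1 e2

lemma Base.neg_set {p pb τ : Plane} (h : Base K p pb τ) : Base (-K) (-p) (-pb) (-τ) where
  mem := by simpa using h.mem
  memb := by simpa using h.memb
  tan := tan_neg.2 h.tan
  tanb := tan_neg.2 h.tanb
  smooth := h.smooth.neg_set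
  exposed := fun k hk hom => by
    have := h.exposed (-k) hk (by
      rw [show -k - p = -(k - -p) by abel, om_neg_right]
      rw [om_neg_left] at hom; exact hom)
    rw [← this, neg_neg]
  exposedb := fun k hk hom => by
    have := h.exposedb (-k) hk (by
      rw [show -k - pb = -(k - -pb) by abel, om_neg_right]
      rw [om_neg_left] at hom; exact hom)
    rw [← this, neg_neg]

lemma Chart.base_neg (C : Chart K w κ p q) {s ρ : ℝ} (hs : s ∈ Set.Ioo (-w) w)
    (hκ : ContinuousAt κ s) (h : HasDerivAt (fun t => p t 0) ρ s) (hρ : ρ < 1)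
    (hn : NoEdge K κ p q s) : Base K (q s) (p s) (-dir (κ s)) := by
  have := (C.neg.base hs hκ (C.hasDerivAt_neg hs h) (by linarith) hn.neg).neg_set
  simpa using this

end Chart


section Chart

variable {K : Set Plane} {w : ℝ} {δ κ : ℝ → ℝ} {p q : ℝ → Plane}

lemma exists_slopes {s : ℝ} {v : Plane} (hm : MonotoneOn κ (Set.Ioo (-w) w))
    (hs : s ∈ Set.Ioo (-w) w) (hκ : ContinuousAt κ s) (hv : 0 < om (dir (κ s)) v)
    (hne : ∀ t ∈ Set.Ioo (-w) w, t ≠ s → κ t ≠ κ s) :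
    ∃ r, (∀ t ∈ Set.Ioo (-r) r, s + t ∈ Set.Ioo (-w) w ∧ 0 < om (dir (κ (s + t))) v) ∧
      Slopes (fun t => (κ (s + t) - κ s) / om (dir (κ (s + t))) v) r := by
  have hadd : Filter.Tendsto (fun t => s + t) (nhds 0) (nhds s) := by
    have := (by fun_prop : Continuous fun t : ℝ => s + t).tendsto 0
    rwa [add_zero] at this
  have hκ0 : Filter.Tendsto (fun t => κ (s + t)) (nhds 0) (nhds (κ s)) := hκ.tendsto.comp hadd
  have hden : Filter.Tendsto (fun t => om (dir (κ (s + t))) v) (nhds 0) (nhds (om (dir (κ s)) v)) := by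
    simp only [om_dir]
    exact (hκ0.mul_const _).const_sub _
  obtain ⟨r, hr, hb⟩ := Metric.eventually_nhds_iff.1
    ((hadd.eventually (isOpen_Ioo.mem_nhds hs)).and (hden.eventually (lt_mem_nhds hv)))
  have hb' : ∀ t ∈ Set.Ioo (-r) r, s + t ∈ Set.Ioo (-w) w ∧ 0 < om (dir (κ (s + t))) v :=
    fun t ht => hb (by rw [Real.dist_eq, sub_zero]; exact abs_lt.2 ht)
  refine ⟨r, hb', hr, by simp, ?_, ?_, ?_⟩
  · have h1 := (hκ0.sub_const (κ s)).div hden hv.ne'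
    rw [sub_self, zero_div] at h1
    unfold ContinuousAt
    simp only [add_zero, sub_self, zero_div]
    exact h1
  · intro t ht u hu htu
    have h1 := (hb' t ht).2
    have h2 := (hb' u hu).2
    have h3 := hm (hb' t ht).1 (hb' u hu).1 (by linarith)
    simp only
    rw [div_le_div_iff₀ h1 h2]
    simp only [om_dir] at hv ⊢
    nlinarith [mul_nonneg hv.le (sub_nonneg.2 h3)]
  · intro t ht ht0
    exact div_ne_zero (sub_ne_zero.2 (hne _ (hb' t ht).1 (by simpa using ht0))) (hb' t ht).2.ne'

lemma tan_slope_of_dir {x v : Plane} {c d : ℝ} (hc : 0 < om (dir c) v) (hd : 0 < om (dir d) v)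
    (h : Tan K x (dir d)) : Tan K x (dir c + ((d - c) / om (dir d) v) • v) := by
  have e : dir c + ((d - c) / om (dir d) v) • v = (om (dir c) v / om (dir d) v) • dir d := by
    have h1 := om_cramer (dir c) v (dir d)
    have h2 : om (dir c) (dir d) = d - c := by rw [om_dir, dir_zero, dir_one, mul_one]
    rw [div_eq_inv_mul (om (dir c) v), mul_smul, h1, h2, smul_add, smul_smul, smul_smul,
      inv_mul_cancel₀ hd.ne', one_smul, div_eq_inv_mul]
  have hpos : 0 < om (dir c) v / om (dir d) v := div_pos hc hd
  rw [e]
  refine ⟨smul_ne_zero hpos.ne' h.1, fun k hk => ?_⟩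
  rw [om_smul_left]
  exact mul_nonneg hpos.le (h.2 k hk)

lemma Chart.curve (C : Chart K w κ p q) (hm : MonotoneOn κ (Set.Ioo (-w) w)) {s r ρ : ℝ}
    {v : Plane} (hs : s ∈ Set.Ioo (-w) w) (hκ : ContinuousAt κ s)
    (h : HasDerivAt (fun t => p t 0) ρ s) (hv : 0 < om (dir (κ s)) v)
    (hr : ∀ t ∈ Set.Ioo (-r) r, s + t ∈ Set.Ioo (-w) w ∧ 0 < om (dir (κ (s + t))) v) :
    Curve {z | p s + z ∈ K} (dir (κ s)) v
      (fun t => (κ (s + t) - κ s) / om (dir (κ (s + t))) v)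
      (fun t => cu (dir (κ s)) v (p (s + t) - p s)) (fun t => ch (dir (κ s)) v (p (s + t) - p s))
      ρ r where
  line := by
    intro t ht z hz
    obtain ⟨h1, h2⟩ := hr t ht
    have h3 := (tan_slope_of_dir hv h2 (C.tan h1)).slope hv hz
    rw [show p s + z - p (s + t) = z - (p (s + t) - p s) by abel, cu_sub, ch_sub] at h3
    linarith
  mem := by
    intro t ht
    rw [combo_cu_ch hv]
    change p s + (p (s + t) - p s) ∈ K
    rw [add_sub_cancel]
    exact C.memp _ (hr t ht).1
  cont := by
    intro t ht
    have h1 := C.continuousAt hm (hr t ht).1 v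
    have h2 : ContinuousAt (fun t => om v (p (s + t))) t :=
      ContinuousAt.comp (f := fun t => s + t) (g := fun t => om v (p t)) h1 (by fun_prop)
    have h3 : ContinuousAt (fun t => (-(om v (p (s + t))) - om (p s) v) / om (dir (κ s)) v) t :=
      (h2.neg.sub continuousAt_const).div_const _
    refine (h3.congr (Filter.Eventually.of_forall fun t => ?_)).continuousWithinAt
    simp only [cu, om_sub_left]
    rw [om_comm (p (s + t)) v]
  deriv := by
    have h1 := C.hasDerivAt_om hs hκ h v
    have h2 : HasDerivAt (fun t => om v (p (s + t))) (ρ * om v (dir (κ s))) 0 :=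
      HasDerivAt.comp_const_add s 0 (by simpa using h1)
    have h3 := (h2.neg.sub_const (om (p s) v)).div_const (om (dir (κ s)) v)
    have e : -(ρ * om v (dir (κ s))) / om (dir (κ s)) v = ρ := by
      rw [om_comm v]; field_simp
    rw [e] at h3
    refine h3.congr_of_eventuallyEq (Filter.Eventually.of_forall fun t => ?_)
    simp only [cu, om_sub_left]
    rw [om_comm (p (s + t)) v]
    rfl
  A0 := by simp [cu_zero]
  B0 := by simp [ch_zero]

lemma Chart.ae_regular (C : Chart K w κ p q) (hm : MonotoneOn κ (Set.Ioo (-w) w)) :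
    ∀ᵐ s : ℝ, s ∈ Set.Ioo (-w) w → ContinuousAt κ s ∧ ∃ ρ, HasDerivAt (fun t => p t 0) ρ s := by
  have h2 : MonotoneOn (fun t => p t 0) (Set.Ioo (-w) w) := fun s hs t ht h => C.monop s hs t ht h
  filter_upwards [hm.ae_differentiableWithinAt_of_mem, h2.ae_differentiableWithinAt_of_mem]
    with s a1 a2 hs
  have hn := isOpen_Ioo.mem_nhds hs
  exact ⟨((a1 hs).differentiableAt hn).continuousAt, _,
    ((a2 hs).differentiableAt hn).hasDerivAt⟩

lemma isolated_pair {g₁ g₂ : ℝ → ℝ} {s s' d d' : ℝ} (h1 : HasDerivAt g₁ d s)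
    (h1' : HasDerivAt g₁ 0 s') (h2 : HasDerivAt g₂ 0 s) (h2' : HasDerivAt g₂ d' s') (hd : d ≠ 0)
    (hd' : d' ≠ 0) (e1 : g₁ s = g₁ s') (e2 : g₂ s = g₂ s') :
    ∀ᶠ z in nhds (s, s'), g₁ z.1 = g₁ z.2 → g₂ z.1 = g₂ z.2 → z = (s, s') := by
  have k1 : 0 < |d| / 4 := by have := abs_pos.2 hd; positivity
  have k2 : 0 < |d'| / 4 := by have := abs_pos.2 hd'; positivity
  rw [nhds_prod_eq]
  filter_upwards [((hasDerivAt_iff_isLittleO.1 h1).def k1).prod_mk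
    ((hasDerivAt_iff_isLittleO.1 h1').def k1), ((hasDerivAt_iff_isLittleO.1 h2).def k2).prod_mk
    ((hasDerivAt_iff_isLittleO.1 h2').def k2)] with z a b c1 c2
  obtain ⟨a1, a2⟩ := a
  obtain ⟨b1, b2⟩ := b
  simp only [smul_eq_mul, mul_zero, sub_zero, Real.norm_eq_abs] at a1 a2 b1 b2
  rw [← c1, ← e1] at a2
  rw [c2, e2] at b1
  have a3 : |(z.1 - s) * d| ≤ |d| / 4 * |z.1 - s| + |d| / 4 * |z.2 - s'| := by
    calc |(z.1 - s) * d| = |(g₁ z.1 - g₁ s) - (g₁ z.1 - g₁ s - (z.1 - s) * d)| := by ring_nf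
      _ ≤ |g₁ z.1 - g₁ s| + |g₁ z.1 - g₁ s - (z.1 - s) * d| := abs_sub _ _
      _ ≤ _ := by linarith
  have b3 : |(z.2 - s') * d'| ≤ |d'| / 4 * |z.1 - s| + |d'| / 4 * |z.2 - s'| := by
    calc |(z.2 - s') * d'| = |(g₂ z.2 - g₂ s') - (g₂ z.2 - g₂ s' - (z.2 - s') * d')| := by ring_nf
      _ ≤ |g₂ z.2 - g₂ s'| + |g₂ z.2 - g₂ s' - (z.2 - s') * d'| := abs_sub _ _
      _ ≤ _ := by linarith
  rw [abs_mul] at a3 b3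
  have a4 : 3 * |z.1 - s| ≤ |z.2 - s'| := by
    have : |d| / 4 * (3 * |z.1 - s|) ≤ |d| / 4 * |z.2 - s'| := by linarith
    exact le_of_mul_le_mul_left this k1
  have b4 : 3 * |z.2 - s'| ≤ |z.1 - s| := by
    have : |d'| / 4 * (3 * |z.2 - s'|) ≤ |d'| / 4 * |z.1 - s| := by linarith
    exact le_of_mul_le_mul_left this k2
  have n1 := abs_nonneg (z.1 - s)
  have n2 := abs_nonneg (z.2 - s')
  have z1 : |z.1 - s| = 0 := by linarith
  have z2 : |z.2 - s'| = 0 := by linarith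
  rw [abs_eq_zero] at z1 z2
  exact Prod.ext (by simp; linarith) (by simp; linarith)

lemma Floor.flat (F : Floor K w δ κ) (C : Chart K w κ p q)
    (hδ : ∀ s ∈ Set.Ioo (-w) w, p s 1 - q s 1 = δ s) {s : ℝ} (hs : s ∈ Set.Ioo (-w) w)
    (h : ¬ NoEdge K κ p q s) :
    ∃ u, u ≠ s ∧ ∀ r, (s < r ∧ r < u) ∨ (u < r ∧ r < s) → r ∈ Set.Ioo (-w) w ∧ κ r = κ s := by
  unfold NoEdge at h
  push Not at h
  obtain ⟨x, hx, y, hy, hxy, hne⟩ := h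
  rw [hδ s hs] at hxy
  have w1 := F.wide x hx y hy
  have w2 := F.wide y hy x hx
  refine ⟨x 0 - y 0, hne, fun r hr => ?_⟩
  have hrI : r ∈ Set.Ioo (-w) w := by
    rcases hr with hr | hr
    · exact ⟨by linarith [hs.1], by linarith⟩
    · exact ⟨by linarith, by linarith [hs.2]⟩
  refine ⟨hrI, ?_⟩
  have a1 := F.line r hrI x hx y hy
  have a2 := F.line r hrI _ (C.memp s hs) _ (C.memq s hs)
  have a3 := F.line s hs _ (C.memp r hrI) _ (C.memq r hrI)
  rw [C.sub s hs, hδ s hs] at a2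
  rw [C.sub r hrI, hδ r hrI] at a3
  rw [hxy] at a1
  set u := x 0 - y 0
  have b1 : (κ r - κ s) * (u - r) ≤ 0 := by nlinarith
  have b2 : (κ r - κ s) * (s - r) ≤ 0 := by nlinarith
  rcases hr with hr | hr
  · refine le_antisymm ?_ ?_
    · by_contra hc; push Not at hc
      nlinarith [mul_pos (sub_pos.2 hc) (sub_pos.2 hr.2)]
    · by_contra hc; push Not at hc
      nlinarith [mul_pos (sub_pos.2 hc) (sub_pos.2 hr.1)]
  · refine le_antisymm ?_ ?_
    · by_contra hc; push Not at hc
      nlinarith [mul_pos (sub_pos.2 hc) (sub_pos.2 hr.2)]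
    · by_contra hc; push Not at hc
      nlinarith [mul_pos (sub_pos.2 hc) (sub_pos.2 hr.1)]

lemma Chart.hasDerivAt_sum_om (C : Chart K w κ p q) {s ρ : ℝ} (hs : s ∈ Set.Ioo (-w) w)
    (hκ : ContinuousAt κ s) (h : HasDerivAt (fun t => p t 0) ρ s) (e : Plane) :
    HasDerivAt (fun t => om e (p t + q t)) ((2 * ρ - 1) * om e (dir (κ s))) s := by
  have h1 := C.hasDerivAt_om hs hκ h e
  have h2 := C.neg.hasDerivAt_om hs hκ (C.hasDerivAt_neg hs h) e
  have h3 := h1.sub h2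
  rw [show (2 * ρ - 1) * om e (dir (κ s)) = ρ * om e (dir (κ s)) - (1 - ρ) * om e (dir (κ s)) by
    ring]
  refine h3.congr_of_eventuallyEq (Filter.Eventually.of_forall fun t => ?_)
  simp [om_add_right, om_neg_right]

lemma Chart.hasDerivAt_sum (C : Chart K w κ p q) {s ρ : ℝ} (hs : s ∈ Set.Ioo (-w) w)
    (h : HasDerivAt (fun t => p t 0) ρ s) :
    HasDerivAt (fun t => p t 0 + q t 0) (2 * ρ - 1) s := by
  have h3 := h.sub (C.hasDerivAt_neg hs h)
  rw [show 2 * ρ - 1 = ρ - (1 - ρ) by ring]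
  refine h3.congr_of_eventuallyEq (Filter.Eventually.of_forall fun t => ?_)
  simp

lemma Chart.lipschitzOnWith_sum (C : Chart K w κ p q) :
    LipschitzOnWith 2 (fun t => p t 0 + q t 0) (Set.Ioo (-w) w) := by
  refine LipschitzOnWith.of_dist_le_mul fun s hs t ht => ?_
  rw [Real.dist_eq, Real.dist_eq]
  have h1 := C.lip ht hs
  have h2 := C.neg.lip ht hs
  simp only [PiLp.neg_apply] at h2
  have h3 := abs_add_le (p s 0 - p t 0) (-(-q s 0 - -q t 0))
  rw [abs_neg] at h3
  rw [show p s 0 + q s 0 - (p t 0 + q t 0) = p s 0 - p t 0 + -(-q s 0 - -q t 0) by ring]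
  simp only [NNReal.coe_ofNat]
  linarith

/-- An antipodal pair of `K` over `s` lies on the supporting lines of the chart. -/
lemma Chart.antipodal (F : Floor K w δ κ) (C : Chart K w κ p q)
    (hδ : ∀ s ∈ Set.Ioo (-w) w, p s 1 - q s 1 = δ s) {x y : Plane} {c s : ℝ} (hx : x ∈ K)
    (hy : y ∈ K) (h1 : Tan K x (dir c)) (h2 : Tan K y (-dir c)) (hs : s ∈ Set.Ioo (-w) w)
    (hxy : x 0 - y 0 = s) :
    om (dir (κ s)) (x - p s) = 0 ∧ om (dir (κ s)) (y - q s) = 0 := by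
  have a1 := tan_dir_iff.1 h1 _ (C.memp s hs)
  have a2 := tan_neg_dir_iff.1 h2 _ (C.memq s hs)
  have e := C.sub s hs
  have e1 := hδ s hs
  have a3 := F.line s hs x hx y hy
  rw [hxy, sub_self, mul_zero, add_zero] at a3
  rw [show q s 0 - y 0 = p s 0 - x 0 by linarith] at a2
  have a4 := C.tanp s hs x hx
  have a5 := C.tanq s hs y hy
  rw [show y 0 - q s 0 = x 0 - p s 0 by linarith] at a5
  simp only [om_dir, PiLp.sub_apply]
  rw [show y 0 - q s 0 = x 0 - p s 0 by linarith]
  constructor <;> linarith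

lemma Chart.nonDouble_aux (F : Floor K w δ κ) (C : Chart K w κ p q)
    (hδ : ∀ s ∈ Set.Ioo (-w) w, p s 1 - q s 1 = δ s) {s M : ℝ} (hs : s ∈ Set.Ioo (-w) w)
    (hn : NoEdge K κ p q s) (hM : ∀ x ∈ K, ∀ y ∈ K, x 0 - y 0 = w → x 0 + y 0 = M)
    (h1 : p s 0 + q s 0 ≠ M)
    (h2 : ∀ r : ℚ, κ r ≠ κ s → om (dir (κ r)) (p s + q s) ≠ om (dir (κ r)) (p r + q r))
    (h3 : ∀ t ∈ Set.Ioo (-w) w, t ≠ s → NoEdge K κ p q t → p s + q s ≠ p t + q t)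
    {x y t : Plane} (hx : x ∈ K) (hy : y ∈ K) (hxy : x + y = p s + q s) (ht : 0 ≤ t 0)
    (tx : Tan K x t) (ty : Tan K y (-t)) : x = p s := by
  have hsum0 : x 0 + y 0 = p s 0 + q s 0 := by
    have := congrArg (fun z : Plane => z 0) hxy; simpa using this
  obtain ⟨X, hX, Y, hY, hXY⟩ := F.attained
  rcases ht.eq_or_lt with ht0 | ht0
  · exfalso
    have a1 := tx.2 X hX
    have a2 := tx.2 Y hY
    have a3 := ty.2 X hX
    have a4 := ty.2 Y hY
    simp only [om, PiLp.sub_apply, PiLp.neg_apply, ← ht0, zero_mul, zero_sub, neg_zero] at a1 a2 a3 a4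
    have t1 : t 1 ≠ 0 := by
      intro h0; exact tx.1 (plane_ext (by simpa using ht0.symm) (by simpa using h0))
    rcases lt_or_gt_of_ne t1 with hl | hg
    · have b1 : x 0 ≤ Y 0 := by nlinarith
      have b2 : X 0 ≤ y 0 := by nlinarith
      have := hM y hy x hx (by linarith [F.wide y hy x hx])
      apply h1; linarith
    · have b1 : X 0 ≤ x 0 := by nlinarith
      have b2 : y 0 ≤ Y 0 := by nlinarith
      have := hM x hx y hy (by linarith [F.wide x hx y hy])
      apply h1; linarith
  have htd : t = t 0 • dir (t 1 / t 0) := by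
    apply plane_ext
    · simp [dir_zero]
    · simp only [PiLp.smul_apply, dir_one, smul_eq_mul]; field_simp
  set c := t 1 / t 0 with hc
  have tx' : Tan K x (dir c) := ⟨dir_ne_zero c, fun k hk => by
    have := tx.2 k hk
    rw [htd, om_smul_left] at this
    exact nonneg_of_mul_nonneg_right this ht0⟩
  have ty' : Tan K y (-dir c) := ⟨neg_ne_zero.2 (dir_ne_zero c), fun k hk => by
    have := ty.2 k hk
    rw [htd, ← smul_neg, om_smul_left] at this
    exact nonneg_of_mul_nonneg_right this ht0⟩
  have w1 := F.wide x hx y hy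
  have w2 := F.wide y hy x hx
  rcases w1.eq_or_lt with e | w1
  · exact absurd (hsum0 ▸ hM x hx y hy e) h1
  rcases w2.eq_or_lt with e | w2
  · exact absurd (by rw [← hsum0, add_comm]; exact hM y hy x hx e) h1
  set u := x 0 - y 0 with hu
  have huI : u ∈ Set.Ioo (-w) w := ⟨by linarith, w1⟩
  obtain ⟨ox, oy⟩ := C.antipodal F hδ hx hy tx' ty' huI rfl
  by_cases hne : NoEdge K κ p q u
  · have ex := hne.exposed C huI x hx ox
    have ey := hne.exposed_neg C huI y hy oy
    by_cases hus : u = s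
    · rw [ex, hus]
    · exact absurd (by rw [← hxy, ← ex, ← ey]) (h3 u huI hus hne)
  · exfalso
    obtain ⟨u', hu', hflat⟩ := F.flat C hδ huI hne
    have hr : ∃ r : ℚ, (u < r ∧ (r:ℝ) < u') ∨ (u' < r ∧ (r:ℝ) < u) := by
      rcases lt_or_gt_of_ne hu' with hl | hg
      · obtain ⟨r, r1, r2⟩ := exists_rat_btwn hl; exact ⟨r, Or.inr ⟨r1, r2⟩⟩
      · obtain ⟨r, r1, r2⟩ := exists_rat_btwn hg; exact ⟨r, Or.inl ⟨r1, r2⟩⟩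
    obtain ⟨r, hr⟩ := hr
    obtain ⟨hrI, hκr⟩ := hflat r hr
    have hru : (r:ℝ) ≠ u := by rcases hr with hr | hr <;> [exact hr.1.ne'; exact hr.2.ne]
    have hκs : κ r ≠ κ s := by
      by_cases hrs : (r:ℝ) = s
      · intro _
        refine hn.slope_ne C hs huI (fun h0 => hru (hrs.trans h0.symm)) ?_
        rw [← hκr, hrs]
      · exact hn.slope_ne C hs hrI hrs
    refine h2 r hκs ?_
    have e1 : om (dir (κ r)) (p r - p u) = 0 := by
      have b1 := C.height_ge huI hrI
      have b2 := C.height_le huI hrI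
      rw [om_dir]; simp only [PiLp.sub_apply]; rw [hκr] at b2 ⊢; linarith
    have e2 : om (dir (κ r)) (q r - q u) = 0 := by
      have b1 := C.neg.height_ge huI hrI
      have b2 := C.neg.height_le huI hrI
      simp only [PiLp.neg_apply] at b1 b2
      rw [om_dir]; simp only [PiLp.sub_apply]; rw [hκr] at b2 ⊢; linarith
    rw [← hκr] at ox oy
    rw [← hxy]
    simp only [om_sub_right, om_add_right] at *
    linarith

lemma Chart.ae_nonDouble (hK : Body K) (F : Floor K w δ κ) (C : Chart K w κ p q)
    (hδ : ∀ s ∈ Set.Ioo (-w) w, p s 1 - q s 1 = δ s) :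
    ∀ᵐ s : ℝ, s ∈ Set.Ioo (-w) w → NoEdge K κ p q s → ContinuousAt κ s →
      ∀ ρ, HasDerivAt (fun t => p t 0) ρ s → ρ ≠ 1 / 2 →
      ∀ x ∈ K, ∀ y ∈ K, x + y = p s + q s → ¬ Ov K (y - x) → x = p s ∨ x = q s := by
  set f : ℝ → ℝ := fun t => p t 0 + q t 0 with hf
  obtain ⟨X, hX, Y, hY, hXY⟩ := F.attained
  have hM : ∀ x ∈ K, ∀ y ∈ K, x 0 - y 0 = w → x 0 + y 0 = X 0 + Y 0 := by
    intro x hx y hy hxy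
    have := F.wide x hx Y hY
    have := F.wide X hX y hy
    linarith
  set Z : Set ℝ := {s | s ∈ Set.Ioo (-w) w ∧
    ¬ (ContinuousAt κ s ∧ ∃ ρ, HasDerivAt (fun t => p t 0) ρ s)} with hZ
  have hZ0 : volume Z = 0 := by
    have := C.ae_regular F.mono
    rw [ae_iff] at this
    refine measure_mono_null (fun s hs => ?_) this
    exact fun h => hs.2 (h hs.1)
  have hN : volume (f '' Z ∪ f '' {s | HasDerivAt f 0 s}) = 0 :=
    measure_union_null (volume_image_eq_zero_of_lipschitzOnWith
      (C.lipschitzOnWith_sum.mono fun s hs => hs.1) hZ0) (volume_image_eq_zero_of_deriv_eq_zero f)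
  set P : Set (ℝ × ℝ) := {z | (z.1 ∈ Set.Ioo (-w) w ∧ ContinuousAt κ z.1 ∧
      ∃ ρ, ρ ≠ 1 / 2 ∧ HasDerivAt (fun t => p t 0) ρ z.1) ∧ (z.2 ∈ Set.Ioo (-w) w ∧
      ContinuousAt κ z.2 ∧ ∃ ρ, ρ ≠ 1 / 2 ∧ HasDerivAt (fun t => p t 0) ρ z.2) ∧
      κ z.1 ≠ κ z.2 ∧ p z.1 + q z.1 = p z.2 + q z.2} with hP
  have hPc : P.Countable := by
    refine countable_of_isolated fun z hz => ?_
    obtain ⟨⟨hs, hκ, ρ, hρ, h⟩, ⟨hs', hκ', ρ', hρ', h'⟩, hne, heq⟩ := hz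
    have om1 : ∀ a b : ℝ, om (dir a) (dir b) = b - a := fun a b => by
      rw [om_dir, dir_zero, dir_one, mul_one]
    have a1 := C.hasDerivAt_sum_om hs hκ h (dir (κ z.2))
    have a2 := C.hasDerivAt_sum_om hs hκ h (dir (κ z.1))
    have b1 := C.hasDerivAt_sum_om hs' hκ' h' (dir (κ z.2))
    have b2 := C.hasDerivAt_sum_om hs' hκ' h' (dir (κ z.1))
    rw [om_self, mul_zero] at a2 b1
    rw [om1] at a1 b2
    have iso := isolated_pair a1 b1 a2 b2
      (mul_ne_zero (fun h0 => hρ (by linarith)) (sub_ne_zero.2 hne))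
      (mul_ne_zero (fun h0 => hρ' (by linarith)) (sub_ne_zero.2 hne.symm)) (by simp only [heq])
      (by simp only [heq])
    have iso' : ∀ᶠ z' in nhdsWithin z {z}ᶜ, _ := mem_nhdsWithin_of_mem_nhds iso
    filter_upwards [iso', self_mem_nhdsWithin] with z' h1 h2 hz'
    exact h2 (h1 (by simp only [hz'.2.2.2]) (by simp only [hz'.2.2.2]))
  have n1 : ∀ᵐ s : ℝ, ¬ ((∃ d, d ≠ 0 ∧ HasDerivAt f d s) ∧ f s = X 0 + Y 0) :=
    measure_eq_zero_iff_ae_notMem.1 ((countable_level_of_deriv_ne_zero f _).measure_zero volume)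
  have n2 : ∀ᵐ s : ℝ, ∀ r : ℚ, ¬ ((∃ d, d ≠ 0 ∧
      HasDerivAt (fun t => om (dir (κ r)) (p t + q t)) d s) ∧
      om (dir (κ r)) (p s + q s) = om (dir (κ r)) (p r + q r)) := by
    rw [ae_all_iff]
    intro r
    exact measure_eq_zero_iff_ae_notMem.1 ((countable_level_of_deriv_ne_zero
      (fun t => om (dir (κ r)) (p t + q t)) _).measure_zero volume)
  have n3 : ∀ᵐ s : ℝ, ¬ ((∃ d, d ≠ 0 ∧ HasDerivAt f d s) ∧
      f s ∈ f '' Z ∪ f '' {s | HasDerivAt f 0 s}) :=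
    measure_eq_zero_iff_ae_notMem.1 (volume_preimage_null_of_deriv_ne_zero f hN)
  have n4 : ∀ᵐ s : ℝ, s ∉ Prod.fst '' P :=
    measure_eq_zero_iff_ae_notMem.1 ((hPc.image _).measure_zero volume)
  filter_upwards [n1, n2, n3, n4] with s m1 m2 m3 m4 hs hn hκ ρ h hρ x hx y hy hxy hov
  have hd0 : 2 * ρ - 1 ≠ 0 := fun h0 => hρ (by linarith)
  have hfd : ∃ d, d ≠ 0 ∧ HasDerivAt f d s := ⟨_, hd0, C.hasDerivAt_sum hs h⟩
  have h1 : p s 0 + q s 0 ≠ X 0 + Y 0 := fun e => m1 ⟨hfd, e⟩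
  have h2 : ∀ r : ℚ, κ r ≠ κ s → om (dir (κ r)) (p s + q s) ≠ om (dir (κ r)) (p r + q r) := by
    intro r hr e
    refine m2 r ⟨⟨_, ?_, C.hasDerivAt_sum_om hs hκ h _⟩, e⟩
    refine mul_ne_zero hd0 ?_
    rw [om_dir, dir_zero, dir_one, mul_one]
    exact sub_ne_zero.2 hr.symm
  have h3 : ∀ t ∈ Set.Ioo (-w) w, t ≠ s → NoEdge K κ p q t → p s + q s ≠ p t + q t := by
    intro t ht hts _ e
    have ef : f t = f s := by
      have := congrArg (fun z : Plane => z 0) e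
      simp only [PiLp.add_apply] at this
      exact this.symm
    by_cases hr : ContinuousAt κ t ∧ ∃ ρ, HasDerivAt (fun t => p t 0) ρ t
    · obtain ⟨hκt, ρt, hρt⟩ := hr
      by_cases h0 : ρt = 1 / 2
      · refine m3 ⟨hfd, Or.inr ⟨t, ?_, ef⟩⟩
        have := C.hasDerivAt_sum ht hρt
        rw [h0] at this
        norm_num at this
        exact this
      · exact m4 ⟨(s, t), ⟨⟨hs, hκ, ρ, hρ, h⟩, ⟨ht, hκt, ρt, h0, hρt⟩,
          (hn.slope_ne C hs ht hts).symm, e⟩, rfl⟩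
    · exact m3 ⟨hfd, Or.inl ⟨t, ⟨ht, hr⟩, ef⟩⟩
  obtain ⟨t, tx, ty⟩ := exists_tan_of_not_ov hK hov hx (by rwa [add_sub_cancel])
  rw [add_sub_cancel] at ty
  rcases le_total 0 (t 0) with h0 | h0
  · exact Or.inl (C.nonDouble_aux F hδ hs hn hM h1 h2 h3 hx hy hxy h0 tx ty)
  · right
    have := C.nonDouble_aux F hδ hs hn hM h1 h2 h3 hy hx (by rw [add_comm, hxy])
      (t := -t) (by simpa using h0) ty (by simpa using tx)
    rw [this, add_comm] at hxy
    exact add_left_cancel hxy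

end Chart


lemma Twins.sig_neg {K L : Set Plane} (T : Twins K L) {x : Plane} (h : Reg K x)
    (hde : Ov K (x + yv K x) ∨ Ov K (yv K x + -x)) : Sig K L (-x) ↔ Sig K L x := by
  have hy : ∀ M : Set Plane, yv M (-x) = - yv M x := fun M => by rw [yv, yv, neg_neg]; abel
  have hl : ∀ M : Set Plane, lo M (-x) = lo M x + (x + yv M x) := fun M => by rw [yv]; abel
  rcases hde with hd | he
  · have key : ∀ M : Set Plane, Body M → Reg M x → Ov M (x + yv M x) →
        (s13 M (-x) ↔ ¬ s13 M x) := by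
      intro M hM hr ho
      rw [s13, hy, hl, show lo M x + (x + yv M x) + (-x + -yv M x) = lo M x by abel]
      exact (hr.para hM).diag_low_symm hM ho
    have hdL : Ov L (x + yv L x) := by rw [T.yv_eq h]; exact (T.ov_iff _).1 hd
    rw [T.sig_iff h hd, T.sig_iff h.neg (by
      rw [hy, show -x + -yv K x = -(x + yv K x) by abel]; exact hd.neg),
      key K T.bK h hd, key L T.bL (T.reg h) hdL]
    tauto
  · have key : ∀ M : Set Plane, Body M → Reg M x → Ov M (yv M x + -x) →
        (s24 M (-x) ↔ ¬ s24 M x) := by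
      intro M hM hr ho
      have := (hr.para hM).reindex.diag_low_symm hM ho
      rw [s24, hy, hl, show lo M x + (x + yv M x) + -x + (-yv M x + - -x) = lo M x + x by abel,
        show lo M x + (x + yv M x) + -x = lo M x + x + (yv M x + -x) by abel]
      exact this
    have heL : Ov L (yv L x + -x) := by rw [T.yv_eq h]; exact (T.ov_iff _).1 he
    rw [T.sig_iff' h he, T.sig_iff' h.neg (by
      rw [hy, show -yv K x + - -x = -(yv K x + -x) by abel]; exact he.neg),
      key K T.bK h he, key L T.bL (T.reg h) heL]
    tauto

lemma Twins.sig_share_of_om_ne {K L : Set Plane} (T : Twins K L) {p pb τ p' pb' τ' q q' : Plane}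
    (h : Good K p pb τ) (h' : Good K p' pb' τ') (hτ : om τ τ' ≠ 0) (hl : Low K p q) (hqp : q ≠ p)
    (hqb : q ≠ pb) (hl' : Low K p' q') (hqp' : q' ≠ p') (hqb' : q' ≠ pb') :
    Sig K L (q - p) ↔ Sig K L (q' - p') := by
  refine T.sig_share h h' ?_ ?_ ?_ hl hqp hqb hl' hqp' hqb'
  · rintro rfl; exact hτ (h.smooth _ _ h.tan h'.tan)
  · rintro rfl
    have := h'.smooth _ _ h.tanb h'.tan
    rw [om_neg_left] at this
    exact hτ (by linarith)
  · rintro rfl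
    have := h.smooth _ _ h.tan h'.tanb
    rw [om_neg_right] at this
    exact hτ (by linarith)

/-- A generic point of the chart at which the derivative differs from one half. -/
structure Nice (K : Set Plane) (w : ℝ) (κ : ℝ → ℝ) (p q : ℝ → Plane) (s ρ : ℝ) : Prop where
  mem : s ∈ Set.Ioo (-w) w
  noEdge : NoEdge K κ p q s
  cont : ContinuousAt κ s
  deriv : HasDerivAt (fun t => p t 0) ρ s
  nonDouble : ∀ x ∈ K, ∀ y ∈ K, x + y = p s + q s → ¬ Ov K (y - x) → x = p s ∨ x = q s

section Nice

variable {K L : Set Plane} {w : ℝ} {δ κ : ℝ → ℝ} {p q p' q' : ℝ → Plane} {s ρ : ℝ}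

lemma Nice.good (N : Nice K w κ p q s ρ) (C : Chart K w κ p q) (hρ : 0 < ρ) :
    Good K (p s) (q s) (dir (κ s)) :=
  ⟨C.base N.mem N.cont N.deriv hρ N.noEdge, N.nonDouble⟩

lemma Nice.neg (N : Nice K w κ p q s ρ) (C : Chart K w κ p q) :
    Nice (-K) w κ (fun s => -q s) (fun s => -p s) s (1 - ρ) where
  mem := N.mem
  noEdge := N.noEdge.neg
  cont := N.cont
  deriv := C.hasDerivAt_neg N.mem N.deriv
  nonDouble := by
    intro x hx y hy hxy ho
    rcases N.nonDouble (-x) hx (-y) hy (by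
      rw [← neg_add, hxy]; abel) (by
      rw [show -y - -x = -(y - x) by abel, ov_neg_iff]; rwa [ov_neg_set] at ho) with h | h
    · right; rw [← h, neg_neg]
    · left; rw [← h, neg_neg]

lemma Twins.deriv_le (T : Twins K L) (hm : MonotoneOn κ (Set.Ioo (-w) w))
    (C : Chart K w κ p q) (C' : Chart L w κ p' q')
    (N : Nice K w κ p q s ρ) (hn' : NoEdge L κ p' q' s) {ρ' : ℝ}
    (h' : HasDerivAt (fun t => p' t 0) ρ' s) (hsub : p' s 1 - q' s 1 = p s 1 - q s 1)
    (hsig : ∀ z, Good K (p s) (q s) (dir (κ s)) → Low K (p s) z → z ≠ p s → z ≠ q s →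
      Sig K L (z - p s)) : ρ ≤ ρ' := by
  by_contra hlt
  push Not at hlt
  have hs := N.mem
  have h0 := C'.deriv_nonneg hs h'
  have h1 := C.deriv_le_one hs N.deriv
  have G := N.good C (by linarith)
  have hv := G.toBase.pos T.bK
  set v := q s - p s with hvdef
  have eK : p s + v = q s := by rw [hvdef]; abel
  have eL : p' s + v = q' s := by
    have e1 := C.sub s hs
    have e2 := C'.sub s hs
    apply plane_ext <;> simp [hvdef] <;> linarith
  obtain ⟨r, hr, hl⟩ := exists_slopes hm hs N.cont hv
    (fun t ht hts => N.noEdge.slope_ne C hs ht hts)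
  have C₁ := C.curve hm hs N.cont N.deriv hv hr
  have C₁' := C'.curve hm hs N.cont h' hv hr
  have C₃ := C.neg.curve hm hs N.cont (C.hasDerivAt_neg hs N.deriv) hv hr
  have C₃' := C'.neg.curve hm hs N.cont (C'.hasDerivAt_neg hs h') hv hr
  have setK : {z | -q s + z ∈ -K} = {z | p s + v - z ∈ K} := by
    ext z; simp only [Set.mem_ofPred_eq, Set.mem_neg, eK]
    rw [show -(-q s + z) = q s - z by abel]
  have setL : {z | -q' s + z ∈ -L} = {z | p' s + v - z ∈ L} := by
    ext z; simp only [Set.mem_ofPred_eq, Set.mem_neg, eL]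
    rw [show -(-q' s + z) = q' s - z by abel]
  rw [setK] at C₃
  rw [setL] at C₃'
  have bL := C'.base_neg hs N.cont h' (by linarith) hn'
  have mid : p' s + (1 / 2 : ℝ) • v ∈ interior L := by
    have := bL.seg_interior T.bL (β := 1 / 2) (by norm_num) (by norm_num)
    rw [← eL] at this
    convert this using 1
    module
  obtain ⟨z, z1, z2, z3, z4⟩ := T.exists_not_sig (o := p s) (o' := p' s) (v := v)
    (τ := dir (κ s)) (by rw [eK]; exact G) (C'.memp s hs) (by rw [eL]; exact C'.memq s hs)
    (C'.tan hs) (by rw [eL]; exact C'.tan_neg hs) (hn'.exposed C' hs)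
    (by rw [eL]; exact hn'.exposed_neg C' hs) mid hl C₁ C₃ C₁' C₃' h0 hlt h1
    (fun h => by rw [eK]; exact C.base_neg hs N.cont N.deriv h N.noEdge)
  rw [eK] at z3
  exact z4 (hsig z G z1 z2 z3)

lemma Twins.deriv_eq (T : Twins K L) (hm : MonotoneOn κ (Set.Ioo (-w) w))
    (C : Chart K w κ p q) (C' : Chart L w κ p' q')
    (N : Nice K w κ p q s ρ) (hn' : NoEdge L κ p' q' s) {ρ' : ℝ}
    (h' : HasDerivAt (fun t => p' t 0) ρ' s) (hsub : p' s 1 - q' s 1 = p s 1 - q s 1)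
    (hsig : ∀ o ob τ z, Good K o ob τ → om τ (dir (κ s)) = 0 → Low K o z → z ≠ o → z ≠ ob →
      Sig K L (z - o)) : ρ' = ρ := by
  refine le_antisymm ?_ (T.deriv_le hm C C' N hn' h' hsub fun z G => hsig _ _ _ z G (om_self _))
  have key := T.neg_left.neg_right.deriv_le hm C.neg C'.neg (N.neg C) hn'.neg
    (C'.hasDerivAt_neg N.mem h') (by simp; linarith) (fun z G hz1 hz2 hz3 => by
      have GK : Good K (q s) (p s) (-dir (κ s)) := by
        refine ⟨?_, fun x hx y hy hxy ho =>
          (N.nonDouble x hx y hy (by rw [hxy, add_comm]) ho).symm⟩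
        have := G.toBase.neg_set
        simpa using this
      have hlow : Low K (q s) (-z) := by rw [← low_neg]; simpa using hz1
      have n1 : -z ≠ q s := fun h => hz2 (by rw [← h, neg_neg])
      have n2 : -z ≠ p s := fun h => hz3 (by rw [← h, neg_neg])
      have hs1 := hsig _ _ _ _ GK (by rw [om_neg_left, om_self, neg_zero]) hlow n1 n2
      obtain ⟨hr, -, hde⟩ := GK.ov_diag T.bK T.balK hlow n1 n2
      rw [← T.sig_neg hr hde] at hs1
      have e : -(-z - q s) = z - -q s := by abel
      rw [e] at hs1
      have hr' : Reg K (z - -q s) := by rw [← e]; exact hr.neg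
      have hy : ∀ M : Set Plane, ∀ x, yv M (-x) = - yv M x := fun M x => by
        rw [yv, yv, neg_neg]; abel
      have hde' : Ov K ((z - -q s) + yv K (z - -q s)) ∨ Ov K (yv K (z - -q s) + -(z - -q s)) := by
        rw [← e, hy]
        rcases hde with h | h
        · left
          rw [← neg_add]; exact h.neg
        · right
          rw [← neg_add]; exact h.neg
      exact (T.sig_neg_neg hr' hde').2 hs1)
  linarith

lemma NoEdge.transfer {K L : Set Plane} (h : ∀ p ∈ L, ∀ q ∈ L, ∃ p' ∈ K, p' + (q - p) ∈ K)
    (hn : NoEdge K κ p q s) (hsub : p' s 1 - q' s 1 = p s 1 - q s 1) : NoEdge L κ p' q' s := by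
  intro x hx y hy hxy
  obtain ⟨z, hz, hz'⟩ := h y hy x hx
  have := hn _ hz' z hz (by simp; rw [hxy, hsub])
  simpa using this

/-- Up to a reflection the derivatives of the charts of twins agree. -/
theorem Twins.ae_deriv (T : Twins K L) (F : Floor K w δ κ) (C : Chart K w κ p q)
    (hδ : ∀ s ∈ Set.Ioo (-w) w, p s 1 - q s 1 = δ s) (C' : Chart L w κ p' q')
    (hδ' : ∀ s ∈ Set.Ioo (-w) w, p' s 1 - q' s 1 = δ s)
    {p'' q'' : ℝ → Plane} (C'' : Chart (-L) w κ p'' q'')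
    (hδ'' : ∀ s ∈ Set.Ioo (-w) w, p'' s 1 - q'' s 1 = δ s) :
    (∀ᵐ s : ℝ, s ∈ Set.Ioo (-w) w → NoEdge K κ p q s → ∀ ρ ρ', HasDerivAt (fun t => p t 0) ρ s →
      HasDerivAt (fun t => p' t 0) ρ' s → ρ ≠ 1 / 2 → ρ' = ρ) ∨
    (∀ᵐ s : ℝ, s ∈ Set.Ioo (-w) w → NoEdge K κ p q s → ∀ ρ ρ', HasDerivAt (fun t => p t 0) ρ s →
      HasDerivAt (fun t => p'' t 0) ρ' s → ρ ≠ 1 / 2 → ρ' = ρ) := by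
  have hdiff : ∀ x ∈ L, ∀ y ∈ L, ∃ z ∈ K, z + (y - x) ∈ K := fun x hx y hy =>
    T.symm.exists_diff hx hy
  by_cases hall : ∀ s ρ, Nice K w κ p q s ρ → ∀ o ob τ z, Good K o ob τ →
      om τ (dir (κ s)) = 0 → Low K o z → z ≠ o → z ≠ ob → Sig K L (z - o)
  · left
    filter_upwards [C.ae_regular F.mono, C.ae_nonDouble T.bK F hδ] with s h1 h2 hs hn ρ ρ' h h' hρ
    have hsub : p' s 1 - q' s 1 = p s 1 - q s 1 := by rw [hδ s hs, hδ' s hs]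
    have N : Nice K w κ p q s ρ := ⟨hs, hn, (h1 hs).1, h, h2 hs hn (h1 hs).1 ρ h hρ⟩
    exact T.deriv_eq F.mono C C' N (hn.transfer hdiff hsub) h' hsub (hall s ρ N)
  · right
    push Not at hall
    obtain ⟨s₀, ρ₀, N₀, o₀, ob₀, τ₀, z₀, G₀, hτ₀, hz₀, hz₀', hz₀'', hsig⟩ := hall
    have hs₀ : ∀ᵐ s : ℝ, s ≠ s₀ :=
      measure_eq_zero_iff_ae_notMem.1 ((Set.countable_singleton s₀).measure_zero volume)
    filter_upwards [C.ae_regular F.mono, C.ae_nonDouble T.bK F hδ, hs₀]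
      with s h1 h2 hss hs hn ρ ρ' h h' hρ
    have hsub : p'' s 1 - q'' s 1 = p s 1 - q s 1 := by rw [hδ s hs, hδ'' s hs]
    have N : Nice K w κ p q s ρ := ⟨hs, hn, (h1 hs).1, h, h2 hs hn (h1 hs).1 ρ h hρ⟩
    exact T.neg_right.deriv_eq F.mono C C'' N
      (hn.transfer (fun x hx y hy => T.neg_right.symm.exists_diff hx hy) hsub) h' hsub (fun o ob τ z G hτ hz hz' hz'' => by
        obtain ⟨hr, -, hde⟩ := G.ov_diag T.bK T.balK hz hz' hz''
        rw [T.sig_neg_right hr hde]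
        have hom : om τ₀ τ ≠ 0 := by
          obtain ⟨a, ha⟩ := exists_smul_of_om_eq_zero (dir_ne_zero (κ s))
            (by rw [om_comm, hτ, neg_zero])
          obtain ⟨b, hb⟩ := exists_smul_of_om_eq_zero (dir_ne_zero (κ s₀))
            (by rw [om_comm, hτ₀, neg_zero])
          have ha0 : a ≠ 0 := by rintro rfl; exact G.tan.1 (by rw [ha, zero_smul])
          have hb0 : b ≠ 0 := by rintro rfl; exact G₀.tan.1 (by rw [hb, zero_smul])
          rw [ha, hb, om_smul_left, om_smul_right, om_dir, dir_zero, dir_one, mul_one]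
          exact mul_ne_zero hb0 (mul_ne_zero ha0
            (sub_ne_zero.2 (N₀.noEdge.slope_ne C N₀.mem hs hss)))
        rw [← T.sig_share_of_om_ne G₀ G hom hz₀ hz₀' hz₀'' hz hz' hz'']
        exact hsig)

end Nice


/-- Endpoints of the two faces of `K` of slope `c`: the lower face runs from `a'` to `a`, the
upper one from `b'` to `b`. -/
structure Faces (K : Set Plane) (c : ℝ) (a a' b b' : Plane) : Prop where
  mema : a ∈ K
  mema' : a' ∈ K
  memb : b ∈ K
  memb' : b' ∈ K
  tana : Tan K a (dir c)
  tana' : Tan K a' (dir c)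
  tanb : Tan K b (-dir c)
  tanb' : Tan K b' (-dir c)
  low : ∀ k ∈ K, Tan K k (dir c) → a' 0 ≤ k 0 ∧ k 0 ≤ a 0
  high : ∀ k ∈ K, Tan K k (-dir c) → b' 0 ≤ k 0 ∧ k 0 ≤ b 0

lemma exists_face {K : Set Plane} (hK : Body K) {τ : Plane} (hτ : τ ≠ 0) :
    ∃ a ∈ K, ∃ a' ∈ K, Tan K a τ ∧ Tan K a' τ ∧ ∀ k ∈ K, Tan K k τ → a' 0 ≤ k 0 ∧ k 0 ≤ a 0 := by
  obtain ⟨x, hx, hmin⟩ := hK.comp.exists_isMinOn hK.nonempty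
    (by fun_prop : Continuous fun z => om τ z).continuousOn
  have hmin' : ∀ k ∈ K, om τ x ≤ om τ k := fun k hk => hmin hk
  have hc : IsCompact (K ∩ {z | om τ z = om τ x}) :=
    hK.comp.inter_right (isClosed_eq (by fun_prop) continuous_const)
  have htan : ∀ z ∈ K, om τ z = om τ x → Tan K z τ := fun z hz h => ⟨hτ, fun k hk => by
    rw [om_sub_right, h]; linarith [hmin' k hk]⟩
  obtain ⟨a, ha, hamax⟩ := hc.exists_isMaxOn ⟨x, hx, rfl⟩
    (by fun_prop : Continuous fun z : Plane => z 0).continuousOn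
  obtain ⟨a', ha', hamin⟩ := hc.exists_isMinOn ⟨x, hx, rfl⟩
    (by fun_prop : Continuous fun z : Plane => z 0).continuousOn
  refine ⟨a, ha.1, a', ha'.1, htan a ha.1 ha.2, htan a' ha'.1 ha'.2, fun k hk ht => ?_⟩
  have hk' : k ∈ K ∩ {z | om τ z = om τ x} := by
    refine ⟨hk, le_antisymm ?_ (hmin' k hk)⟩
    have := ht.2 x hx
    rw [om_sub_right] at this
    linarith
  exact ⟨hamin hk', hamax hk'⟩

lemma Body.exists_faces {K : Set Plane} (hK : Body K) (c : ℝ) :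
    ∃ a a' b b', Faces K c a a' b b' := by
  obtain ⟨a, h1, a', h2, h3, h4, h5⟩ := exists_face hK (dir_ne_zero c)
  obtain ⟨b, k1, b', k2, k3, k4, k5⟩ := exists_face hK (neg_ne_zero.2 (dir_ne_zero c))
  exact ⟨a, a', b, b', h1, h2, k1, k2, h3, h4, k3, k4, h5, k5⟩

section Faces

variable {K L : Set Plane} {c : ℝ} {a a' b b' e e' f f' : Plane}

lemma Faces.neg (h : Faces K c a a' b b') : Faces (-K) c (-b') (-b) (-a') (-a) where
  mema := by simpa using h.memb'
  mema' := by simpa using h.memb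
  memb := by simpa using h.mema'
  memb' := by simpa using h.mema
  tana := by simpa using tan_neg.2 h.tanb'
  tana' := by simpa using tan_neg.2 h.tanb
  tanb := by simpa using tan_neg.2 h.tana'
  tanb' := by simpa using tan_neg.2 h.tana
  low := fun k hk ht => by
    have := h.high (-k) hk (by rw [← tan_neg]; simpa using ht)
    simp at this ⊢
    constructor <;> linarith
  high := fun k hk ht => by
    have := h.low (-k) hk (by rw [← tan_neg]; simpa using ht)
    simp at this ⊢
    constructor <;> linarith

lemma om_eq_of_tan {x y τ : Plane} (hx : x ∈ K) (hy : y ∈ K) (tx : Tan K x τ) (ty : Tan K y τ) :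
    om τ (y - x) = 0 := by
  have h1 := tx.2 y hy
  have h2 := ty.2 x hx
  rw [om_sub_right] at *
  linarith

lemma Faces.length_le (h : Faces K c a a' b b') (h' : Faces L c e e' f f')
    (hE : ∀ x, Edge K x → Edge L x) : a 0 - a' 0 ≤ e 0 - e' 0 := by
  have hle := (h'.low e h'.mema h'.tana).1
  rcases ((h.low a h.mema h.tana).1).eq_or_lt with h0 | h0
  · linarith
  set d := a 0 - a' 0 with hd
  have hd0 : 0 < d := by linarith
  have haa : a' + d • dir c = a := by
    have := om_eq_of_tan h.mema' h.mema h.tana' h.tana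
    rw [om_dir] at this
    simp only [PiLp.sub_apply] at this
    apply plane_ext
    · simp [dir_zero, hd]
    · simp only [PiLp.add_apply, PiLp.smul_apply, dir_one, smul_eq_mul]; linarith
  obtain ⟨x, hx, hx', hx''⟩ := hE (d • dir c) ⟨a', h.mema', by rw [haa]; exact h.mema,
    fun k hk => by rw [om_smul_left]; exact mul_nonneg hd0.le (h.tana'.2 k hk)⟩
  have tx : Tan L x (dir c) := ⟨dir_ne_zero c, fun k hk => by
    have := hx'' k hk
    rw [om_smul_left] at this
    exact nonneg_of_mul_nonneg_right this hd0⟩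
  have tx' : Tan L (x + d • dir c) (dir c) := ⟨dir_ne_zero c, fun k hk => by
    have := tx.2 k hk
    rw [om_sub_right] at this ⊢
    rw [om_add_right, om_smul_right, om_self]
    linarith⟩
  have e1 := (h'.low x hx tx).1
  have e2 := (h'.low _ hx' tx').2
  simp [dir_zero] at e2
  linarith

lemma Faces.length_eq (hb : Bal K) (h : Faces K c a a' b b') : a 0 - a' 0 = b 0 - b' 0 := by
  have h1 := h.length_le h.neg fun x hx => edge_neg_set.2 (hb x hx)
  have h2 := h.neg.length_le h fun x hx => by simpa using hb _ (edge_neg_set.1 hx)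
  simp at h1 h2
  linarith

lemma Faces.left_le (h : Faces K c a a' b b') (h' : Faces L c e e' f f')
    (hD : ∀ x ∈ K, ∀ y ∈ K, ∃ z ∈ L, z + (y - x) ∈ L)
    (hD' : ∀ x ∈ L, ∀ y ∈ L, ∃ z ∈ K, z + (y - x) ∈ K) : e' 0 - f 0 ≤ a' 0 - b 0 := by
  obtain ⟨z, hz, hz'⟩ := hD b h.memb a' h.mema'
  obtain ⟨u, hu, hu'⟩ := hD' f h'.memb e' h'.mema'
  have k1 := h.tana'.2 _ hu'
  have k2 := h.tanb.2 _ hu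
  have k3 := h'.tana'.2 _ hz'
  have k4 := h'.tanb.2 _ hz
  simp only [om_neg_left, om_sub_right, om_add_right] at k1 k2 k3 k4
  have e1 : om (dir c) (z + (a' - b)) = om (dir c) e' := by
    rw [om_add_right, om_sub_right]; linarith
  have e2 : om (dir c) z = om (dir c) f := by linarith
  have t1 : Tan L (z + (a' - b)) (dir c) := ⟨dir_ne_zero c, fun k hk => by
    have := h'.tana'.2 k hk
    rw [om_sub_right] at this ⊢
    rw [e1]; exact this⟩
  have t2 : Tan L z (-dir c) := ⟨neg_ne_zero.2 (dir_ne_zero c), fun k hk => by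
    have := h'.tanb.2 k hk
    rw [om_neg_left, om_sub_right] at this ⊢
    rw [e2]; exact this⟩
  have r1 := (h'.low _ hz' t1).1
  have r2 := (h'.high z hz t2).2
  simp at r1
  linarith

lemma Faces.coord {w : ℝ} {δ κ : ℝ → ℝ} {p q : ℝ → Plane} (hK : Body K) (C : Chart K w κ p q)
    (hδ : ∀ s ∈ Set.Ioo (-w) w, p s 1 - q s 1 = δ s)
    (hmax : ∀ s ∈ Set.Ioo (-w) w, ∀ x ∈ K, ∀ y ∈ K, x 0 - y 0 = s → x 1 - y 1 = δ s →
      x 0 ≤ p s 0) {s : ℝ} (hs : s ∈ Set.Ioo (-w) w) (h : Faces K (κ s) a a' b b') :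
    p s 0 = min (a 0) (s + b 0) := by
  have e := C.sub s hs
  have r1 := (h.low _ (C.memp s hs) (C.tan hs)).2
  have r2 := (h.high _ (C.memq s hs) (C.tan_neg hs)).2
  refine le_antisymm (le_min r1 (by linarith)) ?_
  set m := min (a 0) (s + b 0) with hm
  have m1 : m ≤ a 0 := min_le_left _ _
  have m2 : m ≤ s + b 0 := min_le_right _ _
  by_contra hcon
  push Not at hcon
  have l1 := om_eq_of_tan (C.memp s hs) h.mema (C.tan hs) h.tana
  have l2 := om_eq_of_tan (C.memq s hs) h.memb (C.tan_neg hs) h.tanb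
  rw [om_neg_left] at l2
  simp only [om_dir, PiLp.sub_apply] at l1 l2
  have hx : (!₂[m, p s 1 + κ s * (m - p s 0)] : Plane) ∈ K :=
    convex_coord hK.conv (c := κ s) (C.memp s hs) h.mema (by simpa using hcon.le)
      (by simpa using m1) (by linarith) (by simp)
  have hy : (!₂[m - s, q s 1 + κ s * (m - p s 0)] : Plane) ∈ K :=
    convex_coord hK.conv (c := κ s) (C.memq s hs) h.memb (by simp; linarith)
      (by simp; linarith) (by linarith) (by
        simp only [Matrix.cons_val_zero, Matrix.cons_val_one]
        rw [show m - s - q s 0 = m - p s 0 by linarith]; simp)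
  have := hmax s hs _ hx _ hy (by simp) (by simp [hδ s hs])
  simp only [Matrix.cons_val_zero] at this
  linarith

end Faces

section Final

variable {K L : Set Plane} {w : ℝ} {δ κ : ℝ → ℝ} {p q p' q' : ℝ → Plane}

lemma Twins.flat_eq (T : Twins K L) (C : Chart K w κ p q) (C' : Chart L w κ p' q')
    (hδ : ∀ s ∈ Set.Ioo (-w) w, p s 1 - q s 1 = δ s)
    (hδ' : ∀ s ∈ Set.Ioo (-w) w, p' s 1 - q' s 1 = δ s)
    (hmax : ∀ s ∈ Set.Ioo (-w) w, ∀ x ∈ K, ∀ y ∈ K, x 0 - y 0 = s → x 1 - y 1 = δ s →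
      x 0 ≤ p s 0)
    (hmax' : ∀ s ∈ Set.Ioo (-w) w, ∀ x ∈ L, ∀ y ∈ L, x 0 - y 0 = s → x 1 - y 1 = δ s →
      x 0 ≤ p' s 0) {s t : ℝ} (hs : s ∈ Set.Ioo (-w) w) (ht : t ∈ Set.Ioo (-w) w)
    (hst : κ s = κ t) : p' s 0 - p s 0 = p' t 0 - p t 0 := by
  obtain ⟨a, a', b, b', h⟩ := T.bK.exists_faces (κ s)
  obtain ⟨e, e', f, f', h'⟩ := T.bL.exists_faces (κ s)
  have l1 := h.length_eq T.balK
  have l2 := h'.length_eq T.balL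
  have l3 := h.length_le h' fun x => T.edge_iff.1
  have l4 := h'.length_le h fun x => T.edge_iff.2
  have l5 := h.left_le h' (fun x hx y hy => T.exists_diff hx hy)
    (fun x hx y hy => T.symm.exists_diff hx hy)
  have l6 := h'.left_le h (fun x hx y hy => T.symm.exists_diff hx hy)
    (fun x hx y hy => T.exists_diff hx hy)
  rw [h.coord T.bK C hδ hmax hs, h'.coord T.bL C' hδ' hmax' hs]
  rw [hst] at h h'
  rw [h.coord T.bK C hδ hmax ht, h'.coord T.bL C' hδ' hmax' ht]
  have key : ∀ u, min (e 0) (u + f 0) - min (a 0) (u + b 0) = f 0 - b 0 := by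
    intro u
    have h1 : min (e 0) (u + f 0) = min (e 0 - f 0) u + f 0 := by
      rw [← min_add_add_right]; congr 1; ring
    have h2 : min (a 0) (u + b 0) = min (a 0 - b 0) u + b 0 := by
      rw [← min_add_add_right]; congr 1; ring
    rw [h1, h2, show e 0 - f 0 = a 0 - b 0 by linarith]; ring
  rw [key, key]

lemma eq_of_lipschitzOnWith_of_ae_deriv_eq_zero {g : ℝ → ℝ} {s t : ℝ} (hst : s ≤ t) {c : NNReal}
    (hl : LipschitzOnWith c g (Set.Icc s t))
    (hd : ∀ᵐ u : ℝ, u ∈ Set.Icc s t → HasDerivAt g 0 u) : g s = g t := by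
  have hac : AbsolutelyContinuousOnInterval g s t :=
    LipschitzOnWith.absolutelyContinuousOnInterval (by rwa [Set.uIcc_of_le hst])
  have h1 := hac.integral_deriv_eq_sub
  have h2 : ∫ x in s..t, deriv g x = ∫ x in s..t, (0:ℝ) := by
    refine intervalIntegral.integral_congr_ae ?_
    filter_upwards [hd] with u hu hmem
    rw [Set.uIoc_of_le hst] at hmem
    exact (hu ⟨hmem.1.le, hmem.2⟩).deriv
  rw [h2] at h1
  simp at h1
  linarith

lemma Chart.lipschitzOnWith (C : Chart K w κ p q) :
    LipschitzOnWith 1 (fun t => p t 0) (Set.Ioo (-w) w) := by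
  refine LipschitzOnWith.of_dist_le_mul fun s hs t ht => ?_
  rw [Real.dist_eq, Real.dist_eq]
  simpa using C.lip ht hs

lemma Chart.exists_coord (F : Floor K w δ κ) (C : Chart K w κ p q) {k : Plane}
    (hk : k ∈ interior K) : ∃ s ∈ Set.Ioo (-w) w, p s 0 = k 0 := by
  obtain ⟨X, hX, Y, hY, hXY⟩ := F.attained
  have hlt : Y 0 < k 0 ∧ k 0 < X 0 := by
    obtain ⟨ε, hε, h⟩ := exists_pos_smul_interior hk (dir 0)
    have h1 := F.wide _ (interior_subset (h ε (by rw [abs_of_pos hε]))) Y hY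
    have h2 := F.wide X hX _ (interior_subset (h (-ε) (by rw [abs_neg, abs_of_pos hε])))
    simp [dir_zero] at h1 h2
    constructor <;> linarith
  set s := k 0 - X 0
  set t := k 0 - Y 0
  have hs : s ∈ Set.Ioo (-w) w := ⟨by linarith, by linarith [F.pos]⟩
  have ht : t ∈ Set.Ioo (-w) w := ⟨by linarith [F.pos], by linarith⟩
  have hst : s ≤ t := by linarith [F.pos]
  have e1 := C.sub s hs
  have e2 := C.sub t ht
  have w1 := F.wide _ (C.memq s hs) Y hY
  have w2 := F.wide X hX _ (C.memq t ht)
  have hsub : Set.Icc s t ⊆ Set.Ioo (-w) w := fun u hu =>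
    ⟨hs.1.trans_le hu.1, hu.2.trans_lt ht.2⟩
  obtain ⟨u, hu, hu'⟩ := intermediate_value_Icc hst (C.lipschitzOnWith.continuousOn.mono hsub)
    (show k 0 ∈ Set.Icc (p s 0) (p t 0) from ⟨by linarith, by linarith⟩)
  exact ⟨u, hsub hu, hu'⟩

lemma Chart.subset_translate (hK : Body K) (hL : Body L) (F : Floor K w δ κ)
    (Fn : Floor (-K) w δ κ) (C : Chart K w κ p q) {v : Plane}
    (hp : ∀ s ∈ Set.Ioo (-w) w, p s + v ∈ L) (hq : ∀ s ∈ Set.Ioo (-w) w, q s + v ∈ L) :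
    ∀ k ∈ K, k + v ∈ L := by
  have hinter : ∀ k ∈ interior K, k + v ∈ L := by
    intro k hk
    obtain ⟨s, hs, hps⟩ := C.exists_coord F hk
    obtain ⟨t, ht, hqt⟩ := C.neg.exists_coord Fn (k := -k) (by
      rw [interior_neg_set]; simpa using hk)
    simp only [PiLp.neg_apply, neg_inj] at hqt
    have h1 := C.tanp s hs k (interior_subset hk)
    have h2 := C.tanq t ht k (interior_subset hk)
    rw [hps, sub_self, mul_zero] at h1
    rw [hqt, sub_self, mul_zero] at h2
    rcases (by linarith : p s 1 ≤ q t 1).eq_or_lt with h0 | h0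
    · have : k = p s := plane_ext hps.symm (by linarith)
      rw [this]; exact hp s hs
    have hpos : 0 < q t 1 - p s 1 := by linarith
    have := hL.conv (hp s hs) (hq t ht) (a := (q t 1 - k 1) / (q t 1 - p s 1))
      (b := (k 1 - p s 1) / (q t 1 - p s 1)) (div_nonneg (by linarith) hpos.le)
      (div_nonneg (by linarith) hpos.le) (by field_simp; ring)
    convert this using 1
    apply plane_ext
    · simp only [PiLp.add_apply, PiLp.smul_apply, smul_eq_mul, hps, hqt]; field_simp; ring
    · simp only [PiLp.add_apply, PiLp.smul_apply, smul_eq_mul]; field_simp; ring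
  intro k hk
  rw [← hK.closure_interior] at hk
  exact closure_minimal (t := {k | k + v ∈ L}) hinter
    (hL.comp.isClosed.preimage (by fun_prop : Continuous fun k : Plane => k + v)) hk

lemma Floor.neg (F : Floor K w δ κ) : Floor (-K) w δ κ :=
  F.transfer (L := -K) (fun x hx y hy => ⟨-y, by rw [Set.mem_neg, neg_neg]; exact hy, by
      rw [Set.mem_neg]; convert hx using 1; abel⟩)
    (fun x hx y hy => ⟨-y, hy, by
      have hx' : -x ∈ K := hx
      convert hx' using 1; abel⟩)

/-- Charts with almost everywhere equal derivatives determine the body up to translation. -/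
lemma Twins.translate_of_ae_deriv_eq (T : Twins K L) (F : Floor K w δ κ) (C : Chart K w κ p q)
    (C' : Chart L w κ p' q') (hδ : ∀ s ∈ Set.Ioo (-w) w, p s 1 - q s 1 = δ s)
    (hδ' : ∀ s ∈ Set.Ioo (-w) w, p' s 1 - q' s 1 = δ s)
    (hflat : ∀ s ∈ Set.Ioo (-w) w, ∀ t ∈ Set.Ioo (-w) w, κ s = κ t →
      p' s 0 - p s 0 = p' t 0 - p t 0)
    (hd : ∀ᵐ s : ℝ, s ∈ Set.Ioo (-w) w → NoEdge K κ p q s → ∀ ρ ρ',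
      HasDerivAt (fun t => p t 0) ρ s → HasDerivAt (fun t => p' t 0) ρ' s → ρ' = ρ) :
    ∃ v, L = (fun x => x + v) '' K := by
  have F' : Floor L w δ κ := F.transfer (fun x hx y hy => T.exists_diff hx hy)
    (fun x hx y hy => T.symm.exists_diff hx hy)
  have hsub : ∀ s ∈ Set.Ioo (-w) w, ∀ t ∈ Set.Ioo (-w) w, Set.Icc s t ⊆ Set.Ioo (-w) w :=
    fun s hs t ht u hu => ⟨hs.1.trans_le hu.1, hu.2.trans_lt ht.2⟩
  have hreg := (C.ae_regular F.mono).and (C'.ae_regular F.mono)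
  have hae : ∀ᵐ s : ℝ, s ∈ Set.Ioo (-w) w → HasDerivAt (fun t => p' t 0 - p t 0) 0 s := by
    filter_upwards [hreg, hd] with s hr hds hs
    obtain ⟨-, ρ, hρ⟩ := hr.1 hs
    obtain ⟨-, ρ', hρ'⟩ := hr.2 hs
    have hdiff : HasDerivAt (fun t => p' t 0 - p t 0) (ρ' - ρ) s := hρ'.sub hρ
    by_cases hn : NoEdge K κ p q s
    · rw [hds hs hn ρ ρ' hρ hρ', sub_self] at hdiff
      exact hdiff
    · by_cases h0 : ρ' - ρ = 0
      · rwa [h0] at hdiff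
      exfalso
      obtain ⟨u, hu, hfl⟩ := F.flat C hδ hs hn
      have hev := hdiff.eventually_ne h0 (c := p' s 0 - p s 0)
      rcases lt_or_gt_of_ne hu with hl | hg
      · have h1 := hev.filter_mono (nhdsWithin_mono s (show Set.Iio s ⊆ {s}ᶜ from
          fun x hx => ne_of_lt hx))
        obtain ⟨r, h2, h3⟩ := (h1.and (Ioo_mem_nhdsLT hl)).exists
        obtain ⟨hrI, hκ⟩ := hfl r (Or.inr h3)
        exact h2 (hflat r hrI s hs hκ)
      · have h1 := hev.filter_mono (nhdsWithin_mono s (show Set.Ioi s ⊆ {s}ᶜ from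
          fun x hx => ne_of_gt hx))
        obtain ⟨r, h2, h3⟩ := (h1.and (Ioo_mem_nhdsGT hg)).exists
        obtain ⟨hrI, hκ⟩ := hfl r (Or.inl h3)
        exact h2 (hflat r hrI s hs hκ)
  have hconst : ∀ s ∈ Set.Ioo (-w) w, ∀ t ∈ Set.Ioo (-w) w, s ≤ t →
      p' s 0 - p s 0 = p' t 0 - p t 0 := by
    intro s hs t ht hst
    refine eq_of_lipschitzOnWith_of_ae_deriv_eq_zero (g := fun t => p' t 0 - p t 0) hst
      ((C'.lipschitzOnWith.sub C.lipschitzOnWith).mono (hsub s hs t ht)) ?_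
    filter_upwards [hae] with u hu hmem
    exact hu (hsub s hs t ht hmem)
  have hest : ∀ s ∈ Set.Ioo (-w) w, ∀ t ∈ Set.Ioo (-w) w, s ≤ t →
      |(p' t 1 - p t 1) - (p' s 1 - p s 1)| ≤ (κ t - κ s) * (t - s) := by
    intro s hs t ht hst
    have e := hconst s hs t ht hst
    have a1 := C.height_ge hs ht
    have a2 := C.height_le hs ht
    have b1 := C'.height_ge hs ht
    have b2 := C'.height_le hs ht
    rw [show p' t 0 - p' s 0 = p t 0 - p s 0 by linarith] at b1 b2
    have m1 := C.monop s hs t ht hst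
    have m2 := C.monoq s hs t ht hst
    have m3 := F.mono hs ht hst
    have m4 := C.sub s hs
    have m5 := C.sub t ht
    have m6 := mul_le_mul_of_nonneg_left (by linarith : p t 0 - p s 0 ≤ t - s) (sub_nonneg.2 m3)
    rw [abs_le]
    constructor <;> linarith
  have hheight : ∀ s ∈ Set.Ioo (-w) w, ∀ t ∈ Set.Ioo (-w) w, s ≤ t →
      p' s 1 - p s 1 = p' t 1 - p t 1 := by
    intro s hs t ht hst
    have hκ := F.mono hs ht hst
    refine eq_of_lipschitzOnWith_of_ae_deriv_eq_zero (g := fun t => p' t 1 - p t 1) hst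
      (c := Real.toNNReal (κ t - κ s)) (LipschitzOnWith.of_dist_le_mul ?_) ?_
    · have key : ∀ x ∈ Set.Icc s t, ∀ y ∈ Set.Icc s t, x ≤ y →
          |(p' y 1 - p y 1) - (p' x 1 - p x 1)| ≤ (κ t - κ s) * (y - x) := by
        intro x hx y hy hxy
        have hxI := hsub s hs t ht hx
        have hyI := hsub s hs t ht hy
        have k1 := F.mono hs hxI hx.1
        have k2 := F.mono hyI ht hy.2
        refine (hest x hxI y hyI hxy).trans (mul_le_mul_of_nonneg_right ?_ ?_) <;> linarith
      intro x hx y hy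
      rw [Real.dist_eq, Real.dist_eq, Real.coe_toNNReal _ (by linarith)]
      rcases le_total x y with h | h
      · have := key x hx y hy h
        rw [abs_sub_comm, abs_sub_comm x y, abs_of_nonneg (sub_nonneg.2 h)]
        exact this
      · have := key y hy x hx h
        rw [abs_of_nonneg (sub_nonneg.2 h)]
        exact this
    · filter_upwards [hreg, hae] with u hr hu hmem
      have huI := hsub s hs t ht hmem
      obtain ⟨hκu, ρ, hρ⟩ := hr.1 huI
      obtain ⟨-, ρ', hρ'⟩ := hr.2 huI
      have h0 := (hρ'.sub hρ).unique (hu huI)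
      have := (C'.hasDerivAt_height huI hκu hρ').sub (C.hasDerivAt_height huI hκu hρ)
      rw [← mul_sub, h0, mul_zero] at this
      exact this
  have h0I : (0:ℝ) ∈ Set.Ioo (-w) w := ⟨by linarith [F.pos], F.pos⟩
  set v := p' 0 - p 0 with hv
  have hp : ∀ s ∈ Set.Ioo (-w) w, p' s = p s + v := by
    intro s hs
    have e0 : p' s 0 - p s 0 = p' 0 0 - p 0 0 := by
      rcases le_total s 0 with h | h
      · exact hconst s hs 0 h0I h
      · exact (hconst 0 h0I s hs h).symm
    have e1 : p' s 1 - p s 1 = p' 0 1 - p 0 1 := by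
      rcases le_total s 0 with h | h
      · exact hheight s hs 0 h0I h
      · exact (hheight 0 h0I s hs h).symm
    apply plane_ext <;> simp [hv] <;> linarith
  have hq : ∀ s ∈ Set.Ioo (-w) w, q' s = q s + v := by
    intro s hs
    have e := hp s hs
    have d0 := C.sub s hs
    have d0' := C'.sub s hs
    have d1 := hδ s hs
    have d1' := hδ' s hs
    rw [e] at d0' d1'
    simp only [PiLp.add_apply] at d0' d1'
    apply plane_ext <;> simp only [PiLp.add_apply] <;> linarith
  refine ⟨v, Set.Subset.antisymm (fun x hx => ?_) ?_⟩
  · refine ⟨x + -v, C'.subset_translate T.bL T.bK F' F'.neg ?_ ?_ x hx, by simp⟩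
    · intro s hs; rw [hp s hs, add_neg_cancel_right]; exact C.memp s hs
    · intro s hs; rw [hq s hs, add_neg_cancel_right]; exact C.memq s hs
  · rintro _ ⟨x, hx, rfl⟩
    refine C.subset_translate T.bK T.bL F F.neg ?_ ?_ x hx
    · intro s hs; rw [← hp s hs]; exact C'.memp s hs
    · intro s hs; rw [← hq s hs]; exact C'.memq s hs

/-- The two-sided comparison of derivatives. -/
lemma Twins.translate_of_ae_half (T : Twins K L) (F : Floor K w δ κ) (C : Chart K w κ p q)
    (C' : Chart L w κ p' q') (hδ : ∀ s ∈ Set.Ioo (-w) w, p s 1 - q s 1 = δ s)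
    (hδ' : ∀ s ∈ Set.Ioo (-w) w, p' s 1 - q' s 1 = δ s)
    (hflat : ∀ s ∈ Set.Ioo (-w) w, ∀ t ∈ Set.Ioo (-w) w, κ s = κ t →
      p' s 0 - p s 0 = p' t 0 - p t 0)
    (hd : ∀ᵐ s : ℝ, s ∈ Set.Ioo (-w) w → NoEdge K κ p q s → ∀ ρ ρ',
      HasDerivAt (fun t => p t 0) ρ s → HasDerivAt (fun t => p' t 0) ρ' s → ρ ≠ 1 / 2 → ρ' = ρ) :
    ∃ v, L = (fun x => x + v) '' K := by
  have F' : Floor L w δ κ := F.transfer (fun x hx y hy => T.exists_diff hx hy)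
    (fun x hx y hy => T.symm.exists_diff hx hy)
  refine T.translate_of_ae_deriv_eq F C C' hδ hδ' hflat ?_
  have htr : ∀ s ∈ Set.Ioo (-w) w, NoEdge K κ p q s → NoEdge L κ p' q' s := fun s hs hn =>
    hn.transfer (fun x hx y hy => T.symm.exists_diff hx hy) (by rw [hδ s hs, hδ' s hs])
  rcases T.symm.ae_deriv F' C' hδ' C hδ C.neg (fun s hs => by simp; linarith [hδ s hs]) with h | h
  · filter_upwards [hd, h] with s h1 h2 hs hn ρ ρ' hρ hρ'
    by_cases h0 : ρ = 1 / 2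
    · by_cases h0' : ρ' = 1 / 2
      · rw [h0, h0']
      · exact (h2 hs (htr s hs hn) ρ' ρ hρ' hρ h0').symm
    · exact h1 hs hn ρ ρ' hρ hρ' h0
  · filter_upwards [hd, h] with s h1 h2 hs hn ρ ρ' hρ hρ'
    by_cases h0 : ρ = 1 / 2
    · by_cases h0' : ρ' = 1 / 2
      · rw [h0, h0']
      · have := h2 hs (htr s hs hn) ρ' (1 - ρ) hρ' (C.hasDerivAt_neg hs hρ) h0'
        linarith
    · exact h1 hs hn ρ ρ' hρ hρ' h0

/-- Balanced convex bodies are determined by their covariograms. -/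
theorem Twins.translate_or_reflect (T : Twins K L) :
    (∃ v, L = (fun x => x + v) '' K) ∨ ∃ v, L = (fun x => x + v) '' (-K) := by
  obtain ⟨w, δ, κ, F⟩ := T.bK.exists_floor
  have F' : Floor L w δ κ := F.transfer (fun x hx y hy => T.exists_diff hx hy)
    (fun x hx y hy => T.symm.exists_diff hx hy)
  obtain ⟨p, q, C, hδ, hmax⟩ := F.exists_chart T.bK
  obtain ⟨p', q', C', hδ', hmax'⟩ := F'.exists_chart T.bL
  obtain ⟨p'', q'', C'', hδ'', hmax''⟩ := F'.neg.exists_chart T.bL.neg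
  rcases T.ae_deriv F C hδ C' hδ' C'' hδ'' with h | h
  · left
    exact T.translate_of_ae_half F C C' hδ hδ'
      (fun s hs t ht hst => T.flat_eq C C' hδ hδ' hmax hmax' hs ht hst) h
  · right
    obtain ⟨v, hv⟩ := T.neg_right.translate_of_ae_half F C C'' hδ hδ''
      (fun s hs t ht hst => T.neg_right.flat_eq C C'' hδ hδ'' hmax hmax'' hs ht hst) h
    refine ⟨-v, ?_⟩
    have h2 : L = -((fun x => x + v) '' K) := by rw [← hv, neg_neg]
    rw [h2]
    ext x
    simp only [Set.mem_neg, Set.mem_image]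
    constructor
    · rintro ⟨y, hy, hyx⟩
      exact ⟨-y, by simpa using hy, by rw [← neg_neg x, ← hyx]; abel⟩
    · rintro ⟨y, hy, rfl⟩
      exact ⟨-y, hy, by abel⟩

end Final


lemma countable_edge_aux (K : Set Plane) {x n : Plane} (h : 0 < om x n) :
    {ε : ℝ | Edge K (x + ε • n)}.Countable := by
  classical
  have hch : ∀ ε : {ε : ℝ | Edge K (x + ε • n)}, ∃ p ∈ K, p + (x + (ε:ℝ) • n) ∈ K ∧
      ∀ k ∈ K, 0 ≤ om (x + (ε:ℝ) • n) (k - p) := fun ε => ε.2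
  choose p hp hpx hpl using hch
  rw [← Set.countable_coe_iff]
  refine Pairwise.countable_of_isOpen_disjoint
    (s := fun ε => Set.Ioo (om (p ε) n) (om (p ε) n + om x n)) ?_ (fun ε => isOpen_Ioo)
    (fun ε => Set.nonempty_Ioo.2 (by linarith))
  intro ε ε' hne
  rw [Function.onFun, Set.disjoint_left]
  rintro t ht ht'
  apply hne
  set X := x + (ε:ℝ) • n with hX
  set X' := x + (ε':ℝ) • n with hX'
  have eX : om X n = om x n := by rw [hX, om_add_left, om_smul_left, om_self]; ring
  have eX' : om X' n = om x n := by rw [hX', om_add_left, om_smul_left, om_self]; ring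
  set α := (t - om (p ε) n) / om x n with hα
  set α' := (t - om (p ε') n) / om x n with hα'
  have a0 : 0 < α := div_pos (by linarith [ht.1]) h
  have a1 : α < 1 := (div_lt_one h).2 (by linarith [ht.2])
  have a0' : 0 < α' := div_pos (by linarith [ht'.1]) h
  have a1' : α' < 1 := (div_lt_one h).2 (by linarith [ht'.2])
  set y := p ε + α • X with hy
  set y' := p ε' + α' • X' with hy'
  have ey : om y n = t := by
    rw [hy, om_add_left, om_smul_left, eX, hα]; field_simp; ring
  have ey' : om y' n = t := by
    rw [hy', om_add_left, om_smul_left, eX', hα']; field_simp; ring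
  have hn : n ≠ 0 := by rintro rfl; simp at h
  obtain ⟨β, hβ⟩ := exists_smul_of_om_eq_zero (b := y' - y) hn (by
    rw [om_comm, om_sub_left, ey, ey', sub_self, neg_zero])
  have u1 := hpl ε (p ε') (hp ε')
  have u2 := hpl ε _ (hpx ε')
  have v1 := hpl ε' (p ε) (hp ε)
  have v2 := hpl ε' _ (hpx ε)
  rw [← hX] at u1 u2 v2
  rw [← hX'] at u2 v1 v2
  have z1 : om X (y' - y) = β * om x n := by rw [hβ, om_smul_right, eX]
  have z2 : om X' (y' - y) = β * om x n := by rw [hβ, om_smul_right, eX']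
  have w : om X' X = -om X X' := om_comm _ _
  simp only [hy, hy', om_sub_right, om_add_right, om_smul_right, om_self] at z1 z2 u1 u2 v1 v2
  have b1 : 0 ≤ β * om x n := by nlinarith
  have b2 : β * om x n ≤ 0 := by nlinarith
  have b3 : om X X' = 0 := by
    have c1 : om X (p ε') - om X (p ε) = - (α' * om X X') := by linarith
    have c2 : 0 ≤ -(α' * om X X') := by linarith
    have c3 : 0 ≤ (1 - α') * om X X' := by linarith
    nlinarith
  have b4 : om X X' = ((ε':ℝ) - ε) * om x n := by
    rw [hX, hX']
    simp only [om_add_left, om_add_right, om_smul_left, om_smul_right, om_self]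
    rw [om_comm n x]; ring
  rw [b4] at b3
  rcases mul_eq_zero.1 b3 with h0 | h0
  · exact Subtype.ext (by linarith)
  · linarith

/-- Only countably many directions on a line are edge directions. -/
lemma countable_edge (K : Set Plane) {x n : Plane} (h : om x n ≠ 0) :
    {ε : ℝ | Edge K (x + ε • n)}.Countable := by
  rcases lt_or_gt_of_ne h with h0 | h0
  · have := (countable_edge_aux K (x := x) (n := -n) (by rw [om_neg_right]; linarith)).image
      (fun ε => -ε)
    refine this.mono fun ε hε => (Set.mem_image _ _ _).2 ⟨-ε, ?_, neg_neg ε⟩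
    simpa using hε
  · exact countable_edge_aux K h0

section Reg

variable {K L : Set Plane}

lemma neBot_nhdsGT_diff_countable {C : Set ℝ} (hC : C.Countable) (a : ℝ) :
    (nhdsWithin a (Set.Ioi a ∩ Cᶜ)).NeBot := by
  rw [← mem_closure_iff_nhdsWithin_neBot]
  have h1 : Dense (Cᶜ) := hC.dense_compl ℝ
  have h2 := h1.open_subset_closure_inter (isOpen_Ioi (a := a))
  have h3 := closure_mono h2
  rw [closure_closure] at h3
  exact h3 (by rw [closure_Ioi]; exact Set.self_mem_Ici)

/-- Regular directions on a line through an overlapping vector. -/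
lemma exists_reg_nhds (hK : Body K) (hL : Body L) (hcov : ∀ x, cov K x = cov L x)
    {x n : Plane} (hx : x ≠ 0) (ho : Ov K x) (hn : om x n ≠ 0) :
    ∃ C : Set ℝ, C.Countable ∧ ∀ᶠ ε in nhds (0:ℝ), ε ∉ C → Reg K (x + ε • n) ∧ Reg L (x + ε • n) ∧
      yv K (x + ε • n) = yv L (x + ε • n) := by
  set C : Set ℝ := ({ε | Edge K (x + ε • n)} ∪ {ε | Edge K (-x + ε • (-n))}) ∪
    ({ε | Edge L (x + ε • n)} ∪ {ε | Edge L (-x + ε • (-n))}) with hC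
  have hn' : om (-x) (-n) ≠ 0 := by simpa [om_neg_left, om_neg_right] using hn
  refine ⟨C, ((countable_edge K hn).union (countable_edge K hn')).union
    ((countable_edge L hn).union (countable_edge L hn')), ?_⟩
  have hc : Filter.Tendsto (fun ε : ℝ => x + ε • n) (nhds 0) (nhds x) := by
    have := (by fun_prop : Continuous fun ε : ℝ => x + ε • n).tendsto 0
    simpa using this
  filter_upwards [hc.eventually ((isOpen_ov K).mem_nhds ho), hc.eventually_ne hx] with ε h1 h2 h3
  simp only [hC, Set.mem_union, Set.mem_ofPred_eq, not_or] at h3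
  obtain ⟨⟨e1, e2⟩, e3, e4⟩ := h3
  have en : -x + ε • (-n) = -(x + ε • n) := by module
  rw [en] at e2 e4
  have rK : Reg K (x + ε • n) := ⟨h2, h1, e1, e2⟩
  have rL : Reg L (x + ε • n) := ⟨h2, (ov_iff_of_cov hK hL hcov _).1 h1, e3, e4⟩
  exact ⟨rK, rL, yv_eq_of_cov_eq hK hL hcov rK rL⟩

/-- Bodies with the same covariogram have inscribed parallelograms of the same shape, also for
directions of edges. -/
lemma exists_low_pair (hK : Body K) (hL : Body L) (hcov : ∀ x, cov K x = cov L x)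
    {x : Plane} (hx : x ≠ 0) (ho : Ov K x) :
    ∃ p u p' u', Low K p (p + x) ∧ Low K u (u - x) ∧ Low L p' (p' + x) ∧ Low L u' (u' - x) ∧
      u - p = u' - p' := by
  have hoL := (ov_iff_of_cov hK hL hcov _).1 ho
  obtain ⟨C, hC, hreg⟩ := exists_reg_nhds hK hL hcov hx ho (n := rot x) (om_rot_pos hx).ne'
  have := neBot_nhdsGT_diff_countable hC 0
  set l := nhdsWithin (0:ℝ) (Set.Ioi 0 ∩ Cᶜ) with hl
  set U := Ultrafilter.of l with hU
  have hUl : (U : Filter ℝ) ≤ l := Ultrafilter.of_le l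
  have hreg' : ∀ᶠ ε in (U : Filter ℝ), Reg K (x + ε • rot x) ∧ Reg L (x + ε • rot x) ∧
      yv K (x + ε • rot x) = yv L (x + ε • rot x) := by
    refine hUl ?_
    filter_upwards [mem_nhdsWithin_of_mem_nhds hreg, self_mem_nhdsWithin] with ε h1 h2
    exact h1 h2.2
  have hc : Filter.Tendsto (fun ε : ℝ => x + ε • rot x) (U : Filter ℝ) (nhds x) := by
    have := (by fun_prop : Continuous fun ε : ℝ => x + ε • rot x).tendsto 0
    have h2 : Filter.Tendsto (fun ε : ℝ => x + ε • rot x) (nhds 0) (nhds x) := by simpa using this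
    exact h2.mono_left (hUl.trans nhdsWithin_le_nhds)
  have lim : ∀ M : Set Plane, Body M → ∀ g : ℝ → Plane, (∀ᶠ ε in (U : Filter ℝ), g ε ∈ M) →
      ∃ a, Filter.Tendsto g (U : Filter ℝ) (nhds a) := by
    intro M hM g hg
    obtain ⟨a, -, ha⟩ := hM.comp.ultrafilter_le_nhds (U.map g) (by
      rw [Filter.le_principal_iff]; exact hg)
    exact ⟨a, ha⟩
  have lows : ∀ M : Set Plane, Body M → Ov M x → (∀ᶠ ε in (U : Filter ℝ), Reg M (x + ε • rot x)) →
      ∃ p u, Low M p (p + x) ∧ Low M u (u - x) ∧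
        Filter.Tendsto (fun ε => lo M (x + ε • rot x)) (U : Filter ℝ) (nhds p) ∧
        Filter.Tendsto (fun ε => lo M (-(x + ε • rot x))) (U : Filter ℝ) (nhds u) := by
    intro M hM hov hr
    obtain ⟨p, hp⟩ := lim M hM (fun ε => lo M (x + ε • rot x)) (by
      filter_upwards [hr] with ε h; exact (low_lo hM h.ov).1)
    obtain ⟨u, hu⟩ := lim M hM (fun ε => lo M (-(x + ε • rot x))) (by
      filter_upwards [hr] with ε h; exact (low_lo hM h.ov.neg).1)
    refine ⟨p, u, ?_, ?_, hp, hu⟩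
    · refine Low.of_tendsto hM (by simpa using hov) hp (hp.add hc) ?_
      exact (hr.mono fun ε h => low_lo hM h.ov).frequently
    · refine Low.of_tendsto hM (by simpa using hov.neg) hu (hu.sub hc) ?_
      refine (hr.mono fun ε h => ?_).frequently
      have := low_lo hM h.ov.neg
      rwa [← sub_eq_add_neg] at this
  obtain ⟨p, u, h1, h2, h3, h4⟩ := lows K hK ho (hreg'.mono fun ε h => h.1)
  obtain ⟨p', u', h1', h2', h3', h4'⟩ := lows L hL hoL (hreg'.mono fun ε h => h.2.1)
  refine ⟨p, u, p', u', h1, h2, h1', h2', ?_⟩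
  refine tendsto_nhds_unique (h4.sub h3) ((h4'.sub h3').congr' ?_)
  filter_upwards [hreg'] with ε h
  have := h.2.2
  rw [yv, yv] at this
  have e : ∀ a b c : Plane, a - b = (a - c - b) + c := fun a b c => by abel
  rw [e (lo L _) _ (x + ε • rot x), ← this]
  abel

end Reg

/-- The face of a convex body in a given direction. -/
lemma Body.exists_segment_face {K : Set Plane} (hK : Body K) {τ : Plane} (hτ : τ ≠ 0) :
    ∃ P, ∃ μ : ℝ, 0 ≤ μ ∧ ∀ k, (k ∈ K ∧ Tan K k τ) ↔ ∃ a : ℝ, 0 ≤ a ∧ a ≤ μ ∧ k = P + a • τ := by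
  obtain ⟨x, hx, hmin⟩ := hK.comp.exists_isMinOn hK.nonempty
    (by fun_prop : Continuous fun z => om τ z).continuousOn
  have hmin' : ∀ k ∈ K, om τ x ≤ om τ k := fun k hk => hmin hk
  have hc : IsCompact (K ∩ {z | om τ z = om τ x}) :=
    hK.comp.inter_right (isClosed_eq (by fun_prop) continuous_const)
  have htan : ∀ z ∈ K, Tan K z τ ↔ om τ z = om τ x := fun z hz => by
    refine ⟨fun h => le_antisymm ?_ (hmin' z hz), fun h => ⟨hτ, fun k hk => by
      rw [om_sub_right, h]; linarith [hmin' k hk]⟩⟩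
    have := h.2 x hx
    rw [om_sub_right] at this
    linarith
  have hpos := om_rot_pos hτ
  set n := rot τ
  have hcn : Continuous fun z => om z n := by fun_prop
  obtain ⟨a, ha, hamax⟩ := hc.exists_isMaxOn ⟨x, hx, rfl⟩ hcn.continuousOn
  obtain ⟨P, hP, hPmin⟩ := hc.exists_isMinOn ⟨x, hx, rfl⟩ hcn.continuousOn
  have key : ∀ z ∈ K ∩ {z | om τ z = om τ x}, z = P + (om (z - P) n / om τ n) • τ := by
    rintro z ⟨hz, hz'⟩
    obtain ⟨c, hc⟩ := exists_smul_of_om_eq_zero (b := z - P) hτ (by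
      rw [om_sub_right, show om τ z = om τ x from hz', show om τ P = om τ x from hP.2, sub_self])
    rw [hc, om_smul_left, mul_div_cancel_right₀ _ hpos.ne', ← hc]; abel
  refine ⟨P, om (a - P) n / om τ n, div_nonneg ?_ hpos.le, fun k => ⟨?_, ?_⟩⟩
  · rw [om_sub_left]; exact sub_nonneg.2 (hPmin ha)
  · rintro ⟨hk, ht⟩
    have hk' : k ∈ K ∩ {z | om τ z = om τ x} := ⟨hk, (htan k hk).1 ht⟩
    refine ⟨om (k - P) n / om τ n, div_nonneg ?_ hpos.le, ?_, key k hk'⟩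
    · rw [om_sub_left]; exact sub_nonneg.2 (hPmin hk')
    · rw [div_le_div_iff_of_pos_right hpos, om_sub_left, om_sub_left]
      have : om k n ≤ om a n := hamax hk'
      linarith
  · rintro ⟨b, hb0, hb1, rfl⟩
    have ea := key a ha
    set μ := om (a - P) n / om τ n with hμ
    have hmem : P + b • τ ∈ K := by
      rcases hb0.eq_or_lt with h0 | h0
      · rw [← h0, zero_smul, add_zero]; exact hP.1
      have hμ0 : 0 < μ := h0.trans_le hb1
      have := hK.conv.add_smul_sub_mem hP.1 ha.1 (t := b / μ)
        ⟨by positivity, (div_le_one hμ0).2 hb1⟩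
      rw [ea, add_sub_cancel_left, smul_smul, div_mul_cancel₀ _ hμ0.ne'] at this
      exact this
    refine ⟨hmem, (htan _ hmem).2 ?_⟩
    rw [om_add_right, om_smul_right, om_self, mul_zero, add_zero]
    exact hP.2


/-- A convex body between two parallel supporting lines of direction `τ`, with faces of lengths
`μ` and `ν` at the bottom and at the top. -/
structure Strip (K : Set Plane) (τ v : Plane) (μ ν : ℝ) : Prop where
  body : Body K
  pos : 0 < om τ v
  bot : ∀ a : ℝ, a • τ ∈ K ↔ 0 ≤ a ∧ a ≤ μ
  top : ∀ a : ℝ, a • τ + v ∈ K ↔ 0 ≤ a ∧ a ≤ ν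
  slab : ∀ k ∈ K, 0 ≤ ch τ v k ∧ ch τ v k ≤ 1
  nonneg : 0 ≤ ν
  lt : ν < μ

/-- The extent of the body in direction `τ` at height `h`. -/
noncomputable def reach (K : Set Plane) (τ v : Plane) (h : ℝ) : ℝ :=
  sSup {a : ℝ | a • τ + h • v ∈ K}

/-- The vector from `α • τ` to the right boundary point at height `h`. -/
noncomputable def chord (K : Set Plane) (τ v : Plane) (h α : ℝ) : Plane :=
  (reach K τ v h - α) • τ + h • v

lemma smul_add_chord (K : Set Plane) (τ v : Plane) (h α : ℝ) :
    α • τ + chord K τ v h α = reach K τ v h • τ + h • v := by rw [chord]; module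

namespace Strip

variable {K : Set Plane} {τ v : Plane} {μ ν : ℝ}

lemma ne_zero (S : Strip K τ v μ ν) : τ ≠ 0 := by
  rintro rfl; have := S.pos; simp at this

lemma mu_pos (S : Strip K τ v μ ν) : 0 < μ := S.nonneg.trans_lt S.lt

lemma zero_mem (S : Strip K τ v μ ν) : (0:Plane) ∈ K := by
  have := (S.bot 0).2 ⟨le_rfl, S.mu_pos.le⟩; rwa [zero_smul] at this

lemma v_mem (S : Strip K τ v μ ν) : v ∈ K := by
  have := (S.top 0).2 ⟨le_rfl, S.nonneg⟩; rwa [zero_smul, zero_add] at this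

lemma ch_add_smul_tau (a : ℝ) (z : Plane) : ch τ v (z + a • τ) = ch τ v z := by
  rw [ch, ch, om_add_right, om_smul_right, om_self, mul_zero, add_zero]

lemma ch_smul_tau (a : ℝ) : ch τ v (a • τ) = 0 := by
  rw [ch, om_smul_right, om_self, mul_zero, zero_div]

lemma om_eq (S : Strip K τ v μ ν) (z : Plane) : om τ z = om τ v * ch τ v z := by
  rw [ch, mul_div_cancel₀ _ S.pos.ne']

lemma mix (S : Strip K τ v μ ν) {a b h k t : ℝ} (ha : a • τ + h • v ∈ K) (hb : b • τ + k • v ∈ K)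
    (h0 : 0 ≤ t) (h1 : t ≤ 1) : ((1 - t) * a + t * b) • τ + ((1 - t) * h + t * k) • v ∈ K := by
  have := S.body.conv ha hb (sub_nonneg.2 h1) h0 (by ring)
  convert this using 1
  module

lemma fill (S : Strip K τ v μ ν) {a b c h : ℝ} (ha : a • τ + h • v ∈ K) (hc : c • τ + h • v ∈ K)
    (h0 : a ≤ b) (h1 : b ≤ c) : b • τ + h • v ∈ K := by
  rcases h0.eq_or_lt with rfl | h0
  · exact ha
  have hac : 0 < c - a := by linarith
  have := S.mix ha hc (t := (b - a) / (c - a)) (div_nonneg (by linarith) hac.le)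
    ((div_le_one hac).2 (by linarith))
  have e1 : (1 - (b - a) / (c - a)) * a + (b - a) / (c - a) * c = b := by field_simp; ring
  have e2 : (1 - (b - a) / (c - a)) * h + (b - a) / (c - a) * h = h := by ring
  rwa [e1, e2] at this

lemma mid_mem (S : Strip K τ v μ ν) {h : ℝ} (h0 : 0 ≤ h) (h1 : h ≤ 1) :
    ((1 - h) * μ + h * ν) • τ + h • v ∈ K := by
  have a1 := (S.bot μ).2 ⟨S.mu_pos.le, le_rfl⟩
  have a2 := (S.top ν).2 ⟨S.nonneg, le_rfl⟩
  have := S.mix (a := μ) (b := ν) (h := 0) (k := 1) (by simpa using a1) (by simpa using a2) h0 h1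
  simpa using this

lemma left_mem (S : Strip K τ v μ ν) {h : ℝ} (h0 : 0 ≤ h) (h1 : h ≤ 1) :
    (0:ℝ) • τ + h • v ∈ K := by
  have := S.mix (a := 0) (b := 0) (h := 0) (k := 1) (by simpa using S.zero_mem)
    (by simpa using S.v_mem) h0 h1
  simpa using this

lemma bddAbove (S : Strip K τ v μ ν) (h : ℝ) : BddAbove {a : ℝ | a • τ + h • v ∈ K} := by
  obtain ⟨B, hB⟩ := S.body.comp.bddAbove_image (continuous_cu τ v).continuousOn
  refine ⟨B, fun a ha => ?_⟩
  have := hB (Set.mem_image_of_mem _ ha)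
  rwa [cu_combo S.pos] at this

lemma le_reach (S : Strip K τ v μ ν) {a h : ℝ} (ha : a • τ + h • v ∈ K) : a ≤ reach K τ v h :=
  le_csSup (S.bddAbove h) ha

lemma reach_mem (S : Strip K τ v μ ν) {h : ℝ} (h0 : 0 ≤ h) (h1 : h ≤ 1) :
    reach K τ v h • τ + h • v ∈ K := by
  have hc : IsClosed {a : ℝ | a • τ + h • v ∈ K} :=
    S.body.comp.isClosed.preimage (by fun_prop : Continuous fun a : ℝ => a • τ + h • v)
  exact hc.csSup_mem ⟨0, S.left_mem h0 h1⟩ (S.bddAbove h)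

lemma mem_of_le (S : Strip K τ v μ ν) {a h : ℝ} (h0 : 0 ≤ h) (h1 : h ≤ 1) (ha : 0 ≤ a)
    (ha' : a ≤ reach K τ v h) : a • τ + h • v ∈ K :=
  S.fill (S.left_mem h0 h1) (S.reach_mem h0 h1) ha ha'

lemma mid_le (S : Strip K τ v μ ν) {h : ℝ} (h0 : 0 ≤ h) (h1 : h ≤ 1) :
    (1 - h) * μ + h * ν ≤ reach K τ v h := S.le_reach (S.mid_mem h0 h1)

lemma reach_zero (S : Strip K τ v μ ν) : reach K τ v 0 = μ := by
  refine le_antisymm ?_ ?_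
  · have := S.reach_mem le_rfl zero_le_one
    rw [zero_smul, add_zero] at this
    exact ((S.bot _).1 this).2
  · simpa using S.mid_le le_rfl zero_le_one

lemma concaveOn_reach (S : Strip K τ v μ ν) : ConcaveOn ℝ (Set.Icc 0 1) (reach K τ v) := by
  refine ⟨convex_Icc 0 1, fun x hx y hy a b ha hb hab => ?_⟩
  have := S.mix (S.reach_mem hx.1 hx.2) (S.reach_mem hy.1 hy.2) hb (by linarith)
  rw [show 1 - b = a by linarith] at this
  exact S.le_reach this

lemma continuousOn_reach (S : Strip K τ v μ ν) : ContinuousOn (reach K τ v) (Set.Ico 0 1) := by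
  intro h hh
  rcases hh.1.eq_or_lt with rfl | h0
  · rw [ContinuousWithinAt, S.reach_zero]
    have hm : Filter.Tendsto (fun h => (1 - h) * μ + h * ν) (nhdsWithin 0 (Set.Ico (0:ℝ) 1))
        (nhds μ) := by
      have := ((by fun_prop : Continuous fun h : ℝ => (1 - h) * μ + h * ν).tendsto 0)
      simp only [sub_zero, one_mul, zero_mul, add_zero] at this
      exact this.mono_left nhdsWithin_le_nhds
    refine tendsto_order.2 ⟨fun c hc => ?_, fun c hc => ?_⟩
    · filter_upwards [hm.eventually (lt_mem_nhds hc), self_mem_nhdsWithin] with x h1 h2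
      exact h1.trans_le (S.mid_le h2.1 h2.2.le)
    · have ho : IsOpen {h : ℝ | c • τ + h • v ∉ K} :=
        S.body.comp.isClosed.isOpen_compl.preimage
          (by fun_prop : Continuous fun h : ℝ => c • τ + h • v)
      have h0 : (0:ℝ) ∈ {h : ℝ | c • τ + h • v ∉ K} := by
        intro h
        rw [zero_smul, add_zero] at h
        linarith [((S.bot c).1 h).2]
      filter_upwards [mem_nhdsWithin_of_mem_nhds (ho.mem_nhds h0), self_mem_nhdsWithin] with x h1 h2
      by_contra hcon
      exact h1 (S.mem_of_le h2.1 h2.2.le (S.mu_pos.le.trans hc.le) (not_lt.1 hcon))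
  · have := S.concaveOn_reach.continuousOn_interior
    rw [interior_Icc] at this
    exact ((this h ⟨h0, hh.2⟩).continuousAt (Ioo_mem_nhds h0 hh.2)).continuousWithinAt

lemma not_parallel (S : Strip K τ v μ ν) {z t : Plane} (ht : Tan K z t) (h0 : 0 < ch τ v z)
    (h1 : ch τ v z < 1) : om τ t ≠ 0 := by
  intro h
  obtain ⟨c, rfl⟩ := exists_smul_of_om_eq_zero S.ne_zero h
  have e1 := ht.2 0 S.zero_mem
  have e2 := ht.2 v S.v_mem
  have hp := S.pos
  rw [om_smul_left, om_sub_right, om_zero_right, S.om_eq z] at e1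
  rw [om_smul_left, om_sub_right, S.om_eq z] at e2
  have hc : c ≠ 0 := by rintro rfl; exact ht.1 (zero_smul _ _)
  have p1 : 0 < om τ v * ch τ v z := mul_pos hp h0
  have p2 : 0 < om τ v * (1 - ch τ v z) := mul_pos hp (by linarith)
  rcases lt_or_gt_of_ne hc with hc | hc <;> nlinarith

lemma mem_interior (S : Strip K τ v μ ν) {z : Plane} {b c : ℝ} (hb : 0 < b) (hc : 0 < c)
    (h1 : z + (-b) • τ ∈ K) (h2 : z + c • τ ∈ K) (hz : 0 < ch τ v z) (hz' : ch τ v z < 1) :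
    z ∈ interior K := by
  by_contra h
  obtain ⟨t, ht⟩ := S.body.exists_tan h
  have e1 := ht.2 _ h1
  have e2 := ht.2 _ h2
  rw [add_sub_cancel_left, om_smul_right] at e1 e2
  refine S.not_parallel ht hz hz' ?_
  rw [om_comm]
  nlinarith

lemma tan_bot (S : Strip K τ v μ ν) {z : Plane} (hz : ch τ v z = 0) : Tan K z τ := by
  refine ⟨S.ne_zero, fun k hk => ?_⟩
  rw [om_sub_right, S.om_eq k, S.om_eq z, hz, mul_zero, sub_zero]
  exact mul_nonneg S.pos.le (S.slab k hk).1

lemma tan_bottom (S : Strip K τ v μ ν) {t : Plane} {α : ℝ} (hα : 0 < α) (hα' : α < μ)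
    (ht : Tan K (α • τ) t) : ∃ c : ℝ, 0 < c ∧ t = c • τ := by
  have e1 := ht.2 0 S.zero_mem
  have e2 := ht.2 _ ((S.bot μ).2 ⟨S.mu_pos.le, le_rfl⟩)
  have e3 := ht.2 v S.v_mem
  rw [zero_sub, om_neg_right, om_smul_right] at e1
  rw [← sub_smul, om_smul_right] at e2
  have e4 : om t τ = 0 := by nlinarith
  obtain ⟨c, rfl⟩ := exists_smul_of_om_eq_zero S.ne_zero (by rw [om_comm, e4, neg_zero])
  refine ⟨c, ?_, rfl⟩
  have hc : c ≠ 0 := by rintro rfl; exact ht.1 (zero_smul _ _)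
  rw [om_smul_left, om_sub_right, om_smul_right, om_self, mul_zero, sub_zero] at e3
  have := S.pos
  rcases lt_or_gt_of_ne hc with hc | hc
  · nlinarith
  · exact hc

lemma ov_bottom (S : Strip K τ v μ ν) {q : Plane} {α : ℝ} (hα : 0 < α) (hα' : α < μ) (hq : q ∈ K)
    (hq1 : ch τ v q < 1) : Ov K (q - α • τ) := by
  by_contra h
  obtain ⟨t, h1, h2⟩ := exists_tan_of_not_ov S.body h ((S.bot α).2 ⟨hα.le, hα'.le⟩)
    (by rwa [add_sub_cancel])
  obtain ⟨c, hc, rfl⟩ := S.tan_bottom hα hα' h1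
  rw [add_sub_cancel] at h2
  have := h2.2 v S.v_mem
  rw [om_neg_left, om_smul_left, om_sub_right, S.om_eq q] at this
  have : 0 < c * (om τ v * (1 - ch τ v q)) := mul_pos hc (mul_pos S.pos (by linarith))
  linarith

lemma chord_ne (S : Strip K τ v μ ν) {h α : ℝ} (hα' : α < μ) : chord K τ v h α ≠ 0 := by
  intro h0
  have e1 := ch_combo S.pos (reach K τ v h - α) h
  have e2 := cu_combo S.pos (reach K τ v h - α) h
  rw [chord] at h0
  rw [h0, ch_zero] at e1
  rw [h0, cu_zero] at e2
  rw [← e1, S.reach_zero] at e2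
  linarith

lemma ov_chord (S : Strip K τ v μ ν) {h α : ℝ} (h0 : 0 ≤ h) (h1 : h < 1) (hα : 0 < α)
    (hα' : α < μ) : Ov K (chord K τ v h α) := by
  have := S.ov_bottom hα hα' (S.reach_mem h0 h1.le) (by rwa [ch_combo S.pos])
  rwa [← smul_add_chord K τ v h α, add_sub_cancel_left] at this

lemma low_chord (S : Strip K τ v μ ν) {h α : ℝ} (h0 : 0 ≤ h) (h1 : h < 1) (hα : 0 < α)
    (hα' : α < μ) : Low K (α • τ) (α • τ + chord K τ v h α) := by
  have hp := (S.bot α).2 ⟨hα.le, hα'.le⟩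
  have hq := S.reach_mem h0 h1.le
  have ht := S.tan_bot (ch_smul_tau (v := v) (τ := τ) α)
  rw [smul_add_chord]
  rcases h0.eq_or_lt with rfl | h0
  · refine ⟨hp, hq, fun k hk _ => ?_⟩
    rw [S.reach_zero, zero_smul, add_zero, ← sub_smul, om_smul_left]
    exact mul_nonneg (by linarith) (ht.2 k hk)
  · have hR : 0 < reach K τ v h := lt_of_lt_of_le (by nlinarith [S.mu_pos, S.nonneg])
      (S.mid_le h0.le h1.le)
    have hni : reach K τ v h • τ + h • v ∉ interior K := by
      intro hi
      obtain ⟨c, hc, hi⟩ := exists_pos_smul_interior hi τ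
      have := S.le_reach (a := reach K τ v h + c) (h := h) (by
        convert interior_subset (hi c (abs_of_pos hc).le) using 1; module)
      linarith
    obtain ⟨t, ht2⟩ := S.body.exists_tan hni
    refine low_of_tan hp hq ht ht2 (lt_of_le_of_ne ?_ (S.not_parallel ht2 (by
      rwa [ch_combo S.pos]) (by rwa [ch_combo S.pos])).symm)
    have := ht2.2 _ (S.left_mem h0.le h1.le)
    rw [add_sub_add_right_eq_sub, ← sub_smul, om_smul_right, om_comm] at this
    nlinarith

lemma not_edge_chord (S : Strip K τ v μ ν) {h α : ℝ} (h0 : 0 < h) (h1 : h < 1) (hα : 0 < α)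
    (hα' : α < μ) : ¬ Edge K (chord K τ v h α) := by
  rintro ⟨p, hp, hpx, he⟩
  have hl := S.low_chord h0.le h1 hα hα'
  have e1 := he _ hl.1
  have e2 := hl.2.2 p hp (by rwa [add_sub_cancel_left])
  rw [add_sub_cancel_left] at e2
  have ht : Tan K (α • τ) (chord K τ v h α) := ⟨S.chord_ne hα', fun k hk => by
    have := he k hk
    rw [om_sub_right] at *
    linarith⟩
  obtain ⟨c, -, hc⟩ := S.tan_bottom hα hα' ht
  have := ch_combo S.pos (reach K τ v h - α) h
  rw [chord] at hc
  rw [hc, ch_smul_tau] at this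
  linarith

lemma lo_chord (S : Strip K τ v μ ν) {h α : ℝ} (h0 : 0 < h) (h1 : h < 1) (hα : 0 < α)
    (hα' : α < μ) : lo K (chord K τ v h α) = α • τ :=
  lo_eq S.body (S.chord_ne hα') (S.not_edge_chord h0 h1 hα hα') (S.low_chord h0.le h1 hα hα')

/-- The chord opposite to one based at the bottom ends at a leftmost point. -/
lemma leftmost (S : Strip K τ v μ ν) {x w : Plane} {α : ℝ} (hα : 0 < α) (hα' : α < μ)
    (hx : x ≠ 0) (hov : Ov K x) (hp : Low K (α • τ) (α • τ + x)) (hw : Low K (w + x) w)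
    (h0 : 0 < ch τ v w) (h1 : ch τ v w < 1) {b : ℝ} (hb : 0 < b) : w + (-b) • τ ∉ K := by
  intro hwb
  have hovw := S.ov_bottom hα hα' hw.2.1 h1
  have hl := (low_reindex S.body hx hov hp hw hovw).2
  have hne : w ≠ α • τ := by rintro rfl; rw [ch_smul_tau] at h0; exact lt_irrefl _ h0
  obtain ⟨t, ht⟩ := S.body.exists_tan (hl.left_not_mem_interior S.body.conv hne)
  have e1 := hl.om_tan_nonneg hne (by rw [← neg_sub]; exact hovw.neg) ht
    (S.tan_bot (ch_smul_tau α))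
  have e2 := ht.2 _ hwb
  rw [add_sub_cancel_left, om_smul_right] at e2
  refine S.not_parallel ht h0 h1 ?_
  rw [om_comm]
  nlinarith

lemma ch_pos (S : Strip K τ v μ ν) {h α : ℝ} {w : Plane} (h0 : 0 ≤ h) (h1 : h < 1) (hα : 0 < α)
    (hα' : α < (1 - h) * μ + h * ν) (hw : Low K (w + chord K τ v h α) w) : 0 < ch τ v w := by
  have hαμ : α < μ := by nlinarith [S.lt]
  refine lt_of_le_of_ne (S.slab w hw.2.1).1 fun hw0 => ?_
  have ew := combo_cu_ch S.pos w
  set a := cu τ v w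
  rw [← hw0, zero_smul, add_zero] at ew
  have hpos := Ov.exists_om_pos (S.chord_ne hαμ) (S.ov_chord h0 h1 hα hαμ)
    (S.low_chord h0 h1 hα hαμ) hw
  rw [chord, ← ew, ← sub_smul, om_smul_right, om_add_left, om_smul_left, om_self, om_smul_left,
    om_comm v τ] at hpos
  have ha : 0 ≤ a := ((S.bot a).1 (ew ▸ hw.2.1)).1
  have hp := S.pos
  have hh : 0 < h := by
    rcases h0.eq_or_lt with rfl | h
    · simp at hpos
    · exact h
  have haα : a < α := by
    by_contra hcon
    have : 0 ≤ (a - α) * (h * om τ v) := mul_nonneg (by linarith) (by positivity)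
    nlinarith
  have hR := S.mid_le h0 h1.le
  refine hw.left_not_mem_interior S.body.conv ?_ (S.mem_interior (b := a + reach K τ v h - α)
    (c := α - a) (by linarith) (by linarith) ?_ ?_ ?_ ?_)
  · intro he
    exact S.chord_ne hαμ (by simpa using he)
  · convert S.left_mem h0 h1.le using 1
    rw [← ew, chord]; module
  · convert S.reach_mem h0 h1.le using 1
    rw [← ew, chord]; module
  · rw [ch_add, ← hw0, chord, ch_combo S.pos, zero_add]; exact hh
  · rw [ch_add, ← hw0, chord, ch_combo S.pos, zero_add]; exact h1

lemma ch_add_le (S : Strip K τ v μ ν) {h α : ℝ} {w : Plane}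
    (hw : Low K (w + chord K τ v h α) w) : ch τ v w + h ≤ 1 := by
  have := (S.slab _ hw.1).2
  rwa [ch_add, chord, ch_combo S.pos] at this

lemma eq_of_leftmost (S : Strip K τ v μ ν) {w w' : Plane} (hw : w ∈ K) (hw' : w' ∈ K)
    (hl : ∀ b : ℝ, 0 < b → w + (-b) • τ ∉ K) (hl' : ∀ b : ℝ, 0 < b → w' + (-b) • τ ∉ K)
    (h : ch τ v w = ch τ v w') : w = w' := by
  have e := combo_cu_ch S.pos w
  have e' := combo_cu_ch S.pos w'
  rw [← h] at e'
  rcases lt_trichotomy (cu τ v w) (cu τ v w') with h1 | h1 | h1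
  · refine absurd ?_ (hl' (cu τ v w' - cu τ v w) (by linarith))
    convert hw using 1
    rw [← e, ← e']
    simp only [cu_combo S.pos]
    module
  · rw [← e, ← e', h1]
  · refine absurd ?_ (hl (cu τ v w - cu τ v w') (by linarith))
    convert hw' using 1
    rw [← e, ← e']
    simp only [cu_combo S.pos]
    module

end Strip


lemma exists_three_of_infinite {Y : Set ℝ} (hY : Y.Infinite) :
    ∃ a ∈ Y, ∃ b ∈ Y, ∃ c ∈ Y, a < b ∧ b < c := by
  obtain ⟨s, hs, hc⟩ := hY.exists_subset_card_eq 3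
  have e := fun i => hs (Finset.mem_coe.2 (s.orderEmbOfFin_mem hc i))
  exact ⟨_, e 0, _, e 1, _, e 2, (s.orderEmbOfFin hc).strictMono (by decide),
    (s.orderEmbOfFin hc).strictMono (by decide)⟩

namespace Strip

variable {K L : Set Plane} {τ v : Plane} {μ ν : ℝ}

lemma exists_perturb (S : Strip K τ v μ ν) {h α : ℝ} (h0 : 0 ≤ h) (hα' : α < μ) :
    ∃ b : ℝ, om (chord K τ v h α) (v + b • τ) ≠ 0 := by
  have e : ∀ b, om (chord K τ v h α) (v + b • τ) = (reach K τ v h - α - h * b) * om τ v := by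
    intro b
    rw [chord]
    simp only [om_add_left, om_add_right, om_smul_left, om_smul_right, om_self]
    rw [om_comm v τ]; ring
  by_cases hR : reach K τ v h - α = 0
  · refine ⟨1, ?_⟩
    rw [e, hR]
    have hh : h ≠ 0 := by
      rintro rfl
      rw [S.reach_zero] at hR
      linarith
    have := S.pos.ne'
    simp [hh, this]
  · refine ⟨0, ?_⟩
    rw [e, mul_zero, sub_zero]
    exact mul_ne_zero hR S.pos.ne'

lemma eventually_lo_perturb (S : Strip K τ v μ ν) {h α : ℝ} (h0 : 0 ≤ h) (h1 : h < 1)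
    (hα : 0 < α) (hα' : α < μ) (b : ℝ) :
    Filter.Tendsto (fun ε : ℝ => lo K (chord K τ v h α + ε • (v + b • τ)))
      (nhdsWithin 0 (Set.Ioi 0)) (nhds (α • τ)) := by
  have hh : Filter.Tendsto (fun ε : ℝ => h + ε) (nhdsWithin 0 (Set.Ioi 0)) (nhds h) := by
    have := ((by fun_prop : Continuous fun ε : ℝ => h + ε).tendsto 0)
    rw [add_zero] at this
    exact this.mono_left nhdsWithin_le_nhds
  have hpos : ∀ᶠ ε : ℝ in nhdsWithin 0 (Set.Ioi 0), 0 < ε := self_mem_nhdsWithin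
  have hlt : ∀ᶠ ε : ℝ in nhdsWithin 0 (Set.Ioi 0), h + ε < 1 := hh.eventually (gt_mem_nhds h1)
  have hR : Filter.Tendsto (fun ε : ℝ => reach K τ v (h + ε)) (nhdsWithin 0 (Set.Ioi 0))
      (nhds (reach K τ v h)) := by
    refine (S.continuousOn_reach h ⟨h0, h1⟩).tendsto.comp
      (tendsto_nhdsWithin_iff.2 ⟨hh, ?_⟩)
    filter_upwards [hpos, hlt] with ε e1 e2 using ⟨by linarith, e2⟩
  have hA : Filter.Tendsto (fun ε : ℝ => reach K τ v (h + ε) - reach K τ v h + α - ε * b)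
      (nhdsWithin 0 (Set.Ioi 0)) (nhds α) := by
    have h2 : Filter.Tendsto (fun ε : ℝ => ε * b) (nhdsWithin 0 (Set.Ioi 0)) (nhds 0) := by
      have := ((by fun_prop : Continuous fun ε : ℝ => ε * b).tendsto 0)
      rw [zero_mul] at this
      exact this.mono_left nhdsWithin_le_nhds
    have := ((hR.sub_const (reach K τ v h)).add_const α).sub h2
    simpa using this
  refine (hA.smul_const τ).congr' ?_
  filter_upwards [hpos, hlt, hA.eventually (lt_mem_nhds hα), hA.eventually (gt_mem_nhds hα')]
    with ε e1 e2 e3 e4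
  rw [← S.lo_chord (by linarith) e2 e3 e4]
  congr 1
  rw [chord, chord]
  module

/-- Where the right boundaries agree at height `h`, the opposite chords of the two bodies can be
chosen equal. -/
lemma exists_common (S : Strip K τ v μ ν) (S' : Strip L τ v μ ν) (hcov : ∀ x, cov K x = cov L x)
    {h α : ℝ} (h0 : 0 ≤ h) (h1 : h < 1) (hR : reach K τ v h = reach L τ v h) (hα : 0 < α)
    (hα' : α < μ) :
    ∃ w, Low K (w + chord K τ v h α) w ∧ Low L (w + chord K τ v h α) w := by
  have hch : chord L τ v h α = chord K τ v h α := by rw [chord, chord, hR]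
  set x := chord K τ v h α with hx
  have hov := S.ov_chord h0 h1 hα hα'
  have hovL := S'.ov_chord h0 h1 hα hα'
  rw [hch] at hovL
  rw [← hx] at hov
  obtain ⟨b, hb⟩ := S.exists_perturb h0 hα'
  set n := v + b • τ
  obtain ⟨C, hC, hreg⟩ := exists_reg_nhds S.body S'.body hcov (S.chord_ne hα') hov hb
  have := neBot_nhdsGT_diff_countable hC 0
  set l := nhdsWithin (0:ℝ) (Set.Ioi 0 ∩ Cᶜ) with hl
  set U := Ultrafilter.of l with hU
  have hUl : (U : Filter ℝ) ≤ l := Ultrafilter.of_le l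
  have hU0 : (U : Filter ℝ) ≤ nhdsWithin 0 (Set.Ioi 0) :=
    hUl.trans (nhdsWithin_mono _ Set.inter_subset_left)
  have hreg' : ∀ᶠ ε in (U : Filter ℝ), Reg K (x + ε • n) ∧ Reg L (x + ε • n) ∧
      yv K (x + ε • n) = yv L (x + ε • n) := by
    refine hUl ?_
    filter_upwards [mem_nhdsWithin_of_mem_nhds hreg, self_mem_nhdsWithin] with ε h1 h2
    exact h1 h2.2
  have hc : Filter.Tendsto (fun ε : ℝ => x + ε • n) (U : Filter ℝ) (nhds x) := by
    have := (by fun_prop : Continuous fun ε : ℝ => x + ε • n).tendsto 0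
    have h2 : Filter.Tendsto (fun ε : ℝ => x + ε • n) (nhds 0) (nhds x) := by simpa using this
    exact h2.mono_left (hU0.trans nhdsWithin_le_nhds)
  have lK := (S.eventually_lo_perturb h0 h1 hα hα' b).mono_left hU0
  have lL := (S'.eventually_lo_perturb h0 h1 hα hα' b).mono_left hU0
  rw [hch] at lL
  obtain ⟨u, -, hu⟩ := S.body.comp.ultrafilter_le_nhds (U.map fun ε => lo K (-(x + ε • n))) (by
    rw [Filter.le_principal_iff]
    show ∀ᶠ ε in (U : Filter ℝ), lo K (-(x + ε • n)) ∈ K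
    filter_upwards [hreg'] with ε h
    exact (low_lo S.body h.1.ov.neg).1)
  have hu : Filter.Tendsto (fun ε => lo K (-(x + ε • n))) (U : Filter ℝ) (nhds u) := hu
  have huL : Filter.Tendsto (fun ε => lo L (-(x + ε • n))) (U : Filter ℝ) (nhds u) := by
    have := (hu.sub lK).add lL
    rw [sub_add_cancel] at this
    refine this.congr' ?_
    filter_upwards [hreg'] with ε h
    have := h.2.2
    rw [yv, yv] at this
    have e : ∀ a b c : Plane, a - b = (a - c - b) + c := fun a b c => by abel
    rw [e _ _ (x + ε • n), this]
    abel
  refine ⟨u - x, ?_, ?_⟩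
  · rw [sub_add_cancel]
    refine Low.of_tendsto S.body (by simpa using hov.neg) hu (hu.sub hc) ?_
    refine (hreg'.mono fun ε h => ?_).frequently
    have := low_lo S.body h.1.ov.neg
    rwa [← sub_eq_add_neg] at this
  · rw [sub_add_cancel]
    refine Low.of_tendsto S'.body (by simpa using hovL.neg) huL (huL.sub hc) ?_
    refine (hreg'.mono fun ε h => ?_).frequently
    have := low_lo S'.body h.2.1.ov.neg
    rwa [← sub_eq_add_neg] at this

end Strip

lemma Low.combo {K : Set Plane} (hK : Convex ℝ K) {x w w' : Plane} (h : Low K (w + x) w)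
    (h' : Low K (w' + x) w') {s t : ℝ} (hs : 0 ≤ s) (ht : 0 ≤ t) (hst : s + t = 1) :
    Low K (s • w + t • w' + x) (s • w + t • w') := by
  refine ⟨?_, hK h.2.1 h'.2.1 hs ht hst, fun k hk hkx => ?_⟩
  · have := hK h.1 h'.1 hs ht hst
    convert this using 1
    rw [smul_add, smul_add, add_add_add_comm, ← add_smul, hst, one_smul]
  · have e : ∀ z : Plane, z - (z + x) = -x := fun z => by abel
    rw [e] at hkx ⊢
    have h1 := h.2.2 k hk (by rwa [e])
    have h2 := h'.2.2 k hk (by rwa [e])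
    rw [e] at h1 h2
    have : k - (s • w + t • w' + x) = s • (k - (w + x)) + t • (k - (w' + x)) := by
      obtain rfl : t = 1 - s := by linarith
      module
    rw [this, om_add_right, om_smul_right, om_smul_right]
    positivity

namespace Strip

variable {K L : Set Plane} {τ v : Plane} {μ ν : ℝ}

lemma isClosed_common (S : Strip K τ v μ ν) (S' : Strip L τ v μ ν)
    {h : ℝ} (h0 : 0 ≤ h) (h1 : h < 1) (hR : reach K τ v h = reach L τ v h) {a b : ℝ} (ha : 0 < a)
    (hb : b < μ) {D : Set Plane} (hD : IsClosed D) :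
    IsClosed {α | α ∈ Set.Icc a b ∧
      ∃ w ∈ D, Low K (w + chord K τ v h α) w ∧ Low L (w + chord K τ v h α) w} := by
  have hch : ∀ α, chord L τ v h α = chord K τ v h α := fun α => by rw [chord, chord, hR]
  refine isClosed_iff_ultrafilter.2 fun α U hUα hU => ?_
  have hUα : Filter.Tendsto id (U : Filter ℝ) (nhds α) := hUα
  have hE : ∀ᶠ β in (U : Filter ℝ), β ∈ Set.Icc a b ∧
      ∃ w ∈ D, Low K (w + chord K τ v h β) w ∧ Low L (w + chord K τ v h β) w := hU
  have hαI : α ∈ Set.Icc a b := isClosed_Icc.mem_of_tendsto hUα (hE.mono fun β h => h.1)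
  refine ⟨hαI, ?_⟩
  have hE' := hE.mono fun β h => h.2
  classical
  set w : ℝ → Plane := fun β => if hβ : ∃ w ∈ D, Low K (w + chord K τ v h β) w ∧
    Low L (w + chord K τ v h β) w then hβ.choose else 0 with hw
  have hwE : ∀ᶠ β in (U : Filter ℝ), w β ∈ D ∧ Low K (w β + chord K τ v h β) (w β) ∧
      Low L (w β + chord K τ v h β) (w β) := by
    filter_upwards [hE'] with β hβ
    simp only [hw, dif_pos hβ]
    exact hβ.choose_spec
  obtain ⟨z, -, hz⟩ := S.body.comp.ultrafilter_le_nhds (U.map w) (by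
    rw [Filter.le_principal_iff]
    exact hwE.mono fun β h => h.2.1.2.1)
  have hz : Filter.Tendsto w (U : Filter ℝ) (nhds z) := hz
  have hcont : Filter.Tendsto (chord K τ v h) (U : Filter ℝ) (nhds (chord K τ v h α)) := by
    have : Continuous (chord K τ v h) := by unfold chord; fun_prop
    exact (this.tendsto α).comp hUα
  have e : ∀ x : Plane, z - (z + x) = -x := fun x => by abel
  have a0 : 0 < α := ha.trans_le hαI.1
  have a1 : α < μ := hαI.2.trans_lt hb
  refine ⟨z, hD.mem_of_tendsto hz (hwE.mono fun β h => h.1), ?_, ?_⟩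
  · exact Low.of_tendsto S.body (by rw [e]; exact (S.ov_chord h0 h1 a0 a1).neg) (hz.add hcont) hz
      (hwE.mono fun β h => h.2.1).frequently
  · refine Low.of_tendsto S'.body ?_ (hz.add hcont) hz (hwE.mono fun β h => h.2.2).frequently
    rw [e, ← hch]
    exact (S'.ov_chord h0 h1 a0 a1).neg

/-- Intermediate heights of common opposite chords. -/
lemma exists_common_height (S : Strip K τ v μ ν) (S' : Strip L τ v μ ν)
    (hcov : ∀ x, cov K x = cov L x)
    {h : ℝ} (h0 : 0 ≤ h) (h1 : h < 1) (hR : reach K τ v h = reach L τ v h) {a b : ℝ} (ha : 0 < a)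
    (hb : b < μ) {η : ℝ}
    (hlo : ∃ α ∈ Set.Icc a b, ∃ w, ch τ v w ≤ η ∧ Low K (w + chord K τ v h α) w ∧
      Low L (w + chord K τ v h α) w)
    (hhi : ∃ α ∈ Set.Icc a b, ∃ w, η ≤ ch τ v w ∧ Low K (w + chord K τ v h α) w ∧
      Low L (w + chord K τ v h α) w) :
    ∃ α ∈ Set.Icc a b, ∃ w, ch τ v w = η ∧ Low K (w + chord K τ v h α) w ∧
      Low L (w + chord K τ v h α) w := by
  have c1 := S.isClosed_common S' h0 h1 hR ha hb
    (isClosed_le (continuous_ch τ v) continuous_const : IsClosed {w | ch τ v w ≤ η})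
  have c2 := S.isClosed_common S' h0 h1 hR ha hb
    (isClosed_le continuous_const (continuous_ch τ v) : IsClosed {w | η ≤ ch τ v w})
  obtain ⟨α₁, m1, w₁, l1⟩ := hlo
  obtain ⟨α₂, m2, w₂, l2⟩ := hhi
  obtain ⟨α, hα, ⟨-, w, hw, hwK, hwL⟩, -, w', hw', hwK', hwL'⟩ :=
    isPreconnected_closed_iff.1 (isPreconnected_Icc (a := a) (b := b)) _ _ c1 c2 (fun α hα => by
      obtain ⟨w, hw⟩ := S.exists_common S' hcov h0 h1 hR (ha.trans_le hα.1) (hα.2.trans_lt hb)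
      rcases le_total (ch τ v w) η with h | h
      · exact Or.inl ⟨hα, w, h, hw⟩
      · exact Or.inr ⟨hα, w, h, hw⟩) ⟨α₁, m1, m1, w₁, l1⟩ ⟨α₂, m2, m2, w₂, l2⟩
  have hw : ch τ v w ≤ η := hw
  have hw' : η ≤ ch τ v w' := hw'
  obtain ⟨s, t, hs, ht, hst, he⟩ : η ∈ segment ℝ (ch τ v w) (ch τ v w') := by
    rw [segment_eq_Icc (hw.trans hw')]; exact ⟨hw, hw'⟩
  refine ⟨α, hα, s • w + t • w', ?_, hwK.combo S.body.conv hwK' hs ht hst,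
    hwL.combo S'.body.conv hwL' hs ht hst⟩
  rw [← he, ch_add, ch, ch, ch, ch, om_smul_right, om_smul_right]
  simp only [smul_eq_mul]
  ring

/-- A range of parameters for which the opposite chords stay below the top. -/
lemma exists_interval (S : Strip K τ v μ ν) {h : ℝ} (h0 : 0 ≤ h) (h1 : h < 1) :
    ∃ a b : ℝ, ∃ C : Set ℝ, 0 ≤ a ∧ a < b ∧ b ≤ (1 - h) * μ + h * ν ∧ C.Countable ∧
      (∀ α ∈ Set.Ioo a b, ∀ w, Low K (w + chord K τ v h α) w → ch τ v w + h < 1) ∧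
      ∀ α ∈ Set.Ioo a b, α ∉ C → ¬ Edge K (-chord K τ v h α) := by
  set m := (1 - h) * μ + h * ν with hm
  have hmν : ν < m := by rw [hm]; nlinarith [S.lt]
  have hmμ : m ≤ μ := by rw [hm]; nlinarith [S.lt]
  set T : Set ℝ := {α | 0 < α ∧ α < m ∧ ∃ w, Low K (w + chord K τ v h α) w ∧ ch τ v w + h = 1}
    with hT
  have top : ∀ α w, Low K (w + chord K τ v h α) w → ch τ v w + h = 1 →
      0 ≤ cu τ v w + (reach K τ v h - α) ∧ cu τ v w + (reach K τ v h - α) ≤ ν := by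
    intro α w hw hw1
    refine (S.top _).1 ?_
    convert hw.1 using 1
    conv_rhs => rw [← combo_cu_ch S.pos w, chord]
    rw [show ch τ v w = 1 - h by linarith]
    module
  have diam : ∀ α ∈ T, ∀ α' ∈ T, α' - α ≤ ν := by
    rintro α ⟨a0, a1, w, hw, hw1⟩ α' ⟨a0', a1', w', hw', hw1'⟩
    have t1 := top α w hw hw1
    have t2 := top α' w' hw' hw1'
    rcases h0.eq_or_lt with rfl | hh
    · have : ∀ w ∈ K, ch τ v w = 1 → 0 ≤ cu τ v w := fun w hw h => by
        refine ((S.top _).1 ?_).1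
        convert hw using 1
        conv_rhs => rw [← combo_cu_ch S.pos w, h, one_smul]
      have := this w hw.2.1 (by linarith)
      rw [S.reach_zero] at t1
      linarith
    · have : w = w' := by
        refine S.eq_of_leftmost hw.2.1 hw'.2.1 (fun b hb => ?_) (fun b hb => ?_) (by linarith)
        · exact S.leftmost a0 (a1.trans_le hmμ) (S.chord_ne (a1.trans_le hmμ))
            (S.ov_chord h0 h1 a0 (a1.trans_le hmμ)) (S.low_chord h0 h1 a0 (a1.trans_le hmμ)) hw
            (by linarith) (by linarith) hb
        · exact S.leftmost a0' (a1'.trans_le hmμ) (S.chord_ne (a1'.trans_le hmμ))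
            (S.ov_chord h0 h1 a0' (a1'.trans_le hmμ)) (S.low_chord h0 h1 a0' (a1'.trans_le hmμ)) hw'
            (by linarith) (by linarith) hb
      subst this
      linarith
  have hC : ∃ C : Set ℝ, C.Countable ∧ ∀ α, 0 < α → α < m → α ∉ T → α ∉ C →
      ¬ Edge K (-chord K τ v h α) := by
    rcases h0.eq_or_lt with rfl | hh
    · refine ⟨∅, Set.countable_empty, fun α a0 a1 hαT _ hE => hαT ⟨a0, a1, ?_⟩⟩
      obtain ⟨p, hp, hpx, hpk⟩ := hE
      refine ⟨p - chord K τ v 0 α, ?_, ?_⟩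
      · rw [sub_add_cancel]
        refine ⟨hp, by rwa [sub_eq_add_neg], fun k hk _ => ?_⟩
        have := hpk k hk
        convert this using 2
        abel
      · have e := hpk v S.v_mem
        have hs := (S.slab p hp).2
        rw [chord, zero_smul, add_zero, S.reach_zero, om_neg_left, om_smul_left, om_sub_right,
          S.om_eq p] at e
        rw [ch_sub, chord, ch_combo S.pos]
        have hp0 := S.pos
        have hq : 0 < (μ - α) * om τ v := mul_pos (by linarith) hp0
        nlinarith
    · refine ⟨_, countable_edge K (x := -(reach K τ v h • τ + h • v)) (n := τ) ?_,
        fun α _ _ _ hαC hE => hαC ?_⟩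
      · rw [om_neg_left, om_add_left, om_smul_left, om_smul_left, om_self, om_comm v τ]
        have := S.pos.ne'
        simp [hh.ne', this]
      · show Edge K _
        convert hE using 1
        rw [chord]; module
  obtain ⟨C, hC, hCE⟩ := hC
  have fin : ∀ a b : ℝ, 0 ≤ a → a < b → b ≤ m → (∀ α ∈ Set.Ioo a b, α ∉ T) →
      ∃ a b : ℝ, ∃ C : Set ℝ, 0 ≤ a ∧ a < b ∧ b ≤ m ∧ C.Countable ∧
      (∀ α ∈ Set.Ioo a b, ∀ w, Low K (w + chord K τ v h α) w → ch τ v w + h < 1) ∧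
      ∀ α ∈ Set.Ioo a b, α ∉ C → ¬ Edge K (-chord K τ v h α) := by
    intro a b ha hab hb hT'
    refine ⟨a, b, C, ha, hab, hb, hC, fun α hα w hw => ?_, fun α hα hαC => ?_⟩
    · refine lt_of_le_of_ne (S.ch_add_le hw) fun he => hT' α hα ⟨ha.trans_lt hα.1, ?_, w, hw, he⟩
      exact hα.2.trans_le hb
    · exact hCE α (ha.trans_lt hα.1) (hα.2.trans_le hb) (hT' α hα) hαC
  by_cases hT1 : ∃ α ∈ T, α < (m - ν) / 2
  · obtain ⟨α, hαT, hα⟩ := hT1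
    refine fin (m - (m - ν) / 2) m (by linarith [S.nonneg]) (by linarith) le_rfl
      fun α' hα' hT' => ?_
    have := diam α hαT α' hT'
    linarith [hα'.1]
  · push Not at hT1
    refine fin 0 ((m - ν) / 2) le_rfl (by linarith) (by linarith [S.nonneg]) fun α' hα' hT' => ?_
    linarith [hT1 α' hT', hα'.2]

end Strip


namespace Strip

variable {K L : Set Plane} {τ v : Plane} {μ ν : ℝ}

lemma leftmost_chord (S : Strip K τ v μ ν) {h α : ℝ} {w : Plane} (h0 : 0 ≤ h) (h1 : h < 1)
    (hα : 0 < α) (hα' : α < μ) (hw : Low K (w + chord K τ v h α) w) (hw0 : 0 < ch τ v w)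
    (hw1 : ch τ v w < 1) (b : ℝ) (hb : 0 < b) : w + (-b) • τ ∉ K :=
  S.leftmost hα hα' (S.chord_ne hα') (S.ov_chord h0 h1 hα hα') (S.low_chord h0 h1 hα hα') hw
    hw0 hw1 hb

lemma low_lo_neg_chord (S : Strip K τ v μ ν) {h α : ℝ} (h0 : 0 ≤ h) (h1 : h < 1)
    (hα : 0 < α) (hα' : α < μ) :
    Low K (lo K (-chord K τ v h α) - chord K τ v h α + chord K τ v h α)
      (lo K (-chord K τ v h α) - chord K τ v h α) := by
  have := low_lo S.body (S.ov_chord h0 h1 hα hα').neg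
  rwa [sub_add_cancel, sub_eq_add_neg]

lemma infinite_heights (S : Strip K τ v μ ν) {h a b : ℝ} {C : Set ℝ} (h0 : 0 ≤ h) (h1 : h < 1)
    (ha : 0 ≤ a) (hab : a < b) (hb : b ≤ (1 - h) * μ + h * ν) (hC : C.Countable)
    (hw : ∀ α ∈ Set.Ioo a b, ∀ w, Low K (w + chord K τ v h α) w → ch τ v w + h < 1) :
    ((fun α => ch τ v (lo K (-chord K τ v h α) - chord K τ v h α)) '' (Set.Ioo a b \ C)).Infinite := by
  have hbμ : b ≤ μ := hb.trans (by nlinarith [S.lt])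
  have hinf : (Set.Ioo a b \ C).Infinite := by
    intro hf
    have : (Set.Ioo a b).Countable := (hf.countable.union hC).mono (by
      intro x hx
      by_cases hxC : x ∈ C
      · exact Or.inr hxC
      · exact Or.inl ⟨hx, hxC⟩)
    exact (Cardinal.Real.Ioo_countable_iff.1 this).not_gt hab
  intro hfin
  refine hinf (Set.Finite.of_finite_fibers _ hfin ?_)
  rintro η -
  by_contra hI
  obtain ⟨α₁, m1, α₂, m2, α₃, m3, h12, h23⟩ := exists_three_of_infinite hI
  have low : ∀ α ∈ Set.Ioo a b, Low K _ _ := fun α hα =>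
    S.low_lo_neg_chord h0 h1 (ha.trans_lt hα.1) (hα.2.trans_le hbμ)
  have pos : ∀ α ∈ Set.Ioo a b, 0 < ch τ v (lo K (-chord K τ v h α) - chord K τ v h α) :=
    fun α hα => S.ch_pos h0 h1 (ha.trans_lt hα.1) (hα.2.trans_le hb) (low α hα)
  have left : ∀ α ∈ Set.Ioo a b, ∀ c : ℝ, 0 < c →
      lo K (-chord K τ v h α) - chord K τ v h α + (-c) • τ ∉ K := fun α hα =>
    S.leftmost_chord h0 h1 (ha.trans_lt hα.1) (hα.2.trans_le hbμ) (low α hα) (pos α hα)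
      (by linarith [hw α hα _ (low α hα)])
  have e1 : ch τ v (lo K (-chord K τ v h α₁) - chord K τ v h α₁) = η := m1.2
  have e2 : ch τ v (lo K (-chord K τ v h α₂) - chord K τ v h α₂) = η := m2.2
  have e3 : ch τ v (lo K (-chord K τ v h α₃) - chord K τ v h α₃) = η := m3.2
  have w12 := S.eq_of_leftmost (low α₁ m1.1.1).2.1 (low α₂ m2.1.1).2.1 (left _ m1.1.1)
    (left _ m2.1.1) (e1.trans e2.symm)
  have w32 := S.eq_of_leftmost (low α₃ m3.1.1).2.1 (low α₂ m2.1.1).2.1 (left _ m3.1.1)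
    (left _ m2.1.1) (e3.trans e2.symm)
  have l1 := (low α₁ m1.1.1).1
  have l2 := low α₂ m2.1.1
  have l3 := (low α₃ m3.1.1).1
  have p2 := pos α₂ m2.1.1
  have q2 := hw α₂ m2.1.1 _ l2
  rw [w12] at l1
  rw [w32] at l3
  set w := lo K (-chord K τ v h α₂) - chord K τ v h α₂
  refine l2.left_not_mem_interior S.body.conv ?_ (S.mem_interior (b := α₃ - α₂) (c := α₂ - α₁)
    (by linarith) (by linarith) ?_ ?_ ?_ ?_)
  · intro he
    exact S.chord_ne (m2.1.1.2.trans_le hbμ) (by simpa using he)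
  · convert l3 using 1
    rw [chord, chord]; module
  · convert l1 using 1
    rw [chord, chord]; module
  · rw [ch_add, chord, ch_combo S.pos]; linarith
  · rw [ch_add, chord, ch_combo S.pos]; linarith

/-- Around a suitable height, the leftmost points of the two bodies agree. -/
lemma exists_window (S : Strip K τ v μ ν) (S' : Strip L τ v μ ν) (hcov : ∀ x, cov K x = cov L x)
    {h : ℝ} (h0 : 0 ≤ h) (h1 : h < 1) (hR : reach K τ v h = reach L τ v h) :
    ∃ α η₁ η₂ : ℝ, 0 < α ∧ α < μ ∧ ¬ Edge K (-chord K τ v h α) ∧ 0 < η₁ ∧ η₂ < 1 ∧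
      η₁ < ch τ v (lo K (-chord K τ v h α) - chord K τ v h α) ∧
      ch τ v (lo K (-chord K τ v h α) - chord K τ v h α) < η₂ ∧
      ∀ η ∈ Set.Ioo η₁ η₂, ∃ w, ch τ v w = η ∧ w ∈ K ∧ w ∈ L ∧
        ∀ b : ℝ, 0 < b → w + (-b) • τ ∉ K ∧ w + (-b) • τ ∉ L := by
  obtain ⟨a, b, C, ha, hab, hb, hC, hw, hE⟩ := S.exists_interval h0 h1
  have hbμ : b ≤ μ := hb.trans (by nlinarith [S.lt])
  obtain ⟨_, ⟨α₁, m1, rfl⟩, _, ⟨α₀, m0, rfl⟩, _, ⟨α₂, m2, rfl⟩, l1, l2⟩ :=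
    exists_three_of_infinite (S.infinite_heights h0 h1 ha hab hb hC hw)
  have hch : ∀ α, chord L τ v h α = chord K τ v h α := fun α => by rw [chord, chord, hR]
  have low : ∀ α ∈ Set.Ioo a b, Low K _ _ := fun α hα =>
    S.low_lo_neg_chord h0 h1 (ha.trans_lt hα.1) (hα.2.trans_le hbμ)
  have lowL : ∀ α ∈ Set.Ioo a b \ C, Low L (lo K (-chord K τ v h α) - chord K τ v h α +
      chord K τ v h α) (lo K (-chord K τ v h α) - chord K τ v h α) := by
    intro α hα
    obtain ⟨w, hwK, hwL⟩ := S.exists_common S' hcov h0 h1 hR (ha.trans_lt hα.1.1)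
      (hα.1.2.trans_le hbμ)
    have : lo K (-chord K τ v h α) = w + chord K τ v h α :=
      lo_eq S.body (neg_ne_zero.2 (S.chord_ne (hα.1.2.trans_le hbμ))) (hE α hα.1 hα.2)
        (by rwa [add_neg_cancel_right])
    rwa [this, add_sub_cancel_right]
  refine ⟨α₀, _, _, ha.trans_lt m0.1.1, m0.1.2.trans_le hbμ, hE α₀ m0.1 m0.2,
    S.ch_pos h0 h1 (ha.trans_lt m1.1.1) (m1.1.2.trans_le hb) (low α₁ m1.1),
    by linarith [hw α₂ m2.1 _ (low α₂ m2.1)], l1, l2, fun η hη => ?_⟩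
  have i1 : α₁ ∈ Set.Icc (min α₁ α₂) (max α₁ α₂) := ⟨min_le_left _ _, le_max_left _ _⟩
  have i2 : α₂ ∈ Set.Icc (min α₁ α₂) (max α₁ α₂) := ⟨min_le_right _ _, le_max_right _ _⟩
  have hmin : 0 < min α₁ α₂ := lt_min (ha.trans_lt m1.1.1) (ha.trans_lt m2.1.1)
  have hmax : max α₁ α₂ < b := max_lt m1.1.2 m2.1.2
  obtain ⟨α, hα, w, hwη, hwK, hwL⟩ := S.exists_common_height S' hcov h0 h1 hR hmin
    (hmax.trans_le hbμ) (η := η) ⟨α₁, i1, _, hη.1.le, low α₁ m1.1, lowL α₁ m1⟩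
    ⟨α₂, i2, _, hη.2.le, low α₂ m2.1, lowL α₂ m2⟩
  have a0 : 0 < α := hmin.trans_le hα.1
  have a1 : α < μ := (hα.2.trans_lt hmax).trans_le hbμ
  have w0 : 0 < ch τ v w := S.ch_pos h0 h1 a0 ((hα.2.trans_lt hmax).trans_le hb) hwK
  have w1 : ch τ v w < 1 := by
    have := hw α₂ m2.1 _ (low α₂ m2.1)
    have := hη.2
    simp only at this
    linarith
  refine ⟨w, hwη, hwK.2.1, hwL.2.1, fun c hc => ⟨?_, ?_⟩⟩
  · exact S.leftmost_chord h0 h1 a0 a1 hwK w0 w1 c hc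
  · exact S'.leftmost_chord h0 h1 a0 a1 (by rwa [hch]) w0 w1 c hc

lemma tendsto_reach (S : Strip K τ v μ ν) {h : ℝ} (h0 : 0 ≤ h) (h1 : h < 1) :
    Filter.Tendsto (reach K τ v) (nhdsWithin h (Set.Ioi h)) (nhds (reach K τ v h)) := by
  refine (S.continuousOn_reach h ⟨h0, h1⟩).mono_left ?_
  rw [nhdsWithin, nhdsWithin]
  refine le_inf inf_le_left ?_
  rw [Filter.le_principal_iff]
  filter_upwards [mem_nhdsWithin_of_mem_nhds (Iio_mem_nhds h1), self_mem_nhdsWithin] with y e1 e2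
  exact ⟨h0.trans (le_of_lt e2), e1⟩

/-- Agreement of the right boundaries propagates upwards. -/
lemma eventually_reach_eq (S : Strip K τ v μ ν) (S' : Strip L τ v μ ν)
    (hcov : ∀ x, cov K x = cov L x) {h : ℝ} (h0 : 0 ≤ h) (h1 : h < 1)
    (hR : reach K τ v h = reach L τ v h) :
    ∀ᶠ y in nhdsWithin h (Set.Ioi h), reach K τ v y = reach L τ v y := by
  obtain ⟨α₀, η₁, η₂, a0, a1, hE, hη₁, hη₂, l1, l2, hwin⟩ := S.exists_window S' hcov h0 h1 hR
  set x₀ := chord K τ v h α₀ with hx₀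
  have hcl : ContinuousAt (fun x => ch τ v (lo K (-x) - x)) x₀ := by
    have h1 : ContinuousAt (fun x => lo K (-x)) x₀ :=
      ContinuousAt.comp (g := lo K) (continuousAt_lo S.body (neg_ne_zero.2 (S.chord_ne a1)) hE
        (S.ov_chord h0 h1 a0 a1).neg) continuous_neg.continuousAt
    exact (continuous_ch τ v).continuousAt.comp (h1.sub continuousAt_id)
  have hV : ∀ᶠ x in nhds x₀, ch τ v (lo K (-x) - x) ∈ Set.Ioo η₁ η₂ :=
    hcl.eventually (Ioo_mem_nhds l1 l2)
  have tK := S.tendsto_reach h0 h1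
  have tL := S'.tendsto_reach h0 h1
  have hid : Filter.Tendsto (fun y : ℝ => y) (nhdsWithin h (Set.Ioi h)) (nhds h) := nhdsWithin_le_nhds
  have hxt : Filter.Tendsto (fun y => chord K τ v y α₀) (nhdsWithin h (Set.Ioi h)) (nhds x₀) := by
    rw [hx₀]
    unfold chord
    exact ((tK.sub_const α₀).smul_const τ).add (hid.smul_const v)
  have tD : Filter.Tendsto (fun y => reach L τ v y - reach K τ v y + α₀)
      (nhdsWithin h (Set.Ioi h)) (nhds α₀) := by
    have := (tL.sub tK).add_const α₀
    rwa [hR, sub_self, zero_add] at this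
  filter_upwards [hxt.eventually (eventually_eventually_nhds.2 hV), self_mem_nhdsWithin,
    hid.eventually (gt_mem_nhds h1), tD.eventually (lt_mem_nhds a0), tD.eventually (gt_mem_nhds a1)]
    with y e1 e2 e3 e4 e5
  have y0 : 0 < y := h0.trans_lt e2
  have hom : om (chord K τ v y α₀) τ ≠ 0 := by
    rw [chord, om_add_left, om_smul_left, om_smul_left, om_self, om_comm v τ]
    have := S.pos.ne'
    simp [y0.ne', this]
  obtain ⟨C, hC, hreg⟩ := exists_reg_nhds S.body S'.body hcov (S.chord_ne a1)
    (S.ov_chord y0.le e3 a0 a1) hom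
  have := neBot_nhdsGT_diff_countable hC 0
  have hc : Filter.Tendsto (fun ε : ℝ => chord K τ v y α₀ + ε • τ) (nhds 0)
      (nhds (chord K τ v y α₀)) := by
    have := (by fun_prop : Continuous fun ε : ℝ => chord K τ v y α₀ + ε • τ).tendsto 0
    simpa using this
  have small : ∀ c : ℝ, 0 < c → c < μ → ∀ᶠ ε : ℝ in nhds 0, 0 < c - ε ∧ c - ε < μ := by
    intro c c0 c1
    have := (by fun_prop : Continuous fun ε : ℝ => c - ε).tendsto 0
    rw [sub_zero] at this
    exact (this.eventually (lt_mem_nhds c0)).and (this.eventually (gt_mem_nhds c1))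
  have hnear : ∀ᶠ ε in nhdsWithin (0:ℝ) (Set.Ioi 0 ∩ Cᶜ), _ := mem_nhdsWithin_of_mem_nhds
    (hreg.and ((hc.eventually e1).and ((small _ a0 a1).and (small _ e4 e5))))
  obtain ⟨ε, ⟨r, f1, ⟨f2, f3⟩, f4, f5⟩, -, fC⟩ := (hnear.and self_mem_nhdsWithin).exists
  obtain ⟨-, -, hyv⟩ := r fC
  set α := α₀ - ε with hα
  set β := reach L τ v y - reach K τ v y + α₀ - ε with hβ
  have xK : chord K τ v y α₀ + ε • τ = chord K τ v y α := by rw [chord, chord, hα]; module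
  have xL : chord K τ v y α₀ + ε • τ = chord L τ v y β := by rw [chord, chord, hβ]; module
  rw [xK] at f1 hyv xL
  have loK := S.lo_chord y0 e3 f2 f3
  have loL := S'.lo_chord y0 e3 f4 f5
  have lowK := S.low_lo_neg_chord y0.le e3 f2 f3
  have lowL := S'.low_lo_neg_chord y0.le e3 f4 f5
  have lmL := fun p0 p1 => S'.leftmost_chord y0.le e3 f4 f5 lowL p0 p1
  have lmK := fun p0 p1 => S.leftmost_chord y0.le e3 f2 f3 lowK p0 p1
  rw [← xL] at loL lowL lmL
  rw [yv, yv, loK, loL] at hyv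
  set w := lo K (-chord K τ v y α) - chord K τ v y α with hw
  set w' := lo L (-chord K τ v y α) - chord K τ v y α with hw'
  have hww : w' = w + (β - α) • τ := by
    rw [sub_eq_sub_iff_add_eq_add] at hyv
    rw [sub_smul, ← add_sub_assoc, hyv, add_sub_cancel_right]
  obtain ⟨z, hz, zK, zL, zlm⟩ := hwin _ f1
  have hc' : ch τ v w' = ch τ v w := by rw [hww, ch_add_smul_tau]
  have p0 : 0 < ch τ v w := hη₁.trans f1.1
  have p1 : ch τ v w < 1 := f1.2.trans hη₂
  have q1 : w = z := S.eq_of_leftmost lowK.2.1 zK (lmK p0 p1) (fun b hb => (zlm b hb).1) hz.symm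
  have q2 : w' = z := S'.eq_of_leftmost lowL.2.1 zL (lmL (hc' ▸ p0) (hc' ▸ p1))
    (fun b hb => (zlm b hb).2) (hc'.trans hz.symm)
  rw [q1, q2] at hww
  have : (β - α) • τ = 0 := by simpa using hww.symm
  have := (smul_eq_zero.1 this).resolve_right S.ne_zero
  rw [hα, hβ] at this
  linarith

lemma reach_eq (S : Strip K τ v μ ν) (S' : Strip L τ v μ ν) (hcov : ∀ x, cov K x = cov L x)
    {h : ℝ} (h0 : 0 ≤ h) (h1 : h < 1) : reach K τ v h = reach L τ v h := by
  have hsub : Set.Icc 0 h ⊆ Set.Ico (0:ℝ) 1 := fun y hy => ⟨hy.1, hy.2.trans_lt h1⟩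
  have hcl : IsClosed ({y | reach K τ v y = reach L τ v y} ∩ Set.Icc 0 h) := by
    have := ((S.continuousOn_reach.mono hsub).sub
      (S'.continuousOn_reach.mono hsub)).preimage_isClosed_of_isClosed isClosed_Icc
      (isClosed_singleton (x := (0:ℝ)))
    convert this using 1
    ext y
    simp only [Set.mem_inter_iff, Set.mem_ofPred_eq, Set.mem_preimage, Set.mem_singleton_iff,
      sub_eq_zero, Pi.sub_apply, and_comm]
  exact hcl.Icc_subset_of_forall_mem_nhdsWithin (by
      rw [Set.mem_ofPred_eq, S.reach_zero, S'.reach_zero])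
    (fun y hy => S.eventually_reach_eq S' hcov hy.2.1 (hy.2.2.trans h1) hy.1) ⟨h0, le_rfl⟩

lemma exists_shift_mem (S : Strip K τ v μ ν) (S' : Strip L τ v μ ν)
    (hcov : ∀ x, cov K x = cov L x) {k : Plane} (hk : k ∈ K) : ∃ β : ℝ, 0 ≤ β ∧ k + β • τ ∈ L := by
  have e := combo_cu_ch S.pos k
  obtain ⟨s0, s1⟩ := S.slab k hk
  rcases s1.eq_or_lt with s1 | s1
  · refine ⟨0, le_rfl, ?_⟩
    rw [zero_smul, add_zero, ← e, s1, one_smul]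
    rw [← e, s1, one_smul] at hk
    exact (S'.top _).2 ((S.top _).1 hk)
  · have hr := S.reach_eq S' hcov s0 s1
    refine ⟨reach K τ v (ch τ v k) - cu τ v k, sub_nonneg.2 (S.le_reach (by rwa [e])), ?_⟩
    convert S'.reach_mem s0 s1.le using 1
    conv_lhs => rw [← e, cu_combo S.pos, ch_combo S.pos, hr]
    module

lemma subset (S : Strip K τ v μ ν) (S' : Strip L τ v μ ν) (hcov : ∀ x, cov K x = cov L x) :
    K ⊆ L := by
  intro k hk
  by_contra hkL
  obtain ⟨f, u, hf, hu⟩ := geometric_hahn_banach_closed_point S'.body.conv S'.body.comp.isClosed hkL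
  obtain ⟨l, hl, hmin⟩ := S'.body.comp.exists_isMinOn S'.body.nonempty f.continuous.continuousOn
  have hmin' : ∀ z ∈ L, f l ≤ f z := fun z hz => hmin hz
  obtain ⟨β, hβ, hkβ⟩ := S.exists_shift_mem S' hcov hk
  obtain ⟨γ, hγ, hlγ⟩ := S'.exists_shift_mem S (fun x => (hcov x).symm) hl
  have h1 := hf _ hkβ
  rw [map_add, map_smul, smul_eq_mul] at h1
  have hfτ : f τ < 0 := by
    by_contra hcon
    have : 0 ≤ β * f τ := mul_nonneg hβ (not_lt.1 hcon)
    linarith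
  obtain ⟨p, hp, hpx⟩ := exists_diff_of_ov S.body S'.body
    (fun x => (ov_iff_of_cov S.body S'.body hcov x).1) hlγ hk
  have h2 := hf _ hpx
  have h3 := hmin' p hp
  rw [map_add, map_sub, map_add, map_smul, smul_eq_mul] at h2
  have : γ * f τ ≤ 0 := mul_nonpos_of_nonneg_of_nonpos hγ hfτ.le
  linarith

/-- Bodies with the same covariogram and the same pair of parallel faces of different lengths are
equal. -/
theorem eq_of_cov (S : Strip K τ v μ ν) (S' : Strip L τ v μ ν) (hcov : ∀ x, cov K x = cov L x) :
    K = L :=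
  (S.subset S' hcov).antisymm (S'.subset S fun x => (hcov x).symm)

end Strip


/-- The faces of a convex body on its two supporting lines of direction `τ`. -/
structure Sides (K : Set Plane) (τ P Q : Plane) (μ ν : ℝ) : Prop where
  body : Body K
  ne : τ ≠ 0
  mu : 0 ≤ μ
  nu : 0 ≤ ν
  bot : ∀ k, (k ∈ K ∧ Tan K k τ) ↔ ∃ a : ℝ, 0 ≤ a ∧ a ≤ μ ∧ k = P + a • τ
  top : ∀ k, (k ∈ K ∧ Tan K k (-τ)) ↔ ∃ a : ℝ, 0 ≤ a ∧ a ≤ ν ∧ k = Q + a • τ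

lemma Body.exists_sides {K : Set Plane} (hK : Body K) {τ : Plane} (hτ : τ ≠ 0) :
    ∃ P Q μ ν, Sides K τ P Q μ ν := by
  obtain ⟨P, μ, hμ, hP⟩ := hK.exists_segment_face hτ
  obtain ⟨Q, ν, hν, hQ⟩ := hK.exists_segment_face (neg_ne_zero.2 hτ)
  refine ⟨P, Q - ν • τ, μ, ν, hK, hτ, hμ, hν, hP, fun k => (hQ k).trans ⟨?_, ?_⟩⟩
  · rintro ⟨a, h0, h1, rfl⟩
    exact ⟨ν - a, by linarith, by linarith, by module⟩
  · rintro ⟨a, h0, h1, rfl⟩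
    exact ⟨ν - a, by linarith, by linarith, by module⟩

namespace Sides

variable {K L : Set Plane} {τ P Q P' Q' : Plane} {μ ν μ' ν' : ℝ}

lemma bot_mem (F : Sides K τ P Q μ ν) {a : ℝ} (h0 : 0 ≤ a) (h1 : a ≤ μ) : P + a • τ ∈ K :=
  ((F.bot _).2 ⟨a, h0, h1, rfl⟩).1

lemma top_mem (F : Sides K τ P Q μ ν) {a : ℝ} (h0 : 0 ≤ a) (h1 : a ≤ ν) : Q + a • τ ∈ K :=
  ((F.top _).2 ⟨a, h0, h1, rfl⟩).1

lemma P_mem (F : Sides K τ P Q μ ν) : P ∈ K := by simpa using F.bot_mem le_rfl F.mu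

lemma Q_mem (F : Sides K τ P Q μ ν) : Q ∈ K := by simpa using F.top_mem le_rfl F.nu

lemma le_om (F : Sides K τ P Q μ ν) {k : Plane} (hk : k ∈ K) : om τ P ≤ om τ k := by
  have := ((F.bot P).2 ⟨0, le_rfl, F.mu, by simp⟩).2.2 k hk
  rw [om_sub_right] at this; linarith

lemma om_le (F : Sides K τ P Q μ ν) {k : Plane} (hk : k ∈ K) : om τ k ≤ om τ Q := by
  have := ((F.top Q).2 ⟨0, le_rfl, F.nu, by simp⟩).2.2 k hk
  rw [om_neg_left, om_sub_right] at this; linarith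

lemma exists_bot (F : Sides K τ P Q μ ν) {k : Plane} (hk : k ∈ K) (h : om τ k ≤ om τ P) :
    ∃ a : ℝ, 0 ≤ a ∧ a ≤ μ ∧ k = P + a • τ :=
  (F.bot k).1 ⟨hk, F.ne, fun z hz => by rw [om_sub_right]; linarith [F.le_om hz]⟩

lemma exists_top (F : Sides K τ P Q μ ν) {k : Plane} (hk : k ∈ K) (h : om τ Q ≤ om τ k) :
    ∃ a : ℝ, 0 ≤ a ∧ a ≤ ν ∧ k = Q + a • τ :=
  (F.top k).1 ⟨hk, neg_ne_zero.2 F.ne, fun z hz => by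
    rw [om_neg_left, om_sub_right]; linarith [F.om_le hz]⟩

lemma om_pos (F : Sides K τ P Q μ ν) : 0 < om τ (Q - P) := by
  obtain ⟨c, hc⟩ := F.body.int
  have h1 := ((F.bot P).2 ⟨0, le_rfl, F.mu, by simp⟩).2.pos hc
  have h2 := F.om_le (interior_subset hc)
  rw [om_sub_right] at *
  linarith

lemma smul_cancel (F : Sides K τ P Q μ ν) {a b : ℝ} (h : a • τ = b • τ) : a = b :=
  smul_left_injective ℝ F.ne h

lemma strip (F : Sides K τ P Q μ ν) (h : ν < μ) :
    Strip ((fun y => y + -P) '' K) τ (Q - P) μ ν := by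
  have hmem : ∀ z, z ∈ (fun y => y + -P) '' K ↔ P + z ∈ K := fun z => by
    constructor
    · rintro ⟨y, hy, rfl⟩
      simpa using hy
    · exact fun hz => ⟨_, hz, by simp⟩
  refine ⟨F.body.translate _, F.om_pos, fun a => ?_, fun a => ?_, fun k hk => ?_, F.nu, h⟩
  · rw [hmem]
    refine ⟨fun ha => ?_, fun ha => F.bot_mem ha.1 ha.2⟩
    obtain ⟨b, h0, h1, hb⟩ := F.exists_bot ha (by
      rw [om_add_right, om_smul_right, om_self, mul_zero, add_zero])
    rw [F.smul_cancel (add_left_cancel hb)]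
    exact ⟨h0, h1⟩
  · rw [hmem, show P + (a • τ + (Q - P)) = Q + a • τ by abel]
    refine ⟨fun ha => ?_, fun ha => F.top_mem ha.1 ha.2⟩
    obtain ⟨b, h0, h1, hb⟩ := F.exists_top ha (by
      rw [om_add_right, om_smul_right, om_self, mul_zero, add_zero])
    rw [F.smul_cancel (add_left_cancel hb)]
    exact ⟨h0, h1⟩
  · rw [hmem] at hk
    have h1 := F.le_om hk
    have h2 := F.om_le hk
    rw [om_add_right] at h1 h2
    refine ⟨div_nonneg (by linarith) F.om_pos.le, (div_le_one F.om_pos).2 ?_⟩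
    rw [om_sub_right]; linarith

lemma neg (F : Sides K τ P Q μ ν) : Sides (-K) τ (-Q - ν • τ) (-P - μ • τ) ν μ := by
  refine ⟨F.body.neg, F.ne, F.nu, F.mu, fun k => ?_, fun k => ?_⟩
  · have h1 : Tan (-K) k τ ↔ Tan K (-k) (-τ) := by
      rw [← tan_neg (K := K), neg_neg, neg_neg]
    rw [Set.mem_neg, h1, F.top]
    constructor
    · rintro ⟨a, a0, a1, ha⟩
      exact ⟨ν - a, by linarith, by linarith, by rw [← neg_neg k, ha]; module⟩
    · rintro ⟨a, a0, a1, rfl⟩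
      exact ⟨ν - a, by linarith, by linarith, by module⟩
  · have h1 : Tan (-K) k (-τ) ↔ Tan K (-k) τ := by
      rw [← tan_neg (K := K), neg_neg]
    rw [Set.mem_neg, h1, F.bot]
    constructor
    · rintro ⟨a, a0, a1, ha⟩
      exact ⟨μ - a, by linarith, by linarith, by rw [← neg_neg k, ha]; module⟩
    · rintro ⟨a, a0, a1, rfl⟩
      exact ⟨μ - a, by linarith, by linarith, by module⟩

lemma eq_translate (F : Sides K τ P Q μ ν) (F' : Sides L τ P' Q' μ ν) (hv : Q' - P' = Q - P)
    (h : ν < μ) (hcov : ∀ x, cov K x = cov L x) : L = (fun x => x + (P' - P)) '' K := by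
  have S := F.strip h
  have S' := F'.strip h
  rw [hv] at S'
  have e := S.eq_of_cov S' fun x => by rw [cov_translate, cov_translate, hcov]
  have : L = (fun y => y + P') '' ((fun y => y + -P') '' L) := by
    rw [Set.image_image]; simp
  rw [this, ← e, Set.image_image]
  congr 1
  funext y
  abel

lemma ov (F : Sides K τ P Q μ ν) {r : ℝ} (h0 : 0 < r) (h1 : r < μ) : Ov K (r • τ) := by
  obtain ⟨c, hc⟩ := F.body.int
  have hμ : 0 < μ := h0.trans h1
  have e0 : 0 < 1 - r / μ := sub_pos.2 ((div_lt_one hμ).2 h1)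
  have e1 : 1 - r / μ ≤ 1 := by linarith [div_pos h0 hμ]
  refine ⟨_, F.body.combo_mem_interior F.P_mem hc e0 e1, ?_⟩
  convert F.body.combo_mem_interior (F.bot_mem hμ.le le_rfl) hc e0 e1 using 1
  have : r • τ = (r / μ) • μ • τ := by rw [smul_smul, div_mul_cancel₀ _ hμ.ne']
  rw [this]
  module

lemma om_le_of_cov (F : Sides K τ P Q μ ν) (F' : Sides L τ P' Q' μ' ν')
    (hcov : ∀ x, cov K x = cov L x) : om τ (Q - P) ≤ om τ (Q' - P') := by
  obtain ⟨p, hp, hq⟩ := exists_diff_of_ov F.body F'.body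
    (fun x => (ov_iff_of_cov F.body F'.body hcov x).1) F.P_mem F.Q_mem
  have h1 := F'.le_om hp
  have h2 := F'.om_le hq
  rw [om_add_right] at h2
  rw [om_sub_right τ Q']
  linarith

lemma om_eq_of_cov (F : Sides K τ P Q μ ν) (F' : Sides L τ P' Q' μ' ν')
    (hcov : ∀ x, cov K x = cov L x) : om τ (Q - P) = om τ (Q' - P') :=
  (F.om_le_of_cov F' hcov).antisymm (F'.om_le_of_cov F fun x => (hcov x).symm)

lemma exists_offset (F : Sides K τ P Q μ ν) (F' : Sides L τ P' Q' μ' ν')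
    (hcov : ∀ x, cov K x = cov L x) {p q : Plane} (hp : p ∈ K) (hq : q ∈ K)
    (h : om τ (q - p) = om τ (Q - P)) :
    ∃ b : ℝ, -μ' ≤ b ∧ b ≤ ν' ∧ q - p = Q' - P' + b • τ := by
  obtain ⟨z, hz, hz'⟩ := exists_diff_of_ov F.body F'.body
    (fun x => (ov_iff_of_cov F.body F'.body hcov x).1) hp hq
  have hH := F.om_eq_of_cov F' hcov
  have h1 := F'.le_om hz
  have h2 := F'.om_le hz'
  rw [← h, om_sub_right τ Q'] at hH
  rw [om_add_right, hH] at h2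
  obtain ⟨a, a0, a1, ha⟩ := F'.exists_bot hz (by linarith)
  obtain ⟨b, b0, b1, hb⟩ := F'.exists_top hz' (by rw [om_add_right, hH]; linarith)
  refine ⟨b - a, by linarith, by linarith, ?_⟩
  rw [← add_sub_cancel_left z (q - p), hb, ha]
  module

lemma exists_shift (F : Sides K τ P Q μ ν) (F' : Sides L τ P' Q' μ' ν')
    (hcov : ∀ x, cov K x = cov L x) :
    ∃ d : ℝ, Q - P = Q' - P' + d • τ ∧ ν + d ≤ ν' ∧ μ - d ≤ μ' := by
  have hτ : ∀ (a : ℝ) (z : Plane), om τ (z + a • τ) = om τ z := fun a z => by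
    rw [om_add_right, om_smul_right, om_self, mul_zero, add_zero]
  obtain ⟨d, -, -, hd⟩ := F.exists_offset F' hcov F.P_mem F.Q_mem rfl
  obtain ⟨b, -, b1, hb⟩ := F.exists_offset F' hcov F.P_mem (F.top_mem F.nu le_rfl) (by
    rw [om_sub_right, hτ, om_sub_right])
  obtain ⟨c, c1, -, hc⟩ := F.exists_offset F' hcov (F.bot_mem F.mu le_rfl) F.Q_mem (by
    rw [om_sub_right, hτ, om_sub_right])
  have eb : b = ν + d := by
    refine F.smul_cancel (add_left_cancel (a := Q' - P') ?_)
    rw [← hb, add_sub_right_comm, hd]; module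
  have ec : c = d - μ := by
    refine F.smul_cancel (add_left_cancel (a := Q' - P') ?_)
    rw [← hc, ← sub_sub, hd]; module
  exact ⟨d, hd, by linarith, by linarith⟩

lemma le_of_om_eq (F : Sides K τ P Q μ ν) {p u : Plane} {r : ℝ}
    (hp : Low K p (p + r • τ)) (hu : Low K u (u - r • τ))
    (h : om τ (u - p) = om τ (Q - P)) : r ≤ min μ ν := by
  have hτ : ∀ (a : ℝ) (z : Plane), om τ (z + a • τ) = om τ z := fun a z => by
    rw [om_add_right, om_smul_right, om_self, mul_zero, add_zero]
  have h1 := F.le_om hp.1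
  have h2 := F.om_le hu.1
  rw [om_sub_right, om_sub_right] at h
  obtain ⟨a, a0, a1, ha⟩ := F.exists_bot hp.1 (by linarith)
  obtain ⟨b, b0, b1, hb⟩ := F.exists_bot hp.2.1 (by rw [hτ]; linarith)
  obtain ⟨a', a0', a1', ha'⟩ := F.exists_top hu.1 (by linarith)
  obtain ⟨b', b0', b1', hb'⟩ := F.exists_top hu.2.1 (by
    rw [sub_eq_add_neg, ← neg_smul, hτ]; linarith)
  have e1 : a + r = b := F.smul_cancel (add_left_cancel (a := P) (by rw [← hb, ha]; module))
  have e2 : a' - r = b' := F.smul_cancel (add_left_cancel (a := Q) (by rw [← hb', ha']; module))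
  exact le_min (by linarith) (by linarith)

lemma om_eq_of_le (F : Sides K τ P Q μ ν) {p u : Plane} {r : ℝ} (hr : 0 < r)
    (hp : Low K p (p + r • τ)) (hu : Low K u (u - r • τ)) (h : r ≤ min μ ν) :
    om τ (u - p) = om τ (Q - P) := by
  have h1 := F.le_om hp.1
  have h2 := F.om_le hu.1
  have h3 := hp.2.2 P F.P_mem (by
    rw [add_sub_cancel_left]; exact F.bot_mem hr.le (h.trans (min_le_left _ _)))
  have h4 := hu.2.2 (Q + r • τ) (F.top_mem hr.le (h.trans (min_le_right _ _))) (by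
    rw [sub_sub_cancel_left, add_neg_cancel_right]; exact F.Q_mem)
  rw [add_sub_cancel_left, om_smul_left, om_sub_right] at h3
  rw [sub_sub_cancel_left, om_neg_left, om_smul_left, om_sub_right, om_add_right, om_smul_right,
    om_self, mul_zero, add_zero] at h4
  rw [om_sub_right, om_sub_right]
  have h3' := nonneg_of_mul_nonneg_right h3 hr
  have h4' : 0 ≤ om τ u - om τ Q := nonneg_of_mul_nonneg_right (by linarith : 0 ≤ r * _) hr
  linarith

lemma min_le_of_cov (F : Sides K τ P Q μ ν) (F' : Sides L τ P' Q' μ' ν')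
    (hcov : ∀ x, cov K x = cov L x) : min μ ν ≤ min μ' ν' := by
  by_contra hcon
  obtain ⟨r, r1, r2⟩ := exists_between (not_le.1 hcon)
  have r0 : 0 < r := lt_of_le_of_lt (le_min F'.mu F'.nu) r1
  obtain ⟨p, u, p', u', l1, l2, l3, l4, e⟩ := exists_low_pair F.body F'.body hcov
    (smul_ne_zero r0.ne' F.ne) (F.ov r0 (r2.trans_le (min_le_left _ _)))
  have h1 := F.om_eq_of_le r0 l1 l2 r2.le
  rw [e, F.om_eq_of_cov F' hcov] at h1
  linarith [F'.le_of_om_eq l3 l4 h1]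

end Sides

/-- A body with an edge longer than the opposite one is determined by its covariogram. -/
theorem translate_or_reflect_of_edge {K L : Set Plane} (hK : Body K) (hL : Body L)
    (hcov : ∀ x, cov K x = cov L x) {τ : Plane} (h : Edge K τ) (h' : ¬ Edge K (-τ)) :
    (∃ v, L = (fun x => x + v) '' K) ∨ ∃ v, L = (fun x => x + v) '' (-K) := by
  have hτ : τ ≠ 0 := by
    rintro rfl
    exact h' (by simpa using h)
  obtain ⟨P, Q, μ, ν, F⟩ := hK.exists_sides hτ
  obtain ⟨P', Q', μ', ν', F'⟩ := hL.exists_sides hτ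
  have hμ : 1 ≤ μ := by
    obtain ⟨p, hp, hpx, hl⟩ := h
    obtain ⟨a, a0, a1, ha⟩ := (F.bot p).1 ⟨hp, hτ, hl⟩
    obtain ⟨b, b0, b1, hb⟩ := (F.bot (p + τ)).1 ⟨hpx, hτ, fun k hk => by
      rw [om_sub_right, om_add_right, om_self, add_zero, ← om_sub_right]; exact hl k hk⟩
    have : a + 1 = b := F.smul_cancel (add_left_cancel (a := P) (by rw [← hb, ha]; module))
    linarith
  have hν : ν < 1 := by
    by_contra hcon
    refine h' ⟨Q + τ, by simpa using F.top_mem zero_le_one (not_lt.1 hcon), ?_, fun k hk => ?_⟩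
    · rw [add_neg_cancel_right]; exact F.Q_mem
    · rw [om_neg_left, om_sub_right, om_add_right, om_self, add_zero]
      linarith [F.om_le hk]
  have hlt : ν < μ := hν.trans_le hμ
  obtain ⟨d, hd, d1, d2⟩ := F.exists_shift F' hcov
  obtain ⟨e, he, e1, e2⟩ := F'.exists_shift F fun x => (hcov x).symm
  have hed : e = -d := F.smul_cancel (add_left_cancel (a := Q - P) (by rw [← he, hd]; module))
  have hmin := (F.min_le_of_cov F' hcov).antisymm (F'.min_le_of_cov F fun x => (hcov x).symm)
  rw [min_eq_right hlt.le] at hmin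
  rcases le_total ν' μ' with hle | hle
  · rw [min_eq_right hle] at hmin
    have hd0 : d = 0 := by linarith
    have hμ' : μ' = μ := by linarith
    subst hmin hμ'
    exact Or.inl ⟨_, F.eq_translate F' (by rw [hd, hd0]; module) hlt hcov⟩
  · rw [min_eq_left hle] at hmin
    have hd0 : d = μ - ν := by linarith
    have hν' : ν' = μ := by linarith
    subst hmin hν'
    have := F.eq_translate F'.neg (by rw [hd, hd0]; module) hlt fun x => by rw [cov_neg, hcov]
    set w := -Q' - ν' • τ - P
    refine Or.inr ⟨-w, ?_⟩
    rw [← neg_neg L, this]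
    ext z
    simp only [Set.mem_neg, Set.image_add_right, Set.mem_preimage, neg_add, neg_neg]


theorem covariogram_determines_planar_bodies
    (K L : Set (EuclideanSpace ℝ (Fin 2)))
    (hKcomp : IsCompact K) (hKconv : Convex ℝ K) (hKint : (interior K).Nonempty)
    (hLcomp : IsCompact L) (hLconv : Convex ℝ L) (hLint : (interior L).Nonempty)
    (hcov : ∀ t : EuclideanSpace ℝ (Fin 2),
      volume (K ∩ ((fun x => x + t) '' K)) = volume (L ∩ ((fun x => x + t) '' L))) :
    (∃ v : EuclideanSpace ℝ (Fin 2), L = (fun x => x + v) '' K) ∨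
      (∃ v : EuclideanSpace ℝ (Fin 2), L = (fun x => x + v) '' (-K)) := by
  have hK : Body K := ⟨hKcomp, hKconv, hKint⟩
  have hL : Body L := ⟨hLcomp, hLconv, hLint⟩
  have hc := cov_eq_of_volume_eq hcov
  by_cases h1 : Bal K
  · by_cases h2 : Bal L
    · exact Twins.translate_or_reflect ⟨hK, hL, h1, h2, hc⟩
    · obtain ⟨x, hx, hx'⟩ : ∃ x, Edge L x ∧ ¬ Edge L (-x) := by
        by_contra! h; exact h2 h
      rcases translate_or_reflect_of_edge hL hK (fun x => (hc x).symm) hx hx' with ⟨v, hv⟩ | ⟨v, hv⟩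
      · refine Or.inl ⟨-v, ?_⟩
        rw [hv, Set.image_image]
        simp
      · refine Or.inr ⟨v, ?_⟩
        rw [hv]
        ext z
        simp [add_comm]
  · obtain ⟨x, hx, hx'⟩ : ∃ x, Edge K x ∧ ¬ Edge K (-x) := by
      by_contra! h; exact h1 h
    exact translate_or_reflect_of_edge hK hL hc hx hx'
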